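/- For every integer n ≥ 0 the following two-term and four-term rank-crank inequalities hold. Writing N_i = N(i,11,11n+7) and M_i = M(i,11,11n+7): N_0 ≥ M_1; M_0 ≥ N_4; and N_3 + N_4 ≥ N_5 + M_0. Writing N_i = N(i,11,11n+8) and M_i = M(i,11,11n+8): N_2 ≥ M_1; M_0 ≥ N_3; M_0 + M_1 ≥ N_2 + N_4; N_1 + N_5 ≥ 2N_3; N_0 + M_0 ≥ 2N_2; N_3 + M_0 ≥ N_4 + M_1; N_2 + N_3 ≥ 2M_1; and 2M_0 ≥ N_1 + N_5. Writing N_i = N(i,11,11n+9) and M_i = M(i,11,11n+9): N_2 ≥ M_1; M_0 ≥ N_5; M_1 + M_0 ≥ N_2 + N_5; N_0 + M_0 ≥ N_2 + M_1; and N_2 + N_5 ≥ N_3 + N_4. Writing N_i = N(i,11,11n+10) and M_i = M(i,11,11n+10): N_1 ≥ M_0; M_3 ≥ N_4; N_0 + M_0 ≥ N_1 + N_4; N_2 + N_3 ≥ 2M_0; N_1 + N_4 ≥ 2M_0; and N_1 + M_3 ≥ N_2 + N_3. -/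

import Mathlib

/-- `p n`: the number of partitions of `n`. -/
def partitionCount (n : ℕ) : ℕ := Fintype.card (Nat.Partition n)

/-- The rank of a partition: its largest part minus its number of parts
(the empty partition has rank 0). -/
def partitionRank {n : ℕ} (π : Nat.Partition n) : ℤ :=
  (π.parts.sup : ℤ) - (Multiset.card π.parts : ℤ)

/-- The crank of a partition `π`: if `π` has no parts equal to 1, it is the largest part;
otherwise it is (number of parts larger than the number of ones) − (number of ones). -/
def partitionCrank {n : ℕ} (π : Nat.Partition n) : ℤ :=
  if π.parts.count 1 = 0 then (π.parts.sup : ℤ)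
  else ((π.parts.filter fun x => π.parts.count 1 < x).card : ℤ) - (π.parts.count 1 : ℤ)

/-- `rankCount a r n` = `N(a,r,n)`: the number of partitions of `n` whose rank is
congruent to `a` modulo `r`. -/
def rankCount (a r : ℤ) (n : ℕ) : ℕ :=
  (Finset.univ.filter fun π : Nat.Partition n => partitionRank π % r = a % r).card

/-- `crankCount a n` = `M(a,11,n)`: for `n ≠ 1`, the number of partitions of `n` whose crank
is congruent to `a` modulo 11; at `n = 1` the standard convention `M(0,11,1) = −1`,
`M(1,11,1) = M(10,11,1) = 1`, and `M(a,11,1) = 0` otherwise. -/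
def crankCount (a : ℤ) (n : ℕ) : ℤ :=
  if n = 1 then
    if a % 11 = 0 then -1
    else if a % 11 = 1 ∨ a % 11 = 10 then 1
    else 0
  else ((Finset.univ.filter fun π : Nat.Partition n => partitionCrank π % 11 = a % 11).card : ℤ)

namespace RankCrank
open Finset

/-- Laurent series over `ℚ` in a formal variable `u`. -/
abbrev K := LaurentSeries ℚ

instance : CharZero K := algebraRat.charZero K

/-- The monomial `u ^ n`. -/
noncomputable def u (n : ℤ) : K := HahnSeries.single n 1

theorem u_add (a b : ℤ) : u (a + b) = u a * u b := by simp [u]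

theorem u_zero : u 0 = 1 := rfl

theorem u_ne_zero (n : ℤ) : u n ≠ 0 := by simp [u]

theorem u_neg (n : ℤ) : u (-n) = (u n)⁻¹ := by
  exact eq_inv_of_mul_eq_one_left (by rw [← u_add]; simp [u_zero])

theorem u_sub (a b : ℤ) : u (a - b) = u a / u b := by
  rw [sub_eq_add_neg, u_add, u_neg, div_eq_mul_inv]

theorem u_natMul (n : ℕ) (a : ℤ) : u (n * a) = u a ^ n := by
  induction n with
  | zero => simp [u_zero]
  | succ n ih => rw [pow_succ, ← ih, ← u_add]; congr 1; push_cast; ring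

theorem coeff_u_mul (n i : ℤ) (f : K) : (u n * f).coeff i = f.coeff (i - n) := by
  have := HahnSeries.coeff_single_mul_add (r := (1 : ℚ)) (x := f) (a := i - n) (b := n)
  simpa [u] using this

theorem coeff_u (n i : ℤ) : (u n).coeff i = if i = n then 1 else 0 := by
  simp [u, HahnSeries.coeff_single]

/-- `IsO d f` says that `f = O(u ^ d)`. -/
def IsO (d : ℤ) (f : K) : Prop := ∀ i < d, f.coeff i = 0

theorem IsO.mono {a b : ℤ} {f : K} (h : IsO b f) (hab : a ≤ b) : IsO a f :=
  fun i hi => h i (by omega)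

theorem isO_zero (d : ℤ) : IsO d 0 := fun _ _ => rfl

theorem IsO.add {d : ℤ} {f g : K} (hf : IsO d f) (hg : IsO d g) : IsO d (f + g) := fun i hi => by
  simp [hf i hi, hg i hi]

theorem IsO.neg {d : ℤ} {f : K} (hf : IsO d f) : IsO d (-f) := fun i hi => by
  simp [hf i hi]

theorem IsO.sub {d : ℤ} {f g : K} (hf : IsO d f) (hg : IsO d g) : IsO d (f - g) := by
  rw [sub_eq_add_neg]; exact hf.add hg.neg

theorem IsO.sum {ι : Type*} {d : ℤ} {f : ι → K} {s : Finset ι} (h : ∀ i ∈ s, IsO d (f i)) :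
    IsO d (∑ i ∈ s, f i) := by
  classical
  induction s using Finset.induction_on with
  | empty => simpa using isO_zero d
  | insert a s ha ih =>
    rw [Finset.sum_insert ha]
    exact (h a (by simp)).add (ih fun i hi => h i (by simp [hi]))

theorem IsO.mul {a b : ℤ} {f g : K} (hf : IsO a f) (hg : IsO b g) : IsO (a + b) (f * g) := by
  intro i hi
  rw [HahnSeries.coeff_mul]
  refine Finset.sum_eq_zero fun p hp => ?_
  rw [Finset.mem_antidiagonal] at hp
  by_cases h : p.1 < a
  · rw [hf _ h, zero_mul]
  · rw [hg p.2 (by omega), mul_zero]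

theorem IsO.mul' {a b c : ℤ} {f g : K} (hf : IsO a f) (hg : IsO b g) (h : c ≤ a + b) :
    IsO c (f * g) := (hf.mul hg).mono h

theorem isO_u (n : ℤ) : IsO n (u n) := fun i hi => by
  rw [coeff_u, if_neg (by omega)]

theorem isO_one : IsO 0 1 := by simpa [u_zero] using isO_u 0

theorem exists_isO (f : K) : ∃ d, IsO d f := by
  refine ⟨f.order, fun i hi => HahnSeries.coeff_eq_zero_of_lt_order hi⟩

theorem eq_zero_of_isO {f : K} (h : ∀ d, IsO d f) : f = 0 := by
  ext i
  simpa using h (i + 1) i (by omega)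

theorem isO_intCast (n : ℤ) : IsO 0 (n : K) := by
  intro i hi
  have : ((n : ℤ) : K) = HahnSeries.C (n : ℚ) := by simp
  rw [this, HahnSeries.C_apply, HahnSeries.coeff_single_of_ne (by omega)]

/-- `f` is a power series with constant term `1`. -/
def IsOne (f : K) : Prop := IsO 1 (f - 1)

theorem IsOne.isO {f : K} (h : IsOne f) : IsO 0 f := by
  have := (h.mono zero_le_one).add isO_one
  simpa using this

theorem isOne_one : IsOne 1 := by simpa [IsOne] using isO_zero 1

theorem IsOne.mul {f g : K} (hf : IsOne f) (hg : IsOne g) : IsOne (f * g) := by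
  have h : f * g - 1 = (f - 1) * g + (g - 1) := by ring
  rw [IsOne, h]
  exact (hf.mul' hg.isO (by simp)).add hg

theorem IsOne.prod {ι : Type*} {f : ι → K} {s : Finset ι} (h : ∀ i ∈ s, IsOne (f i)) :
    IsOne (∏ i ∈ s, f i) := by
  classical
  induction s using Finset.induction_on with
  | empty => simpa using isOne_one
  | insert a s ha ih =>
    rw [Finset.prod_insert ha]
    exact (h a (by simp)).mul (ih fun i hi => h i (by simp [hi]))

theorem IsOne.coeff_zero {f : K} (h : IsOne f) : f.coeff 0 = 1 := by
  have := h 0 (by norm_num)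
  rw [HahnSeries.coeff_sub, HahnSeries.coeff_one, if_pos rfl, sub_eq_zero] at this
  exact this

theorem IsOne.ne_zero {f : K} (h : IsOne f) : f ≠ 0 := by
  rintro rfl
  simpa using h.coeff_zero

theorem IsOne.inv {f : K} (h : IsOne f) : IsOne f⁻¹ := by
  have hf := h.ne_zero
  set g := f⁻¹ with hg
  have hg0 : g ≠ 0 := inv_ne_zero hf
  have hfg : g = 1 - (f - 1) * g := by rw [sub_mul, one_mul, hg, mul_inv_cancel₀ hf]; ring
  have hO : IsO g.order g := fun i hi => HahnSeries.coeff_eq_zero_of_lt_order hi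
  have h1 : IsO (1 + g.order) ((f - 1) * g) := IsO.mul h hO
  have hord : 0 ≤ g.order := by
    by_contra hlt
    push Not at hlt
    have hc : g.coeff g.order = 0 := by
      rw [congrArg (fun x : K => x.coeff g.order) hfg]
      rw [HahnSeries.coeff_sub, h1 _ (by omega), HahnSeries.coeff_one, if_neg (by omega), sub_zero]
    exact hg0 (by rwa [HahnSeries.coeff_order_eq_zero] at hc)
  have : g - 1 = -((f - 1) * g) := by
    conv_lhs => rw [hfg]
    ring
  rw [IsOne, this]
  exact (h1.mono (by omega)).neg

theorem isOne_one_sub_u {n : ℤ} (hn : 0 < n) : IsOne (1 - u n) := by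
  have : (1 : K) - u n - 1 = -u n := by ring
  rw [IsOne, this]
  exact ((isO_u n).mono (by omega)).neg

theorem one_sub_u_ne_zero {n : ℤ} (hn : n ≠ 0) : 1 - u n ≠ 0 := by
  intro h
  have := congrArg (fun f : K => f.coeff n) h
  simp [coeff_u, HahnSeries.coeff_one, hn] at this

/-- `∑ i, f i = s` in the `u`-adic topology. -/
def IsSum {ι : Type*} (f : ι → K) (s : K) : Prop :=
  ∀ d, ∃ S₀ : Finset ι, ∀ S, S₀ ⊆ S → IsO d (s - ∑ i ∈ S, f i)

section IsSum

variable {ι κ : Type*} {f g : ι → K} {s t : K}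

theorem IsSum.unique (hs : IsSum f s) (ht : IsSum f t) : s = t := by
  classical
  rw [← sub_eq_zero]
  refine eq_zero_of_isO fun d => ?_
  obtain ⟨S, hS⟩ := hs d
  obtain ⟨T, hT⟩ := ht d
  have := (hS (S ∪ T) Finset.subset_union_left).sub (hT (S ∪ T) Finset.subset_union_right)
  simpa using this

theorem IsSum.add (hf : IsSum f s) (hg : IsSum g t) : IsSum (fun i => f i + g i) (s + t) := by
  classical
  intro d
  obtain ⟨S, hS⟩ := hf d
  obtain ⟨T, hT⟩ := hg d
  refine ⟨S ∪ T, fun U hU => ?_⟩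
  have := (hS U (Finset.union_subset_left hU)).add (hT U (Finset.union_subset_right hU))
  rw [Finset.sum_add_distrib]
  convert this using 1; ring

theorem IsSum.mul_left (c : K) (hf : IsSum f s) : IsSum (fun i => c * f i) (c * s) := by
  intro d
  obtain ⟨a, ha⟩ := exists_isO c
  obtain ⟨S, hS⟩ := hf (d - a)
  refine ⟨S, fun U hU => ?_⟩
  rw [← Finset.mul_sum, ← mul_sub]
  exact ha.mul' (hS U hU) (by omega)

theorem IsSum.neg (hf : IsSum f s) : IsSum (fun i => -f i) (-s) := by
  simpa using hf.mul_left (-1)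

theorem IsSum.sub (hf : IsSum f s) (hg : IsSum g t) : IsSum (fun i => f i - g i) (s - t) := by
  simpa [sub_eq_add_neg] using hf.add hg.neg

theorem IsSum.comp_equiv (e : κ ≃ ι) (hf : IsSum f s) : IsSum (fun k => f (e k)) s := by
  classical
  intro d
  obtain ⟨S, hS⟩ := hf d
  refine ⟨S.map e.symm.toEmbedding, fun U hU => ?_⟩
  have := hS (U.map e.toEmbedding) (fun x hx => by
    rw [Finset.mem_map_equiv]
    exact hU (by simpa using hx))
  simpa using this

theorem IsSum.finite (hf : IsSum f s) (d : ℤ) : {i | ¬ IsO d (f i)}.Finite := by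
  classical
  obtain ⟨S, hS⟩ := hf d
  refine S.finite_toSet.subset fun i hi => ?_
  by_contra hiS
  have hiS' : i ∉ S := by simpa using hiS
  refine hi ?_
  have := (hS S subset_rfl).sub (hS (insert i S) (Finset.subset_insert i S))
  rw [Finset.sum_insert hiS'] at this
  convert this using 1; ring

theorem exists_isO_of_finite (h : ∀ d, {i | ¬ IsO d (f i)}.Finite) : ∃ m, ∀ i, IsO m (f i) := by
  classical
  choose a ha using fun i => exists_isO (f i)
  by_cases hne : (h 0).toFinset.Nonempty
  · refine ⟨min 0 ((h 0).toFinset.inf' hne a), fun i => ?_⟩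
    by_cases hi : IsO 0 (f i)
    · exact hi.mono (min_le_left _ _)
    · exact (ha i).mono ((min_le_right _ _).trans (Finset.inf'_le _ (by simpa using hi)))
  · refine ⟨0, fun i => ?_⟩
    by_contra hi
    exact hne ⟨i, by simpa using hi⟩

theorem exists_isSum (h : ∀ d, {i | ¬ IsO d (f i)}.Finite) : ∃ s, IsSum f s := by
  classical
  obtain ⟨m, hm⟩ := exists_isO_of_finite h
  have hbdd : BddBelow (Function.support fun n => ∑ᶠ i, (f i).coeff n) := by
    refine ⟨m, fun n hn => ?_⟩
    by_contra hlt
    push Not at hlt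
    refine hn ?_
    simp only [fun i => hm i n hlt, finsum_zero]
  refine ⟨HahnSeries.ofSuppBddBelow _ hbdd, fun d => ?_⟩
  · refine ⟨(h d).toFinset, fun S hS n hn => ?_⟩
    rw [HahnSeries.coeff_sub, HahnSeries.coeff_sum, sub_eq_zero, HahnSeries.coeff_ofSuppBddBelow]
    refine finsum_eq_sum_of_support_subset _ fun i hi => ?_
    refine hS ?_
    simp only [Set.Finite.mem_toFinset, Set.mem_ofPred_eq]
    exact fun hO => hi (hO n hn)

theorem IsSum.isO {d : ℤ} (hf : IsSum f s) (h : ∀ i, IsO d (f i)) : IsO d s := by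
  obtain ⟨S, hS⟩ := hf d
  have := (hS S subset_rfl).add (IsO.sum (s := S) fun i _ => h i)
  simpa using this

theorem IsSum.prod {g : κ → K} (hf : IsSum f s) (hg : IsSum g t) :
    IsSum (fun p : ι × κ => f p.1 * g p.2) (s * t) := by
  classical
  obtain ⟨m, hm⟩ := exists_isO_of_finite hf.finite
  obtain ⟨n, hn⟩ := exists_isO_of_finite hg.finite
  have hfin : ∀ d, {p : ι × κ | ¬ IsO d (f p.1 * g p.2)}.Finite := fun d => by
    refine ((hf.finite (d - n)).prod (hg.finite (d - m))).subset fun p hp => ⟨?_, ?_⟩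
    · exact fun h => hp (h.mul' (hn p.2) (by omega))
    · exact fun h => hp ((hm p.1).mul' h (by omega))
  obtain ⟨r, hr⟩ := exists_isSum hfin
  suffices r = s * t by rwa [← this]
  rw [← sub_eq_zero]
  refine eq_zero_of_isO fun d => ?_
  obtain ⟨a, ha⟩ := exists_isO t
  obtain ⟨R, hR⟩ := hr d
  obtain ⟨S, hS⟩ := hf (d - a)
  obtain ⟨T, hT⟩ := hg (d - m)
  set S' := S ∪ R.image Prod.fst
  set T' := T ∪ R.image Prod.snd
  have h1 := hR (S' ×ˢ T') (fun p hp => by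
    rw [Finset.mem_product]
    exact ⟨Finset.mem_union_right _ (Finset.mem_image_of_mem _ hp),
      Finset.mem_union_right _ (Finset.mem_image_of_mem _ hp)⟩)
  rw [Finset.sum_product, ← Finset.sum_mul_sum] at h1
  have h2 := (hS S' Finset.subset_union_left).mul' ha (c := d) (by omega)
  have h3 := (IsO.sum (s := S') fun i _ => hm i).mul' (hT T' Finset.subset_union_left) (c := d)
    (by omega)
  convert (h1.sub h2).sub h3 using 1; ring

theorem IsSum.sum_fintype {α : Type*} [Fintype α] {f : α × κ → K} {s : α → K}
    (h : ∀ a, IsSum (fun k => f (a, k)) (s a)) : IsSum f (∑ a, s a) := by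
  classical
  intro d
  choose S hS using fun a => h a d
  refine ⟨Finset.univ.biUnion fun a => (S a).map ⟨fun k => (a, k), fun _ _ h => by simpa using h⟩,
    fun U hU => ?_⟩
  have hsplit : ∑ p ∈ U, f p = ∑ a, ∑ k ∈ (U.filter fun p => p.1 = a).image Prod.snd, f (a, k) := by
    rw [← Finset.sum_fiberwise_of_maps_to (t := Finset.univ) (g := Prod.fst) (fun _ _ => by simp)]
    refine Finset.sum_congr rfl fun a _ => ?_
    rw [Finset.sum_image]
    · refine Finset.sum_congr rfl fun p hp => ?_
      rw [← (Finset.mem_filter.mp hp).2]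
    · intro p hp q hq hpq
      simp only [Finset.coe_filter, Set.mem_ofPred_eq] at hp hq
      exact Prod.ext (hp.2.trans hq.2.symm) hpq
  rw [hsplit, ← Finset.sum_sub_distrib]
  refine IsO.sum fun a _ => hS a _ fun k hk => ?_
  rw [Finset.mem_image]
  refine ⟨(a, k), Finset.mem_filter.mpr ⟨hU ?_, rfl⟩, rfl⟩
  simp only [Finset.mem_biUnion, Finset.mem_univ, Finset.mem_map, true_and]
  exact ⟨a, k, hk, rfl⟩

theorem isSum_finset [Fintype ι] (f : ι → K) : IsSum f (∑ i, f i) := fun d =>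
  ⟨Finset.univ, fun S hS => by
    rw [Finset.univ_subset_iff.mp hS, sub_self]; exact isO_zero d⟩

theorem IsSum.congr (hf : IsSum f s) (h : ∀ i, f i = g i) : IsSum g s := by
  rwa [← funext h]

/-- Terms outside the range of an injection vanish. -/
theorem IsSum.of_injective {e : κ → ι} (he : Function.Injective e) (h0 : ∀ i ∉ Set.range e, f i = 0)
    (hf : IsSum (fun k => f (e k)) s) : IsSum f s := by
  classical
  intro d
  obtain ⟨S, hS⟩ := hf d
  refine ⟨S.image e, fun U hU => ?_⟩
  have := hS (U.preimage e he.injOn) (fun k hk => by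
    rw [Finset.mem_preimage]; exact hU (Finset.mem_image_of_mem _ hk))
  rwa [Finset.sum_preimage e U he.injOn f fun i _ hi => h0 i hi] at this

end IsSum

/-- `F N → g` in the `u`-adic topology. -/
def Tends (F : ℕ → K) (g : K) : Prop := ∀ d, ∃ N₀, ∀ N ≥ N₀, IsO d (F N - g)

section Tends

variable {F G : ℕ → K} {f g : K}

theorem Tends.unique (hf : Tends F f) (hg : Tends F g) : f = g := by
  rw [← sub_eq_zero]
  refine eq_zero_of_isO fun d => ?_
  obtain ⟨M, hM⟩ := hf d
  obtain ⟨N, hN⟩ := hg d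
  convert (hN (max M N) (le_max_right _ _)).sub (hM (max M N) (le_max_left _ _)) using 1; ring

theorem tends_const (f : K) : Tends (fun _ => f) f := fun d =>
  ⟨0, fun N _ => by simpa using isO_zero d⟩

theorem Tends.congr (hf : Tends F f) (h : ∃ N₀, ∀ N ≥ N₀, F N = G N) : Tends G f := fun d => by
  obtain ⟨M, hM⟩ := hf d
  obtain ⟨N, hN⟩ := h
  exact ⟨max M N, fun k hk => by
    rw [← hN k (le_of_max_le_right hk)]; exact hM k (le_of_max_le_left hk)⟩

theorem Tends.add (hf : Tends F f) (hg : Tends G g) : Tends (fun N => F N + G N) (f + g) :=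
  fun d => by
    obtain ⟨M, hM⟩ := hf d
    obtain ⟨N, hN⟩ := hg d
    refine ⟨max M N, fun k hk => ?_⟩
    convert (hM k (le_of_max_le_left hk)).add (hN k (le_of_max_le_right hk)) using 1; ring

theorem Tends.mul (hf : Tends F f) (hg : Tends G g) : Tends (fun N => F N * G N) (f * g) :=
  fun d => by
    obtain ⟨a, ha⟩ := exists_isO f
    obtain ⟨b, hb⟩ := exists_isO g
    obtain ⟨M, hM⟩ := hf (max (d - b) a)
    obtain ⟨N, hN⟩ := hg (d - a)
    refine ⟨max M N, fun k hk => ?_⟩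
    have h1 := hM k (le_of_max_le_left hk)
    have h2 := hN k (le_of_max_le_right hk)
    have h3 : IsO a (F k) := by simpa using (h1.mono (le_max_right _ _)).add ha
    convert (h3.mul' h2 (c := d) (by omega)).add
      ((h1.mono (le_max_left _ _)).mul' hb (c := d) (by omega)) using 1
    ring

theorem Tends.const_mul (c : K) (hf : Tends F f) : Tends (fun N => c * F N) (c * f) :=
  (tends_const c).mul hf

theorem Tends.neg (hf : Tends F f) : Tends (fun N => -F N) (-f) := by
  simpa using hf.const_mul (-1)

theorem Tends.sub (hf : Tends F f) (hg : Tends G g) : Tends (fun N => F N - G N) (f - g) := by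
  simpa [sub_eq_add_neg] using hf.add hg.neg

theorem Tends.isO {d : ℤ} (hf : Tends F f) (h : ∃ N₀, ∀ N ≥ N₀, IsO d (F N)) : IsO d f := by
  obtain ⟨M, hM⟩ := hf d
  obtain ⟨N, hN⟩ := h
  convert (hN (max M N) (le_max_right _ _)).sub (hM (max M N) (le_max_left _ _)) using 1; ring

theorem Tends.isOne (hf : Tends F f) (h : ∃ N₀, ∀ N ≥ N₀, IsOne (F N)) : IsOne f :=
  (hf.sub (tends_const 1)).isO h

theorem Tends.inv (hf : Tends F f) (h : ∃ N₀, ∀ N ≥ N₀, IsOne (F N)) :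
    Tends (fun N => (F N)⁻¹) f⁻¹ := fun d => by
  have h1 := hf.isOne h
  obtain ⟨M, hM⟩ := hf d
  obtain ⟨N, hN⟩ := h
  refine ⟨max M N, fun k hk => ?_⟩
  have h2 := hN k (le_of_max_le_right hk)
  have h3 : (F k)⁻¹ - f⁻¹ = -(F k - f) * ((F k)⁻¹ * f⁻¹) := by
    have := h1.ne_zero
    have := h2.ne_zero
    field_simp
    ring
  rw [h3]
  exact (hM k (le_of_max_le_left hk)).neg.mul' (h2.inv.mul h1.inv).isO (by simp)

theorem Tends.sum {ι : Type*} {s : Finset ι} {F : ι → ℕ → K} {f : ι → K}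
    (h : ∀ i ∈ s, Tends (F i) (f i)) : Tends (fun N => ∑ i ∈ s, F i N) (∑ i ∈ s, f i) := by
  classical
  induction s using Finset.induction_on with
  | empty => simpa using tends_const 0
  | insert a s ha ih =>
    simp only [Finset.sum_insert ha]
    exact (h a (by simp)).add (ih fun i hi => h i (by simp [hi]))

theorem Tends.comp (hf : Tends F f) {φ : ℕ → ℕ} (h : ∀ n, ∃ N₀, ∀ N ≥ N₀, n ≤ φ N) :
    Tends (fun N => F (φ N)) f := fun d => by
  obtain ⟨M, hM⟩ := hf d
  obtain ⟨N, hN⟩ := h M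
  exact ⟨N, fun k hk => hM _ (hN k hk)⟩

theorem tends_zero_of_isO (h : ∀ d : ℤ, ∃ N₀, ∀ N ≥ N₀, IsO d (F N)) : Tends F 0 := by
  simpa [Tends] using h

theorem exists_tends (h : ∀ d : ℤ, ∃ N₀, ∀ N ≥ N₀, IsO d (F (N + 1) - F N)) : ∃ f, Tends F f := by
  obtain ⟨s, hs⟩ := exists_isSum (f := fun n => F (n + 1) - F n) (fun d => by
    obtain ⟨N, hN⟩ := h d
    refine (Set.finite_lt_nat N).subset fun n hn => ?_
    by_contra hlt
    exact hn (hN n (by simpa using hlt)))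
  refine ⟨F 0 + s, fun d => ?_⟩
  obtain ⟨S, hS⟩ := hs d
  obtain ⟨M, hM⟩ := S.exists_nat_subset_range
  refine ⟨M, fun N hN => ?_⟩
  have := hS (Finset.range N) (hM.trans (Finset.range_subset_range.mpr hN))
  rw [Finset.sum_range_sub] at this
  convert this.neg using 1; ring

theorem exists_subset_Icc (S : Finset ℤ) : ∃ M : ℕ, S ⊆ Finset.Icc (-M : ℤ) M := by
  refine ⟨S.sup Int.natAbs, fun i hi => ?_⟩
  have := Finset.le_sup (f := Int.natAbs) hi
  rw [Finset.mem_Icc]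
  omega

theorem IsSum.tends_Icc {f : ℤ → K} {s : K} (hf : IsSum f s) :
    Tends (fun N => ∑ j ∈ Finset.Icc (-N : ℤ) N, f j) s := fun d => by
  obtain ⟨S, hS⟩ := hf d
  obtain ⟨M, hM⟩ := exists_subset_Icc S
  refine ⟨M, fun N hN => ?_⟩
  have := hS (Finset.Icc (-N : ℤ) N) (hM.trans (Finset.Icc_subset_Icc (by omega) (by omega)))
  convert this.neg using 1; ring

/-- Dominated convergence for symmetric partial sums. -/
theorem IsSum.tends_mul {f : ℤ → K} {s : K} (hf : IsSum f s) {v : ℕ → ℤ → K} {w : K}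
    (hv : ∀ (N : ℕ) (j : ℤ), -N ≤ j → j ≤ N → IsO 0 (v N j)) (hw : ∀ j, Tends (fun N => v N j) w) :
    Tends (fun N => ∑ j ∈ Finset.Icc (-N : ℤ) N, f j * v N j) (s * w) := by
  have hw0 : IsO 0 w := (hw 0).isO ⟨0, fun N _ => hv N 0 (by omega) (by omega)⟩
  have key : Tends (fun N => ∑ j ∈ Finset.Icc (-N : ℤ) N, f j * (v N j - w)) 0 := by
    refine tends_zero_of_isO fun d => ?_
    obtain ⟨m, hm⟩ := exists_isO_of_finite hf.finite
    choose A hA using fun j => hw j (d - m)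
    refine ⟨(hf.finite d).toFinset.sup A, fun N hN => IsO.sum fun j hj => ?_⟩
    rw [Finset.mem_Icc] at hj
    by_cases hd : IsO d (f j)
    · exact hd.mul' ((hv N j hj.1 hj.2).sub hw0) (by simp)
    · have hjA : A j ≤ N := (Finset.le_sup (f := A) (by simpa using hd)).trans hN
      exact (hm j).mul' (hA j N hjA) (by omega)
  have h2 := key.add (hf.tends_Icc.mul (tends_const w))
  rw [zero_add] at h2
  refine h2.congr ⟨0, fun N _ => ?_⟩
  rw [Finset.sum_mul, ← Finset.sum_add_distrib]
  exact Finset.sum_congr rfl fun j _ => by ring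

end Tends

/-- The sign `(-1) ^ n` as an element of `K`. -/
noncomputable def sg (n : ℤ) : K := (-1) ^ n

theorem sg_add (a b : ℤ) : sg (a + b) = sg a * sg b := zpow_add₀ (by simp) a b

theorem sg_zero : sg 0 = 1 := zpow_zero _

theorem sg_one : sg 1 = -1 := zpow_one _

theorem sg_sq (a : ℤ) : sg a * sg a = 1 := by
  rw [← sg_add]; exact Even.neg_one_zpow ⟨a, rfl⟩

theorem sg_neg (a : ℤ) : sg (-a) = sg a := by
  have h := sg_sq a
  have h2 : sg (-a) * sg a = 1 := by rw [← sg_add]; simp [sg_zero]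
  calc sg (-a) = sg (-a) * (sg a * sg a) := by rw [h, mul_one]
    _ = sg a := by rw [← mul_assoc, h2, one_mul]

theorem sg_sub (a b : ℤ) : sg (a - b) = sg a * sg b := by
  rw [sub_eq_add_neg, sg_add, sg_neg]

theorem sg_even {a : ℤ} (h : Even a) : sg a = 1 := Even.neg_one_zpow h

theorem sg_odd {a : ℤ} (h : Odd a) : sg a = -1 := Odd.neg_one_zpow h

theorem sg_eq_of_even_sub {a b : ℤ} (h : Even (a - b)) : sg a = sg b := by
  have := sg_add (a - b) b
  rw [sg_even h, one_mul, sub_add_cancel] at this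
  exact this

theorem sg_ne_zero (a : ℤ) : sg a ≠ 0 := zpow_ne_zero _ (by simp)

theorem isO_sg (a : ℤ) : IsO 0 (sg a) := by
  rcases Int.even_or_odd a with h | h
  · rw [sg_even h]; exact isO_one
  · rw [sg_odd h]; exact isO_one.neg

/-- The sum of a family in the `u`-adic topology (`0` if it does not converge). -/
noncomputable def lsum {ι : Type*} (f : ι → K) : K :=
  open Classical in if h : ∃ s, IsSum f s then h.choose else 0

theorem isSum_lsum {ι : Type*} {f : ι → K} (h : ∃ s, IsSum f s) : IsSum f (lsum f) := by
  rw [lsum, dif_pos h]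
  exact h.choose_spec

/-- A family indexed by `ℤ` with linearly growing order is summable. -/
theorem isSum_of_isO {f : ℤ → K} (C : ℤ) (h : ∀ k, IsO (|k| - C) (f k)) : IsSum f (lsum f) := by
  refine isSum_lsum (exists_isSum fun d => ?_)
  refine (Set.finite_Icc (-|d + C|) (|d + C|)).subset fun k hk => ?_
  rw [Set.mem_Icc]
  by_contra hlt
  refine hk ((h k).mono ?_)
  by_contra hd
  refine hlt (abs_le.mp ?_)
  have := le_abs_self (d + C)
  omega

/-- The limit of a sequence in the `u`-adic topology (`0` if it does not converge). -/
noncomputable def lim (F : ℕ → K) : K :=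
  open Classical in if h : ∃ s, Tends F s then h.choose else 0

theorem tends_lim {F : ℕ → K} (h : ∃ s, Tends F s) : Tends F (lim F) := by
  rw [lim, dif_pos h]
  exact h.choose_spec

/-- `y ^ e` where `y = u ^ 264`. -/
noncomputable def y (e : ℤ) : K := u (264 * e)

theorem y_add (a b : ℤ) : y (a + b) = y a * y b := by rw [y, mul_add, u_add]; rfl

theorem y_zero : y 0 = 1 := u_zero

theorem y_ne_zero (a : ℤ) : y a ≠ 0 := u_ne_zero _

theorem y_neg (a : ℤ) : y (-a) = (y a)⁻¹ := by rw [y, mul_neg, u_neg]; rfl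

theorem isOne_one_sub_y {a : ℤ} (h : 0 < a) : IsOne (1 - y a) := isOne_one_sub_u (by omega)

theorem one_sub_y_ne_zero {a : ℤ} (h : a ≠ 0) : 1 - y a ≠ 0 := one_sub_u_ne_zero (by omega)

/-- The finite product `∏_{i < N} (1 - y ^ (a + 11 i))`. -/
noncomputable def poch (a : ℤ) (N : ℕ) : K := ∏ i ∈ range N, (1 - y (a + 11 * i))

theorem poch_zero (a : ℤ) : poch a 0 = 1 := by simp [poch]

theorem poch_succ (a : ℤ) (N : ℕ) : poch a (N + 1) = poch a N * (1 - y (a + 11 * N)) := by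
  rw [poch, prod_range_succ, poch]

theorem isOne_poch {a : ℤ} (ha : 0 < a) (N : ℕ) : IsOne (poch a N) :=
  IsOne.prod fun i _ => isOne_one_sub_y (by omega)

/-- The infinite product `∏_{i ≥ 0} (1 - y ^ (a + 11 i))`. -/
noncomputable def pochInf (a : ℤ) : K := lim (poch a)

theorem tends_poch {a : ℤ} (ha : 0 < a) : Tends (poch a) (pochInf a) := by
  refine tends_lim (exists_tends fun d => ⟨d.toNat, fun N hN => ?_⟩)
  rw [poch_succ, mul_sub, mul_one, sub_sub_cancel_left]
  exact ((isOne_poch ha N).isO.mul' (isO_u _) (by omega)).neg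

theorem isOne_pochInf {a : ℤ} (ha : 0 < a) : IsOne (pochInf a) :=
  (tends_poch ha).isOne ⟨0, fun N _ => isOne_poch ha N⟩

/-- Euler's product in `Y = y ^ 11`. -/
noncomputable def E : K := pochInf 11

theorem isOne_E : IsOne E := isOne_pochInf (by norm_num)

theorem E_ne_zero : E ≠ 0 := isOne_E.ne_zero

/-- The Dedekind function `η(11·)` normalised in `u`. -/
noncomputable def h : K := u 121 * E

theorem h_ne_zero : h ≠ 0 := mul_ne_zero (u_ne_zero _) E_ne_zero

section qBinomial

/-- The Gaussian binomial in base `Y`. -/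
noncomputable def qb (m n : ℕ) : K := poch 11 (m + n) / (poch 11 m * poch 11 n)

theorem poch11_ne_zero (N : ℕ) : poch 11 N ≠ 0 := (isOne_poch (by norm_num) N).ne_zero

theorem isOne_qb (m n : ℕ) : IsOne (qb m n) := by
  rw [qb, div_eq_mul_inv]
  exact (isOne_poch (by norm_num) _).mul
    ((isOne_poch (by norm_num) _).mul (isOne_poch (by norm_num) _)).inv

theorem qb_zero_right (m : ℕ) : qb m 0 = 1 := by
  simp [qb, poch_zero, poch11_ne_zero]

theorem qb_zero_left (m : ℕ) : qb 0 m = 1 := by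
  simp [qb, poch_zero, poch11_ne_zero]

theorem qb_succ (m n : ℕ) : qb (m + 1) (n + 1) = qb m (n + 1) * y (11 * (n + 1)) + qb (m + 1) n := by
  have h1 := poch11_ne_zero m
  have h2 := poch11_ne_zero n
  have h3 := one_sub_y_ne_zero (a := 11 + 11 * m) (by omega)
  have h4 := one_sub_y_ne_zero (a := 11 + 11 * n) (by omega)
  have e1 : m + 1 + (n + 1) = (m + n + 1) + 1 := by ring
  have e2 : m + (n + 1) = m + n + 1 := by ring
  have e3 : m + 1 + n = m + n + 1 := by ring
  have e4 : y (11 + 11 * ((m + n + 1 : ℕ) : ℤ)) = y (11 + 11 * m) * y (11 + 11 * n) := by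
    rw [← y_add]; congr 1; push_cast; ring
  have e5 : (11 * ((n : ℤ) + 1)) = 11 + 11 * n := by ring
  simp only [qb, e1, e2, e3, poch_succ 11 m, poch_succ 11 n, poch_succ 11 (m + n + 1), e4, e5]
  field_simp
  ring

/-- The polynomial `∏_{i < M} (1 - Y ^ i z)`. -/
noncomputable def rothe (M : ℕ) : Polynomial K :=
  ∏ i ∈ range M, (1 - Polynomial.C (y (11 * i)) * Polynomial.X)

theorem rothe_coeff (M k : ℕ) : (rothe M).coeff k =
    if k ≤ M then sg k * u (1452 * (k * (k - 1))) * qb k (M - k) else 0 := by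
  induction M generalizing k with
  | zero =>
    rcases k with _ | k
    · simp [rothe, sg_zero, u_zero, qb_zero_right]
    · simp [rothe, Polynomial.coeff_one]
  | succ M ih =>
    have hs : rothe (M + 1) = rothe M - Polynomial.C (y (11 * M)) * (rothe M * Polynomial.X) := by
      rw [rothe, prod_range_succ, ← rothe]; ring
    rw [hs, Polynomial.coeff_sub, Polynomial.coeff_C_mul]
    rcases k with _ | k
    · simp [ih, qb_zero_left]
    · rw [Polynomial.coeff_mul_X, ih, ih]
      have hu : u (1452 * (((k + 1 : ℕ) : ℤ) * ((k + 1 : ℕ) - 1)))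
          = u (1452 * (k * (k - 1))) * y (11 * k) := by
        rw [y, ← u_add]; congr 1; push_cast; ring
      have hsg : sg ((k + 1 : ℕ) : ℤ) = -sg k := by
        push_cast; rw [sg_add, sg_one]; ring
      rcases lt_trichotomy k M with hk | rfl | hk
      · rw [if_pos (by omega), if_pos (by omega), if_pos (by omega)]
        obtain ⟨n, rfl⟩ := Nat.exists_eq_add_of_lt hk
        have e1 : k + n + 1 + 1 - (k + 1) = n + 1 := by omega
        have e2 : k + n + 1 - (k + 1) = n := by omega
        have e3 : k + n + 1 - k = n + 1 := by omega
        have e4 : y (11 * ((k + n + 1 : ℕ) : ℤ)) = y (11 * k) * y (11 * (n + 1)) := by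
          rw [← y_add]; congr 1; push_cast; ring
        rw [e1, e2, e3, e4, qb_succ, hu, hsg]
        ring
      · rw [if_neg (by omega), if_pos le_rfl, if_pos (by omega), hu, hsg]
        simp only [Nat.sub_self, qb_zero_right]
        ring
      · rw [if_neg (by omega), if_neg (by omega), if_neg (by omega)]
        ring

theorem rothe_natDegree (M : ℕ) : (rothe M).natDegree < M + 1 := by
  refine Nat.lt_succ_of_le (Polynomial.natDegree_le_iff_coeff_eq_zero.mpr fun k hk => ?_)
  rw [rothe_coeff, if_neg (by omega)]

theorem rothe_eval (M : ℕ) (z : K) : (rothe M).eval z = ∏ i ∈ range M, (1 - y (11 * i) * z) := by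
  simp [rothe, Polynomial.eval_prod]

theorem sum_Icc_shift (N : ℕ) (f : ℤ → K) :
    ∑ k ∈ Icc (-N : ℤ) N, f k = ∑ i ∈ range (2 * N + 1), f (i - N) := by
  symm
  refine sum_bij' (fun i _ => (i : ℤ) - N) (fun k _ => (k + N).toNat) ?_ ?_ ?_ ?_ ?_
  · intro a ha; rw [mem_range] at ha; rw [mem_Icc]; omega
  · intro a ha; rw [mem_Icc] at ha; rw [mem_range]; omega
  · intro a ha; rw [mem_range] at ha; omega
  · intro a ha; rw [mem_Icc] at ha; omega
  · intro a ha; rfl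

end qBinomial

/-- The summand of the theta series, normalised so that the term at `0` is `1`. -/
noncomputable def jt (γ k : ℤ) : K := sg k * u (1452 * (k * (k - 1)) + 264 * (γ * k))

theorem prod_range_two_mul (N : ℕ) (f : ℤ → K) :
    ∏ i ∈ range (2 * N), f (i - N) = (∏ l ∈ range N, f l) * ∏ l ∈ range N, f (-(l + 1)) := by
  rw [two_mul, prod_range_add, mul_comm]
  congr 1
  · refine prod_congr rfl fun i _ => ?_
    congr 1; push_cast; ring
  · rw [← prod_range_reflect]
    refine prod_congr rfl fun i hi => ?_
    have := mem_range.mp hi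
    congr 1; omega

theorem sum_range_two_mul (N : ℕ) (f : ℤ → K) :
    ∑ i ∈ range (2 * N), f (i - N) = (∑ l ∈ range N, f l) + ∑ l ∈ range N, f (-(l + 1)) := by
  rw [two_mul, sum_range_add, add_comm]
  congr 1
  · refine sum_congr rfl fun i _ => ?_
    congr 1; push_cast; ring
  · rw [← sum_range_reflect]
    refine sum_congr rfl fun i hi => ?_
    have := mem_range.mp hi
    congr 1; omega

theorem prod_one_sub_neg (γ : ℤ) (N : ℕ) : ∏ l ∈ range N, (1 - y (γ + 11 * (-((l : ℤ) + 1))))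
    = sg N * u (264 * (γ * N) - 1452 * (N * (N + 1))) * poch (11 - γ) N := by
  induction N with
  | zero => simp [sg_zero, u_zero, poch_zero]
  | succ N ih =>
    rw [prod_range_succ, ih, poch_succ]
    have e1 : u (264 * (γ * ((N + 1 : ℕ) : ℤ)) - 1452 * (((N + 1 : ℕ) : ℤ) * (((N + 1 : ℕ) : ℤ) + 1)))
      = u (264 * (γ * N) - 1452 * (N * (N + 1))) * y (γ + 11 * (-((N : ℤ) + 1))) := by
      rw [y, ← u_add]; congr 1; push_cast; ring
    have e2 : y (γ + 11 * (-((N : ℤ) + 1))) * y (11 - γ + 11 * N) = 1 := by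
      rw [← y_add, ← y_zero]; congr 1; ring
    have e3 : sg ((N + 1 : ℕ) : ℤ) = -sg N := by push_cast; rw [sg_add, sg_one]; ring
    rw [e1, e3]
    linear_combination (-sg N * u (264 * (γ * N) - 1452 * (N * (N + 1))) * poch (11 - γ) N) * e2

theorem rothe_term (γ : ℤ) (N i : ℕ) (hi : i ≤ 2 * N) :
    (rothe (2 * N)).coeff i * y (γ - 11 * N) ^ i
      = sg N * u (264 * (γ * N) - 1452 * (N * (N + 1))) *
        (jt γ (i - N) * qb (N + (i - N : ℤ)).toNat (N - (i - N : ℤ)).toNat) := by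
  rw [rothe_coeff, if_pos hi, jt, y, ← u_natMul]
  have e1 : ((N : ℤ) + (i - N)).toNat = i := by omega
  have e2 : ((N : ℤ) - (i - N)).toNat = 2 * N - i := by omega
  rw [e1, e2, sg_sub]
  have e3 : u (264 * (γ * N) - 1452 * (N * (N + 1)))
        * u (1452 * (((i : ℤ) - N) * ((i : ℤ) - N - 1)) + 264 * (γ * ((i : ℤ) - N)))
      = u (1452 * (i * (i - 1))) * u (i * (264 * (γ - 11 * N))) := by
    rw [← u_add, ← u_add]; congr 1; ring
  linear_combination (-sg i * qb i (2 * N - i)) * e3 - (sg i * qb i (2 * N - i)) *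
    (u (264 * (γ * N) - 1452 * (N * (N + 1)))
        * u (1452 * (((i : ℤ) - N) * ((i : ℤ) - N - 1)) + 264 * (γ * ((i : ℤ) - N)))) * sg_sq N

/-- The finite form of the Jacobi triple product. -/
theorem finite_jtp (γ : ℤ) (N : ℕ) :
    ∑ k ∈ Icc (-N : ℤ) N, jt γ k * qb (N + k).toNat (N - k).toNat
      = poch γ N * poch (11 - γ) N := by
  set z := y (γ - 11 * N) with hz
  have h1 := rothe_eval (2 * N) z
  rw [Polynomial.eval_eq_sum_range' (rothe_natDegree _)] at h1
  have h2 := prod_range_two_mul N (fun l => 1 - y (γ + 11 * l))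
  rw [prod_one_sub_neg] at h2
  have h3 : ∏ i ∈ range (2 * N), (1 - y (11 * i) * z)
      = ∏ i ∈ range (2 * N), (1 - y (γ + 11 * ((i : ℤ) - N))) := by
    refine prod_congr rfl fun i _ => ?_
    rw [hz, ← y_add]; congr 2; ring
  rw [h3, h2] at h1
  have hc : sg N * u (264 * (γ * N) - 1452 * (N * (N + 1))) ≠ 0 :=
    mul_ne_zero (sg_ne_zero _) (u_ne_zero _)
  refine mul_left_cancel₀ hc ?_
  have h4 : ∏ l ∈ range N, (1 - y (γ + 11 * (l : ℤ))) = poch γ N := rfl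
  rw [h4] at h1
  calc _ = _ := by
        rw [sum_Icc_shift, mul_sum]
        exact sum_congr rfl fun i hi => (rothe_term γ N i (by rw [mem_range] at hi; omega)).symm
    _ = _ := h1
    _ = _ := by ring

/-- `z d/dz` of the finite Jacobi triple product. -/
theorem finite_jtp_deriv_aux (γ : ℤ) (N : ℕ) :
    sg N * u (264 * (γ * N) - 1452 * (N * (N + 1))) *
      ∑ k ∈ Icc (-N : ℤ) N, (k + N) * (jt γ k * qb (N + k).toNat (N - k).toNat)
      = ∑ i ∈ range (2 * N), -y (γ + 11 * ((i : ℤ) - N)) *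
          ∏ j ∈ (range (2 * N)).erase i, (1 - y (γ + 11 * ((j : ℤ) - N))) := by
  set z := y (γ - 11 * N) with hz
  have hd : (Polynomial.X * Polynomial.derivative (rothe (2 * N))).eval z
      = ∑ i ∈ range (2 * N), -y (γ + 11 * ((i : ℤ) - N)) *
          ∏ j ∈ (range (2 * N)).erase i, (1 - y (γ + 11 * ((j : ℤ) - N))) := by
    rw [rothe, Polynomial.derivative_prod_finset, Polynomial.eval_mul, Polynomial.eval_X,
      Polynomial.eval_finsetSum, mul_sum]
    refine sum_congr rfl fun i _ => ?_
    have hw : ∀ j : ℕ, y (γ + 11 * ((j : ℤ) - N)) = y (11 * j) * z := fun j => by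
      rw [hz, ← y_add]; congr 1; ring
    simp [Polynomial.eval_prod, hw]
    ring
  have hd2 : (Polynomial.X * Polynomial.derivative (rothe (2 * N))).eval z
      = ∑ i ∈ range (2 * N + 1), i * ((rothe (2 * N)).coeff i * z ^ i) := by
    rw [Polynomial.eval_mul, Polynomial.eval_X, Polynomial.derivative_eval,
      Polynomial.sum_over_range' _ (fun _ => by simp) _ (rothe_natDegree (2 * N)), mul_sum]
    refine sum_congr rfl fun i _ => ?_
    rcases i with _ | i
    · simp
    · rw [Nat.add_sub_cancel, pow_succ]; ring
  rw [← hd, hd2, sum_Icc_shift, mul_sum]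
  refine sum_congr rfl fun i hi => ?_
  rw [rothe_term γ N i (by rw [mem_range] at hi; omega)]
  push_cast
  ring

theorem prod_ne_of_not_dvd {γ : ℤ} (hγ : ¬ 11 ∣ γ) (l : ℤ) : 1 - y (γ + 11 * l) ≠ 0 :=
  one_sub_y_ne_zero (by omega)

theorem finite_jtp_deriv {γ : ℤ} (hγ : ¬ 11 ∣ γ) (N : ℕ) :
    ∑ k ∈ Icc (-N : ℤ) N, k * (jt γ k * qb (N + k).toNat (N - k).toNat)
      = poch γ N * poch (11 - γ) N * ∑ l ∈ range N,
        (y (11 - γ + 11 * l) / (1 - y (11 - γ + 11 * l)) - y (γ + 11 * l) / (1 - y (γ + 11 * l))) := by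
  have h1 := finite_jtp_deriv_aux γ N
  set c := sg N * u (264 * (γ * N) - 1452 * (N * (N + 1))) with hcdef
  have hc : c ≠ 0 := mul_ne_zero (sg_ne_zero _) (u_ne_zero _)
  have h2 := prod_range_two_mul N (fun l => 1 - y (γ + 11 * l))
  rw [prod_one_sub_neg, ← hcdef] at h2
  have h3 := sum_range_two_mul N (fun l => -y (γ + 11 * l) / (1 - y (γ + 11 * l)))
  have h4 : ∑ i ∈ range (2 * N), -y (γ + 11 * ((i : ℤ) - N)) *
          ∏ j ∈ (range (2 * N)).erase i, (1 - y (γ + 11 * ((j : ℤ) - N)))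
      = (∑ i ∈ range (2 * N), -y (γ + 11 * ((i : ℤ) - N)) / (1 - y (γ + 11 * ((i : ℤ) - N)))) *
        ∏ i ∈ range (2 * N), (1 - y (γ + 11 * ((i : ℤ) - N))) := by
    rw [sum_mul]
    refine sum_congr rfl fun i hi => ?_
    rw [← mul_prod_erase _ _ hi]
    have := prod_ne_of_not_dvd hγ ((i : ℤ) - N)
    field_simp
  have h5 : ∑ l ∈ range N, -y (γ + 11 * (-((l : ℤ) + 1))) / (1 - y (γ + 11 * (-((l : ℤ) + 1))))
      = N + ∑ l ∈ range N, y (11 - γ + 11 * l) / (1 - y (11 - γ + 11 * l)) := by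
    have : (N : K) = ∑ l ∈ range N, 1 := by simp
    rw [this, ← sum_add_distrib]
    refine sum_congr rfl fun l _ => ?_
    have e1 := prod_ne_of_not_dvd hγ (-((l : ℤ) + 1))
    have e2 : 1 - y (11 - γ + 11 * l) ≠ 0 := one_sub_y_ne_zero (by omega)
    have e3 : y (11 - γ + 11 * l) = (y (γ + 11 * (-((l : ℤ) + 1))))⁻¹ := by
      rw [← y_neg]; congr 1; ring
    have e4 := y_ne_zero (γ + 11 * (-((l : ℤ) + 1)))
    have e5 : y (γ + 11 * (-((l : ℤ) + 1))) - 1 ≠ 0 := by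
      intro h; exact e1 (by linear_combination -h)
    rw [e3] at e2 ⊢
    field_simp
    ring
  have h6 : ∑ k ∈ Icc (-N : ℤ) N, ((k : K) + N) * (jt γ k * qb (N + k).toNat (N - k).toNat)
      = ∑ k ∈ Icc (-N : ℤ) N, k * (jt γ k * qb (N + k).toNat (N - k).toNat)
        + N * (poch γ N * poch (11 - γ) N) := by
    rw [← finite_jtp γ N, mul_sum, ← sum_add_distrib]
    exact sum_congr rfl fun k _ => by ring
  have h7 : ∏ l ∈ range N, (1 - y (γ + 11 * (l : ℤ))) = poch γ N := rfl
  have h8 : ∑ l ∈ range N, -y (γ + 11 * (l : ℤ)) / (1 - y (γ + 11 * (l : ℤ)))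
      = -∑ l ∈ range N, y (γ + 11 * (l : ℤ)) / (1 - y (γ + 11 * (l : ℤ))) := by
    rw [← sum_neg_distrib]
    exact sum_congr rfl fun l _ => by ring
  rw [h4, h3, h2, h6, h7, h5, h8] at h1
  refine mul_left_cancel₀ hc ?_
  rw [sum_sub_distrib]
  linear_combination h1

theorem finite_jtp_deriv_zero (N : ℕ) :
    ∑ k ∈ Icc (-(N + 1 : ℕ) : ℤ) (N + 1 : ℕ),
      k * (jt 0 k * qb ((N + 1 : ℕ) + k).toNat ((N + 1 : ℕ) - k).toNat)
      = -(poch 11 N * poch 11 (N + 1)) := by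
  set M := N + 1 with hM
  have h1 := finite_jtp_deriv_aux 0 M
  set c := sg M * u (264 * (0 * M) - 1452 * (M * (M + 1))) with hcdef
  have hc : c ≠ 0 := mul_ne_zero (sg_ne_zero _) (u_ne_zero _)
  have hz : poch 0 M = 0 := by
    rw [poch, prod_eq_zero (i := 0) (by simp [hM])]
    simp [y_zero]
  have h6 : ∑ k ∈ Icc (-M : ℤ) M, ((k : K) + M) * (jt 0 k * qb (M + k).toNat (M - k).toNat)
      = ∑ k ∈ Icc (-M : ℤ) M, k * (jt 0 k * qb (M + k).toNat (M - k).toNat) := by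
    have h := finite_jtp 0 M
    rw [hz, zero_mul] at h
    calc _ = ∑ k ∈ Icc (-M : ℤ) M, k * (jt 0 k * qb (M + k).toNat (M - k).toNat)
          + M * ∑ k ∈ Icc (-M : ℤ) M, jt 0 k * qb (M + k).toNat (M - k).toNat := by
          rw [mul_sum, ← sum_add_distrib]
          exact sum_congr rfl fun k _ => by ring
      _ = _ := by rw [h, mul_zero, add_zero]
  have h0 : (1 : K) - y (0 + 11 * ((M : ℤ) - M)) = 0 := by simp [y_zero]
  have h4 : ∑ i ∈ range (2 * M), -y (0 + 11 * ((i : ℤ) - M)) *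
          ∏ j ∈ (range (2 * M)).erase i, (1 - y (0 + 11 * ((j : ℤ) - M)))
      = - ∏ j ∈ (range (2 * M)).erase M, (1 - y (0 + 11 * ((j : ℤ) - M))) := by
    rw [sum_eq_single M]
    · simp [y_zero]
    · intro i _ hi
      rw [prod_eq_zero (i := M) (mem_erase.mpr ⟨Ne.symm hi, by simp; omega⟩) h0, mul_zero]
    · intro h; simp at h; omega
  have h5 : ∏ j ∈ (range (2 * M)).erase M, (1 - y (0 + 11 * ((j : ℤ) - M)))
      = poch 11 N * (c * poch 11 M) := by
    have h := prod_range_two_mul M (fun l => if l = 0 then 1 else 1 - y (0 + 11 * l))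
    have e1 : ∏ i ∈ range (2 * M), (if (i : ℤ) - M = 0 then (1 : K) else 1 - y (0 + 11 * ((i : ℤ) - M)))
        = ∏ j ∈ (range (2 * M)).erase M, (1 - y (0 + 11 * ((j : ℤ) - M))) := by
      rw [← mul_prod_erase (range (2 * M)) _ (a := M) (by simp; omega), if_pos (by omega), one_mul]
      refine prod_congr rfl fun j hj => ?_
      rw [if_neg]
      have := (mem_erase.mp hj).1
      omega
    have e2 : ∏ l ∈ range M, (if (l : ℤ) = 0 then (1 : K) else 1 - y (0 + 11 * (l : ℤ))) = poch 11 N := by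
      rw [hM, prod_range_succ', poch]
      simp only [Nat.cast_zero, if_true, mul_one]
      refine prod_congr rfl fun j _ => ?_
      rw [if_neg (by omega)]
      congr 2; push_cast; ring
    have e3 : ∏ l ∈ range M, (if -((l : ℤ) + 1) = 0 then (1 : K) else 1 - y (0 + 11 * (-((l : ℤ) + 1))))
        = c * poch 11 M := by
      have := prod_one_sub_neg 0 M
      rw [sub_zero, ← hcdef] at this
      rw [← this]
      exact prod_congr rfl fun l _ => if_neg (by omega)
    rw [e1, e2, e3] at h
    exact h
  rw [h6, h4, h5] at h1
  exact mul_left_cancel₀ hc (by linear_combination h1)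

/-- The terms of the theta series. -/
noncomputable def th (a n : ℤ) : K := sg (n + a) * u (3 * (22 * n + 2 * a - 11) ^ 2)

/-- The moments of the theta series. -/
noncomputable def Tm (m : ℕ) (a : ℤ) : K :=
  lsum fun n : ℤ => ((22 * n + 2 * a - 11 : ℤ) : K) ^ m * th a n

/-- The periodic theta series. -/
noncomputable def T (a : ℤ) : K := Tm 0 a

theorem isO_intCast_pow (n : ℤ) (m : ℕ) : IsO 0 ((n : K) ^ m) := by
  have := isO_intCast (n ^ m)
  push_cast at this
  exact this

theorem three_sq_ge (x : ℤ) : |x| ≤ 3 * x ^ 2 := by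
  have : x ^ 2 = |x| ^ 2 := (sq_abs x).symm
  have h0 := abs_nonneg x
  rcases eq_or_lt_of_le h0 with h | h
  · rw [this, ← h]; simp
  · nlinarith

theorem isO_th (a n : ℤ) : IsO (|n| - |2 * a - 11|) (th a n) := by
  refine (isO_sg _).mul' (isO_u _) ?_
  have h1 := three_sq_ge (22 * n + 2 * a - 11)
  have h2 : |22 * n| - |2 * a - 11| ≤ |22 * n + 2 * a - 11| := by
    have := abs_sub_abs_le_abs_add (22 * n) (2 * a - 11)
    rwa [← add_sub_assoc] at this
  rw [abs_mul] at h2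
  have := abs_nonneg n
  norm_num at h2
  omega

theorem isSum_Tm (m : ℕ) (a : ℤ) :
    IsSum (fun n : ℤ => ((22 * n + 2 * a - 11 : ℤ) : K) ^ m * th a n) (Tm m a) :=
  isSum_of_isO |2 * a - 11| fun n => (isO_intCast_pow _ m).mul' (isO_th a n) (by omega)

theorem isSum_T (a : ℤ) : IsSum (th a) (T a) :=
  (isSum_Tm 0 a).congr fun n => by simp

theorem Tm_add_eleven (m : ℕ) (a : ℤ) : Tm m (a + 11) = Tm m a := by
  refine (isSum_Tm m (a + 11)).unique (((isSum_Tm m a).comp_equiv (Equiv.addRight 1)).congr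
    fun n => ?_)
  have e : 22 * (n + 1) + 2 * a - 11 = 22 * n + 2 * (a + 11) - 11 := by ring
  simp only [Equiv.coe_addRight, th, e]
  rw [sg_eq_of_even_sub (a := n + 1 + a) (b := n + (a + 11)) ⟨-5, by ring⟩]

theorem Tm_neg (m : ℕ) (a : ℤ) : Tm m (-a) = -(-1) ^ m * Tm m a := by
  refine (isSum_Tm m (-a)).unique ((((isSum_Tm m a).comp_equiv
    (Equiv.subLeft (1 : ℤ))).mul_left (-(-1) ^ m)).congr fun n => ?_)
  have e : 22 * (1 - n) + 2 * a - 11 = -(22 * n + 2 * -a - 11) := by ring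
  have e2 : sg (1 - n + a) = -sg (n + -a) := by
    rw [show 1 - n + a = 1 + -(n + -a) by ring, sg_add, sg_one, sg_neg]; ring
  have e3 : ((-1 : K) ^ m) * (-1) ^ m = 1 := by rw [← mul_pow]; simp
  simp only [Equiv.subLeft_apply, th, e, e2]
  rw [neg_sq, Int.cast_neg, neg_pow]
  linear_combination (((22 * n + 2 * -a - 11 : ℤ) : K) ^ m * (sg (n + -a) *
    u (3 * (22 * n + 2 * -a - 11) ^ 2))) * e3

theorem T_add_eleven (a : ℤ) : T (a + 11) = T a := Tm_add_eleven 0 a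

theorem T_neg (a : ℤ) : T (-a) = -T a := by simpa [T] using Tm_neg 0 a

theorem periodic_int {α : Type*} {f : ℤ → α} (hf : ∀ a, f (a + 11) = f a) (a j : ℤ) :
    f (a + 11 * j) = f a := by
  have hn : ∀ (n : ℕ) a, f (a + 11 * n) = f a := fun n => by
    induction n with
    | zero => simp
    | succ n ih => intro a; rw [← ih a, ← hf (a + 11 * n)]; congr 1; push_cast; ring
  obtain ⟨n, rfl | rfl⟩ := j.eq_nat_or_neg
  · exact hn n a
  · rw [← hn n (a + 11 * -n)]; congr 1; ring

theorem isSum_jt (γ : ℤ) (m : ℕ) :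
    IsSum (fun n : ℤ => ((22 * n + 2 * γ - 11 : ℤ) : K) ^ m * jt γ n)
      (sg γ * u (-(3 * (2 * γ - 11) ^ 2)) * Tm m γ) := by
  refine ((isSum_Tm m γ).mul_left _).congr fun n => ?_
  have e1 : u (3 * (22 * n + 2 * γ - 11) ^ 2) * u (-(3 * (2 * γ - 11) ^ 2))
      = u (1452 * (n * (n - 1)) + 264 * (γ * n)) := by
    rw [← u_add]; congr 1; ring
  rw [th, jt, sg_add]
  linear_combination (sg γ * sg γ * ((22 * n + 2 * γ - 11 : ℤ) : K) ^ m * sg n) * e1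
    + (((22 * n + 2 * γ - 11 : ℤ) : K) ^ m * sg n *
      u (1452 * (n * (n - 1)) + 264 * (γ * n))) * sg_sq γ

theorem tends_qb (k : ℤ) : Tends (fun N : ℕ => qb (N + k).toNat (N - k).toNat) E⁻¹ := by
  have h0 : Tends (poch 11) E := tends_poch (by norm_num)
  have h1 : Tends (fun N : ℕ => poch 11 ((N + k).toNat + (N - k).toNat)) E :=
    h0.comp fun n => ⟨n + k.natAbs, fun N _ => by omega⟩
  have h2 : Tends (fun N : ℕ => poch 11 (N + k).toNat) E :=
    h0.comp fun n => ⟨n + k.natAbs, fun N _ => by omega⟩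
  have h3 : Tends (fun N : ℕ => poch 11 (N - k).toNat) E :=
    h0.comp fun n => ⟨n + k.natAbs, fun N _ => by omega⟩
  have h4 := h1.mul ((h2.mul h3).inv ⟨0, fun N _ =>
    (isOne_poch (by norm_num) _).mul (isOne_poch (by norm_num) _)⟩)
  have h5 : E * (E * E)⁻¹ = E⁻¹ := by have := E_ne_zero; field_simp
  rw [h5] at h4
  exact h4

theorem tends_finite_jtp (γ : ℤ) (m : ℕ) :
    Tends (fun N : ℕ => ∑ k ∈ Icc (-N : ℤ) N, ((22 * k + 2 * γ - 11 : ℤ) : K) ^ m *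
      (jt γ k * qb (N + k).toNat (N - k).toNat))
      (sg γ * u (-(3 * (2 * γ - 11) ^ 2)) * Tm m γ * E⁻¹) := by
  refine ((isSum_jt γ m).tends_mul (v := fun N k => qb (N + k).toNat (N - k).toNat)
    (fun N j _ _ => (isOne_qb _ _).isO) tends_qb).congr ⟨0, fun N _ => ?_⟩
  exact sum_congr rfl fun k _ => by ring

/-- The Jacobi triple product. -/
theorem T_eq {γ : ℤ} (h0 : 0 < γ) (h1 : γ < 11) :
    T γ = sg γ * u (3 * (2 * γ - 11) ^ 2) * E * pochInf γ * pochInf (11 - γ) := by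
  have h2 := tends_finite_jtp γ 0
  have h3 : Tends (fun N => poch γ N * poch (11 - γ) N) (pochInf γ * pochInf (11 - γ)) :=
    (tends_poch h0).mul (tends_poch (by omega))
  have h4 := h2.unique (h3.congr ⟨0, fun N _ => by
    rw [← finite_jtp γ N]; exact sum_congr rfl fun k _ => by simp⟩)
  have e : u (3 * (2 * γ - 11) ^ 2) * u (-(3 * (2 * γ - 11) ^ 2)) = 1 := by
    rw [← u_add, add_neg_cancel, u_zero]
  have hE := E_ne_zero
  rw [T]
  have h5 : sg γ * u (-(3 * (2 * γ - 11) ^ 2)) * Tm 0 γ = pochInf γ * pochInf (11 - γ) * E := by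
    rw [← h4]; field_simp
  linear_combination (-Tm 0 γ) * e + (sg γ * u (3 * (2 * γ - 11) ^ 2)) * h5
    - Tm 0 γ * (u (3 * (2 * γ - 11) ^ 2) * u (-(3 * (2 * γ - 11) ^ 2))) * sg_sq γ

theorem T_ne_zero {a : ℤ} (ha : ¬ 11 ∣ a) : T a ≠ 0 := by
  have h1 : T a = T (a % 11) := by
    rw [← periodic_int T_add_eleven (a % 11) (a / 11), Int.emod_add_mul_ediv]
  rw [h1, T_eq (by omega) (by omega)]
  have h2 := (isOne_pochInf (a := a % 11) (by omega)).ne_zero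
  have h3 := (isOne_pochInf (a := 11 - a % 11) (by omega)).ne_zero
  have := E_ne_zero
  have := sg_ne_zero (a % 11)
  have := u_ne_zero (3 * (2 * (a % 11) - 11) ^ 2)
  positivity

/-- The partial sums of the logarithmic derivative of the theta product. -/
noncomputable def Ls (γ : ℤ) (N : ℕ) : K := ∑ l ∈ range N,
  (y (11 - γ + 11 * l) / (1 - y (11 - γ + 11 * l)) - y (γ + 11 * l) / (1 - y (γ + 11 * l)))

/-- The normalised logarithmic derivative of the theta series. -/
noncomputable def rho (a : ℤ) : K := -Tm 1 a / (22 * T a)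

theorem isSum_deriv (γ : ℤ) : Tends (fun N : ℕ => ∑ k ∈ Icc (-N : ℤ) N,
      k * (jt γ k * qb (N + k).toNat (N - k).toNat))
      (sg γ * u (-(3 * (2 * γ - 11) ^ 2)) * E⁻¹ * ((Tm 1 γ - (2 * γ - 11) * T γ) / 22)) := by
  have h1 := (tends_finite_jtp γ 1).const_mul (22⁻¹)
  have h2 := (tends_finite_jtp γ 0).const_mul (22⁻¹ * (2 * γ - 11))
  have h3 := h1.sub h2
  have e : sg γ * u (-(3 * (2 * γ - 11) ^ 2)) * E⁻¹ * ((Tm 1 γ - (2 * γ - 11) * T γ) / 22)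
    = 22⁻¹ * (sg γ * u (-(3 * (2 * γ - 11) ^ 2)) * Tm 1 γ * E⁻¹)
     - 22⁻¹ * (2 * γ - 11) * (sg γ * u (-(3 * (2 * γ - 11) ^ 2)) * Tm 0 γ * E⁻¹) := by
    rw [T]; ring
  rw [e]
  refine h3.congr ⟨0, fun N _ => ?_⟩
  simp only [mul_sum]
  rw [← sum_sub_distrib]
  refine sum_congr rfl fun k _ => ?_
  push_cast
  have : (22 : K)⁻¹ * 22 = 1 := by norm_num
  linear_combination (k * (jt γ k * qb (N + k).toNat (N - k).toNat)) * this

theorem tends_Ls {γ : ℤ} (h0 : 0 < γ) (h1 : γ < 11) :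
    Tends (Ls γ) (-rho γ - (2 * γ - 11) / 22) := by
  have h2 : Tends (fun N => poch γ N * poch (11 - γ) N) (pochInf γ * pochInf (11 - γ)) :=
    (tends_poch h0).mul (tends_poch (by omega))
  have hone : ∀ N, IsOne (poch γ N * poch (11 - γ) N) := fun N =>
    (isOne_poch h0 _).mul (isOne_poch (by omega) _)
  have h3 := (isSum_deriv γ).mul (h2.inv ⟨0, fun N _ => hone N⟩)
  have hT := T_ne_zero (a := γ) (by omega)
  have e : sg γ * u (-(3 * (2 * γ - 11) ^ 2)) * E⁻¹ * ((Tm 1 γ - (2 * γ - 11) * T γ) / 22) *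
      (pochInf γ * pochInf (11 - γ))⁻¹ = -rho γ - (2 * γ - 11) / 22 := by
    have e2 : (pochInf γ * pochInf (11 - γ))⁻¹ =
        sg γ * u (3 * (2 * γ - 11) ^ 2) * E / T γ := by
      have a1 := (isOne_pochInf h0).ne_zero
      have a2 := (isOne_pochInf (a := 11 - γ) (by omega)).ne_zero
      have a3 := E_ne_zero
      have a4 := u_ne_zero (3 * (2 * γ - 11) ^ 2)
      have a5 := sg_ne_zero γ
      rw [T_eq h0 h1]
      field_simp
    have e3 : u (3 * (2 * γ - 11) ^ 2) * u (-(3 * (2 * γ - 11) ^ 2)) = 1 := by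
      rw [← u_add, add_neg_cancel, u_zero]
    have hE := E_ne_zero
    rw [e2, rho]
    calc _ = (sg γ * sg γ) * (u (3 * (2 * γ - 11) ^ 2) * u (-(3 * (2 * γ - 11) ^ 2))) * (E⁻¹ * E)
          * ((Tm 1 γ - (2 * γ - 11) * T γ) / 22 / T γ) := by ring
      _ = _ := by
        rw [sg_sq, e3, inv_mul_cancel₀ hE]
        field_simp
  rw [e] at h3
  refine h3.congr ⟨0, fun N _ => ?_⟩
  rw [finite_jtp_deriv (by omega), mul_comm, ← mul_assoc, inv_mul_cancel₀ (hone N).ne_zero, one_mul]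
  rfl

/-- Jacobi's derivative formula. -/
theorem Tm_one_zero : Tm 1 0 = -22 * h ^ 3 := by
  have h1 := (isSum_deriv 0).comp (φ := fun N => N + 1) fun n => ⟨n, fun N _ => by omega⟩
  have hE : Tends (poch 11) E := tends_poch (by norm_num)
  have h2 := (hE.mul (hE.comp (φ := fun N => N + 1) fun n => ⟨n, fun N _ => by omega⟩)).neg
  have h3 := h1.unique (h2.congr ⟨0, fun N _ => by rw [← finite_jtp_deriv_zero]⟩)
  have h4 : T 0 = 0 := by
    have := T_neg 0
    rw [neg_zero] at this
    linear_combination this / 2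
  rw [h4, sg_zero] at h3
  have e : u (-(3 * (2 * 0 - 11) ^ 2)) * u 121 ^ 3 = 1 := by
    rw [← u_natMul, ← u_add, ← u_zero]; congr 1
  have hE0 := E_ne_zero
  have h5 : u (-(3 * (2 * 0 - 11) ^ 2)) * Tm 1 0 = -22 * E ^ 3 := by
    field_simp at h3
    linear_combination h3
  rw [h]
  linear_combination (-Tm 1 0) * e + u 121 ^ 3 * h5

theorem rho_neg (a : ℤ) : rho (-a) = -rho a := by
  rw [rho, rho, Tm_neg, T_neg]; ring

theorem rho_add_eleven (a : ℤ) : rho (a + 11) = rho a := by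
  rw [rho, rho, Tm_add_eleven, T_add_eleven]

section Lagrange

variable {ι κ F : Type*} [Field F] [DecidableEq ι] [DecidableEq κ]

theorem lagrange_simple {s : Finset ι} {v : ι → F} (hv : Set.InjOn v s) {f : Polynomial F}
    (hf : f.degree < #s) {x : F} (hx : ∀ i ∈ s, x ≠ v i) :
    ∑ i ∈ s, f.eval (v i) / ((x - v i) * ∏ j ∈ s.erase i, (v i - v j))
      = f.eval x / ∏ i ∈ s, (x - v i) := by
  have h0 : ∏ i ∈ s, (x - v i) ≠ 0 := prod_ne_zero_iff.mpr fun i hi => sub_ne_zero.mpr (hx i hi)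
  have h := congrArg (Polynomial.eval x) (Lagrange.eq_interpolate hv hf)
  rw [Lagrange.eval_interpolate_not_at_node _ hx, Lagrange.eval_nodal] at h
  rw [h, mul_div_cancel_left₀ _ h0]
  refine sum_congr rfl fun i _ => ?_
  rw [Lagrange.nodalWeight, prod_inv_distrib]
  field_simp

theorem eval_derivative_nodal {s : Finset ι} {v : ι → F} {x : F} (hx : ∀ i ∈ s, x ≠ v i) :
    (Polynomial.derivative (Lagrange.nodal s v)).eval x
      = (∏ i ∈ s, (x - v i)) * ∑ i ∈ s, (x - v i)⁻¹ := by
  rw [Lagrange.derivative_nodal, Polynomial.eval_finsetSum, mul_sum]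
  refine sum_congr rfl fun i hi => ?_
  rw [Lagrange.eval_nodal, ← mul_prod_erase _ _ hi]
  have := sub_ne_zero.mpr (hx i hi)
  field_simp

/-- Partial fractions with a double pole at the node `v i₀`, in logarithmic form. -/
theorem lagrange_double {s : Finset ι} {v : ι → F} (hv : Set.InjOn v s) {f : Polynomial F}
    (hf : f.degree < #s) {i₀ : ι} (hi₀ : i₀ ∈ s) {D : F}
    (hD : (Polynomial.derivative f).eval (v i₀) = f.eval (v i₀) * D) :
    ∑ i ∈ s.erase i₀, f.eval (v i) / ((v i₀ - v i) * ∏ j ∈ s.erase i, (v i - v j))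
      = f.eval (v i₀) / (∏ i ∈ s.erase i₀, (v i₀ - v i)) *
        (D - ∑ i ∈ s.erase i₀, (v i₀ - v i)⁻¹) := by
  set x := v i₀
  set t := s.erase i₀ with ht
  have hx : ∀ i ∈ t, x ≠ v i := fun i hi h =>
    (mem_erase.mp hi).1 (hv (mem_erase.mp hi).2 hi₀ h.symm)
  set g := Lagrange.nodal t v with hg
  have hg0 : g.eval x = ∏ i ∈ t, (x - v i) := Lagrange.eval_nodal
  have hgx : g.eval x ≠ 0 := by
    rw [hg0]; exact prod_ne_zero_iff.mpr fun i hi => sub_ne_zero.mpr (hx i hi)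
  have hdvd : Polynomial.X - Polynomial.C x ∣
      f * Polynomial.C (g.eval x) - Polynomial.C (f.eval x) * g := by
    rw [Polynomial.dvd_iff_isRoot]
    simp [Polynomial.IsRoot]
  obtain ⟨q, hq⟩ := hdvd
  have hcard : #t + 1 = #s := card_erase_add_one hi₀
  have hdeg : q.degree < #t := by
    by_cases hq0 : q = 0
    · rw [hq0, Polynomial.degree_zero]; exact WithBot.bot_lt_coe _
    have h1 : (f * Polynomial.C (g.eval x) - Polynomial.C (f.eval x) * g).degree < #s := by
      refine (Polynomial.degree_sub_le _ _).trans_lt (max_lt ?_ ?_)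
      · rwa [Polynomial.degree_mul_C hgx]
      · refine lt_of_le_of_lt (b := g.degree) ?_ ?_
        · by_cases h0 : f.eval x = 0
          · simp [h0]
          · rw [Polynomial.degree_C_mul h0]
        · rw [hg, Lagrange.degree_nodal, ← hcard]
          exact_mod_cast Nat.lt_succ_self _
    rw [hq, Polynomial.degree_mul, Polynomial.degree_X_sub_C, ← hcard,
      Polynomial.degree_eq_natDegree hq0] at h1
    rw [Polynomial.degree_eq_natDegree hq0]
    have : 1 + q.natDegree < #t + 1 := by exact_mod_cast h1
    exact_mod_cast (by omega : q.natDegree < #t)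
  have hqx : q.eval x = f.eval x * D * g.eval x - f.eval x * (g.eval x * ∑ i ∈ t, (x - v i)⁻¹) := by
    have h := congrArg (fun p => (Polynomial.derivative p).eval x) hq
    simp only [Polynomial.derivative_sub, Polynomial.derivative_mul, Polynomial.derivative_C,
      Polynomial.derivative_X, Polynomial.eval_sub, Polynomial.eval_add, Polynomial.eval_mul,
      Polynomial.eval_C, Polynomial.eval_X, Polynomial.eval_zero, Polynomial.eval_one] at h
    rw [hD, hg, eval_derivative_nodal hx, ← hg0, ← hg] at h
    linear_combination -h
  have hqv : ∀ i ∈ t, q.eval (v i) = -(f.eval (v i) * g.eval x) / (x - v i) := fun i hi => by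
    have h := congrArg (fun p => p.eval (v i)) hq
    have hgi : g.eval (v i) = 0 := Lagrange.eval_nodal_at_node hi
    simp only [Polynomial.eval_sub, Polynomial.eval_mul,
      Polynomial.eval_C, Polynomial.eval_X, hgi] at h
    have := sub_ne_zero.mpr (hx i hi)
    field_simp
    linear_combination h
  have h := lagrange_simple (hv.mono (by rw [ht]; exact_mod_cast erase_subset _ _)) hdeg hx
  rw [hqx, ← hg0] at h
  have h2 : ∑ i ∈ t, f.eval (v i) / ((x - v i) * ∏ j ∈ s.erase i, (v i - v j))
      = (g.eval x)⁻¹ * ∑ i ∈ t, q.eval (v i) / ((x - v i) * ∏ j ∈ t.erase i, (v i - v j)) := by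
    rw [mul_sum]
    refine sum_congr rfl fun i hi => ?_
    have hi₁ : i₀ ∈ s.erase i := mem_erase.mpr ⟨(mem_erase.mp hi).1.symm, hi₀⟩
    have h3 : (s.erase i).erase i₀ = t.erase i := by rw [ht, erase_right_comm]
    have h4 := sub_ne_zero.mpr (hx i hi)
    have h5 : v i - x ≠ 0 := sub_ne_zero.mpr (hx i hi).symm
    have h6 : ∏ j ∈ t.erase i, (v i - v j) ≠ 0 := prod_ne_zero_iff.mpr fun j hj => by
      refine sub_ne_zero.mpr fun h => (mem_erase.mp hj).1 ?_
      exact hv (mem_erase.mp (mem_erase.mp hj).2).2 (mem_erase.mp hi).2 h.symm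
    rw [← mul_prod_erase _ _ hi₁, h3, hqv i hi]
    have h7 : v i - v i₀ = -(x - v i) := by ring
    rw [h7]
    field_simp
  rw [h2, h, ← hg0]
  field_simp

end Lagrange

/-- `s(e) = y ^ (e / 2) - y ^ (-e / 2)`. -/
noncomputable def sn (e : ℤ) : K := u (132 * e) - u (-(132 * e))

theorem y_sub_y (a b : ℤ) : y a - y b = u (132 * (a + b)) * sn (a - b) := by
  rw [sn, mul_sub, ← u_add, ← u_add, y, y]
  congr 2 <;> ring

theorem prod_u {ι : Type*} (s : Finset ι) (f : ι → ℤ) : ∏ i ∈ s, u (f i) = u (∑ i ∈ s, f i) := by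
  classical
  induction s using Finset.induction_on with
  | empty => simp [u_zero]
  | insert a s ha ih => rw [prod_insert ha, sum_insert ha, ih, u_add]

theorem sum_Icc_id (N : ℕ) : ∑ l ∈ Icc (-N : ℤ) N, l = 0 := by
  have h : ∑ l ∈ Icc (-N : ℤ) N, l = ∑ l ∈ Icc (-N : ℤ) N, -l :=
    sum_equiv (Equiv.neg ℤ) (by intro i; simp only [mem_Icc, Equiv.neg_apply]; omega)
      (by intro i _; simp)
  rw [sum_neg_distrib] at h
  omega

theorem card_Icc_neg (N : ℕ) : #(Icc (-N : ℤ) N) = 2 * N + 1 := by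
  rw [Int.card_Icc]; omega

/-- The symmetric finite theta product. -/
noncomputable def sprod (N : ℕ) (γ : ℤ) : K := ∏ l ∈ Icc (-N : ℤ) N, sn (γ - 11 * l)

/-- The symmetric finite theta product at `11 j` without its zero factor. -/
noncomputable def sprod' (N : ℕ) (j : ℤ) : K :=
  ∏ l ∈ (Icc (-N : ℤ) N).erase j, sn (11 * j - 11 * l)

theorem prod_y_sub (N : ℕ) (k d : ℤ) : ∏ l ∈ Icc (-N : ℤ) N, (y k - y (d + 11 * l))
    = u (132 * ((2 * N + 1) * (k + d))) * sprod N (k - d) := by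
  simp_rw [y_sub_y, prod_mul_distrib, prod_u, sprod]
  congr 1
  · congr 1
    rw [← mul_sum]
    congr 1
    simp_rw [← add_assoc]
    rw [sum_add_distrib, ← mul_sum, sum_Icc_id, sum_const, card_Icc_neg]
    simp
  · exact prod_congr rfl fun l _ => by congr 1; ring

theorem prod_y_sub' (N : ℕ) (d : ℤ) {j : ℤ} (hj : j ∈ Icc (-N : ℤ) N) :
    ∏ l ∈ (Icc (-N : ℤ) N).erase j, (y (d + 11 * j) - y (d + 11 * l))
    = u (132 * ((2 * N + 1) * (2 * d + 11 * j) - 2 * (d + 11 * j))) * sprod' N j := by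
  simp_rw [y_sub_y, prod_mul_distrib, prod_u, sprod']
  congr 1
  · congr 1
    rw [← mul_sum]
    congr 1
    rw [← add_right_inj (d + 11 * j + (d + 11 * j)),
      add_sum_erase _ (fun l => d + 11 * j + (d + 11 * l)) hj]
    have : ∀ l, d + 11 * j + (d + 11 * l) = (2 * d + 11 * j) + 11 * l := fun l => by ring
    simp_rw [this]
    rw [sum_add_distrib, ← mul_sum, sum_Icc_id, sum_const, card_Icc_neg]
    simp
    ring
  · exact prod_congr rfl fun l _ => by congr 1; ring

theorem prod_sn (γ : ℤ) (a b : ℕ) :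
    (∏ i ∈ range a, sn (γ + 11 * i)) * ∏ i ∈ range b, sn (γ - 11 * (i + 1))
      = sg a * u (-(132 * ((a - b) * γ) + 726 * (a * (a - 1) + b * (b + 1)))) *
        (poch γ a * poch (11 - γ) b) := by
  have ha : ∏ i ∈ range a, sn (γ + 11 * i)
      = sg a * u (-(132 * (a * γ) + 726 * (a * (a - 1)))) * poch γ a := by
    induction a with
    | zero => simp [sg_zero, u_zero, poch_zero]
    | succ a ih =>
      have e1 : sn (γ + 11 * a) = -(u (-(132 * (γ + 11 * a))) * (1 - y (γ + 11 * a))) := by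
        rw [sn, mul_sub, y, ← u_add, mul_one, neg_sub]; congr 2; ring
      have e2 : u (-(132 * (((a + 1 : ℕ) : ℤ) * γ) + 726 * (((a + 1 : ℕ) : ℤ) * (((a + 1 : ℕ) : ℤ) - 1))))
          = u (-(132 * (a * γ) + 726 * (a * (a - 1)))) * u (-(132 * (γ + 11 * a))) := by
        rw [← u_add]; congr 1; push_cast; ring
      have e3 : sg ((a + 1 : ℕ) : ℤ) = -sg a := by push_cast; rw [sg_add, sg_one]; ring
      rw [prod_range_succ, ih, e1, e2, e3, poch_succ]
      ring
  have hb : ∏ i ∈ range b, sn (γ - 11 * (i + 1))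
      = u (132 * (b * γ) - 726 * (b * (b + 1))) * poch (11 - γ) b := by
    induction b with
    | zero => simp [u_zero, poch_zero]
    | succ b ih =>
      have e1 : sn (γ - 11 * (b + 1)) = u (132 * (γ - 11 * (b + 1))) * (1 - y (11 - γ + 11 * b)) := by
        rw [sn, y, mul_sub (u (132 * (γ - 11 * (b + 1)))), mul_one, ← u_add]; congr 2; ring
      have e2 : u (132 * (((b + 1 : ℕ) : ℤ) * γ) - 726 * (((b + 1 : ℕ) : ℤ) * (((b + 1 : ℕ) : ℤ) + 1)))
          = u (132 * (b * γ) - 726 * (b * (b + 1))) * u (132 * (γ - 11 * (b + 1))) := by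
        rw [← u_add]; congr 1; push_cast; ring
      rw [prod_range_succ, ih, e1, e2, poch_succ]
      ring
  have e : u (-(132 * ((a - b) * γ) + 726 * (a * (a - 1) + b * (b + 1))))
      = u (-(132 * (a * γ) + 726 * (a * (a - 1)))) * u (132 * (b * γ) - 726 * (b * (b + 1))) := by
    rw [← u_add]; congr 1; ring
  rw [ha, hb, e]
  ring

theorem prod_Icc_split {M : Type*} [CommMonoid M] {N : ℕ} {j : ℤ} (h1 : -(N + 1 : ℤ) ≤ j)
    (h2 : j ≤ N) (f : ℤ → M) : ∏ l ∈ Icc (-N : ℤ) N, f (j - l)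
      = (∏ i ∈ range (N + j + 1).toNat, f i) * ∏ i ∈ range (N - j).toNat, f (-(i + 1)) := by
  have hs : Icc (-N : ℤ) N = (Icc (-N : ℤ) j) ∪ Icc (j + 1) N := by
    ext l; simp only [mem_union, mem_Icc]; omega
  rw [hs, prod_union (by
    rw [disjoint_left]; intro l; simp only [mem_Icc]; omega)]
  congr 1
  · refine prod_bij' (fun l _ => (j - l).toNat) (fun i _ => j - i) ?_ ?_ ?_ ?_ ?_
    · intro l hl; rw [mem_Icc] at hl; rw [mem_range]; omega
    · intro i hi; rw [mem_range] at hi; rw [mem_Icc]; omega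
    · intro l hl; rw [mem_Icc] at hl; omega
    · intro i hi; omega
    · intro l hl; rw [mem_Icc] at hl; congr 1; omega
  · refine prod_bij' (fun l _ => (l - j - 1).toNat) (fun i _ => j + 1 + i) ?_ ?_ ?_ ?_ ?_
    · intro l hl; rw [mem_Icc] at hl; rw [mem_range]; omega
    · intro i hi; rw [mem_range] at hi; rw [mem_Icc]; omega
    · intro l hl; rw [mem_Icc] at hl; omega
    · intro i hi; omega
    · intro l hl; rw [mem_Icc] at hl; congr 1; omega

/-- The normalised symmetric product. -/
noncomputable def Bn (N : ℕ) (γ : ℤ) : K :=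
  sg (N + γ + 1) * u (1452 * (N * (N + 1)) + 363 + 12 * γ ^ 2) * sprod N γ

/-- The normalised symmetric product without its zero factor. -/
noncomputable def Bn' (N : ℕ) (j : ℤ) : K :=
  sg (N + j + 1) * u (1452 * (N * (N + 1)) + 363 + 12 * (11 * j) ^ 2) * sprod' N j

theorem Bn_eq {N : ℕ} {γ j : ℤ} (h1 : -(N + 1 : ℤ) ≤ j) (h2 : j ≤ N) :
    Bn N (γ + 11 * j) = sg γ * u (3 * (2 * γ - 11) ^ 2) *
      (poch γ (N + j + 1).toNat * poch (11 - γ) (N - j).toNat) := by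
  have h := prod_Icc_split h1 h2 (fun l => sn (γ + 11 * l))
  have e0 : ∏ i ∈ range (N - j).toNat, sn (γ + 11 * (-((i : ℤ) + 1)))
      = ∏ i ∈ range (N - j).toNat, sn (γ - 11 * (i + 1)) :=
    prod_congr rfl fun i _ => by congr 1
  have e1 : sprod N (γ + 11 * j) = ∏ l ∈ Icc (-N : ℤ) N, sn (γ + 11 * (j - l)) :=
    prod_congr rfl fun l _ => by congr 1; ring
  rw [e0, prod_sn, ← e1] at h
  have ca : (((N + j + 1).toNat : ℕ) : ℤ) = N + j + 1 := by omega
  have cb : (((N - j).toNat : ℕ) : ℤ) = N - j := by omega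
  rw [Bn, h, ca, cb]
  have e2 : u (1452 * (N * (N + 1)) + 363 + 12 * (γ + 11 * j) ^ 2) *
      u (-(132 * (((N + j + 1) - (N - j)) * γ) + 726 * ((N + j + 1) * ((N + j + 1) - 1)
        + (N - j) * ((N - j) + 1)))) = u (3 * (2 * γ - 11) ^ 2) := by
    rw [← u_add]; congr 1; ring
  have e3 : sg (N + (γ + 11 * j) + 1) * sg (N + j + 1) = sg γ := by
    rw [← sg_add]; exact sg_eq_of_even_sub ⟨N + 6 * j + 1, by ring⟩
  rw [← e2, ← e3]
  ring

theorem Bn'_eq {N : ℕ} {j : ℤ} (h1 : -N ≤ j) (h2 : j ≤ N) :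
    Bn' N j = -u 363 * (poch 11 (N + j).toNat * poch 11 (N - j).toNat) := by
  have h := prod_Icc_split (by omega) h2 (fun l => if l = 0 then 1 else sn (11 * l))
  have e1 : sprod' N j = ∏ l ∈ Icc (-N : ℤ) N, (if j - l = 0 then 1 else sn (11 * (j - l))) := by
    rw [← mul_prod_erase _ _ (a := j) (by rw [mem_Icc]; omega), sub_self, if_pos rfl, one_mul, sprod']
    refine prod_congr rfl fun l hl => ?_
    rw [if_neg (by have := (mem_erase.mp hl).1; omega)]
    congr 1; ring
  have ha : (N + j + 1).toNat = (N + j).toNat + 1 := by omega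
  have e2 : ∏ i ∈ range ((N + j).toNat + 1), (if (i : ℤ) = 0 then (1 : K) else sn (11 * i))
      = ∏ i ∈ range (N + j).toNat, sn (11 + 11 * i) := by
    rw [prod_range_succ']
    simp only [Nat.cast_zero, if_true, mul_one]
    refine prod_congr rfl fun i _ => ?_
    rw [if_neg (by omega)]
    congr 1; push_cast; ring
  have e3 : ∏ i ∈ range (N - j).toNat, (if -((i : ℤ) + 1) = 0 then (1 : K) else sn (11 * (-(i + 1))))
      = ∏ i ∈ range (N - j).toNat, sn (0 - 11 * (i + 1)) :=
    prod_congr rfl fun i _ => by rw [if_neg (by omega)]; congr 1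
  have p1 := prod_sn 11 (N + j).toNat 0
  have p2 := prod_sn 0 0 (N - j).toNat
  have ca : (((N + j).toNat : ℕ) : ℤ) = N + j := by omega
  have cb : (((N - j).toNat : ℕ) : ℤ) = N - j := by omega
  simp only [range_zero, prod_empty, mul_one, one_mul, poch_zero, ca, cb, Nat.cast_zero, sg_zero] at p1 p2
  rw [ha, e2, e3, p1, p2] at h
  rw [Bn', e1, h]
  have e4 : u (1452 * (N * (N + 1)) + 363 + 12 * (11 * j) ^ 2) *
      (u (-(132 * ((N + j - 0) * 11) + 726 * ((N + j) * (N + j - 1) + 0 * (0 + 1)))) *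
       u (-(132 * ((0 - (N - j)) * 0) + 726 * (0 * (0 - 1) + (N - j) * (N - j + 1))))) = u 363 := by
    rw [← u_add, ← u_add]; congr 1; ring
  have e5 : sg (N + j + 1) * sg (N + j) = -1 := by
    rw [← sg_add]; exact sg_odd ⟨N + j, by ring⟩
  rw [← e4, show (11 : ℤ) - 0 = 11 from rfl]
  generalize u (1452 * (N * (N + 1)) + 363 + 12 * (11 * j) ^ 2) = A
  generalize u (-(132 * ((N + j - 0) * 11) + 726 * ((N + j) * (N + j - 1) + 0 * (0 + 1)))) = B
  generalize u (-(132 * ((0 - (N - j)) * 0) + 726 * (0 * (0 - 1) + (N - j) * (N - j + 1)))) = C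
  linear_combination (A * (B * C) * (poch 11 (N + j).toNat * poch 11 (N - j).toNat)) * e5

/-- A uniformly bounded array with invertible limits. -/
def Nice (V : ℕ → ℤ → K) (c : K) : Prop :=
  ∃ a : K, a ≠ 0 ∧ (∀ (N : ℕ) (j : ℤ), -N ≤ j → j ≤ N → IsOne (a * V N j)) ∧
    ∀ j, Tends (fun N => V N j) c

theorem Nice.mul {V W : ℕ → ℤ → K} {c d : K} (hV : Nice V c) (hW : Nice W d) :
    Nice (fun N j => V N j * W N j) (c * d) := by
  obtain ⟨a, ha, h1, h2⟩ := hV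
  obtain ⟨b, hb, h3, h4⟩ := hW
  refine ⟨a * b, mul_ne_zero ha hb, fun N j i1 i2 => ?_, fun j => (h2 j).mul (h4 j)⟩
  convert (h1 N j i1 i2).mul (h3 N j i1 i2) using 1; ring

theorem Nice.inv {V : ℕ → ℤ → K} {c : K} (hV : Nice V c) : Nice (fun N j => (V N j)⁻¹) c⁻¹ := by
  obtain ⟨a, ha, h1, h2⟩ := hV
  refine ⟨a⁻¹, inv_ne_zero ha, fun N j i1 i2 => ?_, fun j => ?_⟩
  · rw [← mul_inv]; exact (h1 N j i1 i2).inv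
  · have h3 := (((h2 j).const_mul a).inv
      ⟨j.natAbs, fun N hN => h1 N j (by omega) (by omega)⟩).const_mul a
    simp only [mul_inv, mul_inv_cancel_left₀ ha] at h3
    exact h3

theorem Nice.prod {ι : Type*} {s : Finset ι} {V : ι → ℕ → ℤ → K} {c : ι → K}
    (h : ∀ i ∈ s, Nice (V i) (c i)) : Nice (fun N j => ∏ i ∈ s, V i N j) (∏ i ∈ s, c i) := by
  classical
  induction s using Finset.induction_on with
  | empty =>
    exact ⟨1, one_ne_zero, fun N j _ _ => by simpa using isOne_one,
      fun j => by simpa using tends_const 1⟩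
  | insert a s ha ih =>
    simp only [Finset.prod_insert ha]
    exact (h a (mem_insert_self _ _)).mul (ih fun i hi => h i (mem_insert_of_mem hi))

theorem Nice.tends_sum {V : ℕ → ℤ → K} {c : K} (hV : Nice V c) {f : ℤ → K} {s : K}
    (hf : IsSum f s) : Tends (fun N => ∑ j ∈ Icc (-N : ℤ) N, f j * V N j) (s * c) := by
  obtain ⟨a, ha, h1, h2⟩ := hV
  have h3 := (hf.tends_mul (fun N j i1 i2 => (h1 N j i1 i2).isO)
    (fun j => (h2 j).const_mul a)).const_mul a⁻¹
  have e : a⁻¹ * (s * (a * c)) = s * c := by field_simp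
  rw [e] at h3
  refine h3.congr ⟨0, fun N _ => ?_⟩
  rw [mul_sum]
  exact sum_congr rfl fun j _ => by field_simp

theorem nice_poch {γ : ℤ} (hγ : 0 < γ) {φ : ℕ → ℤ → ℕ}
    (hφ : ∀ j : ℤ, ∀ n, ∃ N₀, ∀ N ≥ N₀, n ≤ φ N j) :
    Nice (fun N j => poch γ (φ N j)) (pochInf γ) :=
  ⟨1, one_ne_zero, fun N j _ _ => by rw [one_mul]; exact isOne_poch hγ _,
    fun j => (tends_poch hγ).comp (hφ j)⟩

theorem nice_const {c : K} (hc : c ≠ 0) : Nice (fun _ _ => c) c :=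
  ⟨c⁻¹, inv_ne_zero hc, fun N j _ _ => by rw [inv_mul_cancel₀ hc]; exact isOne_one,
    fun _ => tends_const c⟩

theorem Nice.congr {V W : ℕ → ℤ → K} {c : K} (hV : Nice V c)
    (h : ∀ (N : ℕ) (j : ℤ), -N ≤ j → j ≤ N → V N j = W N j) : Nice W c := by
  obtain ⟨a, ha, h1, h2⟩ := hV
  exact ⟨a, ha, fun N j i1 i2 => by rw [← h N j i1 i2]; exact h1 N j i1 i2,
    fun j => (h2 j).congr ⟨j.natAbs, fun N hN => h N j (by omega) (by omega)⟩⟩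

theorem nice_Bn_pos {γ : ℤ} (h0 : 0 < γ) (h1 : γ < 11) (s : ℤ) (hs : s = 0 ∨ s = -1) :
    Nice (fun N j => Bn N (γ + 11 * (j + s))) (T γ / E) := by
  have h2 := (nice_const (mul_ne_zero (sg_ne_zero γ) (u_ne_zero (3 * (2 * γ - 11) ^ 2)))).mul
    ((nice_poch h0 (φ := fun N j => (N + (j + s) + 1).toNat)
      (fun j n => ⟨n + (j + s).natAbs, fun N hN => by omega⟩)).mul
    (nice_poch (γ := 11 - γ) (by omega) (φ := fun N j => (N - (j + s)).toNat)
      (fun j n => ⟨n + (j + s).natAbs, fun N hN => by omega⟩)))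
  have e : T γ / E = sg γ * u (3 * (2 * γ - 11) ^ 2) * (pochInf γ * pochInf (11 - γ)) := by
    rw [T_eq h0 h1]
    have := E_ne_zero
    field_simp
  rw [e]
  exact h2.congr fun N j i1 i2 => (Bn_eq (by omega) (by omega)).symm

theorem nice_Bn {γ : ℤ} (h0 : γ ≠ 0) (h1 : |γ| < 11) :
    Nice (fun N j => Bn N (γ + 11 * j)) (T γ / E) := by
  rw [abs_lt] at h1
  rcases lt_or_gt_of_ne h0 with h | h
  · have h2 := nice_Bn_pos (γ := γ + 11) (by omega) (by omega) (-1) (Or.inr rfl)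
    rw [T_add_eleven] at h2
    exact h2.congr fun N j _ _ => by congr 1; ring
  · exact (nice_Bn_pos h h1.2 0 (Or.inl rfl)).congr fun N j _ _ => by congr 1; ring

theorem nice_Bn' : Nice Bn' (-h ^ 3 / E) := by
  have h2 := (nice_const (neg_ne_zero.mpr (u_ne_zero 363))).mul
    ((nice_poch (γ := 11) (by norm_num) (φ := fun N j => (N + j).toNat)
      (fun j n => ⟨n + j.natAbs, fun N hN => by omega⟩)).mul
    (nice_poch (γ := 11) (by norm_num) (φ := fun N j => (N - j).toNat)
      (fun j n => ⟨n + j.natAbs, fun N hN => by omega⟩)))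
  have e : -h ^ 3 / E = -u 363 * (pochInf 11 * pochInf 11) := by
    have e1 : u 121 ^ 3 = u 363 := by rw [← u_natMul]; congr 1
    have := E_ne_zero
    change _ = -u 363 * (E * E)
    rw [h, mul_pow, e1]
    field_simp
  rw [e]
  exact h2.congr fun N j i1 i2 => (Bn'_eq i1 i2).symm

/-- The conversion factor between `∏ (y k - y (e + 11 l))` and `Bn N (k - e)`. -/
noncomputable def cf (N : ℕ) (k e : ℤ) : K := sg (N + 1 + k + e) *
  u (132 * ((2 * N + 1) * (k + e)) - (1452 * (N * (N + 1)) + 363) - 12 * (k - e) ^ 2)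

theorem cf_ne_zero (N : ℕ) (k e : ℤ) : cf N k e ≠ 0 := mul_ne_zero (sg_ne_zero _) (u_ne_zero _)

theorem prod_y_sub_eq (N : ℕ) (k e : ℤ) :
    ∏ l ∈ Icc (-N : ℤ) N, (y k - y (e + 11 * l)) = cf N k e * Bn N (k - e) := by
  rw [prod_y_sub, Bn, cf]
  have e1 : u (132 * ((2 * N + 1) * (k + e))) =
      u (132 * ((2 * N + 1) * (k + e)) - (1452 * (N * (N + 1)) + 363) - 12 * (k - e) ^ 2) *
      u (1452 * (N * (N + 1)) + 363 + 12 * (k - e) ^ 2) := by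
    rw [← u_add]; congr 1; ring
  have e2 : sg (N + 1 + k + e) * sg (N + (k - e) + 1) = 1 := by
    rw [← sg_add]; exact sg_even ⟨N + 1 + k, by ring⟩
  rw [e1]
  linear_combination (-u (132 * ((2 * N + 1) * (k + e)) - (1452 * (N * (N + 1)) + 363) - 12 * (k - e) ^ 2) *
      u (1452 * (N * (N + 1)) + 363 + 12 * (k - e) ^ 2) * sprod N (k - e)) * e2

theorem prod_y_sub'_eq (N : ℕ) (d : ℤ) {j : ℤ} (hj : j ∈ Icc (-N : ℤ) N) :
    ∏ l ∈ (Icc (-N : ℤ) N).erase j, (y (d + 11 * j) - y (d + 11 * l))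
      = cf N (d + 11 * j) d * u (-(264 * (d + 11 * j))) * Bn' N j := by
  rw [prod_y_sub' N d hj, Bn', cf]
  have e1 : u (132 * ((2 * N + 1) * (2 * d + 11 * j) - 2 * (d + 11 * j))) =
      u (132 * ((2 * N + 1) * (d + 11 * j + d)) - (1452 * (N * (N + 1)) + 363)
        - 12 * (d + 11 * j - d) ^ 2) * u (-(264 * (d + 11 * j))) *
      u (1452 * (N * (N + 1)) + 363 + 12 * (11 * j) ^ 2) := by
    rw [← u_add, ← u_add]; congr 1; ring
  have e2 : sg (N + 1 + (d + 11 * j) + d) * sg (N + j + 1) = 1 := by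
    rw [← sg_add]; exact sg_even ⟨N + 1 + d + 6 * j, by ring⟩
  rw [e1]
  generalize u (132 * ((2 * N + 1) * (d + 11 * j + d)) - (1452 * (N * (N + 1)) + 363)
        - 12 * (d + 11 * j - d) ^ 2) = A
  generalize u (-(264 * (d + 11 * j))) = B
  generalize u (1452 * (N * (N + 1)) + 363 + 12 * (11 * j) ^ 2) = C
  linear_combination (-A * B * C * sprod' N j) * e2

theorem prod_sg {ι : Type*} (s : Finset ι) (f : ι → ℤ) : ∏ i ∈ s, sg (f i) = sg (∑ i ∈ s, f i) := by
  classical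
  induction s using Finset.induction_on with
  | empty => simp [sg_zero]
  | insert a s ha ih => rw [prod_insert ha, sum_insert ha, ih, sg_add]

theorem prod_cf (N : ℕ) (k : ℤ) (S : Finset ℤ) : ∏ e ∈ S, cf N k e
    = sg (#S * (N + 1 + k) + ∑ e ∈ S, e) *
      u (132 * (2 * N + 1) * (#S * k + ∑ e ∈ S, e) - #S * (1452 * (N * (N + 1)) + 363)
        - 12 * (#S * k ^ 2 - 2 * k * (∑ e ∈ S, e) + ∑ e ∈ S, e ^ 2)) := by
  simp_rw [cf]
  rw [prod_mul_distrib, prod_sg, prod_u]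
  congr 2
  · rw [sum_add_distrib, sum_const]; simp
  · have e : ∀ x : ℤ, 132 * ((2 * N + 1) * (k + x)) - (1452 * (N * (N + 1)) + 363) - 12 * (k - x) ^ 2
        = (132 * (2 * N + 1) * k - (1452 * (N * (N + 1)) + 363) - 12 * k ^ 2)
          + (132 * (2 * N + 1) + 24 * k) * x - 12 * x ^ 2 := fun x => by ring
    simp_rw [e]
    rw [sum_sub_distrib, sum_add_distrib, sum_const, ← mul_sum, ← mul_sum, nsmul_eq_mul]
    ring

/-- The general term of the Lambert series. -/
noncomputable def lt (n β k : ℤ) : K := sg k * u (12 * n * k ^ 2 + β * k) / (1 - y k)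

/-- The Lambert series along the residue class of `d` modulo `11`. -/
noncomputable def Lam (n β d : ℤ) : K := lsum fun j => lt n β (d + 11 * j)

theorem lt_zero (n β : ℤ) : lt n β 0 = 0 := by simp [lt, y_zero]

theorem isO_inv_one_sub_y (k : ℤ) : IsO 0 (1 - y k)⁻¹ := by
  rcases lt_trichotomy k 0 with hk | rfl | hk
  · have e : (1 - y k)⁻¹ = -(y (-k) * (1 - y (-k))⁻¹) := by
      have h1 := one_sub_y_ne_zero hk.ne
      have h2 := one_sub_y_ne_zero (a := -k) (by omega)
      have h3 : y (-k) * y k = 1 := by rw [← y_add, neg_add_cancel, y_zero]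
      field_simp
      linear_combination -h3
    rw [e]
    exact ((isO_u _).mul' (isOne_one_sub_y (a := -k) (by omega)).inv.isO (by omega)).neg
  · simp [y_zero]; exact isO_zero _
  · exact (isOne_one_sub_y hk).inv.isO

theorem isSum_Lam {n : ℤ} (hn : 1 ≤ n) (β d : ℤ) :
    IsSum (fun j => lt n β (d + 11 * j)) (Lam n β d) := by
  refine isSum_of_isO (|d| + (|β| + 1) ^ 2) fun j => ?_
  rw [lt, div_eq_mul_inv]
  refine IsO.mul' (IsO.mul' (isO_sg _) (isO_u _) le_rfl) (isO_inv_one_sub_y _) ?_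
  set k := d + 11 * j with hk
  have h1 : |j| ≤ |k| + |d| := by
    rcases abs_cases j with h | h <;> rcases abs_cases k with h' | h' <;>
      rcases abs_cases d with h'' | h'' <;> omega
  have h2 : -(|β| * |k|) ≤ β * k := by rw [← abs_mul]; exact neg_abs_le _
  have h3 : k ^ 2 = |k| ^ 2 := (sq_abs k).symm
  have h4 : 12 * |k| ^ 2 ≤ 12 * n * k ^ 2 := by rw [h3]; nlinarith [sq_nonneg |k|]
  nlinarith [sq_nonneg (|k| - |β| - 1), sq_nonneg (2 * |k| - |β| - 1), sq_nonneg |k|, sq_nonneg (|β| + 1)]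

theorem Lam_add_eleven (n β d : ℤ) (hn : 1 ≤ n) : Lam n β (d + 11) = Lam n β d := by
  have h1 := (isSum_Lam hn β d).comp_equiv (Equiv.addRight (1 : ℤ))
  refine (isSum_Lam hn β (d + 11)).unique (h1.congr fun j => ?_)
  simp only [Equiv.coe_addRight]
  congr 1; ring

theorem prod_erase_product {M : Type*} [CommMonoid M] {A B : Finset ℤ} {d j : ℤ}
    (hd : d ∈ A) (F : ℤ × ℤ → M) : ∏ i ∈ (A ×ˢ B).erase (d, j), F i
      = (∏ l ∈ B.erase j, F (d, l)) * ∏ e ∈ A.erase d, ∏ l ∈ B, F (e, l) := by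
  have h1 : (A ×ˢ B).erase (d, j) = ({d} ×ˢ B.erase j) ∪ (A.erase d ×ˢ B) := by
    ext ⟨a, b⟩
    simp only [mem_erase, mem_product, mem_union, mem_singleton, ne_eq, Prod.mk.injEq, not_and]
    constructor
    · rintro ⟨h2, h3, h4⟩
      by_cases ha : a = d
      · exact Or.inl ⟨ha, h2 ha, h4⟩
      · exact Or.inr ⟨⟨ha, h3⟩, h4⟩
    · rintro (⟨rfl, h3, h4⟩ | ⟨⟨h2, h3⟩, h4⟩)
      · exact ⟨fun _ => h3, hd, h4⟩
      · exact ⟨fun h => absurd h h2, h3, h4⟩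
  rw [h1, prod_union, prod_product, prod_product, prod_singleton]
  rw [disjoint_left]
  rintro ⟨a, b⟩ h2 h3
  simp only [mem_product, mem_singleton, mem_erase] at h2 h3
  exact h3.1.1 h2.1

section Partial

variable {D G : Finset ℤ} {n q β : ℤ}

/-- The nodes of the interpolation. -/
noncomputable def nd (i : ℤ × ℤ) : K := y (i.1 + 11 * i.2)

theorem u_injective : Function.Injective u := fun a b hab => by
  by_contra hne
  have h1 : u (a - b) = 1 := by rw [u_sub, hab, div_self (u_ne_zero _)]
  exact one_sub_u_ne_zero (sub_ne_zero.mpr hne) (by rw [h1, sub_self])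

theorem y_injective : Function.Injective y := fun a b hab => by
  have := u_injective hab
  omega

theorem injOn_nd {S : Finset ℤ} (hS : S ⊆ Icc 0 10) (I : Finset ℤ) :
    Set.InjOn nd (S ×ˢ I : Finset (ℤ × ℤ)) := by
  rintro ⟨a, b⟩ h1 ⟨c, d⟩ h2 hab
  have h3 := y_injective hab
  rw [mem_coe, mem_product] at h1 h2
  have h4 := mem_Icc.mp (hS h1.1)
  have h5 := mem_Icc.mp (hS h2.1)
  simp only at h3 h4 h5
  ext <;> simp only <;> omega

/-- The interpolated polynomial. -/
noncomputable def ipol (G : Finset ℤ) (N p : ℕ) : Polynomial K :=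
  Polynomial.X ^ p * Lagrange.nodal (G ×ˢ Icc (-N : ℤ) N) nd

theorem degree_ipol (G : Finset ℤ) (N p : ℕ) :
    (ipol G N p).degree = ((p + #G * (2 * N + 1) : ℕ) : WithBot ℕ) := by
  rw [ipol, Polynomial.degree_mul, Polynomial.degree_X_pow, Lagrange.degree_nodal, card_product,
    card_Icc_neg]
  push_cast; rfl

theorem eval_ipol (G : Finset ℤ) (N p : ℕ) (k : ℤ) : (ipol G N p).eval (y k)
    = u (264 * k * p) * ((∏ g ∈ G, cf N k g) * ∏ g ∈ G, Bn N (k - g)) := by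
  rw [ipol, Polynomial.eval_mul, Polynomial.eval_pow, Polynomial.eval_X, Lagrange.eval_nodal,
    prod_product, ← prod_mul_distrib, y, ← u_natMul]
  congr 1
  · congr 1; ring
  · exact prod_congr rfl fun g _ => prod_y_sub_eq N k g

/-- The coefficients in the finite partial fraction expansion. -/
noncomputable def Vf (D G : Finset ℤ) (d : ℤ) (N : ℕ) (j : ℤ) : K :=
  (∏ g ∈ G, Bn N (d - g + 11 * j)) * (Bn' N j * ∏ e ∈ D.erase d, Bn N (d - e + 11 * j))⁻¹

theorem cf_key (hn : n = #D - #G) (hno : Odd n) (hβ : β = 132 * q - 24 * (∑ d ∈ D, d - ∑ g ∈ G, g))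
    {N p : ℕ} (hp : 2 * (p : ℤ) = q + (2 * N + 1) * n - 2) (k : ℤ) :
    u (264 * k * p) * (∏ g ∈ G, cf N k g) / ((∏ d ∈ D, cf N k d) * u (-(264 * k)))
      = (∏ g ∈ G, cf N 0 g) / (∏ d ∈ D, cf N 0 d) * (sg k * u (12 * n * k ^ 2 + β * k)) := by
  have h1 : ∀ k, ∏ d ∈ D, cf N k d ≠ 0 := fun k => prod_ne_zero_iff.mpr fun d _ => cf_ne_zero _ _ _
  rw [div_mul_eq_mul_div, div_eq_div_iff (mul_ne_zero (h1 k) (u_ne_zero _)) (h1 0)]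
  simp only [prod_cf]
  set a := ∑ d ∈ D, d
  set b := ∑ g ∈ G, g
  have e1 : sg (#G * (N + 1 + k) + b) * sg (#D * (N + 1 + 0) + a)
      = sg (#G * (N + 1 + 0) + b) * sg (#D * (N + 1 + k) + a) * sg k := by
    rw [← sg_add, ← sg_add, ← sg_add]
    obtain ⟨m, hm⟩ := hno
    refine sg_eq_of_even_sub ⟨-(m + 1) * k, ?_⟩
    linear_combination (-k) * hm + k * hn
  generalize e2 : u (264 * k * p) = A
  generalize e3 : u (-(264 * k)) = B
  generalize e4 : u (12 * n * k ^ 2 + β * k) = C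
  generalize e5 : u (132 * (2 * N + 1) * (#G * k + b) - #G * (1452 * (N * (N + 1)) + 363)
        - 12 * (#G * k ^ 2 - 2 * k * b + ∑ e ∈ G, e ^ 2)) = F
  generalize e6 : u (132 * (2 * N + 1) * (#D * k + a) - #D * (1452 * (N * (N + 1)) + 363)
        - 12 * (#D * k ^ 2 - 2 * k * a + ∑ e ∈ D, e ^ 2)) = F'
  generalize e7 : u (132 * (2 * N + 1) * (#G * 0 + b) - #G * (1452 * (N * (N + 1)) + 363)
        - 12 * (#G * 0 ^ 2 - 2 * 0 * b + ∑ e ∈ G, e ^ 2)) = H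
  generalize e8 : u (132 * (2 * N + 1) * (#D * 0 + a) - #D * (1452 * (N * (N + 1)) + 363)
        - 12 * (#D * 0 ^ 2 - 2 * 0 * a + ∑ e ∈ D, e ^ 2)) = H'
  have e9 : A * F * H' = H * C * (F' * B) := by
    subst e2 e3 e4 e5 e6 e7 e8
    simp only [← u_add]
    congr 1
    rw [hβ]
    linear_combination (132 * k) * hp + (12 * k ^ 2 - 132 * k * (2 * N + 1)) * hn * (-1)
  linear_combination (A * F * H') * e1 + (sg (#G * (N + 1 + 0) + b) * sg (#D * (N + 1 + k) + a) * sg k) * e9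

theorem node_term (hn : n = #D - #G) (hno : Odd n)
    (hβ : β = 132 * q - 24 * (∑ d ∈ D, d - ∑ g ∈ G, g))
    {N p : ℕ} (hp : 2 * (p : ℤ) = q + (2 * N + 1) * n - 2) {d j : ℤ} (hd : d ∈ D)
    (hj : j ∈ Icc (-N : ℤ) N) :
    (ipol G N p).eval (nd (d, j)) / ∏ i ∈ (D ×ˢ Icc (-N : ℤ) N).erase (d, j), (nd (d, j) - nd i)
      = (∏ g ∈ G, cf N 0 g) / (∏ d ∈ D, cf N 0 d) *
        (sg (d + 11 * j) * u (12 * n * (d + 11 * j) ^ 2 + β * (d + 11 * j))) * Vf D G d N j := by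
  rw [← cf_key hn hno hβ hp, prod_erase_product hd]
  simp only [nd]
  rw [prod_y_sub'_eq N d hj, eval_ipol]
  simp_rw [prod_y_sub_eq]
  rw [prod_mul_distrib, ← mul_prod_erase D (cf N (d + 11 * j)) hd, Vf]
  have e : ∀ e, d - e + 11 * j = d + 11 * j - e := fun e => by ring
  simp_rw [e]
  simp only [div_eq_mul_inv, mul_inv]
  ring

theorem prod_T_div_E (S : Finset ℤ) (f : ℤ → ℤ) :
    ∏ e ∈ S, (T (f e) / E) = (∏ e ∈ S, T (f e)) / E ^ #S := by
  rw [prod_div_distrib, prod_const]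

theorem nice_Vf (hD : D ⊆ Icc 0 10) (hG : G ⊆ Icc 0 10) (hDG : Disjoint D G) {d : ℤ} (hd : d ∈ D) :
    Nice (Vf D G d) ((∏ g ∈ G, T (d - g)) / (∏ e ∈ D.erase d, T (d - e)) * (-(h ^ 3)⁻¹)
      * (E ^ #D / E ^ #G)) := by
  have hd' := mem_Icc.mp (hD hd)
  have h1 := (Nice.prod (s := G) fun g hg => nice_Bn (γ := d - g)
    (fun h => disjoint_left.mp hDG hd (by rwa [sub_eq_zero.mp h]))
    (by have := mem_Icc.mp (hG hg); rw [abs_lt]; omega)).mul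
    (nice_Bn'.mul (Nice.prod (s := D.erase d) fun e he => nice_Bn (γ := d - e)
    (fun h => (mem_erase.mp he).1 (sub_eq_zero.mp h).symm)
    (by have := mem_Icc.mp (hD (mem_erase.mp he).2); rw [abs_lt]; omega))).inv
  suffices e : (∏ g ∈ G, T (d - g)) / (∏ e ∈ D.erase d, T (d - e)) * (-(h ^ 3)⁻¹)
      * (E ^ #D / E ^ #G) = (∏ i ∈ G, T (d - i) / E) * (-h ^ 3 / E * ∏ i ∈ D.erase d, T (d - i) / E)⁻¹ by
    rw [e]; exact h1
  rw [prod_T_div_E, prod_T_div_E, ← card_erase_add_one hd, pow_succ]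
  have := E_ne_zero
  have := h_ne_zero
  generalize ∏ e ∈ D.erase d, T (d - e) = B
  by_cases hB : B = 0
  · simp [hB]
  · field_simp
    ring

theorem exists_ipol_degree (hn : n = #D - #G) (hn1 : 1 ≤ n) (hno : Odd n) (hq : Odd q) :
    ∃ N₀ : ℕ, ∀ N ≥ N₀, ∃ p : ℕ, 2 * (p : ℤ) = q + (2 * N + 1) * n - 2 ∧
      (ipol G N p).degree < #(D ×ˢ Icc (-N : ℤ) N) := by
  refine ⟨q.natAbs + 2, fun N hN => ?_⟩
  obtain ⟨a, ha⟩ := hno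
  obtain ⟨b, hb⟩ := hq
  have h1 : (2 * N + 1 : ℤ) ≤ (2 * N + 1) * n := le_mul_of_one_le_right (by omega) hn1
  have h2 : q + (2 * N + 1) * n - 2 = 2 * (b + N * n + a) := by
    linear_combination hb + ha
  have hp : ((b + N * n + a).toNat : ℤ) = b + N * n + a := by omega
  refine ⟨(b + N * n + a).toNat, by rw [hp, h2], ?_⟩
  rw [degree_ipol, card_product, card_Icc_neg, Nat.cast_lt]
  zify
  rw [hp]
  have h3 : (#D : ℤ) * (2 * N + 1) = #G * (2 * N + 1) + (2 * N + 1) * n := by rw [hn]; ring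
  omega

theorem sum_Vf (D : Finset ℤ) (N : ℕ) :
    ∑ i ∈ D ×ˢ Icc (-N : ℤ) N, lt n β (i.1 + 11 * i.2) * Vf D G i.1 N i.2
      = ∑ d ∈ D, ∑ j ∈ Icc (-N : ℤ) N, lt n β (d + 11 * j) * Vf D G d N j := sum_product _ _ _

/-- The partial fraction expansion of a quotient of theta products without pole at `1`. -/
theorem lambert_simple (hD : D ⊆ Icc 0 10) (hG : G ⊆ Icc 0 10) (hDG : Disjoint D G)
    (h0 : 0 ∉ D) (h0' : 0 ∉ G) (hn : n = #D - #G) (hn1 : 1 ≤ n) (hno : Odd n) (hq : Odd q)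
    (hβ : β = 132 * q - 24 * (∑ d ∈ D, d - ∑ g ∈ G, g)) :
    ∑ d ∈ D, (∏ g ∈ G, T (d - g)) / (∏ e ∈ D.erase d, T (d - e)) * Lam n β d
      = -h ^ 3 * ((∏ g ∈ G, T (-g)) / ∏ d ∈ D, T (-d)) := by
  have hL := Tends.sum (s := D) fun d hd => (nice_Vf hD hG hDG hd).tends_sum (isSum_Lam hn1 β d)
  have hb : ∀ {S : Finset ℤ}, S ⊆ Icc 0 10 → 0 ∉ S → ∀ e ∈ S, Nice (fun N j => Bn N (-e + 11 * j)) (T (-e) / E) :=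
    fun hS h0 e he => nice_Bn (γ := -e) (by rintro h; rw [neg_eq_zero] at h; exact h0 (h ▸ he))
      (by have := mem_Icc.mp (hS he); rw [abs_lt]; omega)
  have hR := ((Nice.prod (hb hG h0')).mul (Nice.prod (hb hD h0)).inv)
  obtain ⟨-, -, -, hR⟩ := hR
  have hR := hR 0
  have key := hL.unique (hR.congr ?_)
  · rw [prod_T_div_E, prod_T_div_E] at key
    have hE := E_ne_zero
    have hh := h_ne_zero
    have hc : (-(h ^ 3)⁻¹ * (E ^ #D / E ^ #G)) ≠ 0 := by
      have := pow_ne_zero #D hE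
      have := pow_ne_zero #G hE
      have := pow_ne_zero 3 hh
      simp [*]
    refine mul_right_cancel₀ hc ?_
    rw [sum_mul]
    calc _ = _ := sum_congr rfl fun d _ => by ring
      _ = _ := key
      _ = _ := by field_simp
  obtain ⟨N₀, hN₀⟩ := exists_ipol_degree (G := G) hn hn1 hno hq
  refine ⟨N₀, fun N hN => ?_⟩
  obtain ⟨p, hp, hdeg⟩ := hN₀ N hN
  have hx : ∀ i ∈ D ×ˢ Icc (-N : ℤ) N, (1 : K) ≠ nd i := fun i hi h => by
    rw [mem_product] at hi
    have h1 := mem_Icc.mp (hD hi.1)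
    rw [← y_zero] at h
    have h2 := y_injective h
    have h3 : i.1 = 0 := by omega
    exact h0 (h3 ▸ hi.1)
  have h1 := lagrange_simple (injOn_nd hD _) hdeg hx
  set c := (∏ g ∈ G, cf N 0 g) / (∏ d ∈ D, cf N 0 d) with hc
  have hc0 : c ≠ 0 := div_ne_zero (prod_ne_zero_iff.mpr fun _ _ => cf_ne_zero _ _ _)
    (prod_ne_zero_iff.mpr fun _ _ => cf_ne_zero _ _ _)
  have h2 : ∑ i ∈ D ×ˢ Icc (-N : ℤ) N, (ipol G N p).eval (nd i) /
      ((1 - nd i) * ∏ j ∈ (D ×ˢ Icc (-N : ℤ) N).erase i, (nd i - nd j))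
      = c * ∑ i ∈ D ×ˢ Icc (-N : ℤ) N, lt n β (i.1 + 11 * i.2) * Vf D G i.1 N i.2 := by
    rw [mul_sum]
    refine sum_congr rfl fun i hi => ?_
    rw [mem_product] at hi
    have h3 := node_term hn hno hβ hp hi.1 hi.2
    rw [mul_comm, ← div_div, h3, lt, nd]
    ring
  rw [h2, sum_Vf, ← y_zero, eval_ipol, prod_product] at h1
  simp only [nd] at h1
  simp_rw [prod_y_sub_eq] at h1
  rw [prod_mul_distrib] at h1
  simp only [mul_zero, add_zero, zero_mul, u_zero, one_mul, zero_sub] at h1 ⊢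
  refine mul_left_cancel₀ hc0 ?_
  rw [h1, hc]
  simp only [div_eq_mul_inv, mul_inv]
  ring

end Partial

theorem sum_Icc_halves (N : ℕ) (f : ℤ → K) : ∑ l ∈ Icc (-N : ℤ) N, f l
    = (∑ i ∈ range (N + 1), f i) + ∑ i ∈ range N, f (-(i + 1)) := by
  have := sum_range_two_mul (N + 1) f
  rw [sum_Icc_shift]
  rw [show 2 * (N + 1) = 2 * N + 1 + 1 by ring, sum_range_succ', sum_range_succ (fun l : ℕ => f (-((l : ℤ) + 1)))] at this
  have e : ∀ i : ℕ, ((i + 1 : ℕ) : ℤ) - ((N + 1 : ℕ) : ℤ) = i - N := fun i => by push_cast; ring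
  simp_rw [e] at this
  have e2 : (((0 : ℕ) : ℤ) - ((N + 1 : ℕ) : ℤ)) = -((N : ℤ) + 1) := by push_cast; ring
  rw [e2, ← add_assoc] at this
  exact add_right_cancel this

/-- The symmetric partial sums of the simple poles in the class of `d`. -/
noncomputable def Ps (d : ℤ) (N : ℕ) : K := ∑ l ∈ Icc (-N : ℤ) N, (1 - y (d + 11 * l))⁻¹

theorem inv_one_sub_y_neg {k : ℤ} (hk : k ≠ 0) : (1 - y (-k))⁻¹ = -(y k / (1 - y k)) := by
  have h1 := one_sub_y_ne_zero hk
  have h2 := one_sub_y_ne_zero (a := -k) (by omega)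
  have h3 : y (-k) * y k = 1 := by rw [← y_add, neg_add_cancel, y_zero]
  field_simp
  linear_combination -h3

theorem tends_Ps {d : ℤ} (h0 : 0 < d) (h1 : d < 11) :
    Tends (fun N => Ps d N - (N + 1)) (rho d + (2 * d - 11) / 22) := by
  have h2 : Tends (fun N : ℕ => y (d + 11 * N) * (1 - y (d + 11 * N))⁻¹) 0 :=
    tends_zero_of_isO fun e => ⟨e.natAbs, fun N hN =>
      (isO_u _).mul' (isOne_one_sub_y (a := d + 11 * N) (by omega)).inv.isO (by omega)⟩
  have h3 := (tends_Ls h0 h1).neg.add h2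
  have e : -(-rho d - (2 * d - 11) / 22) + 0 = rho d + (2 * (d : K) - 11) / 22 := by ring
  rw [e] at h3
  refine h3.congr ⟨0, fun N _ => ?_⟩
  rw [Ps, sum_Icc_halves, Ls, sum_sub_distrib]
  have e1 : ∑ i ∈ range (N + 1), (1 - y (d + 11 * i))⁻¹
      = (N + 1) + ∑ i ∈ range N, y (d + 11 * i) / (1 - y (d + 11 * i))
        + y (d + 11 * N) * (1 - y (d + 11 * N))⁻¹ := by
    have e2 : ∀ i ∈ range (N + 1), (1 - y (d + 11 * i))⁻¹ = 1 + y (d + 11 * i) / (1 - y (d + 11 * i)) := by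
      intro i _
      have := one_sub_y_ne_zero (a := d + 11 * i) (by omega)
      field_simp
      ring
    rw [sum_congr rfl e2, sum_add_distrib, sum_range_succ (fun i : ℕ => y (d + 11 * i) / (1 - y (d + 11 * i)))]
    simp only [sum_const, card_range, nsmul_eq_mul, mul_one, Nat.cast_add, Nat.cast_one, div_eq_mul_inv]
    ring
  have e3 : ∑ i ∈ range N, (1 - y (d + 11 * (-((i : ℤ) + 1))))⁻¹
      = -∑ i ∈ range N, y (11 - d + 11 * i) / (1 - y (11 - d + 11 * i)) := by
    rw [← sum_neg_distrib]
    refine sum_congr rfl fun i _ => ?_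
    rw [← inv_one_sub_y_neg (by omega)]
    congr 3; ring
  rw [e1, e3]
  ring

theorem sum_erase_zero (N : ℕ) : ∑ l ∈ (Icc (-N : ℤ) N).erase 0, (1 - y (11 * l))⁻¹ = N := by
  have h1 : ∑ l ∈ (Icc (-N : ℤ) N).erase 0, (1 - y (11 * l))⁻¹ = ∑ l ∈ Icc (-N : ℤ) N, (1 - y (11 * l))⁻¹ := by
    rw [← add_sum_erase (Icc (-N : ℤ) N) _ (a := (0 : ℤ)) (by rw [mem_Icc]; omega)]
    simp [y_zero]
  rw [h1, sum_Icc_halves, sum_range_succ']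
  simp only [Nat.cast_zero, mul_zero, y_zero, sub_self, inv_zero, add_zero]
  rw [← sum_add_distrib]
  calc _ = ∑ i ∈ range N, (1 : K) := sum_congr rfl fun i _ => ?_
    _ = N := by simp
  have h2 := inv_one_sub_y_neg (k := 11 * ((i : ℤ) + 1)) (by omega)
  have h3 := one_sub_y_ne_zero (a := 11 * ((i : ℤ) + 1)) (by omega)
  rw [show (11 : ℤ) * -((i : ℤ) + 1) = -(11 * ((i : ℤ) + 1)) by ring, h2]
  push_cast
  field_simp
  ring

section Partial

variable {D G : Finset ℤ} {n q β : ℤ}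

/-- The partial fraction expansion of a quotient of theta products with a pole at `1`. -/
theorem lambert_double (hD : D ⊆ Icc 0 10) (hG : G ⊆ Icc 0 10) (hDG : Disjoint D G)
    (h0 : 0 ∈ D) (hn : n = #D - #G) (hn1 : 1 ≤ n) (hno : Odd n) (hq : Odd q)
    (hβ : β = 132 * q - 24 * (∑ d ∈ D, d - ∑ g ∈ G, g)) :
    ∑ d ∈ D, (∏ g ∈ G, T (d - g)) / (∏ e ∈ D.erase d, T (d - e)) * Lam n β d
      = -((∏ g ∈ G, T (-g)) / ∏ d ∈ D.erase 0, T (-d)) *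
        (1 / 2 - β / 264 + ∑ d ∈ D.erase 0, rho d - ∑ g ∈ G, rho g) := by
  have hL := Tends.sum (s := D) fun d hd => (nice_Vf hD hG hDG hd).tends_sum (isSum_Lam hn1 β d)
  obtain ⟨-, -, -, hV⟩ := nice_Vf hD hG hDG h0
  have hG0 : 0 ∉ G := disjoint_left.mp hDG h0
  have hpos : ∀ {S : Finset ℤ}, S ⊆ Icc 0 10 → 0 ∉ S → ∀ e ∈ S, 0 < e ∧ e < 11 := fun hS h0 e he => by
    have h1 := mem_Icc.mp (hS he)
    have : e ≠ 0 := fun h => h0 (h ▸ he)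
    omega
  have hsG := Tends.sum fun g hg => tends_Ps (hpos hG hG0 g hg).1 (hpos hG hG0 g hg).2
  have hpD := hpos ((erase_subset 0 D).trans hD) (notMem_erase 0 D)
  have hsD := Tends.sum fun d hd => tends_Ps (hpD d hd).1 (hpD d hd).2
  have hR := (hV 0).mul (((tends_const (((q : K) - n) / 2)).add hsG).sub hsD)
  have key := hL.unique (hR.congr ?_)
  · have hE := E_ne_zero
    have hh := h_ne_zero
    have hc : (-(h ^ 3)⁻¹ * (E ^ #D / E ^ #G)) ≠ 0 := by
      have := pow_ne_zero #D hE
      have := pow_ne_zero #G hE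
      have := pow_ne_zero 3 hh
      simp [*]
    refine mul_right_cancel₀ hc ?_
    rw [sum_mul]
    calc _ = _ := sum_congr rfl fun d _ => by ring
      _ = _ := key
      _ = _ := ?_
    simp only [zero_sub]
    have e1 : ∑ d ∈ D, (d : K) = ∑ d ∈ D.erase 0, (d : K) := by
      rw [← add_sum_erase D _ h0]; simp
    have e2 : (#D : K) = #(D.erase 0) + 1 := by rw [← card_erase_add_one h0]; push_cast; ring
    have e3 : (n : K) = #D - #G := by rw [hn]; push_cast; ring
    have e4 : (β : K) = 132 * q - 24 * (∑ d ∈ D, (d : K) - ∑ g ∈ G, (g : K)) := by rw [hβ]; push_cast; ring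
    simp only [sum_add_distrib, ← sum_div, sum_sub_distrib, ← mul_sum, sum_const, nsmul_eq_mul]
    rw [e4, e3, e2, e1]
    ring
  obtain ⟨N₀, hN₀⟩ := exists_ipol_degree (G := G) hn hn1 hno hq
  refine ⟨N₀, fun N hN => ?_⟩
  obtain ⟨p, hp, hdeg⟩ := hN₀ N hN
  set I := Icc (-N : ℤ) N with hI
  have h0I : (0 : ℤ) ∈ I := by rw [hI, mem_Icc]; omega
  have hi₀ : ((0 : ℤ), (0 : ℤ)) ∈ D ×ˢ I := mem_product.mpr ⟨h0, h0I⟩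
  have hnd0 : nd (0, 0) = 1 := by simp [nd, y_zero]
  have hx : ∀ i ∈ G ×ˢ I, (1 : K) ≠ nd i := fun i hi h => by
    rw [mem_product] at hi
    have h1 := hpos hG hG0 _ hi.1
    rw [← y_zero] at h
    have h2 := y_injective h
    omega
  have hder : (Polynomial.derivative (ipol G N p)).eval (nd (0, 0))
      = (ipol G N p).eval (nd (0, 0)) * (p + ∑ i ∈ G ×ˢ I, (1 - nd i)⁻¹) := by
    rw [hnd0, ipol, Polynomial.derivative_mul, Polynomial.eval_add, Polynomial.eval_mul,
      Polynomial.eval_mul, Polynomial.eval_mul, eval_derivative_nodal hx, Lagrange.eval_nodal]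
    simp [Polynomial.derivative_X_pow]
    ring
  have h1 := lagrange_double (injOn_nd hD I) hdeg hi₀ hder
  set c := (∏ g ∈ G, cf N 0 g) / (∏ d ∈ D, cf N 0 d) with hc
  have hc0 : c ≠ 0 := div_ne_zero (prod_ne_zero_iff.mpr fun _ _ => cf_ne_zero _ _ _)
    (prod_ne_zero_iff.mpr fun _ _ => cf_ne_zero _ _ _)
  have h2 : ∑ i ∈ (D ×ˢ I).erase (0, 0), (ipol G N p).eval (nd i) /
      ((nd (0, 0) - nd i) * ∏ j ∈ (D ×ˢ I).erase i, (nd i - nd j))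
      = c * ∑ i ∈ D ×ˢ I, lt n β (i.1 + 11 * i.2) * Vf D G i.1 N i.2 := by
    rw [← add_sum_erase (D ×ˢ I) _ hi₀]
    simp only [mul_zero, add_zero, lt_zero, zero_mul, zero_add, mul_sum]
    refine sum_congr rfl fun i hi => ?_
    have hi' := mem_product.mp (mem_erase.mp hi).2
    have h3 := node_term hn hno hβ hp hi'.1 hi'.2
    rw [mul_comm, ← div_div, h3, lt, hnd0, nd]
    ring
  have h3 := node_term hn hno hβ hp h0 h0I
  have hsums : (p + ∑ i ∈ G ×ˢ I, (1 - nd i)⁻¹) - ∑ i ∈ (D ×ˢ I).erase (0, 0), (nd (0, 0) - nd i)⁻¹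
      = ((q : K) - n) / 2 + ∑ g ∈ G, (Ps g N - (N + 1)) - ∑ d ∈ D.erase 0, (Ps d N - (N + 1)) := by
    have e1 : ∑ i ∈ G ×ˢ I, (1 - nd i)⁻¹ = ∑ g ∈ G, Ps g N := sum_product _ _ _
    have e2 : ∑ i ∈ (D ×ˢ I).erase (0, 0), (nd (0, 0) - nd i)⁻¹ = N + ∑ d ∈ D.erase 0, Ps d N := by
      have a1 : ∑ i ∈ (D ×ˢ I).erase (0, 0), (nd (0, 0) - nd i)⁻¹ = ∑ i ∈ D ×ˢ I, (1 - nd i)⁻¹ := by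
        rw [← add_sum_erase _ _ hi₀, hnd0]; simp
      have a2 : ∑ i ∈ D ×ˢ I, (1 - nd i)⁻¹ = ∑ d ∈ D, Ps d N := sum_product _ _ _
      have a3 := sum_erase_zero N
      rw [← hI] at a3
      have a4 : Ps 0 N = N := by
        rw [← a3, Ps, ← hI, ← add_sum_erase _ _ h0I]; simp [y_zero]
      rw [a1, a2, ← add_sum_erase D _ h0, a4]
    have e3 : (n : K) = #D - #G := by rw [hn]; push_cast; ring
    have e4 : (#D : K) = #(D.erase 0) + 1 := by rw [← card_erase_add_one h0]; push_cast; ring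
    have e5 : 2 * (p : K) = q + (2 * N + 1) * n - 2 := by exact_mod_cast congrArg (Int.cast : ℤ → K) hp
    rw [e1, e2]
    simp only [sum_sub_distrib, sum_const, nsmul_eq_mul]
    linear_combination e5 / 2 + (N + 1) * e3 + (N + 1) * e4
  rw [h2, sum_Vf, h3, hsums] at h1
  simp only [mul_zero, add_zero, sg_zero, u_zero, mul_one, zero_pow two_ne_zero] at h1
  refine mul_left_cancel₀ hc0 ?_
  rw [h1]
  ring

end Partial

theorem eq_of_dvd_sub {α : Type*} {f : ℤ → α} (hf : ∀ a, f (a + 11) = f a) {a b : ℤ}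
    (hab : 11 ∣ a - b) : f a = f b := by
  obtain ⟨j, hj⟩ := hab
  rw [show a = b + 11 * j by omega, periodic_int hf]

theorem T_congr {a b : ℤ} (hab : 11 ∣ a - b) : T a = T b := eq_of_dvd_sub T_add_eleven hab

theorem rho_congr {a b : ℤ} (hab : 11 ∣ a - b) : rho a = rho b := eq_of_dvd_sub rho_add_eleven hab

theorem Lam_congr {n : ℤ} (β : ℤ) {a b : ℤ} (hn : 1 ≤ n) (hab : 11 ∣ a - b) :
    Lam n β a = Lam n β b :=
  eq_of_dvd_sub (f := Lam n β) (fun d => Lam_add_eleven n β d hn) hab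

section
variable {a b c B : ℤ}

theorem lambert_three_rep (ha : 0 < a) (ha' : a < 11) (hb : 0 < b) (hb' : b < 11) (hc : 0 < c)
    (hc' : c < 11) (hab : a ≠ b) (hac : a ≠ c) (hbc : b ≠ c) (hB : Odd B)
    (h11 : 11 ∣ B + 2 * (a + b + c)) :
    Lam 3 (12 * B) a / (T (a - b) * T (a - c)) + Lam 3 (12 * B) b / (T (b - a) * T (b - c))
      + Lam 3 (12 * B) c / (T (c - a) * T (c - b)) = -h ^ 3 / (T (-a) * T (-b) * T (-c)) := by
  obtain ⟨q, hq⟩ := h11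
  have hqo : Odd q := by
    obtain ⟨k, hk⟩ := hB
    exact Int.odd_iff.2 (by omega)
  have hD : ({a, b, c} : Finset ℤ) ⊆ Icc 0 10 := by
    intro x hx; simp only [mem_insert, mem_singleton] at hx; rw [mem_Icc]; omega
  have hσ : ∑ d ∈ ({a, b, c} : Finset ℤ), d = a + b + c := by
    rw [sum_insert (by simp [hab, hac]), sum_pair hbc]; ring
  have key := lambert_simple (D := {a, b, c}) (G := ∅) (n := 3) (q := q) (β := 12 * B) hD
    (by simp) (by simp) (by simp; omega) (by simp)
    (by rw [card_insert_of_notMem (by simp [hab, hac]), card_pair hbc]; simp) (by norm_num)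
    (by decide) hqo (by rw [hσ]; simp; linarith)
  have e1 : ({a, b, c} : Finset ℤ).erase a = {b, c} := by ext x; simp; grind
  have e2 : ({a, b, c} : Finset ℤ).erase b = {a, c} := by ext x; simp; grind
  have e3 : ({a, b, c} : Finset ℤ).erase c = {a, b} := by ext x; simp; grind
  rw [sum_insert (by simp [hab, hac]), sum_pair hbc, e1, e2, e3, prod_pair hbc, prod_pair hac,
    prod_pair hab, prod_insert (by simp [hab, hac]), prod_pair hbc] at key
  simp only [prod_empty] at key
  linear_combination key

theorem lambert_three_zero_rep (ha : 0 < a) (ha' : a < 11) (hb : 0 < b) (hb' : b < 11)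
    (hab : a ≠ b) (hB : Odd B) (h11 : 11 ∣ B + 2 * (a + b)) :
    Lam 3 (12 * B) a / (T a * T (a - b)) + Lam 3 (12 * B) b / (T b * T (b - a))
      + Lam 3 (12 * B) 0 / (T (-a) * T (-b))
      = -(1 / 2 - (B : K) / 22 + rho a + rho b) / (T (-a) * T (-b)) := by
  obtain ⟨q, hq⟩ := h11
  have hqo : Odd q := by
    obtain ⟨k, hk⟩ := hB
    exact Int.odd_iff.2 (by omega)
  have hD : ({0, a, b} : Finset ℤ) ⊆ Icc 0 10 := by
    intro x hx; simp only [mem_insert, mem_singleton] at hx; rw [mem_Icc]; omega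
  have h0a : (0 : ℤ) ≠ a := by omega
  have h0b : (0 : ℤ) ≠ b := by omega
  have hσ : ∑ d ∈ ({0, a, b} : Finset ℤ), d = a + b := by
    rw [sum_insert (by simp [h0a, h0b]), sum_pair hab]; ring
  have key := lambert_double (D := {0, a, b}) (G := ∅) (n := 3) (q := q) (β := 12 * B) hD
    (by simp) (by simp) (by simp)
    (by rw [card_insert_of_notMem (by simp [h0a, h0b]), card_pair hab]; simp) (by norm_num)
    (by decide) hqo (by rw [hσ]; simp; linarith)
  have e1 : ({0, a, b} : Finset ℤ).erase 0 = {a, b} := by ext x; simp; grind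
  have e2 : ({0, a, b} : Finset ℤ).erase a = {0, b} := by ext x; simp; grind
  have e3 : ({0, a, b} : Finset ℤ).erase b = {0, a} := by ext x; simp; grind
  rw [sum_insert (by simp [h0a, h0b]), sum_pair hab, e1, e2, e3, prod_pair hab, prod_pair h0b,
    prod_pair h0a, prod_pair hab, sum_pair hab] at key
  simp only [prod_empty, sum_empty, sub_zero, zero_sub] at key
  push_cast at key
  linear_combination key

theorem lambert_three (ha : ¬ 11 ∣ a) (hb : ¬ 11 ∣ b) (hc : ¬ 11 ∣ c) (hab : ¬ 11 ∣ a - b)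
    (hac : ¬ 11 ∣ a - c) (hbc : ¬ 11 ∣ b - c) (hB : Odd B) (h11 : 11 ∣ B + 2 * (a + b + c)) :
    Lam 3 (12 * B) a / (T (a - b) * T (a - c)) + Lam 3 (12 * B) b / (T (b - a) * T (b - c))
      + Lam 3 (12 * B) c / (T (c - a) * T (c - b)) = -h ^ 3 / (T (-a) * T (-b) * T (-c)) := by
  have key := lambert_three_rep (a := a % 11) (b := b % 11) (c := c % 11) (B := B)
    (by omega) (by omega) (by omega) (by omega) (by omega) (by omega) (by omega) (by omega)
    (by omega) hB (by omega)
  have hL : ∀ x : ℤ, Lam 3 (12 * B) (x % 11) = Lam 3 (12 * B) x := fun x =>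
    Lam_congr _ (by norm_num) (by omega)
  have hT : ∀ x z : ℤ, T (x % 11 - z % 11) = T (x - z) := fun x z => T_congr (by omega)
  have hN : ∀ x : ℤ, T (-(x % 11)) = T (-x) := fun x => T_congr (by omega)
  simpa only [hL, hT, hN] using key

theorem lambert_three_zero (ha : ¬ 11 ∣ a) (hb : ¬ 11 ∣ b) (hab : ¬ 11 ∣ a - b) (hB : Odd B)
    (h11 : 11 ∣ B + 2 * (a + b)) :
    Lam 3 (12 * B) a / (T a * T (a - b)) + Lam 3 (12 * B) b / (T b * T (b - a))
      + Lam 3 (12 * B) 0 / (T (-a) * T (-b))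
      = -(1 / 2 - (B : K) / 22 + rho a + rho b) / (T (-a) * T (-b)) := by
  have key := lambert_three_zero_rep (a := a % 11) (b := b % 11) (B := B)
    (by omega) (by omega) (by omega) (by omega) (by omega) hB (by omega)
  have hL : ∀ x : ℤ, Lam 3 (12 * B) (x % 11) = Lam 3 (12 * B) x := fun x =>
    Lam_congr _ (by norm_num) (by omega)
  have hT : ∀ x z : ℤ, T (x % 11 - z % 11) = T (x - z) := fun x z => T_congr (by omega)
  have hT' : ∀ x : ℤ, T (x % 11) = T x := fun x => T_congr (by omega)
  have hR : ∀ x : ℤ, rho (x % 11) = rho x := fun x => rho_congr (by omega)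
  have hN : ∀ x : ℤ, T (-(x % 11)) = T (-x) := fun x => T_congr (by omega)
  simpa only [hL, hT, hN, hT', hR] using key

theorem not_dvd_mul_two {a : ℤ} (ha : ¬ 11 ∣ a) : ¬ 11 ∣ 2 * a := by omega

theorem lambert_pair {c t : ℤ} (hc : ¬ 11 ∣ c) (ht : ¬ 11 ∣ t) (hp : ¬ 11 ∣ c + t)
    (hm : ¬ 11 ∣ c - t) (hB : Odd B) (h11 : 11 ∣ B + 6 * c) :
    Lam 3 (12 * B) (c + t) + Lam 3 (12 * B) (c - t) = T (2 * t) / T t * Lam 3 (12 * B) c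
      + h ^ 3 * T t * T (2 * t) / (T c * T (c + t) * T (c - t)) := by
  have key := lambert_three (a := c + t) (b := c - t) (c := c) (B := B) hp hm hc (by omega)
    (by omega) (by omega) hB (by omega)
  have e1 : c + t - (c - t) = 2 * t := by ring
  have e2 : c + t - c = t := by ring
  have e3 : c - t - (c + t) = -(2 * t) := by ring
  have e4 : c - t - c = -t := by ring
  have e5 : c - (c + t) = -t := by ring
  have e6 : c - (c - t) = t := by ring
  rw [e1, e2, e3, e4, e5, e6] at key
  simp only [T_neg] at key
  have n1 := T_ne_zero hc
  have n2 := T_ne_zero ht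
  have n3 := T_ne_zero hp
  have n4 := T_ne_zero hm
  have n5 := T_ne_zero (not_dvd_mul_two ht)
  generalize Lam 3 (12 * B) (c + t) = P at *
  generalize Lam 3 (12 * B) (c - t) = Q at *
  generalize Lam 3 (12 * B) c = R at *
  field_simp at key ⊢
  linear_combination key

theorem lambert_special {c : ℤ} (hc : ¬ 11 ∣ c) (hB : Odd B) (h11 : 11 ∣ B + 6 * c) :
    Lam 3 (12 * B) (2 * c) + Lam 3 (12 * B) 0 = T (2 * c) / T c * Lam 3 (12 * B) c
      - (1 / 2 - (B : K) / 22 + rho c + rho (2 * c)) := by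
  have key := lambert_three_zero (a := 2 * c) (b := c) (B := B) (by omega) hc (by omega) hB
    (by omega)
  have e1 : 2 * c - c = c := by ring
  have e2 : c - 2 * c = -c := by ring
  rw [e1, e2] at key
  simp only [T_neg] at key
  have n1 := T_ne_zero hc
  have n5 := T_ne_zero (not_dvd_mul_two hc)
  generalize Lam 3 (12 * B) (2 * c) = P at *
  generalize Lam 3 (12 * B) 0 = Q at *
  generalize Lam 3 (12 * B) c = R at *
  generalize rho c = x1 at *
  generalize rho (2 * c) = x2 at *
  field_simp at key ⊢
  linear_combination key

end

section
variable (m : ℕ) [NeZero m]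

/-- Multiplication by `m` as an order embedding. -/
def mulEmb : ℤ ↪o ℤ where
  toFun z := m * z
  inj' a b hab := by simpa [NeZero.ne m] using hab
  map_rel_iff' := mul_le_mul_iff_right₀ (by exact_mod_cast NeZero.pos m)

/-- The substitution `X ↦ u ^ m` of formal power series. -/
noncomputable def emb : PowerSeries ℚ →+* K :=
  (HahnSeries.embDomainRingHom (AddMonoidHom.mulLeft (m : ℤ)) (mulEmb m).injective
    fun _ _ => (mulEmb m).le_iff_le).comp (HahnSeries.ofPowerSeries ℤ ℚ)

theorem emb_apply (p : PowerSeries ℚ) :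
    emb m p = HahnSeries.embDomain (mulEmb m) (HahnSeries.ofPowerSeries ℤ ℚ p) := rfl

theorem coeff_emb_int (p : PowerSeries ℚ) (z : ℤ) :
    (emb m p).coeff (m * z) = (HahnSeries.ofPowerSeries ℤ ℚ p).coeff z :=
  HahnSeries.embDomain_coeff (f := mulEmb m)

theorem coeff_emb (p : PowerSeries ℚ) (n : ℕ) : (emb m p).coeff (m * n) = p.coeff n := by
  rw [coeff_emb_int, HahnSeries.ofPowerSeries_apply_coeff]

theorem coeff_emb_eq_zero (p : PowerSeries ℚ) {i : ℤ} (hi : ∀ n : ℕ, (m : ℤ) * n ≠ i) :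
    (emb m p).coeff i = 0 := by
  by_cases h : ∃ z : ℤ, (m : ℤ) * z = i
  · obtain ⟨z, rfl⟩ := h
    rw [coeff_emb_int, HahnSeries.ofPowerSeries_apply]
    refine HahnSeries.embDomain_of_notMem_range ?_
    rintro ⟨k, hk⟩
    exact hi k (by rw [← hk]; rfl)
  · rw [emb_apply]
    refine HahnSeries.embDomain_of_notMem_range ?_
    rintro ⟨z, hz⟩
    exact h ⟨z, hz⟩

theorem emb_X : emb m PowerSeries.X = u m := by
  rw [emb_apply, HahnSeries.ofPowerSeries_X, HahnSeries.embDomain_single]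
  exact congrArg (fun z => HahnSeries.single z (1 : ℚ)) (mul_one (m : ℤ))

theorem emb_X_pow (n : ℕ) : emb m (PowerSeries.X ^ n) = u (m * n) := by
  rw [map_pow, emb_X, ← u_natMul, mul_comm]

theorem isO_emb (p : PowerSeries ℚ) (d : ℕ) (h : ∀ n < d, p.coeff n = 0) : IsO d (emb m p) := by
  intro i hi
  by_cases hn : ∃ n : ℕ, (m : ℤ) * n = i
  · obtain ⟨n, rfl⟩ := hn
    rw [coeff_emb]
    refine h n ?_
    have := NeZero.pos m
    have h2 : (n : ℤ) ≤ m * n := by exact_mod_cast Nat.le_mul_of_pos_left n this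
    omega
  · exact coeff_emb_eq_zero m p (by simpa using hn)

theorem le_pentagonal (k : ℤ) : |k| ≤ pentagonal k := by
  have := two_mul_natCast_pentagonal k
  rcases abs_cases k with ⟨h, _⟩ | ⟨h, _⟩ <;> rw [h] <;> nlinarith

theorem negOnePow_eq_sg (k : ℤ) : (((Int.negOnePow k : ℤˣ) : ℤ) : K) = sg k := by
  rcases Int.even_or_odd k with hk | hk
  · rw [Int.negOnePow_even k hk, sg_even hk]; simp
  · rw [Int.negOnePow_odd k hk, sg_odd hk]; simp

theorem isSum_emb_pentagonal :
    IsSum (fun k : ℤ => sg k * u (m * pentagonal k)) (emb m (PowerSeries.pentagonalSeries ℚ)) := by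
  intro d
  refine ⟨Icc (-d.toNat) d.toNat, fun S hS => ?_⟩
  have e : ∑ k ∈ S, sg k * u (m * pentagonal k)
      = emb m (∑ k ∈ S, (((Int.negOnePow k : ℤˣ) : ℤ) : PowerSeries ℚ)
          * PowerSeries.X ^ pentagonal k) := by
    rw [map_sum]
    refine sum_congr rfl fun k _ => ?_
    rw [map_mul, map_intCast, negOnePow_eq_sg, emb_X_pow]
  rw [e, ← map_sub]
  refine (isO_emb m _ d.toNat fun n hn => ?_).mono (by omega)
  rw [map_sub, map_sum, sub_eq_zero]
  have e2 : ∀ k : ℤ, ((((Int.negOnePow k : ℤˣ) : ℤ) : PowerSeries ℚ)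
      * PowerSeries.X ^ pentagonal k).coeff n
      = if n = pentagonal k then (((Int.negOnePow k : ℤˣ) : ℤ) : ℚ) else 0 := fun k => by
    rw [← map_intCast (PowerSeries.C (R := ℚ)), PowerSeries.coeff_C_mul, PowerSeries.coeff_X_pow]
    simp
  simp_rw [e2]
  by_cases hk : ∃ k, pentagonal k = n
  · obtain ⟨k, rfl⟩ := hk
    rw [PowerSeries.coeff_pentagonalSeries_pentagonal, sum_eq_single k]
    · simp
    · intro b _ hb
      rw [if_neg fun h => hb (pentagonal_injective h).symm]
    · intro hk
      exfalso
      refine hk (hS (mem_Icc.2 ?_))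
      have := le_pentagonal k
      have := abs_le.1 (this.trans (by omega : (pentagonal k : ℤ) ≤ d.toNat))
      exact this
  · rw [PowerSeries.coeff_pentagonalSeries_eq_zero ℚ (by simpa using hk)]
    refine (sum_eq_zero fun k _ => if_neg fun h => hk ⟨k, h.symm⟩).symm

theorem tends_emb_pentagonal : Tends (fun N : ℕ => ∏ i ∈ range N, (1 - u (m * (i + 1))))
    (emb m (PowerSeries.pentagonalSeries ℚ)) := by
  intro d
  have h1 : ∀ n : ℕ, ∃ N₀, ∀ N ≥ N₀, (∏ i ∈ range N, (1 - PowerSeries.X ^ (i + 1)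
      : PowerSeries ℚ)).coeff n = (PowerSeries.pentagonalSeries ℚ).coeff n := fun n => by
    have := (PowerSeries.coeff_prod_one_sub_X_pow_eventually_eq ℚ n)
    have := Filter.tendsto_finset_range.eventually this
    exact Filter.eventually_atTop.1 this
  choose N₀ hN₀ using h1
  refine ⟨∑ n ∈ range d.toNat, N₀ n, fun N hN => ?_⟩
  have e : ∏ i ∈ range N, (1 - u (m * (i + 1)))
      = emb m (∏ i ∈ range N, (1 - PowerSeries.X ^ (i + 1))) := by
    rw [map_prod]
    refine prod_congr rfl fun i _ => ?_
    rw [map_sub, map_one, emb_X_pow]; simp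
  simp only
  rw [e, ← map_sub]
  refine (isO_emb m _ d.toNat fun n hn => ?_).mono (by omega)
  rw [map_sub, hN₀ n N ((single_le_sum (f := N₀) (fun _ _ => Nat.zero_le _)
    (mem_range.2 hn)).trans hN), sub_self]

theorem E_eq_emb : E = emb 2904 (PowerSeries.pentagonalSeries ℚ) := by
  refine (tends_poch (by norm_num)).unique ((tends_emb_pentagonal 2904).congr ⟨0, fun N _ => ?_⟩)
  refine prod_congr rfl fun i _ => ?_
  rw [y]; congr 2; push_cast; ring

theorem isSum_h : IsSum (fun j : ℤ => sg j * u (121 * (6 * j - 1) ^ 2)) h := by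
  rw [h, E_eq_emb]
  refine ((isSum_emb_pentagonal 2904).mul_left (u 121)).congr fun j => ?_
  rw [mul_left_comm, ← u_add]
  congr 2
  have := two_mul_natCast_pentagonal j
  push_cast
  linear_combination 1452 * this

/-- The eta function `∑ (-1) ^ k u ^ (6 k - 1) ^ 2`. -/
noncomputable def eta : K := u 1 * emb 24 (PowerSeries.pentagonalSeries ℚ)

theorem isSum_eta : IsSum (fun k : ℤ => sg k * u (36 * k ^ 2 + 12 * k + 1)) eta := by
  have := ((isSum_emb_pentagonal 24).mul_left (u 1)).comp_equiv (Equiv.neg ℤ)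
  refine this.congr fun j => ?_
  have := two_mul_natCast_pentagonal (-j)
  rw [Equiv.neg_apply, sg_neg, mul_left_comm, ← u_add]
  congr 2
  push_cast
  linear_combination 12 * this
end

theorem IsSum.of_classes {f : ℤ → K} {s : ℤ → K}
    (hs : ∀ d, IsSum (fun j => f (d + 11 * j)) (s d)) : IsSum f (∑ d : Fin 11, s d) := by
  have := IsSum.sum_fintype (f := fun p : Fin 11 × ℤ => f (p.1 + 11 * p.2))
    (s := fun d => s d) (fun d => hs d)
  refine (this.comp_equiv ((Int.divModEquiv 11).trans (Equiv.prodComm _ _))).congr fun k => ?_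
  congr 1
  simp [Int.divModEquiv, Int.natMod]
  omega

theorem sum_classes {s : ℤ → K} (hs : ∀ a, s (a + 11) = s a) {c : ℤ} (hc : ¬ 11 ∣ c) :
    ∑ d : Fin 11, s d = s c + (s (2 * c) + s 0) + (s (c + 2 * c) + s (c - 2 * c))
      + (s (c + 3 * c) + s (c - 3 * c)) + (s (c + 4 * c) + s (c - 4 * c))
      + (s (c + 5 * c) + s (c - 5 * c)) := by
  have key : ∀ r : ℤ, 0 < r → r < 11 → ∑ d : Fin 11, s d = s (r % 11)
      + (s (2 * r % 11) + s 0) + (s ((r + 2 * r) % 11) + s ((r - 2 * r) % 11))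
      + (s ((r + 3 * r) % 11) + s ((r - 3 * r) % 11)) + (s ((r + 4 * r) % 11) + s ((r - 4 * r) % 11))
      + (s ((r + 5 * r) % 11) + s ((r - 5 * r) % 11)) := fun r h0 h1 => by
    simp only [Fin.sum_univ_succ, Fin.sum_univ_zero]
    interval_cases r <;> norm_num <;> ring
  rw [key (c % 11) (by omega) (by omega)]
  have hm : ∀ a b : ℤ, 11 ∣ a - b → s a = s b := fun a b hab => eq_of_dvd_sub hs hab
  rw [hm (c % 11 % 11) c (by omega), hm (2 * (c % 11) % 11) (2 * c) (by omega),
    hm ((c % 11 + 2 * (c % 11)) % 11) (c + 2 * c) (by omega),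
    hm ((c % 11 - 2 * (c % 11)) % 11) (c - 2 * c) (by omega),
    hm ((c % 11 + 3 * (c % 11)) % 11) (c + 3 * c) (by omega),
    hm ((c % 11 - 3 * (c % 11)) % 11) (c - 3 * c) (by omega),
    hm ((c % 11 + 4 * (c % 11)) % 11) (c + 4 * c) (by omega),
    hm ((c % 11 - 4 * (c % 11)) % 11) (c - 4 * c) (by omega),
    hm ((c % 11 + 5 * (c % 11)) % 11) (c + 5 * c) (by omega),
    hm ((c % 11 - 5 * (c % 11)) % 11) (c - 5 * c) (by omega)]

/-- The quotient `η / h` in terms of theta functions. -/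
noncomputable def tq (c : ℤ) : K := 1 + T (2 * c) / T c + T (4 * c) / T (2 * c)
  + T (6 * c) / T (3 * c) + T (8 * c) / T (4 * c) + T (10 * c) / T (5 * c)

theorem tq_eq {c : ℤ} (hc : ¬ 11 ∣ c) : tq c = tq 1 := by
  have hT : ∀ r m : ℤ, T (m * c) = T (m * (c % 11)) := fun r m => T_congr (by
    rw [← mul_sub]; exact Dvd.dvd.mul_left (by omega) m)
  have hm : ∀ a b : ℤ, 11 ∣ a - b → T a = T b := fun a b hab => T_congr hab
  have hn : ∀ a b : ℤ, 11 ∣ a + b → T a = - T b := fun a b hab => by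
    rw [← T_neg]; exact T_congr (by omega)
  have e1 : ∀ r : ℤ, 0 < r → r < 11 → tq r = tq 1 := fun r h0 h1 => by
    simp only [tq]
    interval_cases r <;> norm_num <;>
      simp only [hm 12 1 (by norm_num), hm 14 3 (by norm_num), hm 15 4 (by norm_num),
        hm 16 5 (by norm_num), hm 18 7 (by norm_num), hm 20 9 (by norm_num),
        hm 24 2 (by norm_num), hm 30 8 (by norm_num), hm 32 10 (by norm_num),
        hm 36 3 (by norm_num), hm 40 7 (by norm_num), hm 50 6 (by norm_num),
        hm 21 10 (by norm_num), hm 25 3 (by norm_num), hm 28 6 (by norm_num),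
        hm 27 5 (by norm_num), hm 35 2 (by norm_num), hm 42 9 (by norm_num),
        hm 48 4 (by norm_num), hm 56 1 (by norm_num), hm 60 5 (by norm_num), hm 70 4 (by norm_num),
        hm 64 9 (by norm_num), hm 80 3 (by norm_num), hm 72 6 (by norm_num),
        hm 54 10 (by norm_num), hm 45 1 (by norm_num), hm 90 2 (by norm_num),
        hm 100 1 (by norm_num), hm 30 8 (by norm_num), hm 12 1 (by norm_num),
        hn 10 1 (by norm_num), hn 9 2 (by norm_num), hn 8 3 (by norm_num), hn 7 4 (by norm_num),
        hn 6 5 (by norm_num), neg_div_neg_eq, div_neg, neg_div] <;> ring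
  rw [← e1 (c % 11) (by omega) (by omega)]
  have h1 : T c = T (c % 11) := T_congr (by omega)
  simp only [tq, ← hT c, ← h1]

section
variable {B c : ℤ}

/-- The sum of a Lambert series over all residue classes. -/
noncomputable def lamSum (n β : ℤ) : K := ∑ d : Fin 11, Lam n β d

theorem isSum_lamSum {n : ℤ} (hn : 1 ≤ n) (β : ℤ) : IsSum (lt n β) (lamSum n β) :=
  IsSum.of_classes fun d => isSum_Lam hn β d

theorem lamSum_three (hc : ¬ 11 ∣ c) (hB : Odd B) (h11 : 11 ∣ B + 6 * c) :
    lamSum 3 (12 * B) + (1 / 2 - (B : K) / 22) = Lam 3 (12 * B) c * tq c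
      + h ^ 3 * (T (2 * c) * T (4 * c) / (T c * T (3 * c) * T (-c))
        + T (3 * c) * T (6 * c) / (T c * T (4 * c) * T (-(2 * c)))
        + T (4 * c) * T (8 * c) / (T c * T (5 * c) * T (-(3 * c)))
        + T (5 * c) * T (10 * c) / (T c * T (6 * c) * T (-(4 * c))))
      - (rho c + rho (2 * c)) := by
  rw [lamSum, sum_classes (fun d => Lam_add_eleven 3 _ d (by norm_num)) hc]
  rw [lambert_pair (t := 2 * c) hc (by omega) (by omega) (by omega) hB h11,
    lambert_pair (t := 3 * c) hc (by omega) (by omega) (by omega) hB h11,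
    lambert_pair (t := 4 * c) hc (by omega) (by omega) (by omega) hB h11,
    lambert_pair (t := 5 * c) hc (by omega) (by omega) (by omega) hB h11,
    lambert_special hc hB h11, tq,
    show c + 2 * c = 3 * c by ring, show c + 3 * c = 4 * c by ring,
    show c + 4 * c = 5 * c by ring, show c + 5 * c = 6 * c by ring,
    show c - 2 * c = -c by ring, show c - 3 * c = -(2 * c) by ring,
    show c - 4 * c = -(3 * c) by ring, show c - 5 * c = -(4 * c) by ring,
    show 2 * (2 * c) = 4 * c by ring, show 2 * (3 * c) = 6 * c by ring,
    show 2 * (4 * c) = 8 * c by ring, show 2 * (5 * c) = 10 * c by ring]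
  ring

end

theorem lt_sub {β k : ℤ} (hk : k ≠ 0) :
    lt 3 β k - lt 3 (β + 264) k = sg k * u (36 * k ^ 2 + β * k) := by
  have h1 := one_sub_y_ne_zero hk
  rw [lt, lt, show 12 * 3 * k ^ 2 + (β + 264) * k = (36 * k ^ 2 + β * k) + 264 * k by ring,
    u_add (36 * k ^ 2 + β * k), ← y, show (12 : ℤ) * 3 = 36 by norm_num]
  field_simp

/-- The part of the eta series in the class of `d`. -/
noncomputable def etaPart (d : ℤ) : K := lsum fun j =>
  sg (d + 11 * j) * u (36 * (d + 11 * j) ^ 2 + 12 * (d + 11 * j))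

theorem isSum_etaPart (d : ℤ) : IsSum (fun j : ℤ =>
    sg (d + 11 * j) * u (36 * (d + 11 * j) ^ 2 + 12 * (d + 11 * j))) (etaPart d) := by
  refine isSum_of_isO (|d|+1) fun k => (isO_sg _).mul' (isO_u _) ?_
  have h1 : |k| - |d| ≤ |d + 11 * k| := by
    have := abs_sub_abs_le_abs_add (11 * k) d
    rw [abs_mul, add_comm (11 * k)] at this
    have h2 := abs_nonneg k
    norm_num at this
    omega
  set x := d + 11 * k
  rcases abs_cases x with ⟨h, _⟩ | ⟨h, _⟩ <;> rw [h] at h1 <;> nlinarith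

theorem etaPart_add_eleven (d : ℤ) : etaPart (d + 11) = etaPart d := by
  refine (isSum_etaPart (d + 11)).unique (((isSum_etaPart d).comp_equiv (Equiv.addRight 1)).congr
    fun n => ?_)
  simp only [Equiv.coe_addRight]
  rw [show d + 11 * (n + 1) = d + 11 + 11 * n by ring]

theorem etaPart_eq {d : ℤ} (hd : ¬ 11 ∣ d) :
    etaPart d = Lam 3 (12 * 1) d - Lam 3 (12 * 23) d := by
  refine (isSum_etaPart d).unique (((isSum_Lam (by norm_num) (12 * 1) d).sub
    (isSum_Lam (by norm_num) (12 * 23) d)).congr fun j => ?_)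
  exact lt_sub (β := 12 * 1) (by omega)

theorem etaPart_zero : etaPart 0 = Lam 3 (12 * 1) 0 - Lam 3 (12 * 23) 0 + 1 := by
  refine (isSum_etaPart 0).unique ((((isSum_Lam (by norm_num) (12 * 1) 0).sub
    (isSum_Lam (by norm_num) (12 * 23) 0)).add
      (IsSum.of_injective (e := fun _ : Unit => (0 : ℤ)) (fun _ _ _ => rfl)
      (f := fun j : ℤ => if j = 0 then (1 : K) else 0) (s := 1) (fun i hi => if_neg fun h => hi ⟨(), h.symm⟩)
      (by simpa using isSum_finset fun _ : Unit => (1 : K)))).congr fun j => ?_)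
  by_cases hj : j = 0
  · simp [hj, lt_zero, sg_zero, u_zero]
  · rw [if_neg hj, add_zero]
    exact lt_sub (β := 12 * 1) (by omega)

theorem etaPart_nine : u 1 * etaPart 9 = h := by
  refine (((isSum_etaPart 9).mul_left (u 1)).unique ((isSum_h.comp_equiv
    (Equiv.addRight 1)).congr fun j => ?_))
  simp only [Equiv.coe_addRight]
  rw [mul_left_comm, ← u_add, sg_eq_of_even_sub (a := j + 1) (b := 9 + 11 * j) ⟨-5 * j - 4, by ring⟩]
  congr 2
  ring

theorem eta_eq_sum : eta = u 1 * ∑ d : Fin 11, etaPart d := by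
  refine isSum_eta.unique (((IsSum.of_classes (f := fun k => sg k * u (36 * k ^ 2 + 12 * k))
    isSum_etaPart).mul_left (u 1)).congr fun j => ?_)
  rw [mul_left_comm, ← u_add]
  congr 2
  ring

theorem etaPart_pair {t : ℤ} (ht : ¬ 11 ∣ t) (hp : ¬ 11 ∣ 9 + t) (hm : ¬ 11 ∣ 9 - t) :
    etaPart (9 + t) + etaPart (9 - t) = T (2 * t) / T t * etaPart 9 := by
  rw [etaPart_eq hp, etaPart_eq hm, etaPart_eq (by norm_num)]
  have h1 := lambert_pair (c := 9) (B := 1) (by norm_num) ht hp hm (by decide) (by norm_num)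
  have h2 := lambert_pair (c := 9) (B := 23) (by norm_num) ht hp hm (by decide) (by norm_num)
  linear_combination h1 - h2

theorem etaPart_special : etaPart (2 * 9) + etaPart 0 = T (2 * 9) / T 9 * etaPart 9 := by
  rw [etaPart_eq (by norm_num), etaPart_zero, etaPart_eq (by norm_num)]
  have h1 := lambert_special (c := 9) (B := 1) (by norm_num) (by decide) (by norm_num)
  have h2 := lambert_special (c := 9) (B := 23) (by norm_num) (by decide) (by norm_num)
  simp only [Int.cast_one, Int.cast_ofNat] at h1 h2
  linear_combination h1 - h2

theorem eta_eq : eta = h * tq 1 := by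
  rw [eta_eq_sum, sum_classes etaPart_add_eleven (c := 9) (by norm_num), etaPart_special,
    etaPart_pair (t := 2 * 9) (by norm_num) (by norm_num) (by norm_num),
    etaPart_pair (t := 3 * 9) (by norm_num) (by norm_num) (by norm_num),
    etaPart_pair (t := 4 * 9) (by norm_num) (by norm_num) (by norm_num),
    etaPart_pair (t := 5 * 9) (by norm_num) (by norm_num) (by norm_num), ← tq_eq (c := 9)
    (by norm_num), ← etaPart_nine, tq]
  ring_nf

section
variable {a b c B : ℤ}

theorem lambert_one_rep (hc : 0 < c) (hc' : c < 11) (hB : Odd B) (h11 : 11 ∣ B + 2 * c) :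
    Lam 1 (12 * B) c = -h ^ 3 / T (-c) := by
  obtain ⟨q, hq⟩ := h11
  have hqo : Odd q := by
    obtain ⟨k, hk⟩ := hB
    exact Int.odd_iff.2 (by omega)
  have hD : ({c} : Finset ℤ) ⊆ Icc 0 10 := by
    intro x hx; simp only [mem_singleton] at hx; rw [mem_Icc]; omega
  have key := lambert_simple (D := {c}) (G := ∅) (n := 1) (q := q) (β := 12 * B) hD
    (by simp) (by simp) (by simp; omega) (by simp) (by simp) (by norm_num)
    (by decide) hqo (by simp; linarith)
  simp only [sum_singleton, prod_empty, erase_singleton, prod_singleton] at key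
  linear_combination key

theorem lambert_two_one_rep (ha : 0 < a) (ha' : a < 11) (hb : 0 < b) (hb' : b < 11) (hc : 0 < c)
    (hc' : c < 11) (hab : a ≠ b) (hac : a ≠ c) (hbc : b ≠ c) (hB : Odd B)
    (h11 : 11 ∣ B + 2 * (a + b - c)) :
    T (a - c) / T (a - b) * Lam 1 (12 * B) a + T (b - c) / T (b - a) * Lam 1 (12 * B) b
      = -h ^ 3 * T (-c) / (T (-a) * T (-b)) := by
  obtain ⟨q, hq⟩ := h11
  have hqo : Odd q := by
    obtain ⟨k, hk⟩ := hB
    exact Int.odd_iff.2 (by omega)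
  have hD : ({a, b} : Finset ℤ) ⊆ Icc 0 10 := by
    intro x hx; simp only [mem_insert, mem_singleton] at hx; rw [mem_Icc]; omega
  have hG : ({c} : Finset ℤ) ⊆ Icc 0 10 := by
    intro x hx; simp only [mem_singleton] at hx; rw [mem_Icc]; omega
  have key := lambert_simple (D := {a, b}) (G := {c}) (n := 1) (q := q) (β := 12 * B) hD
    hG (by simp; grind) (by simp; omega) (by simp; omega) (by rw [card_pair hab]; simp) (by norm_num)
    (by decide) hqo (by rw [sum_pair hab]; simp; linarith)
  have e1 : ({a, b} : Finset ℤ).erase a = {b} := by ext x; simp; grind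
  have e2 : ({a, b} : Finset ℤ).erase b = {a} := by ext x; simp; grind
  rw [sum_pair hab, e1, e2, prod_pair hab] at key
  simp only [prod_singleton] at key
  linear_combination key

theorem lambert_two_one_zero_rep (ha : 0 < a) (ha' : a < 11) (hc : 0 < c)
    (hc' : c < 11) (hac : a ≠ c) (hB : Odd B) (h11 : 11 ∣ B + 2 * (a - c)) :
    T (a - c) / T a * Lam 1 (12 * B) a + T (-c) / T (-a) * Lam 1 (12 * B) 0
      = -(T (-c) / T (-a)) * (1 / 2 - (B : K) / 22 + rho a - rho c) := by
  obtain ⟨q, hq⟩ := h11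
  have hqo : Odd q := by
    obtain ⟨k, hk⟩ := hB
    exact Int.odd_iff.2 (by omega)
  have hD : ({0, a} : Finset ℤ) ⊆ Icc 0 10 := by
    intro x hx; simp only [mem_insert, mem_singleton] at hx; rw [mem_Icc]; omega
  have hG : ({c} : Finset ℤ) ⊆ Icc 0 10 := by
    intro x hx; simp only [mem_singleton] at hx; rw [mem_Icc]; omega
  have h0a : (0 : ℤ) ≠ a := by omega
  have key := lambert_double (D := {0, a}) (G := {c}) (n := 1) (q := q) (β := 12 * B) hD
    hG (by simp; grind) (by simp) (by rw [card_pair h0a]; simp) (by norm_num)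
    (by decide) hqo (by rw [sum_pair h0a]; simp; linarith)
  have e1 : ({0, a} : Finset ℤ).erase 0 = {a} := by ext x; simp; grind
  have e2 : ({0, a} : Finset ℤ).erase a = {0} := by ext x; simp; grind
  rw [sum_pair h0a, e1, e2] at key
  simp only [prod_singleton, sum_singleton, sub_zero, zero_sub] at key
  push_cast at key
  linear_combination key

theorem lambert_one (hc : ¬ 11 ∣ c) (hB : Odd B) (h11 : 11 ∣ B + 2 * c) :
    Lam 1 (12 * B) c = h ^ 3 / T c := by
  have key := lambert_one_rep (c := c % 11) (B := B) (by omega) (by omega) hB (by omega)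
  rw [Lam_congr (b := c) _ (by norm_num) (by omega), T_congr (b := -c) (by omega), T_neg] at key
  have := T_ne_zero hc
  rw [key]
  field_simp

theorem lambert_one_pair {c t : ℤ} (hc : ¬ 11 ∣ c) (ht : ¬ 11 ∣ t) (hp : ¬ 11 ∣ c + t)
    (hm : ¬ 11 ∣ c - t) (hB : Odd B) (h11 : 11 ∣ B + 2 * c) :
    Lam 1 (12 * B) (c + t) + Lam 1 (12 * B) (c - t) =
      h ^ 3 * T (2 * t) * T c / (T t * T (c + t) * T (c - t)) := by
  have key := lambert_two_one_rep (a := (c + t) % 11) (b := (c - t) % 11) (c := c % 11) (B := B)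
    (by omega) (by omega) (by omega) (by omega) (by omega) (by omega) (by omega) (by omega)
    (by omega) hB (by omega)
  have hL : ∀ x : ℤ, Lam 1 (12 * B) (x % 11) = Lam 1 (12 * B) x := fun x =>
    Lam_congr _ (by norm_num) (by omega)
  have hT : ∀ x z : ℤ, T (x % 11 - z % 11) = T (x - z) := fun x z => T_congr (by omega)
  have hN : ∀ x : ℤ, T (-(x % 11)) = T (-x) := fun x => T_congr (by omega)
  simp only [hL, hT, hN] at key
  rw [show c + t - c = t by ring, show c + t - (c - t) = 2 * t by ring,
    show c - t - c = -t by ring, show c - t - (c + t) = -(2 * t) by ring] at key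
  simp only [T_neg] at key
  have n1 := T_ne_zero hc
  have n2 := T_ne_zero ht
  have n3 := T_ne_zero hp
  have n4 := T_ne_zero hm
  have n5 := T_ne_zero (not_dvd_mul_two ht)
  generalize Lam 1 (12 * B) (c + t) = P at *
  generalize Lam 1 (12 * B) (c - t) = Q at *
  field_simp at key ⊢
  linear_combination key

theorem lambert_one_special (hc : ¬ 11 ∣ c) (hB : Odd B) (h11 : 11 ∣ B + 2 * c) :
    Lam 1 (12 * B) (2 * c) + Lam 1 (12 * B) 0 = -(1 / 2 - (B : K) / 22 + rho (2 * c) - rho c) := by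
  have key := lambert_two_one_zero_rep (a := (2 * c) % 11) (c := c % 11) (B := B)
    (by omega) (by omega) (by omega) (by omega) (by omega) hB (by omega)
  have hL : ∀ x : ℤ, Lam 1 (12 * B) (x % 11) = Lam 1 (12 * B) x := fun x =>
    Lam_congr _ (by norm_num) (by omega)
  have hT : ∀ x z : ℤ, T (x % 11 - z % 11) = T (x - z) := fun x z => T_congr (by omega)
  have hT' : ∀ x : ℤ, T (x % 11) = T x := fun x => T_congr (by omega)
  have hR : ∀ x : ℤ, rho (x % 11) = rho x := fun x => rho_congr (by omega)
  have hN : ∀ x : ℤ, T (-(x % 11)) = T (-x) := fun x => T_congr (by omega)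
  simp only [hL, hT, hN, hT', hR] at key
  rw [show 2 * c - c = c by ring] at key
  simp only [T_neg] at key
  have n1 := T_ne_zero hc
  have n5 := T_ne_zero (not_dvd_mul_two hc)
  generalize Lam 1 (12 * B) (2 * c) = P at *
  generalize Lam 1 (12 * B) 0 = Q at *
  generalize rho c = x1 at *
  generalize rho (2 * c) = x2 at *
  field_simp at key ⊢
  linear_combination key

theorem lamSum_one (hc : ¬ 11 ∣ c) (hB : Odd B) (h11 : 11 ∣ B + 2 * c) :
    lamSum 1 (12 * B) + (1 / 2 - (B : K) / 22) = h ^ 3 * (1 / T c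
        + T (4 * c) * T c / (T (2 * c) * T (3 * c) * T (-c))
        + T (6 * c) * T c / (T (3 * c) * T (4 * c) * T (-(2 * c)))
        + T (8 * c) * T c / (T (4 * c) * T (5 * c) * T (-(3 * c)))
        + T (10 * c) * T c / (T (5 * c) * T (6 * c) * T (-(4 * c))))
      + (rho c - rho (2 * c)) := by
  rw [lamSum, sum_classes (fun d => Lam_add_eleven 1 _ d (by norm_num)) hc]
  rw [lambert_one_pair (t := 2 * c) hc (by omega) (by omega) (by omega) hB h11,
    lambert_one_pair (t := 3 * c) hc (by omega) (by omega) (by omega) hB h11,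
    lambert_one_pair (t := 4 * c) hc (by omega) (by omega) (by omega) hB h11,
    lambert_one_pair (t := 5 * c) hc (by omega) (by omega) (by omega) hB h11,
    lambert_one_special hc hB h11, lambert_one hc hB h11,
    show c + 2 * c = 3 * c by ring, show c + 3 * c = 4 * c by ring,
    show c + 4 * c = 5 * c by ring, show c + 5 * c = 6 * c by ring,
    show c - 2 * c = -c by ring, show c - 3 * c = -(2 * c) by ring,
    show c - 4 * c = -(3 * c) by ring, show c - 5 * c = -(4 * c) by ring,
    show 2 * (2 * c) = 4 * c by ring, show 2 * (3 * c) = 6 * c by ring,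
    show 2 * (4 * c) = 8 * c by ring, show 2 * (5 * c) = 10 * c by ring]
  ring

end

/-- The moments of the series `∑ u ^ (6 x²)`, with `x ≡ b` modulo `22`. -/
noncomputable def Bm (s : ℕ) (b : ℤ) : K :=
  lsum fun m : ℤ => ((22 * m + b : ℤ) : K) ^ s * u (6 * (22 * m + b) ^ 2)

theorem isSum_Bm (s : ℕ) (b : ℤ) :
    IsSum (fun m : ℤ => ((22 * m + b : ℤ) : K) ^ s * u (6 * (22 * m + b) ^ 2)) (Bm s b) := by
  refine isSum_of_isO |b| fun n => (isO_intCast_pow _ s).mul' (isO_u _) ?_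
  have h1 := three_sq_ge (22 * n + b)
  have h2 : |22 * n| - |b| ≤ |22 * n + b| := abs_sub_abs_le_abs_add (22 * n) b
  rw [abs_mul] at h2
  have := abs_nonneg n
  have := sq_nonneg (22 * n + b)
  norm_num at h2
  omega

/-- The bracket of two moment vectors. -/
noncomputable def br (s t : ℕ) (a b : ℤ) : K :=
  Bm s (2 * a + 11) * Bm t (2 * b) - Bm s (2 * a) * Bm t (2 * b + 11)

theorem br_symm (s t : ℕ) (a b : ℤ) : br s t a b = -br t s b a := by
  rw [br, br]; ring

/-- The general term of the double series of a product of two theta series. -/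
noncomputable def brTerm (s t : ℕ) (a b : ℤ) (x : ℤ × ℤ) : K :=
  sg (x.1 + x.2) * ((11 * (x.1 + x.2 - 1) + 2 * a : ℤ) ^ s * (11 * (x.1 - x.2) + 2 * b : ℤ) ^ t *
    u (6 * (11 * (x.1 + x.2 - 1) + 2 * a) ^ 2 + 6 * (11 * (x.1 - x.2) + 2 * b) ^ 2))

theorem isSum_br (s t : ℕ) (a b : ℤ) : IsSum (brTerm s t a b) (br s t a b) := by
  have h1 : IsSum (fun x : ℤ × ℤ => if Odd (x.1 + x.2) then brTerm s t a b x else 0)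
      (-(Bm s (2 * a) * Bm t (2 * b + 11))) := by
    refine IsSum.of_injective (e := fun p : ℤ × ℤ => (p.1 + p.2 + 1, p.1 - p.2)) ?_ ?_
      (((isSum_Bm s (2 * a)).prod (isSum_Bm t (2 * b + 11))).neg.congr ?_)
    · rintro ⟨x, y⟩ ⟨x', y'⟩ h
      simp only [Prod.mk.injEq] at h ⊢
      omega
    · rintro ⟨x, y⟩ h
      refine if_neg fun ⟨k, hk⟩ => h ⟨(k, x - k - 1), ?_⟩
      simp only [Prod.mk.injEq] at hk ⊢
      omega
    · rintro ⟨x, y⟩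
      have ho : Odd (x + y + 1 + (x - y)) := ⟨x, by ring⟩
      simp only [if_pos ho, brTerm]
      rw [sg_odd ho, u_add, show 11 * (x + y + 1 + (x - y) - 1) + 2 * a = 22 * x + 2 * a by ring,
        show 11 * (x + y + 1 - (x - y)) + 2 * b = 22 * y + (2 * b + 11) by ring]
      ring
  have h2 : IsSum (fun x : ℤ × ℤ => if Odd (x.1 + x.2) then 0 else brTerm s t a b x)
      (Bm s (2 * a + 11) * Bm t (2 * b)) := by
    refine IsSum.of_injective (e := fun p : ℤ × ℤ => (p.1 + p.2 + 1, p.1 - p.2 + 1)) ?_ ?_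
      (((isSum_Bm s (2 * a + 11)).prod (isSum_Bm t (2 * b))).congr ?_)
    · rintro ⟨x, y⟩ ⟨x', y'⟩ h
      simp only [Prod.mk.injEq] at h ⊢
      omega
    · rintro ⟨x, y⟩ h
      refine if_pos ?_
      by_contra hc
      rw [Int.not_odd_iff_even] at hc
      obtain ⟨k, hk⟩ := hc
      refine h ⟨(k - 1, x - k), ?_⟩
      simp only [Prod.mk.injEq] at hk ⊢
      omega
    · rintro ⟨x, y⟩
      have he : Even (x + y + 1 + (x - y + 1)) := ⟨x + 1, by ring⟩
      simp only [if_neg (Int.not_odd_iff_even.2 he), brTerm]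
      rw [sg_even he, u_add,
        show 11 * (x + y + 1 + (x - y + 1) - 1) + 2 * a = 22 * x + (2 * a + 11) by ring,
        show 11 * (x + y + 1 - (x - y + 1)) + 2 * b = 22 * y + 2 * b by ring]
      ring
  have h3 := h2.add h1
  rw [← sub_eq_add_neg] at h3
  refine h3.congr fun x => ?_
  split_ifs <;> simp

theorem isSum_Tm_mul (i j : ℕ) (a b : ℤ) : IsSum (fun x : ℤ × ℤ =>
    ((11 * (x.1 + x.2 - 1) + 2 * a : ℤ) + (11 * (x.1 - x.2) + 2 * b : ℤ) : K) ^ i *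
    ((11 * (x.1 + x.2 - 1) + 2 * a : ℤ) - (11 * (x.1 - x.2) + 2 * b : ℤ) : K) ^ j *
      brTerm 0 0 a b x) (Tm i (a + b) * Tm j (a - b)) := by
  refine ((isSum_Tm i (a + b)).prod (isSum_Tm j (a - b))).congr fun ⟨x, y⟩ => ?_
  simp only [th, brTerm, pow_zero]
  rw [show 6 * (11 * (x + y - 1) + 2 * a) ^ 2 + 6 * (11 * (x - y) + 2 * b) ^ 2 =
    3 * (22 * x + 2 * (a + b) - 11) ^ 2 + 3 * (22 * y + 2 * (a - b) - 11) ^ 2 by ring, u_add,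
    sg_eq_of_even_sub (a := x + y) (b := (x + (a + b)) + (y + (a - b))) ⟨-a, by ring⟩,
    sg_add (x + (a + b))]
  push_cast
  ring

theorem T_mul_T (a b : ℤ) : T (a + b) * T (a - b) = br 0 0 a b :=
  (isSum_Tm_mul 0 0 a b).unique ((isSum_br 0 0 a b).congr fun x => by simp)

theorem brTerm_eq (s t : ℕ) (a b : ℤ) (x : ℤ × ℤ) : brTerm s t a b x =
    ((11 * (x.1 + x.2 - 1) + 2 * a : ℤ) : K) ^ s * ((11 * (x.1 - x.2) + 2 * b : ℤ) : K) ^ t *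
      brTerm 0 0 a b x := by
  simp only [brTerm]; ring

theorem Tm_one_mul_T (a b : ℤ) : Tm 1 (a + b) * T (a - b) = br 1 0 a b + br 0 1 a b :=
  (isSum_Tm_mul 1 0 a b).unique (((isSum_br 1 0 a b).add (isSum_br 0 1 a b)).congr fun x => by
    rw [brTerm_eq 1 0, brTerm_eq 0 1]; ring)

theorem T_mul_Tm_one (a b : ℤ) : T (a + b) * Tm 1 (a - b) = br 1 0 a b - br 0 1 a b :=
  (isSum_Tm_mul 0 1 a b).unique (((isSum_br 1 0 a b).sub (isSum_br 0 1 a b)).congr fun x => by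
    rw [brTerm_eq 1 0, brTerm_eq 0 1]; ring)

theorem Tm_one_mul_Tm_one (a b : ℤ) : Tm 1 (a + b) * Tm 1 (a - b) = br 2 0 a b - br 0 2 a b :=
  (isSum_Tm_mul 1 1 a b).unique (((isSum_br 2 0 a b).sub (isSum_br 0 2 a b)).congr fun x => by
    rw [brTerm_eq 2 0, brTerm_eq 0 2]; ring)

theorem Tm_two_mul_T_add (a b : ℤ) : Tm 2 (a + b) * T (a - b) + T (a + b) * Tm 2 (a - b) =
    2 * (br 2 0 a b + br 0 2 a b) :=
  ((isSum_Tm_mul 2 0 a b).add (isSum_Tm_mul 0 2 a b)).unique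
    ((((isSum_br 2 0 a b).add (isSum_br 0 2 a b)).mul_left 2).congr fun x => by
      rw [brTerm_eq 2 0, brTerm_eq 0 2]; ring)

theorem Tm_two_mul_Tm_one (a b : ℤ) : Tm 2 (a + b) * Tm 1 (a - b) =
    br 3 0 a b + br 2 1 a b - (br 1 2 a b + br 0 3 a b) :=
  (isSum_Tm_mul 2 1 a b).unique ((((isSum_br 3 0 a b).add (isSum_br 2 1 a b)).sub
    ((isSum_br 1 2 a b).add (isSum_br 0 3 a b))).congr fun x => by
      rw [brTerm_eq 3 0, brTerm_eq 0 3, brTerm_eq 2 1, brTerm_eq 1 2]; ring)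

theorem T_mul_Tm_three (a b : ℤ) : T (a + b) * Tm 3 (a - b) =
    br 3 0 a b - 3 * br 2 1 a b + (3 * br 1 2 a b - br 0 3 a b) :=
  (isSum_Tm_mul 0 3 a b).unique ((((isSum_br 3 0 a b).sub ((isSum_br 2 1 a b).mul_left 3)).add
    (((isSum_br 1 2 a b).mul_left 3).sub (isSum_br 0 3 a b))).congr fun x => by
      rw [brTerm_eq 3 0, brTerm_eq 0 3, brTerm_eq 2 1, brTerm_eq 1 2]; ring)


/-- Weierstrass's three-term relation. -/
theorem weierstrass (a b c d : ℤ) : T (a + b) * T (a - b) * (T (c + d) * T (c - d))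
    - T (a + c) * T (a - c) * (T (b + d) * T (b - d))
    + T (a + d) * T (a - d) * (T (b + c) * T (b - c)) = 0 := by
  simp only [T_mul_T, br]; ring

theorem br_one_zero_self (a : ℤ) : br 1 0 a a = -11 * h ^ 3 * T (2 * a) := by
  have h1 := T_mul_Tm_one a a
  rw [br_symm 0 1, sub_self, Tm_one_zero, ← two_mul] at h1
  linear_combination -h1 / 2

theorem rho_relation {a b c : ℤ} (hp : ¬ 11 ∣ a + b) (hq : ¬ 11 ∣ a - b) (hr : ¬ 11 ∣ a + c)
    (hs : ¬ 11 ∣ a - c) :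
    rho (a + b) + rho (a - b) - rho (a + c) - rho (a - c) =
      h ^ 3 * T (2 * a) * T (b - c) * T (b + c) /
        (T (a + b) * T (a - b) * T (a + c) * T (a - c)) := by
  have np := T_ne_zero hp
  have nq := T_ne_zero hq
  have nr := T_ne_zero hr
  have ns := T_ne_zero hs
  have h1 := Tm_one_mul_T a b
  have h2 := T_mul_Tm_one a b
  have h3 := Tm_one_mul_T a c
  have h4 := T_mul_Tm_one a c
  have h5 := T_mul_T a b
  have h6 := T_mul_T a c
  have h7 := T_mul_T b c
  have h8 := br_one_zero_self a
  have key : br 1 0 a b * br 0 0 a c - br 1 0 a c * br 0 0 a b = br 1 0 a a * br 0 0 b c := by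
    simp only [br]; ring
  rw [← h5, ← h6, ← h7, h8] at key
  simp only [rho]
  field_simp
  linear_combination (-2) * key - (h1 + h2) * T (a + c) * T (a - c) +
    (h3 + h4) * T (a + b) * T (a - b)

/-- The logarithmic derivative of `h`. -/
noncomputable def tau : K := Tm 3 0 / Tm 1 0

/-- A third of the logarithmic derivative of `T a / h`. -/
noncomputable def psi (a : ℤ) : K := Tm 2 a / T a - tau / 3

theorem psi_neg (a : ℤ) : psi (-a) = psi a := by
  rw [psi, psi, Tm_neg, T_neg]; ring

theorem psi_add_eleven (a : ℤ) : psi (a + 11) = psi a := by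
  rw [psi, psi, Tm_add_eleven, T_add_eleven]

theorem Tm_one_zero_ne_zero : Tm 1 0 ≠ 0 := by
  rw [Tm_one_zero]
  exact mul_ne_zero (by norm_num) (pow_ne_zero _ h_ne_zero)

theorem psi_relation {a b : ℤ} (hp : ¬ 11 ∣ a + b) (hq : ¬ 11 ∣ a - b) (hr : ¬ 11 ∣ 2 * a)
    (hs : ¬ 11 ∣ 2 * b) :
    2 * psi (a + b) + 2 * psi (a - b) + psi (2 * a) + psi (2 * b) =
      968 * (rho (2 * a) * (rho (a + b) + rho (a - b)) +
        rho (2 * b) * (rho (a + b) - rho (a - b))) := by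
  have np := T_ne_zero hp
  have nq := T_ne_zero hq
  have nr := T_ne_zero hr
  have ns := T_ne_zero hs
  have nt := Tm_one_zero_ne_zero
  have e00 := T_mul_T a b
  have e1 := Tm_one_mul_T a b
  have e2 := T_mul_Tm_one a b
  have e3 := Tm_two_mul_T_add a b
  have self : ∀ x : ℤ, br 1 0 x x = T (2 * x) * Tm 1 0 / 2 ∧
      br 2 0 x x = Tm 1 (2 * x) * Tm 1 0 / 2 ∧
      br 2 1 x x = (Tm 2 (2 * x) * Tm 1 0 - T (2 * x) * Tm 3 0) / 8 := fun x => by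
    have f1 := T_mul_Tm_one x x
    have f2 := Tm_one_mul_Tm_one x x
    have f3 := Tm_two_mul_Tm_one x x
    have f4 := T_mul_Tm_three x x
    rw [br_symm 0 1, sub_self, ← two_mul] at f1
    rw [br_symm 0 2, sub_self, ← two_mul] at f2
    rw [br_symm 0 3, br_symm 1 2, sub_self, ← two_mul] at f3 f4
    refine ⟨by linear_combination -f1 / 2, by linear_combination -f2 / 2, ?_⟩
    linear_combination -f3 / 8 + f4 / 8
  obtain ⟨a1, a2, a3⟩ := self a
  obtain ⟨b1, b2, b3⟩ := self b
  have k1 : br 2 0 a b * br 1 0 a a = -br 2 1 a a * br 0 0 a b + br 2 0 a a * br 1 0 a b := by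
    simp only [br]; ring
  have k2 : br 0 2 a b * br 1 0 b b = -br 2 1 b b * br 0 0 a b + br 2 0 b b * br 0 1 a b := by
    simp only [br]; ring
  rw [← e00, a1, a2, a3] at k1
  rw [← e00, b1, b2, b3] at k2
  have g1 : br 1 0 a b = (Tm 1 (a + b) * T (a - b) + T (a + b) * Tm 1 (a - b)) / 2 := by
    linear_combination -(e1 + e2) / 2
  have g2 : br 0 1 a b = (Tm 1 (a + b) * T (a - b) - T (a + b) * Tm 1 (a - b)) / 2 := by
    linear_combination -(e1 - e2) / 2
  rw [g1] at k1
  rw [g2] at k2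
  have k3 : Tm 2 (a + b) / T (a + b) + Tm 2 (a - b) / T (a - b) =
      2 * (br 2 0 a b + br 0 2 a b) / (T (a + b) * T (a - b)) := by
    rw [← e3]; field_simp
  have m1 : br 2 0 a b / (T (a + b) * T (a - b)) = -(Tm 2 (2 * a) / T (2 * a) - tau) / 4 +
      242 * rho (2 * a) * (rho (a + b) + rho (a - b)) := by
    simp only [rho, tau]
    field_simp
    linear_combination 3872 * k1
  have m2 : br 0 2 a b / (T (a + b) * T (a - b)) = -(Tm 2 (2 * b) / T (2 * b) - tau) / 4 +
      242 * rho (2 * b) * (rho (a + b) - rho (a - b)) := by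
    simp only [rho, tau]
    field_simp
    linear_combination 3872 * k2
  rw [mul_div_assoc, add_div, m1, m2] at k3
  simp only [psi]
  linear_combination 2 * k3

/-- The derivation `u d/du`. -/
noncomputable def D (f : K) : K where
  coeff n := n * f.coeff n
  isPWO_support' := f.isPWO_support.mono fun n hn => by
    simp only [Function.mem_support, ne_eq, HahnSeries.mem_support] at hn ⊢
    exact right_ne_zero_of_mul hn

theorem coeff_D (f : K) (n : ℤ) : (D f).coeff n = n * f.coeff n := rfl

theorem D_add (f g : K) : D (f + g) = D f + D g := by
  ext n; simp [coeff_D, mul_add]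

theorem D_sub (f g : K) : D (f - g) = D f - D g := by
  ext n; simp [coeff_D, mul_sub]

theorem D_support (f : K) : (D f).support ⊆ f.support := fun n hn => by
  rw [HahnSeries.mem_support, coeff_D] at hn
  exact right_ne_zero_of_mul hn

theorem D_mul (f g : K) : D (f * g) = D f * g + f * D g := by
  ext n
  rw [coeff_D, HahnSeries.coeff_add, HahnSeries.coeff_mul_left' f.isPWO_support (D_support f),
    HahnSeries.coeff_mul_right' g.isPWO_support (D_support g), HahnSeries.coeff_mul, mul_sum,
    ← sum_add_distrib]
  refine sum_congr rfl fun p hp => ?_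
  rw [mem_addAntidiagonal] at hp
  rw [coeff_D, coeff_D, ← hp.2.2]
  push_cast
  ring

theorem IsO.D {d : ℤ} {f : K} (hf : IsO d f) : IsO d (D f) := fun i hi => by
  rw [coeff_D, hf i hi, mul_zero]

theorem D_sum {ι : Type*} (f : ι → K) (s : Finset ι) : D (∑ i ∈ s, f i) = ∑ i ∈ s, D (f i) := by
  classical
  induction s using Finset.induction_on with
  | empty => ext n; simp [coeff_D]
  | insert a s ha ih => rw [sum_insert ha, sum_insert ha, D_add, ih]

theorem IsSum.D {ι : Type*} {f : ι → K} {s : K} (hf : IsSum f s) :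
    IsSum (fun i => D (f i)) (D s) := fun d => by
  obtain ⟨S, hS⟩ := hf d
  refine ⟨S, fun U hU => ?_⟩
  rw [← D_sum, ← D_sub]
  exact (hS U hU).D

theorem D_u (n : ℤ) : D (u n) = n * u n := by
  ext m
  have : ((n : K) * u n).coeff m = n * (u n).coeff m := by
    rw [← zsmul_eq_mul, HahnSeries.coeff_smul, zsmul_eq_mul]
  rw [coeff_D, this, coeff_u]
  split_ifs with hm
  · rw [hm]
  · simp

theorem D_intCast (n : ℤ) : D (n : K) = 0 := by
  have h1 := D_mul 1 1
  have h2 := D_mul (n : K) 1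
  have h0 : D (1 : K) = 0 := by simp only [mul_one, one_mul] at h1; linear_combination -h1
  induction n using Int.induction_on with
  | zero => have := D_sub 1 1; simpa using this
  | succ n ih => push_cast; rw [D_add, h0]; simpa using ih (D_mul _ _)
  | pred n ih => push_cast; rw [D_sub, h0]; simpa using ih (D_mul _ _)

theorem D_sg (n : ℤ) : D (sg n) = 0 := by
  have h2 : sg n = 1 ∨ sg n = -1 := by
    rcases Int.even_or_odd n with hn | hn
    · exact Or.inl (sg_even hn)
    · exact Or.inr (sg_odd hn)
  rcases h2 with h2 | h2 <;> rw [h2]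
  · simpa using D_intCast 1
  · simpa using D_intCast (-1)

/-- The heat equation. -/
theorem D_Tm (m : ℕ) (a : ℤ) : D (Tm m a) = 3 * Tm (m + 2) a := by
  refine (isSum_Tm m a).D.unique (((isSum_Tm (m + 2) a).mul_left 3).congr fun n => ?_)
  have := D_intCast ((22 * n + 2 * a - 11) ^ m)
  rw [Int.cast_pow] at this
  rw [th, D_mul, this, D_mul, D_sg, D_u]
  push_cast
  ring

/-- The logarithmic derivative. -/
noncomputable def dlog (f : K) : K := D f / f

theorem dlog_mul {f g : K} (hf : f ≠ 0) (hg : g ≠ 0) : dlog (f * g) = dlog f + dlog g := by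
  rw [dlog, dlog, dlog, D_mul]; field_simp

theorem dlog_one : dlog 1 = 0 := by
  have := D_intCast 1
  rw [Int.cast_one] at this
  rw [dlog, this, zero_div]

theorem dlog_inv {f : K} (hf : f ≠ 0) : dlog f⁻¹ = -dlog f := by
  have := dlog_mul hf (inv_ne_zero hf)
  rw [mul_inv_cancel₀ hf, dlog_one] at this
  linear_combination -this

theorem dlog_pow {f : K} (hf : f ≠ 0) (n : ℕ) : dlog (f ^ n) = n * dlog f := by
  induction n with
  | zero => simp [dlog_one]
  | succ n ih => rw [pow_succ, dlog_mul (pow_ne_zero _ hf) hf, ih]; push_cast; ring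

theorem dlog_zpow {f : K} (hf : f ≠ 0) (n : ℤ) : dlog (f ^ n) = n * dlog f := by
  obtain ⟨m, rfl | rfl⟩ := n.eq_nat_or_neg
  · rw [zpow_natCast, dlog_pow hf]; simp
  · rw [zpow_neg, zpow_natCast, dlog_inv (pow_ne_zero _ hf), dlog_pow hf]; push_cast; ring

theorem dlog_T (a : ℤ) : dlog (T a) = 3 * (Tm 2 a / T a) := by
  rw [dlog, T, D_Tm, mul_div_assoc]

theorem dlog_h : dlog h = tau := by
  have h1 : dlog (h ^ 3) = dlog (Tm 1 0) := by
    have e : Tm 1 0 = ((-22 : ℤ) : K) * h ^ 3 := by rw [Tm_one_zero]; push_cast; ring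
    have h3 : h ^ 3 ≠ 0 := pow_ne_zero _ h_ne_zero
    rw [e, dlog, dlog, D_mul, D_intCast]
    push_cast
    field_simp
    ring
  rw [dlog_pow h_ne_zero, show dlog (Tm 1 0) = 3 * tau by rw [dlog, D_Tm, mul_div_assoc, tau]] at h1
  push_cast at h1
  linear_combination h1 / 3

theorem eq_const_of_D_eq_zero {f : K} (hf : D f = 0) {m : ℤ} (hm : IsO 1 (f - m)) : f = m := by
  ext n
  have h1 : (n : ℚ) * f.coeff n = 0 := by rw [← coeff_D, hf]; rfl
  rcases eq_or_ne n 0 with rfl | hn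
  · have := hm 0 one_pos
    rw [HahnSeries.coeff_sub] at this
    linear_combination this
  · rcases mul_eq_zero.mp h1 with h | h
    · exact absurd (by exact_mod_cast h) hn
    · have h2 := D_intCast m
      have h3 : (n : ℚ) * (m : K).coeff n = 0 := by rw [← coeff_D, h2]; rfl
      rcases mul_eq_zero.mp h3 with h' | h'
      · exact absurd (by exact_mod_cast h') hn
      · rw [h, h']

theorem three_term (a b d : ℤ) : T (a + b) * T (a - b) * T d ^ 2
    - T (a + d) * T (a - d) * T b ^ 2 + T (b + d) * T (b - d) * T a ^ 2 = 0 := by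
  have := weierstrass a b d 0
  simp only [add_zero, sub_zero] at this
  linear_combination this

/-- Monomials in the theta series. -/
noncomputable def mo (c e₁ e₂ e₃ e₄ e₅ : ℤ) : K :=
  (-T c) ^ e₁ * T (2 * c) ^ e₂ * (-T (3 * c)) ^ e₃ * T (4 * c) ^ e₄ * (-T (5 * c)) ^ e₅

/-- First coordinate on the modular curve. -/
noncomputable def X (c : ℤ) : K := mo c 2 (-2) 1 0 (-1)

/-- Second coordinate on the modular curve. -/
noncomputable def Y (c : ℤ) : K := mo c 3 (-3) 0 (-1) 1

section
variable {c : ℤ} (hc : ¬ 11 ∣ c)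
include hc

theorem mo_mul (a₁ a₂ a₃ a₄ a₅ b₁ b₂ b₃ b₄ b₅ : ℤ) :
    mo c a₁ a₂ a₃ a₄ a₅ * mo c b₁ b₂ b₃ b₄ b₅ =
      mo c (a₁ + b₁) (a₂ + b₂) (a₃ + b₃) (a₄ + b₄) (a₅ + b₅) := by
  have n1 := neg_ne_zero.2 (T_ne_zero hc)
  have n2 := T_ne_zero (a := 2 * c) (by omega)
  have n3 := neg_ne_zero.2 (T_ne_zero (a := 3 * c) (by omega))
  have n4 := T_ne_zero (a := 4 * c) (by omega)
  have n5 := neg_ne_zero.2 (T_ne_zero (a := 5 * c) (by omega))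
  simp only [mo, zpow_add₀ n1, zpow_add₀ n2, zpow_add₀ n3, zpow_add₀ n4, zpow_add₀ n5]
  ring

theorem mo_ne_zero (a₁ a₂ a₃ a₄ a₅ : ℤ) : mo c a₁ a₂ a₃ a₄ a₅ ≠ 0 := by
  have n1 := neg_ne_zero.2 (T_ne_zero hc)
  have n2 := T_ne_zero (a := 2 * c) (by omega)
  have n3 := neg_ne_zero.2 (T_ne_zero (a := 3 * c) (by omega))
  have n4 := T_ne_zero (a := 4 * c) (by omega)
  have n5 := neg_ne_zero.2 (T_ne_zero (a := 5 * c) (by omega))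
  exact mul_ne_zero (mul_ne_zero (mul_ne_zero (mul_ne_zero (zpow_ne_zero _ n1) (zpow_ne_zero _ n2))
    (zpow_ne_zero _ n3)) (zpow_ne_zero _ n4)) (zpow_ne_zero _ n5)

omit hc in
theorem mo_pow (a₁ a₂ a₃ a₄ a₅ : ℤ) (n : ℕ) : mo c a₁ a₂ a₃ a₄ a₅ ^ n =
    mo c (a₁ * n) (a₂ * n) (a₃ * n) (a₄ * n) (a₅ * n) := by
  simp only [mo, mul_pow, zpow_mul, zpow_natCast]

theorem one_sub_X : 1 - X c = mo c 1 (-2) 1 (-1) 1 := by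
  have n1 := T_ne_zero hc
  have n2 := T_ne_zero (a := 2 * c) (by omega)
  have n3 := T_ne_zero (a := 3 * c) (by omega)
  have n4 := T_ne_zero (a := 4 * c) (by omega)
  have n5 := T_ne_zero (a := 5 * c) (by omega)
  have key := three_term (5 * c) (2 * c) c
  rw [T_congr (b := -(4 * c)) (by omega), T_neg, T_congr (a := 5 * c + c) (b := -(5 * c)) (by omega),
    T_neg, show 5 * c - 2 * c = 3 * c by ring, show 5 * c - c = 4 * c by ring,
    show 2 * c + c = 3 * c by ring, show 2 * c - c = c by ring] at key
  simp only [X, mo]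
  field_simp
  linear_combination key

theorem one_sub_Y : 1 - Y c = mo c 1 (-3) 3 (-1) 0 := by
  have n1 := T_ne_zero hc
  have n2 := T_ne_zero (a := 2 * c) (by omega)
  have n3 := T_ne_zero (a := 3 * c) (by omega)
  have n4 := T_ne_zero (a := 4 * c) (by omega)
  have n5 := T_ne_zero (a := 5 * c) (by omega)
  have key := three_term (3 * c) (2 * c) c
  rw [show 3 * c + 2 * c = 5 * c by ring, show 3 * c - 2 * c = c by ring,
    show 3 * c + c = 4 * c by ring, show 3 * c - c = 2 * c by ring,
    show 2 * c + c = 3 * c by ring, show 2 * c - c = c by ring] at key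
  simp only [Y, mo]
  field_simp
  linear_combination -key

theorem curve : Y c ^ 2 - Y c + X c * (1 - X c) ^ 2 = 0 := by
  have h1 : Y c * (1 - Y c) = X c * (1 - X c) ^ 2 := by
    rw [one_sub_X hc, one_sub_Y hc, X, Y, mo_pow, mo_mul hc, mo_mul hc]; norm_num
  linear_combination -h1

theorem Z_eq : (1 - X c) ^ 2 - Y c = mo c 3 (-5) 0 0 2 := by
  have n1 := T_ne_zero hc
  have n2 := T_ne_zero (a := 2 * c) (by omega)
  have n3 := T_ne_zero (a := 3 * c) (by omega)
  have n4 := T_ne_zero (a := 4 * c) (by omega)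
  have n5 := T_ne_zero (a := 5 * c) (by omega)
  have key := three_term (4 * c) (3 * c) (2 * c)
  rw [T_congr (a := 4 * c + 3 * c) (b := -(4 * c)) (by omega), T_neg,
    T_congr (a := 4 * c + 2 * c) (b := -(5 * c)) (by omega), T_neg,
    show 4 * c - 3 * c = c by ring, show 4 * c - 2 * c = 2 * c by ring,
    show 3 * c + 2 * c = 5 * c by ring,
    show 3 * c - 2 * c = c by ring] at key
  rw [one_sub_X hc]
  simp only [Y, mo]
  field_simp
  linear_combination key

theorem mo_eq (b₁ b₂ b₃ b₄ b₅ a₁ a₂ a₃ a₄ a₅ : ℤ) (i j k l : ℕ)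
    (h : a₁ = b₁ + 2 * i + j + 3 * k + 3 * l ∧ a₂ = b₂ - 2 * i - 2 * j - 3 * k - 5 * l ∧
      a₃ = b₃ + i + j ∧ a₄ = b₄ - j - k ∧ a₅ = b₅ - i + j + k + 2 * l := by norm_num) :
    mo c a₁ a₂ a₃ a₄ a₅ = mo c b₁ b₂ b₃ b₄ b₅ *
      (X c ^ i * (1 - X c) ^ j * Y c ^ k * ((1 - X c) ^ 2 - Y c) ^ l) := by
  obtain ⟨rfl, rfl, rfl, rfl, rfl⟩ := h
  rw [Z_eq hc, one_sub_X hc, X, Y, mo_pow, mo_pow, mo_pow, mo_pow, mo_mul hc, mo_mul hc, mo_mul hc,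
    mo_mul hc]
  congr 1 <;> ring

theorem mo_mul_eq (b₁ b₂ b₃ b₄ b₅ a₁ a₂ a₃ a₄ a₅ d₁ d₂ d₃ d₄ d₅ : ℤ) (i j k l : ℕ)
    (h : a₁ + d₁ = b₁ + 2 * i + j + 3 * k + 3 * l ∧
      a₂ + d₂ = b₂ - 2 * i - 2 * j - 3 * k - 5 * l ∧
      a₃ + d₃ = b₃ + i + j ∧ a₄ + d₄ = b₄ - j - k ∧
      a₅ + d₅ = b₅ - i + j + k + 2 * l := by norm_num) :
    mo c a₁ a₂ a₃ a₄ a₅ * mo c d₁ d₂ d₃ d₄ d₅ = mo c b₁ b₂ b₃ b₄ b₅ *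
      (X c ^ i * (1 - X c) ^ j * Y c ^ k * ((1 - X c) ^ 2 - Y c) ^ l) := by
  rw [mo_mul hc]
  exact mo_eq hc _ _ _ _ _ _ _ _ _ _ i j k l h

theorem tq_mo : tq c = 1 - mo c (-1) 1 0 0 0 + mo c 0 (-1) 0 1 0 - mo c 0 0 (-1) 0 1
    + mo c 0 0 1 (-1) 0 - mo c 1 0 0 0 (-1) := by
  have n1 := T_ne_zero hc
  have n2 := T_ne_zero (a := 2 * c) (by omega)
  have n3 := T_ne_zero (a := 3 * c) (by omega)
  have n4 := T_ne_zero (a := 4 * c) (by omega)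
  have n5 := T_ne_zero (a := 5 * c) (by omega)
  rw [tq, T_congr (a := 6 * c) (b := -(5 * c)) (by omega),
    T_congr (a := 8 * c) (b := -(3 * c)) (by omega), T_congr (a := 10 * c) (b := -c) (by omega)]
  simp only [T_neg, mo]
  field_simp
  ring

end

section
variable {c : ℤ} (hc : ¬ 11 ∣ c)
include hc

theorem rho_row_a : -rho c + 2 * rho (2 * c) - rho (3 * c) =
    -(h ^ 3 * mo c (-6) 5 (-3) 2 1 * (X c ^ 2 * Y c)) := by
  have n1 := T_ne_zero hc
  have n2 := T_ne_zero (a := 2 * c) (by omega)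
  have n3 := T_ne_zero (a := 3 * c) (by omega)
  have n4 := T_ne_zero (a := 4 * c) (by omega)
  have n5 := T_ne_zero (a := 5 * c) (by omega)
  have key := rho_relation (a := 2 * c) (b := 0 * c) (c := 1 * c) (by omega) (by omega)
    (by omega) (by omega)
  rw [rho_congr (a := 2 * c + 0 * c) (b := 2 * c) (by omega), rho_congr (a := 2 * c - 0 * c) (b :=
    2 * c) (by omega), rho_congr (a := 2 * c + 1 * c) (b := 3 * c) (by omega), rho_congr (a := 2 *
    c - 1 * c) (b := c) (by omega), T_congr (a := 2 * c + 0 * c) (b := 2 * c) (by omega), T_congr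
    (a := 2 * c - 0 * c) (b := 2 * c) (by omega), T_congr (a := 2 * c + 1 * c) (b := 3 * c) (by
    omega), T_congr (a := 2 * c - 1 * c) (b := c) (by omega), T_congr (a := 2 * (2 * c)) (b := 4 *
    c) (by omega), T_congr (a := 0 * c - 1 * c) (b := -c) (by omega), T_congr (a := 0 * c + 1 * c)
    (b := c) (by omega)] at key
  simp only [rho_neg, T_neg] at key
  have e := mo_eq hc (-6) 5 (-3) 2 1 1 (-2) (-1) 1 0 2 0 1 0
  simp only [pow_zero, pow_one, mul_one, one_mul] at e
  rw [mul_assoc, ← e]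
  refine Eq.trans (Eq.trans ?_ key) ?_
  · ring
  · simp only [mo]
    field_simp

theorem rho_row_b : -rho c + rho (2 * c) + 2 * rho (5 * c) =
    -(h ^ 3 * mo c (-6) 5 (-3) 2 1 * (X c ^ 3)) := by
  have n1 := T_ne_zero hc
  have n2 := T_ne_zero (a := 2 * c) (by omega)
  have n3 := T_ne_zero (a := 3 * c) (by omega)
  have n4 := T_ne_zero (a := 4 * c) (by omega)
  have n5 := T_ne_zero (a := 5 * c) (by omega)
  have key := rho_relation (a := (-2) * c) (b := 4 * c) (c := 3 * c) (by omega) (by omega)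
    (by omega) (by omega)
  rw [rho_congr (a := (-2) * c + 4 * c) (b := 2 * c) (by omega), rho_congr (a := (-2) * c - 4 * c)
    (b := 5 * c) (by omega), rho_congr (a := (-2) * c + 3 * c) (b := c) (by omega), rho_congr (a
    := (-2) * c - 3 * c) (b := -(5 * c)) (by omega), T_congr (a := (-2) * c + 4 * c) (b := 2 * c)
    (by omega), T_congr (a := (-2) * c - 4 * c) (b := 5 * c) (by omega), T_congr (a := (-2) * c +
    3 * c) (b := c) (by omega), T_congr (a := (-2) * c - 3 * c) (b := -(5 * c)) (by omega),
    T_congr (a := 2 * ((-2) * c)) (b := -(4 * c)) (by omega), T_congr (a := 4 * c - 3 * c) (b :=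
    c) (by omega), T_congr (a := 4 * c + 3 * c) (b := -(4 * c)) (by omega)] at key
  simp only [rho_neg, T_neg] at key
  have e := mo_eq hc (-6) 5 (-3) 2 1 0 (-1) 0 2 (-2) 3 0 0 0
  simp only [pow_zero, pow_one, mul_one, one_mul] at e
  rw [mul_assoc, ← e]
  refine Eq.trans (Eq.trans ?_ key) ?_
  · ring
  · simp only [mo]
    field_simp

theorem rho_row_c : -2 * rho c - rho (3 * c) + rho (5 * c) =
    -(h ^ 3 * mo c (-6) 5 (-3) 2 1 * (X c ^ 2)) := by
  have n1 := T_ne_zero hc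
  have n2 := T_ne_zero (a := 2 * c) (by omega)
  have n3 := T_ne_zero (a := 3 * c) (by omega)
  have n4 := T_ne_zero (a := 4 * c) (by omega)
  have n5 := T_ne_zero (a := 5 * c) (by omega)
  have key := rho_relation (a := 1 * c) (b := 4 * c) (c := 0 * c) (by omega) (by omega)
    (by omega) (by omega)
  rw [rho_congr (a := 1 * c + 4 * c) (b := 5 * c) (by omega), rho_congr (a := 1 * c - 4 * c) (b :=
    -(3 * c)) (by omega), rho_congr (a := 1 * c + 0 * c) (b := c) (by omega), rho_congr (a := 1 *
    c - 0 * c) (b := c) (by omega), T_congr (a := 1 * c + 4 * c) (b := 5 * c) (by omega), T_congr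
    (a := 1 * c - 4 * c) (b := -(3 * c)) (by omega), T_congr (a := 1 * c + 0 * c) (b := c) (by
    omega), T_congr (a := 1 * c - 0 * c) (b := c) (by omega), T_congr (a := 2 * (1 * c)) (b := 2 *
    c) (by omega), T_congr (a := 4 * c - 0 * c) (b := 4 * c) (by omega), T_congr (a := 4 * c + 0 *
    c) (b := 4 * c) (by omega)] at key
  simp only [rho_neg, T_neg] at key
  have e := mo_eq hc (-6) 5 (-3) 2 1 (-2) 1 (-1) 2 (-1) 2 0 0 0
  simp only [pow_zero, pow_one, mul_one, one_mul] at e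
  rw [mul_assoc, ← e]
  refine Eq.trans (Eq.trans ?_ key) ?_
  · ring
  · simp only [mo]
    field_simp

theorem rho_row_d : -rho c - 2 * rho (3 * c) - rho (4 * c) =
    -(h ^ 3 * mo c (-6) 5 (-3) 2 1 * (X c * Y c)) := by
  have n1 := T_ne_zero hc
  have n2 := T_ne_zero (a := 2 * c) (by omega)
  have n3 := T_ne_zero (a := 3 * c) (by omega)
  have n4 := T_ne_zero (a := 4 * c) (by omega)
  have n5 := T_ne_zero (a := 5 * c) (by omega)
  have key := rho_relation (a := 2 * c) (b := 6 * c) (c := 1 * c) (by omega) (by omega)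
    (by omega) (by omega)
  rw [rho_congr (a := 2 * c + 6 * c) (b := -(3 * c)) (by omega), rho_congr (a := 2 * c - 6 * c) (b
    := -(4 * c)) (by omega), rho_congr (a := 2 * c + 1 * c) (b := 3 * c) (by omega), rho_congr (a
    := 2 * c - 1 * c) (b := c) (by omega), T_congr (a := 2 * c + 6 * c) (b := -(3 * c)) (by
    omega), T_congr (a := 2 * c - 6 * c) (b := -(4 * c)) (by omega), T_congr (a := 2 * c + 1 * c)
    (b := 3 * c) (by omega), T_congr (a := 2 * c - 1 * c) (b := c) (by omega), T_congr (a := 2 *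
    (2 * c)) (b := 4 * c) (by omega), T_congr (a := 6 * c - 1 * c) (b := 5 * c) (by omega),
    T_congr (a := 6 * c + 1 * c) (b := -(4 * c)) (by omega)] at key
  simp only [rho_neg, T_neg] at key
  have e := mo_eq hc (-6) 5 (-3) 2 1 (-1) 0 (-2) 1 1 1 0 1 0
  simp only [pow_zero, pow_one, mul_one, one_mul] at e
  rw [mul_assoc, ← e]
  refine Eq.trans (Eq.trans ?_ key) ?_
  · ring
  · simp only [mo]
    field_simp

theorem rho_row_e : -rho (2 * c) - 3 * rho (3 * c) =
    -(h ^ 3 * mo c (-6) 5 (-3) 2 1 * (Y c ^ 2)) := by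
  have n1 := T_ne_zero hc
  have n2 := T_ne_zero (a := 2 * c) (by omega)
  have n3 := T_ne_zero (a := 3 * c) (by omega)
  have n4 := T_ne_zero (a := 4 * c) (by omega)
  have n5 := T_ne_zero (a := 5 * c) (by omega)
  have key := rho_relation (a := (-3) * c) (b := 0 * c) (c := 5 * c) (by omega) (by omega)
    (by omega) (by omega)
  rw [rho_congr (a := (-3) * c + 0 * c) (b := -(3 * c)) (by omega), rho_congr (a := (-3) * c - 0 *
    c) (b := -(3 * c)) (by omega), rho_congr (a := (-3) * c + 5 * c) (b := 2 * c) (by omega),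
    rho_congr (a := (-3) * c - 5 * c) (b := 3 * c) (by omega), T_congr (a := (-3) * c + 0 * c) (b
    := -(3 * c)) (by omega), T_congr (a := (-3) * c - 0 * c) (b := -(3 * c)) (by omega), T_congr
    (a := (-3) * c + 5 * c) (b := 2 * c) (by omega), T_congr (a := (-3) * c - 5 * c) (b := 3 * c)
    (by omega), T_congr (a := 2 * ((-3) * c)) (b := 5 * c) (by omega), T_congr (a := 0 * c - 5 *
    c) (b := -(5 * c)) (by omega), T_congr (a := 0 * c + 5 * c) (b := 5 * c) (by omega)] at key
  simp only [rho_neg, T_neg] at key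
  have e := mo_eq hc (-6) 5 (-3) 2 1 0 (-1) (-3) 0 3 0 0 2 0
  simp only [pow_zero, pow_one, mul_one, one_mul] at e
  rw [mul_assoc, ← e]
  refine Eq.trans (Eq.trans ?_ key) ?_
  · ring
  · simp only [mo]
    field_simp

theorem rho_formula_one : 11 * rho c =
    h ^ 3 * mo c (-6) 5 (-3) 2 1 * (-5 / 2 * Y c + 5 / 2 * X c + 2 * X c ^ 2 + 1 / 2 * X c ^ 2 * Y c - X c ^ 3) := by
  linear_combination (-1/2) * rho_row_a hc + (7/2) * rho_row_b hc + (-7) * rho_row_c hc + (5/2) *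
    rho_row_e hc + (-5/2) * (h ^ 3 * mo c (-6) 5 (-3) 2 1) * curve hc

theorem rho_formula_two : 11 * rho (2 * c) =
    h ^ 3 * mo c (-6) 5 (-3) 2 1 * (1 / 2 * Y c - 1 / 2 * X c + 4 * X c ^ 2 - 9 / 2 * X c ^ 2 * Y c - 2 * X c ^ 3) := by
  linear_combination (9/2) * rho_row_a hc + (3/2) * rho_row_b hc + (-3) * rho_row_c hc + (-1/2) *
    rho_row_e hc + (1/2) * (h ^ 3 * mo c (-6) 5 (-3) 2 1) * curve hc

theorem rho_formula_three : 11 * rho (3 * c) =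
    h ^ 3 * mo c (-6) 5 (-3) 2 1 * (7 / 2 * Y c - 7 / 2 * X c + 6 * X c ^ 2 + 3 / 2 * X c ^ 2 * Y c - 3 * X c ^ 3) := by
  linear_combination (-3/2) * rho_row_a hc + (-1/2) * rho_row_b hc + 1 * rho_row_c hc + (-7/2) *
    rho_row_e hc + (7/2) * (h ^ 3 * mo c (-6) 5 (-3) 2 1) * curve hc

theorem rho_formula_four : 11 * rho (4 * c) =
    h ^ 3 * mo c (-6) 5 (-3) 2 1 * (-9 / 2 * Y c + 9 / 2 * X c + 11 * X c * Y c - 14 * X c ^ 2 - 7 / 2 * X c ^ 2 * Y c + 7 * X c ^ 3) := by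
  linear_combination (7/2) * rho_row_a hc + (-5/2) * rho_row_b hc + 5 * rho_row_c hc + (-11) *
    rho_row_d hc + (9/2) * rho_row_e hc + (-9/2) * (h ^ 3 * mo c (-6) 5 (-3) 2 1) * curve hc

theorem rho_formula_five : 11 * rho (5 * c) =
    h ^ 3 * mo c (-6) 5 (-3) 2 1 * (-3 / 2 * Y c + 3 / 2 * X c - X c ^ 2 + 5 / 2 * X c ^ 2 * Y c - 5 * X c ^ 3) := by
  linear_combination (-5/2) * rho_row_a hc + (13/2) * rho_row_b hc + (-2) * rho_row_c hc + (3/2) *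
    rho_row_e hc + (-3/2) * (h ^ 3 * mo c (-6) 5 (-3) 2 1) * curve hc

end

theorem psi_congr {a b : ℤ} (hab : 11 ∣ a - b) : psi a = psi b :=
  eq_of_dvd_sub psi_add_eleven hab

section
variable {c : ℤ} (hc : ¬ 11 ∣ c)
include hc

theorem psi_row_a : 3 * psi c + 2 * psi (2 * c) + psi (3 * c) =
    (h ^ 3 * mo c (-6) 5 (-3) 2 1) ^ 2 * (-116 * Y c + 116 * X c + 232 * X c * Y c - 348 * X c ^ 2
      + 56 * X c ^ 2 * Y c + 60 * X c ^ 3 - 16 * X c ^ 3 * Y c + 312 * X c ^ 4 - 260 * X c ^ 4 * Y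
      c - 228 * X c ^ 5 + 96 * X c ^ 5 * Y c - 56 * X c ^ 6 + 68 * X c ^ 7) := by
  have key := psi_relation (a := (-4) * c) (b := 6 * c) (by omega) (by omega)
    (by omega) (by omega)
  rw [psi_congr (a := (-4) * c + 6 * c) (b := 2 * c) (by omega), rho_congr (a := (-4) * c + 6 * c)
    (b := 2 * c) (by omega), psi_congr (a := (-4) * c - 6 * c) (b := c) (by omega), rho_congr (a
    := (-4) * c - 6 * c) (b := c) (by omega), psi_congr (a := 2 * ((-4) * c)) (b := 3 * c) (by
    omega), rho_congr (a := 2 * ((-4) * c)) (b := 3 * c) (by omega), psi_congr (a := 2 * (6 * c))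
    (b := c) (by omega), rho_congr (a := 2 * (6 * c)) (b := c) (by omega)] at key
  have r1 := (eq_div_iff (by norm_num)).2 ((mul_comm _ _).trans (rho_formula_one hc))
  have r2 := (eq_div_iff (by norm_num)).2 ((mul_comm _ _).trans (rho_formula_two hc))
  have r3 := (eq_div_iff (by norm_num)).2 ((mul_comm _ _).trans (rho_formula_three hc))
  rw [r1, r2, r3] at key
  linear_combination key + (h ^ 3 * mo c (-6) 5 (-3) 2 1) ^ 2 * (-116 - 24 * X c ^ 2 - 68 * X c ^
    4) * curve hc

theorem psi_row_b : 2 * psi c + psi (2 * c) + 2 * psi (3 * c) + psi (4 * c) =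
    (h ^ 3 * mo c (-6) 5 (-3) 2 1) ^ 2 * (-12 * Y c + 12 * X c + 112 * X c * Y c - 124 * X c ^ 2 -
      592 * X c ^ 2 * Y c + 692 * X c ^ 3 + 1288 * X c ^ 3 * Y c - 1752 * X c ^ 4 - 1004 * X c ^ 4
      * Y c + 1524 * X c ^ 5 + 280 * X c ^ 5 * Y c - 552 * X c ^ 6 + 92 * X c ^ 7) := by
  have key := psi_relation (a := 2 * c) (b := 1 * c) (by omega) (by omega)
    (by omega) (by omega)
  rw [psi_congr (a := 2 * c + 1 * c) (b := 3 * c) (by omega), rho_congr (a := 2 * c + 1 * c) (b :=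
    3 * c) (by omega), psi_congr (a := 2 * c - 1 * c) (b := c) (by omega), rho_congr (a := 2 * c -
    1 * c) (b := c) (by omega), psi_congr (a := 2 * (2 * c)) (b := 4 * c) (by omega), rho_congr (a
    := 2 * (2 * c)) (b := 4 * c) (by omega), psi_congr (a := 2 * (1 * c)) (b := 2 * c) (by omega),
    rho_congr (a := 2 * (1 * c)) (b := 2 * c) (by omega)] at key
  have r1 := (eq_div_iff (by norm_num)).2 ((mul_comm _ _).trans (rho_formula_one hc))
  have r2 := (eq_div_iff (by norm_num)).2 ((mul_comm _ _).trans (rho_formula_two hc))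
  have r3 := (eq_div_iff (by norm_num)).2 ((mul_comm _ _).trans (rho_formula_three hc))
  have r4 := (eq_div_iff (by norm_num)).2 ((mul_comm _ _).trans (rho_formula_four hc))
  rw [r1, r2, r3, r4] at key
  linear_combination key + (h ^ 3 * mo c (-6) 5 (-3) 2 1) ^ 2 * (-12 + 88 * X c - 312 * X c ^ 2 +
    176 * X c ^ 3 - 92 * X c ^ 4) * curve hc

theorem psi_row_c : psi c + 2 * psi (2 * c) + 2 * psi (3 * c) + psi (5 * c) =
    (h ^ 3 * mo c (-6) 5 (-3) 2 1) ^ 2 * (-108 * Y c + 108 * X c + 216 * X c * Y c - 324 * X c ^ 2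
      - 136 * X c ^ 2 * Y c + 244 * X c ^ 3 - 112 * X c ^ 3 * Y c + 72 * X c ^ 4 + 292 * X c ^ 4 *
      Y c - 364 * X c ^ 5 - 32 * X c ^ 5 * Y c + 136 * X c ^ 6 + 36 * X c ^ 7) := by
  have key := psi_relation (a := (-3) * c) (b := 6 * c) (by omega) (by omega)
    (by omega) (by omega)
  rw [psi_congr (a := (-3) * c + 6 * c) (b := 3 * c) (by omega), rho_congr (a := (-3) * c + 6 * c)
    (b := 3 * c) (by omega), psi_congr (a := (-3) * c - 6 * c) (b := 2 * c) (by omega), rho_congr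
    (a := (-3) * c - 6 * c) (b := 2 * c) (by omega), psi_congr (a := 2 * ((-3) * c)) (b := 5 * c)
    (by omega), rho_congr (a := 2 * ((-3) * c)) (b := 5 * c) (by omega), psi_congr (a := 2 * (6 *
    c)) (b := c) (by omega), rho_congr (a := 2 * (6 * c)) (b := c) (by omega)] at key
  have r1 := (eq_div_iff (by norm_num)).2 ((mul_comm _ _).trans (rho_formula_one hc))
  have r2 := (eq_div_iff (by norm_num)).2 ((mul_comm _ _).trans (rho_formula_two hc))
  have r3 := (eq_div_iff (by norm_num)).2 ((mul_comm _ _).trans (rho_formula_three hc))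
  have r5 := (eq_div_iff (by norm_num)).2 ((mul_comm _ _).trans (rho_formula_five hc))
  rw [r1, r2, r3, r5] at key
  linear_combination key + (h ^ 3 * mo c (-6) 5 (-3) 2 1) ^ 2 * (-108 + 8 * X c ^ 2 - 36 * X c ^
    4) * curve hc

theorem psi_row_d : 2 * psi c + psi (3 * c) + 2 * psi (4 * c) + psi (5 * c) =
    (h ^ 3 * mo c (-6) 5 (-3) 2 1) ^ 2 * (28 * Y c - 28 * X c + 120 * X c * Y c - 92 * X c ^ 2 -
      760 * X c ^ 2 * Y c + 908 * X c ^ 3 + 1512 * X c ^ 3 * Y c - 2160 * X c ^ 4 - 1412 * X c ^ 4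
      * Y c + 2252 * X c ^ 5 + 432 * X c ^ 5 * Y c - 1000 * X c ^ 6 + 108 * X c ^ 7) := by
  have key := psi_relation (a := (-3) * c) (b := 7 * c) (by omega) (by omega)
    (by omega) (by omega)
  rw [psi_congr (a := (-3) * c + 7 * c) (b := 4 * c) (by omega), rho_congr (a := (-3) * c + 7 * c)
    (b := 4 * c) (by omega), psi_congr (a := (-3) * c - 7 * c) (b := c) (by omega), rho_congr (a
    := (-3) * c - 7 * c) (b := c) (by omega), psi_congr (a := 2 * ((-3) * c)) (b := 5 * c) (by
    omega), rho_congr (a := 2 * ((-3) * c)) (b := 5 * c) (by omega), psi_congr (a := 2 * (7 * c))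
    (b := 3 * c) (by omega), rho_congr (a := 2 * (7 * c)) (b := 3 * c) (by omega)] at key
  have r1 := (eq_div_iff (by norm_num)).2 ((mul_comm _ _).trans (rho_formula_one hc))
  have r3 := (eq_div_iff (by norm_num)).2 ((mul_comm _ _).trans (rho_formula_three hc))
  have r4 := (eq_div_iff (by norm_num)).2 ((mul_comm _ _).trans (rho_formula_four hc))
  have r5 := (eq_div_iff (by norm_num)).2 ((mul_comm _ _).trans (rho_formula_five hc))
  rw [r1, r3, r4, r5] at key
  linear_combination key + (h ^ 3 * mo c (-6) 5 (-3) 2 1) ^ 2 * (28 + 176 * X c - 240 * X c ^ 2 +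
    352 * X c ^ 3 - 108 * X c ^ 4) * curve hc

theorem psi_row_e : 2 * psi c + psi (4 * c) + 3 * psi (5 * c) =
    (h ^ 3 * mo c (-6) 5 (-3) 2 1) ^ 2 * (-84 * Y c + 84 * X c + 256 * X c * Y c - 340 * X c ^ 2 -
      96 * X c ^ 2 * Y c + 268 * X c ^ 3 - 136 * X c ^ 3 * Y c + 144 * X c ^ 4 - 604 * X c ^ 4 * Y
      c + 724 * X c ^ 5 + 464 * X c ^ 5 * Y c - 872 * X c ^ 6 + 116 * X c ^ 7) := by
  have key := psi_relation (a := 3 * c) (b := 2 * c) (by omega) (by omega)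
    (by omega) (by omega)
  rw [psi_congr (a := 3 * c + 2 * c) (b := 5 * c) (by omega), rho_congr (a := 3 * c + 2 * c) (b :=
    5 * c) (by omega), psi_congr (a := 3 * c - 2 * c) (b := c) (by omega), rho_congr (a := 3 * c -
    2 * c) (b := c) (by omega), psi_congr (a := 2 * (3 * c)) (b := -(5 * c)) (by omega), rho_congr
    (a := 2 * (3 * c)) (b := -(5 * c)) (by omega), psi_congr (a := 2 * (2 * c)) (b := 4 * c) (by
    omega), rho_congr (a := 2 * (2 * c)) (b := 4 * c) (by omega)] at key
  simp only [rho_neg, psi_neg] at key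
  have r1 := (eq_div_iff (by norm_num)).2 ((mul_comm _ _).trans (rho_formula_one hc))
  have r4 := (eq_div_iff (by norm_num)).2 ((mul_comm _ _).trans (rho_formula_four hc))
  have r5 := (eq_div_iff (by norm_num)).2 ((mul_comm _ _).trans (rho_formula_five hc))
  rw [r1, r4, r5] at key
  linear_combination key + (h ^ 3 * mo c (-6) 5 (-3) 2 1) ^ 2 * (-84 + 88 * X c + 16 * X c ^ 2 +
    176 * X c ^ 3 - 116 * X c ^ 4) * curve hc

theorem psi_formula_one : psi c =
    (h ^ 3 * mo c (-6) 5 (-3) 2 1) ^ 2 * (-46 / 3 * Y c + 46 / 3 * X c + 92 / 3 * X c * Y c - 46 *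
      X c ^ 2 + 92 / 3 * X c ^ 2 * Y c - 46 / 3 * X c ^ 3 + 332 / 3 * X c ^ 3 * Y c - 24 * X c ^ 4
      - 354 * X c ^ 4 * Y c + 826 / 3 * X c ^ 5 + 472 / 3 * X c ^ 5 * Y c - 236 * X c ^ 6 + 118 /
      3 * X c ^ 7) := by
  linear_combination (1/6) * psi_row_a hc + (2/3) * psi_row_b hc + (-1/2) * psi_row_c hc + (-1/2)
    * psi_row_d hc + (1/3) * psi_row_e hc

theorem psi_formula_two : psi (2 * c) =
    (h ^ 3 * mo c (-6) 5 (-3) 2 1) ^ 2 * (-118 / 3 * Y c + 118 / 3 * X c + 236 / 3 * X c * Y c -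
      118 * X c ^ 2 + 236 / 3 * X c ^ 2 * Y c - 118 / 3 * X c ^ 3 - 1180 / 3 * X c ^ 3 * Y c + 520
      * X c ^ 4 + 542 * X c ^ 4 * Y c - 2438 / 3 * X c ^ 5 - 752 / 3 * X c ^ 5 * Y c + 420 * X c ^
      6 - 122 / 3 * X c ^ 7) := by
  linear_combination (1/2) * psi_row_a hc + (-5/3) * psi_row_b hc + (5/6) * psi_row_c hc + (7/6) *
    psi_row_d hc + (-2/3) * psi_row_e hc

theorem psi_formula_three : psi (3 * c) =
    (h ^ 3 * mo c (-6) 5 (-3) 2 1) ^ 2 * (26 / 3 * Y c - 26 / 3 * X c - 52 / 3 * X c * Y c + 26 *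
      X c ^ 2 - 580 / 3 * X c ^ 2 * Y c + 554 / 3 * X c ^ 3 + 1316 / 3 * X c ^ 3 * Y c - 656 * X c
      ^ 4 - 282 * X c ^ 4 * Y c + 1714 / 3 * X c ^ 5 + 376 / 3 * X c ^ 5 * Y c - 188 * X c ^ 6 +
      94 / 3 * X c ^ 7) := by
  linear_combination (-1/2) * psi_row_a hc + (4/3) * psi_row_b hc + (-1/6) * psi_row_c hc + (-5/6)
    * psi_row_d hc + (1/3) * psi_row_e hc

theorem psi_formula_four : psi (4 * c) =
    (h ^ 3 * mo c (-6) 5 (-3) 2 1) ^ 2 * (122 / 3 * Y c - 122 / 3 * X c + 20 / 3 * X c * Y c + 34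
      * X c ^ 2 - 1036 / 3 * X c ^ 2 * Y c + 1178 / 3 * X c ^ 3 + 1748 / 3 * X c ^ 3 * Y c - 912 *
      X c ^ 4 - 274 * X c ^ 4 * Y c + 1930 / 3 * X c ^ 5 - 104 / 3 * X c ^ 5 * Y c - 124 * X c ^ 6
      - 26 / 3 * X c ^ 7) := by
  linear_combination (1/6) * psi_row_a hc + (-4/3) * psi_row_b hc + (1/2) * psi_row_c hc + (3/2) *
    psi_row_d hc + (-2/3) * psi_row_e hc

theorem psi_formula_five : psi (5 * c) =
    (h ^ 3 * mo c (-6) 5 (-3) 2 1) ^ 2 * (-94 / 3 * Y c + 94 / 3 * X c + 188 / 3 * X c * Y c - 94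
      * X c ^ 2 + 188 / 3 * X c ^ 2 * Y c - 94 / 3 * X c ^ 3 - 940 / 3 * X c ^ 3 * Y c + 368 * X c
      ^ 4 + 126 * X c ^ 4 * Y c - 470 / 3 * X c ^ 5 + 184 / 3 * X c ^ 5 * Y c - 92 * X c ^ 6 + 46
      / 3 * X c ^ 7) := by
  linear_combination (-1/6) * psi_row_a hc + (1/6) * psi_row_c hc + (-1/6) * psi_row_d hc + (1/3)
    * psi_row_e hc

theorem dlog_mo (e₁ e₂ e₃ e₄ e₅ : ℤ) : dlog (mo c e₁ e₂ e₃ e₄ e₅) =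
    e₁ * (3 * psi c + tau) + e₂ * (3 * psi (2 * c) + tau) + e₃ * (3 * psi (3 * c) + tau)
      + e₄ * (3 * psi (4 * c) + tau) + e₅ * (3 * psi (5 * c) + tau) := by
  have n1 := T_ne_zero hc
  have n2 := T_ne_zero (a := 2 * c) (by omega)
  have n3 := T_ne_zero (a := 3 * c) (by omega)
  have n4 := T_ne_zero (a := 4 * c) (by omega)
  have n5 := T_ne_zero (a := 5 * c) (by omega)
  have hT (a : ℤ) : dlog (T a) = 3 * psi a + tau := by rw [dlog_T, psi]; ring
  have z1 := zpow_ne_zero e₁ (neg_ne_zero.2 n1)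
  have z2 := zpow_ne_zero e₂ n2
  have z3 := zpow_ne_zero e₃ (neg_ne_zero.2 n3)
  have z4 := zpow_ne_zero e₄ n4
  have z5 := zpow_ne_zero e₅ (neg_ne_zero.2 n5)
  have hneg (a : ℤ) : dlog (-T a) = dlog (T a) := by
    have := D_sub 0 (T a)
    have h0 := D_intCast 0
    rw [Int.cast_zero] at h0
    rw [zero_sub, h0, zero_sub] at this
    rw [dlog, this, dlog]
    ring
  rw [mo, dlog_mul (by simp [*]) z5, dlog_mul (by simp [*]) z4, dlog_mul (by simp [*]) z3,
    dlog_mul z1 z2, dlog_zpow (neg_ne_zero.2 n1), dlog_zpow n2, dlog_zpow (neg_ne_zero.2 n3),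
    dlog_zpow n4, dlog_zpow (neg_ne_zero.2 n5)]
  simp only [hneg, hT]

theorem D_mo (e₁ e₂ e₃ e₄ e₅ : ℤ) : D (mo c e₁ e₂ e₃ e₄ e₅) =
    (e₁ * (3 * psi c + tau) + e₂ * (3 * psi (2 * c) + tau) + e₃ * (3 * psi (3 * c) + tau)
      + e₄ * (3 * psi (4 * c) + tau) + e₅ * (3 * psi (5 * c) + tau)) * mo c e₁ e₂ e₃ e₄ e₅ := by
  rw [← dlog_mo hc, dlog, div_mul_cancel₀ _ (mo_ne_zero hc _ _ _ _ _)]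

end

/-- The cubic form relating a power of `h` to theta monomials. -/
noncomputable def fcub (c : ℤ) : K :=
  1 - (5 : ℤ) * X c - Y c + (2 : ℤ) * (X c * X c) + (3 : ℤ) * (X c * Y c) + X c * X c * X c

theorem D_fcub {c : ℤ} (hc : ¬ 11 ∣ c) : D (fcub c) =
    3 * fcub c * (6 * psi c - 3 * psi (2 * c) + 5 * psi (3 * c) + 2 * psi (4 * c)
      + 2 * psi (5 * c)) := by
  have h1 := D_intCast 1
  rw [Int.cast_one] at h1
  have hX : D (X c) = 3 * (2 * psi c - 2 * psi (2 * c) + psi (3 * c) - psi (5 * c)) * X c := by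
    rw [X, D_mo hc]; push_cast; ring
  have hY : D (Y c) = 3 * (3 * psi c - 3 * psi (2 * c) - psi (4 * c) + psi (5 * c)) * Y c := by
    rw [Y, D_mo hc]; push_cast; ring
  simp only [fcub, D_add, D_sub, D_mul, D_intCast, h1, hX, hY]
  rw [psi_formula_one hc, psi_formula_two hc, psi_formula_three hc, psi_formula_four hc,
    psi_formula_five hc]
  push_cast
  linear_combination (-3) * (h ^ 3 * mo c (-6) 5 (-3) 2 1) ^ 2 * (-88 - 88 * X c + 2640 * X c ^ 2
    - 8448 * X c ^ 3 + 9768 * X c ^ 4 - 3960 * X c ^ 5 + 528 * X c ^ 6) * curve hc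

theorem IsOne.zpow {f : K} (hf : IsOne f) (n : ℤ) : IsOne (f ^ n) := by
  have hn (m : ℕ) : IsOne (f ^ m) := by
    induction m with
    | zero => rw [pow_zero]; exact isOne_one
    | succ m ih => rw [pow_succ]; exact ih.mul hf
  obtain ⟨m, rfl | rfl⟩ := n.eq_nat_or_neg
  · rw [zpow_natCast]; exact hn m
  · rw [zpow_neg, zpow_natCast]; exact (hn m).inv

theorem u_zpow (n a : ℤ) : u a ^ n = u (n * a) := by
  obtain ⟨m, rfl | rfl⟩ := n.eq_nat_or_neg
  · rw [zpow_natCast, u_natMul]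
  · rw [zpow_neg, zpow_natCast, neg_mul, u_neg, u_natMul]

theorem mo_one_eq (e₁ e₂ e₃ e₄ e₅ : ℤ) : ∃ g, IsOne g ∧ mo 1 e₁ e₂ e₃ e₄ e₅ =
    u (3 * (81 * e₁ + 49 * e₂ + 25 * e₃ + 9 * e₄ + e₅)) * g := by
  have hT {a : ℤ} (h0 : 0 < a) (h1 : a < 11) :
      ∃ g, IsOne g ∧ sg a * T a = u (3 * (2 * a - 11) ^ 2) * g := by
    refine ⟨E * pochInf a * pochInf (11 - a),
      (isOne_E.mul (isOne_pochInf h0)).mul (isOne_pochInf (by omega)), ?_⟩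
    rw [T_eq h0 h1]
    have := sg_sq a
    linear_combination (u (3 * (2 * a - 11) ^ 2) * E * pochInf a * pochInf (11 - a)) * this
  obtain ⟨g1, o1, h1⟩ := hT (a := 1) (by norm_num) (by norm_num)
  obtain ⟨g2, o2, h2⟩ := hT (a := 2) (by norm_num) (by norm_num)
  obtain ⟨g3, o3, h3⟩ := hT (a := 3) (by norm_num) (by norm_num)
  obtain ⟨g4, o4, h4⟩ := hT (a := 4) (by norm_num) (by norm_num)
  obtain ⟨g5, o5, h5⟩ := hT (a := 5) (by norm_num) (by norm_num)
  rw [sg_one, neg_one_mul] at h1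
  rw [sg_even (by decide), one_mul] at h2 h4
  rw [sg_odd (by decide), neg_one_mul] at h3 h5
  refine ⟨g1 ^ e₁ * g2 ^ e₂ * g3 ^ e₃ * g4 ^ e₄ * g5 ^ e₅,
    ((((o1.zpow _).mul (o2.zpow _)).mul (o3.zpow _)).mul (o4.zpow _)).mul (o5.zpow _), ?_⟩
  rw [mo, mul_one, mul_one, mul_one, mul_one, h1, h2, h3, h4, h5, mul_zpow, mul_zpow, mul_zpow,
    mul_zpow, mul_zpow, u_zpow, u_zpow, u_zpow, u_zpow, u_zpow,
    show 3 * (81 * e₁ + 49 * e₂ + 25 * e₃ + 9 * e₄ + e₅) = e₁ * (3 * (2 * 1 - 11) ^ 2) +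
      e₂ * (3 * (2 * 2 - 11) ^ 2) + e₃ * (3 * (2 * 3 - 11) ^ 2) + e₄ * (3 * (2 * 4 - 11) ^ 2) +
      e₅ * (3 * (2 * 5 - 11) ^ 2) by ring, u_add, u_add, u_add, u_add]
  ring

theorem h_pow_twelve_one : h ^ 12 * fcub 1 = mo 1 6 (-3) 5 2 2 := by
  have hc : ¬ (11 : ℤ) ∣ 1 := by norm_num
  have hn := mo_ne_zero hc 6 (-3) 5 2 2
  have hD : D (h ^ 12 * fcub 1 * mo 1 (-6) 3 (-5) (-2) (-2)) = 0 := by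
    have h12 : D (h ^ 12) = 12 * tau * h ^ 12 := by
      have := dlog_pow h_ne_zero 12
      rw [dlog_h, dlog, div_eq_iff (pow_ne_zero _ h_ne_zero)] at this
      rw [this]; push_cast; ring
    rw [D_mul, D_mul, h12, D_fcub hc, D_mo hc]
    push_cast
    ring
  have hO : IsOne (h ^ 12 * fcub 1 * mo 1 (-6) 3 (-5) (-2) (-2)) := by
    obtain ⟨g, hg, e⟩ := mo_one_eq (-6) 3 (-5) (-2) (-2)
    obtain ⟨gX, hgX, eX⟩ := mo_one_eq 2 (-2) 1 0 (-1)
    obtain ⟨gY, hgY, eY⟩ := mo_one_eq 3 (-3) 0 (-1) 1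
    have oX : IsO 1 (X 1) := by
      rw [X, eX]; exact (isO_u _).mul' hgX.isO (by norm_num)
    have oY : IsO 1 (Y 1) := by
      rw [Y, eY]; exact (isO_u _).mul' hgY.isO (by norm_num)
    have of : IsOne (fcub 1) := by
      have : fcub 1 - 1 = X 1 * (-(5 : ℤ) + (2 : ℤ) * X 1 + (3 : ℤ) * Y 1 + X 1 * X 1) - Y 1 := by
        rw [fcub]; ring
      rw [IsOne, this]
      refine (oX.mul' (b := 0) ?_ (by norm_num)).sub oY
      have o0 : IsO 0 (X 1) := oX.mono (by norm_num)
      exact ((((isO_intCast 5).neg).add ((isO_intCast 2).mul' o0 (by norm_num))).add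
        ((isO_intCast 3).mul' (oY.mono (by norm_num) : IsO 0 (Y 1)) (by norm_num))).add
        (o0.mul' o0 (by norm_num))
    have : h ^ 12 * fcub 1 * mo 1 (-6) 3 (-5) (-2) (-2) = E ^ (12 : ℤ) * fcub 1 * g := by
      have e0 : u 121 ^ 12 * u (3 * (81 * -6 + 49 * 3 + 25 * -5 + 9 * -2 + -2)) = 1 := by
        rw [← u_natMul, ← u_add, ← u_zero]; norm_num
      have e1 : E ^ (12 : ℤ) = E ^ 12 := zpow_ofNat E 12
      rw [e, h, mul_pow, e1]
      linear_combination (E ^ 12 * fcub 1 * g) * e0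
    rw [this]
    exact ((isOne_E.zpow 12).mul of).mul hg
  have := eq_const_of_D_eq_zero (m := 1) hD (by rw [Int.cast_one]; exact hO)
  rw [Int.cast_one] at this
  have h2 := mo_mul hc (-6) 3 (-5) (-2) (-2) 6 (-3) 5 2 2
  have h3 : mo 1 0 0 0 0 0 = 1 := by simp [mo]
  norm_num at h2
  rw [h3] at h2
  linear_combination mo 1 6 (-3) 5 2 2 * this - h ^ 12 * fcub 1 * h2

/-- The non-mock part of the rank generating functions. -/
noncomputable def frank (c : ℤ) : K := h ^ 14 / 11 *
    (mo c (-7) 3 (-5) (-2) (-2) * (3 - 3 * Y c + 7 * X c - 2 * X c * Y c - 27 * X c ^ 2 + 14 * X c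
      ^ 3) + mo c (-7) 3 (-5) (-1) (-3) * (3 - 6 * Y c + 7 * X c + 17 * X c * Y c - 23 * X c ^ 2 -
      8 * X c ^ 2 * Y c + 13 * X c ^ 3) + mo c (-8) 3 (-5) (-1) (-2) * (6 * Y c - 16 * X c * Y c +
      14 * X c ^ 2 - 6 * X c ^ 2 * Y c - 9 * X c ^ 3) + mo c (-7) 4 (-6) (-2) (-2) * (9 - 9 * Y c
      - 23 * X c + 16 * X c * Y c + 18 * X c ^ 2 - 11 * X c ^ 2 * Y c - 2 * X c ^ 3) + mo c (-6) 2
      (-5) (-2) (-2) * (4 - 4 * Y c + 13 * X c + X c * Y c - 14 * X c ^ 2 + 4 * X c ^ 3) + mo c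
      (-6) 2 (-5) (-1) (-3) * (10 - 21 * Y c - 6 * X c + 19 * X c * Y c - 2 * X c ^ 2 - X c ^ 3) +
      mo c (-6) 0 (-4) (-2) (-1) * (11 * Y c + 11 * X c ^ 2) + mo c (-6) 3 (-6) (-2) (-2) * (12 -
      12 * Y c - 16 * X c + 14 * X c * Y c + 13 * X c ^ 2 - 10 * X c ^ 3) + mo c (-6) 3 (-6) (-1)
      (-3) * (11 - 15 * Y c + 7 * X c * Y c - 13 * X c ^ 2 + 4 * X c ^ 2 * Y c + 6 * X c ^ 3) + mo
      c (-6) 3 (-5) (-3) (-2) * (13 - 13 * Y c - 10 * X c - 5 * X c * Y c + 15 * X c ^ 2 - 9 * X c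
      ^ 3) + mo c (-7) 3 (-6) 0 (-3) * (11 + 5 * Y c - 55 * X c + 5 * X c * Y c + 52 * X c ^ 2 - 5
      * X c ^ 2 * Y c - 13 * X c ^ 3))

section
variable {c : ℤ} (hc : ¬ 11 ∣ c)
include hc

theorem rank_class_a : (mo c (-7) 4 (-6) (-2) (-2) * mo c 0 0 1 (-1) 0) * (9 - 9 * Y c - 23 * X c
    + 16 * X c * Y c + 18 * X c ^ 2 - 11 * X c ^ 2 * Y c - 2 * X c ^ 3) + mo c (-6) 2 (-5) (-1)
    (-3) * (10 - 21 * Y c - 6 * X c + 19 * X c * Y c - 2 * X c ^ 2 - X c ^ 3) - (mo c (-6) 0 (-4)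
    (-2) (-1) * mo c 1 0 0 0 (-1)) * (11 * Y c + 11 * X c ^ 2) - (mo c (-6) 3 (-6) (-1) (-3) * mo
    c 0 0 (-1) 0 1) * (11 - 15 * Y c + 7 * X c * Y c - 13 * X c ^ 2 + 4 * X c ^ 2 * Y c + 6 * X c
    ^ 3) - (mo c (-6) 3 (-5) (-3) (-2) * mo c (-1) 1 0 0 0) * (13 - 13 * Y c - 10 * X c - 5 * X c
    * Y c + 15 * X c ^ 2 - 9 * X c ^ 3) + (mo c (-7) 3 (-6) 0 (-3) * mo c 0 (-1) 0 1 0) * (11 + 5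
    * Y c - 55 * X c + 5 * X c * Y c + 52 * X c ^ 2 - 5 * X c ^ 2 * Y c - 13 * X c ^ 3) - 11 * mo
    c (-8) 4 (-6) (-1) (-2) * (1 - Y c - 5 * X c + 3 * X c * Y c + 2 * X c ^ 2 + X c ^ 3) = 0 :=
    by
  rw [mo_mul_eq hc (-15) 14 (-7) 1 (-6) (-7) 4 (-6) (-2) (-2) 0 0 1 (-1) 0 0 2 2 0, mo_eq hc
    (-15) 14 (-7) 1 (-6) (-6) 2 (-5) (-1) (-3) 1 1 1 1, mo_mul_eq hc (-15) 14 (-7) 1 (-6) (-6) 0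
    (-4) (-2) (-1) 1 0 0 0 (-1) 1 2 1 1, mo_mul_eq hc (-15) 14 (-7) 1 (-6) (-6) 3 (-6) (-1) (-3)
    0 0 (-1) 0 1 0 0 2 1, mo_mul_eq hc (-15) 14 (-7) 1 (-6) (-6) 3 (-5) (-3) (-2) (-1) 1 0 0 0 0
    2 2 0, mo_mul_eq hc (-15) 14 (-7) 1 (-6) (-7) 3 (-6) 0 (-3) 0 (-1) 0 1 0 1 0 0 2, mo_eq hc
    (-15) 14 (-7) 1 (-6) (-8) 4 (-6) (-1) (-2) 0 1 1 1]
  linear_combination mo c (-15) 14 (-7) 1 (-6) * (11 + 4 * Y c - 15 * Y c ^ 2 - 77 * X c + 64 * X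
    c * Y c + 7 * X c * Y c ^ 2 + 173 * X c ^ 2 - 123 * X c ^ 2 * Y c + 4 * X c ^ 2 * Y c ^ 2 -
    172 * X c ^ 3 + 75 * X c ^ 3 * Y c + 78 * X c ^ 4 - 15 * X c ^ 4 * Y c - 13 * X c ^ 5) * curve
    hc

theorem rank_class_b : (mo c (-7) 3 (-5) (-2) (-2) * mo c 0 (-1) 0 1 0) * (3 - 3 * Y c + 7 * X c -
    2 * X c * Y c - 27 * X c ^ 2 + 14 * X c ^ 3) + (mo c (-6) 2 (-5) (-2) (-2) * mo c 0 0 1 (-1)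
    0) * (4 - 4 * Y c + 13 * X c + X c * Y c - 14 * X c ^ 2 + 4 * X c ^ 3) + mo c (-6) 0 (-4) (-2)
    (-1) * (11 * Y c + 11 * X c ^ 2) - (mo c (-6) 3 (-6) (-2) (-2) * mo c 1 0 0 0 (-1)) * (12 - 12
    * Y c - 16 * X c + 14 * X c * Y c + 13 * X c ^ 2 - 10 * X c ^ 3) - (mo c (-6) 3 (-5) (-3) (-2)
    * mo c 0 0 (-1) 0 1) * (13 - 13 * Y c - 10 * X c - 5 * X c * Y c + 15 * X c ^ 2 - 9 * X c ^ 3)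
    - (mo c (-7) 3 (-6) 0 (-3) * mo c (-1) 1 0 0 0) * (11 + 5 * Y c - 55 * X c + 5 * X c * Y c +
    52 * X c ^ 2 - 5 * X c ^ 2 * Y c - 13 * X c ^ 3) + mo c (-12) 8 (-8) 0 (-1) * (-2 * Y c + 2 *
    Y c ^ 2 + 2 * X c + 8 * X c * Y c - 6 * X c * Y c ^ 2 - 4 * X c ^ 2 - 8 * X c ^ 2 * Y c + 4 *
    X c ^ 2 * Y c ^ 2 - 29 * X c ^ 3 + 39 * X c ^ 3 * Y c - 12 * X c ^ 3 * Y c ^ 2 + 29 * X c ^ 4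
    - 17 * X c ^ 4 * Y c - 4 * X c ^ 5 * Y c - 3 * X c ^ 6) = 0 := by
  rw [mo_mul_eq hc (-15) 13 (-8) 0 (-3) (-7) 3 (-5) (-2) (-2) 0 (-1) 0 1 0 2 1 0 1, mo_mul_eq
    hc (-15) 13 (-8) 0 (-3) (-6) 2 (-5) (-2) (-2) 0 0 1 (-1) 0 2 2 1 0, mo_eq hc (-15) 13 (-8) 0
    (-3) (-6) 0 (-4) (-2) (-1) 2 2 0 1, mo_mul_eq hc (-15) 13 (-8) 0 (-3) (-6) 3 (-6) (-2) (-2) 1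
    0 0 0 (-1) 2 0 2 0, mo_mul_eq hc (-15) 13 (-8) 0 (-3) (-6) 3 (-5) (-3) (-2) 0 0 (-1) 0 1 1 1
    2 0, mo_mul_eq hc (-15) 13 (-8) 0 (-3) (-7) 3 (-6) 0 (-3) (-1) 1 0 0 0 2 0 0 1, mo_eq hc
    (-15) 13 (-8) 0 (-3) (-12) 8 (-8) 0 (-1) 0 0 0 1]
  linear_combination mo c (-15) 13 (-8) 0 (-3) * (2 - 2 * Y c - 12 * X c + 19 * X c * Y c + 30 * X
    c ^ 2 - 46 * X c ^ 3 - 7 * X c ^ 3 * Y c + 32 * X c ^ 4 - 6 * X c ^ 5) * curve hc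

theorem rank_class_c : -(mo c (-7) 3 (-5) (-2) (-2) * mo c (-1) 1 0 0 0) * (3 - 3 * Y c + 7 * X c
    - 2 * X c * Y c - 27 * X c ^ 2 + 14 * X c ^ 3) + (mo c (-7) 3 (-5) (-1) (-3) * mo c 0 (-1) 0 1
    0) * (3 - 6 * Y c + 7 * X c + 17 * X c * Y c - 23 * X c ^ 2 - 8 * X c ^ 2 * Y c + 13 * X c ^
    3) + (mo c (-6) 2 (-5) (-1) (-3) * mo c 0 0 1 (-1) 0) * (10 - 21 * Y c - 6 * X c + 19 * X c *
    Y c - 2 * X c ^ 2 - X c ^ 3) + mo c (-6) 3 (-6) (-2) (-2) * (12 - 12 * Y c - 16 * X c + 14 * X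
    c * Y c + 13 * X c ^ 2 - 10 * X c ^ 3) - (mo c (-6) 3 (-6) (-1) (-3) * mo c 1 0 0 0 (-1)) *
    (11 - 15 * Y c + 7 * X c * Y c - 13 * X c ^ 2 + 4 * X c ^ 2 * Y c + 6 * X c ^ 3) - (mo c (-7)
    3 (-6) 0 (-3) * mo c 0 0 (-1) 0 1) * (11 + 5 * Y c - 55 * X c + 5 * X c * Y c + 52 * X c ^ 2 -
    5 * X c ^ 2 * Y c - 13 * X c ^ 3) + 11 * mo c (-7) 2 (-4) (-3) (-1) * (1 - Y c - 5 * X c + 3 *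
    X c * Y c + 2 * X c ^ 2 + X c ^ 3) = 0 := by
  rw [mo_mul_eq hc (-13) 11 (-7) 1 (-5) (-7) 3 (-5) (-2) (-2) (-1) 1 0 0 0 0 2 1 0, mo_mul_eq
    hc (-13) 11 (-7) 1 (-5) (-7) 3 (-5) (-1) (-3) 0 (-1) 0 1 0 1 1 0 1, mo_mul_eq hc (-13) 11
    (-7) 1 (-5) (-6) 2 (-5) (-1) (-3) 0 0 1 (-1) 0 1 2 1 0, mo_eq hc (-13) 11 (-7) 1 (-5) (-6) 3
    (-6) (-2) (-2) 0 1 2 0, mo_mul_eq hc (-13) 11 (-7) 1 (-5) (-6) 3 (-6) (-1) (-3) 1 0 0 0 (-1)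
    1 0 2 0, mo_mul_eq hc (-13) 11 (-7) 1 (-5) (-7) 3 (-6) 0 (-3) 0 0 (-1) 0 1 0 0 1 1, mo_eq
    hc (-13) 11 (-7) 1 (-5) (-7) 2 (-4) (-3) (-1) 0 3 1 0]
  linear_combination mo c (-13) 11 (-7) 1 (-5) * (3 - 7 * Y c + 4 * X c + 46 * X c * Y c - 30 * X
    c ^ 2 - 26 * X c ^ 2 * Y c + 36 * X c ^ 3 - 4 * X c ^ 3 * Y c - 13 * X c ^ 4) * curve hc

theorem rank_class_d : -(mo c (-7) 3 (-5) (-2) (-2) * mo c 0 0 (-1) 0 1) * (3 - 3 * Y c + 7 * X c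
    - 2 * X c * Y c - 27 * X c ^ 2 + 14 * X c ^ 3) - (mo c (-7) 3 (-5) (-1) (-3) * mo c (-1) 1 0 0
    0) * (3 - 6 * Y c + 7 * X c + 17 * X c * Y c - 23 * X c ^ 2 - 8 * X c ^ 2 * Y c + 13 * X c ^
    3) + (mo c (-8) 3 (-5) (-1) (-2) * mo c 0 (-1) 0 1 0) * (6 * Y c - 16 * X c * Y c + 14 * X c ^
    2 - 6 * X c ^ 2 * Y c - 9 * X c ^ 3) + (mo c (-6) 0 (-4) (-2) (-1) * mo c 0 0 1 (-1) 0) * (11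
    * Y c + 11 * X c ^ 2) + mo c (-6) 3 (-6) (-1) (-3) * (11 - 15 * Y c + 7 * X c * Y c - 13 * X c
    ^ 2 + 4 * X c ^ 2 * Y c + 6 * X c ^ 3) - (mo c (-6) 3 (-5) (-3) (-2) * mo c 1 0 0 0 (-1)) *
    (13 - 13 * Y c - 10 * X c - 5 * X c * Y c + 15 * X c ^ 2 - 9 * X c ^ 3) = 0 := by
  rw [mo_mul_eq hc (-17) 16 (-7) 1 (-6) (-7) 3 (-5) (-2) (-2) 0 0 (-1) 0 1 0 1 2 1, mo_mul_eq
    hc (-17) 16 (-7) 1 (-6) (-7) 3 (-5) (-1) (-3) (-1) 1 0 0 0 1 1 1 1, mo_mul_eq hc (-17) 16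
    (-7) 1 (-6) (-8) 3 (-5) (-1) (-2) 0 (-1) 0 1 0 1 1 0 2, mo_mul_eq hc (-17) 16 (-7) 1 (-6)
    (-6) 0 (-4) (-2) (-1) 0 0 1 (-1) 0 1 3 1 1, mo_eq hc (-17) 16 (-7) 1 (-6) (-6) 3 (-6) (-1)
    (-3) 1 0 2 1, mo_mul_eq hc (-17) 16 (-7) 1 (-6) (-6) 3 (-5) (-3) (-2) 1 0 0 0 (-1) 1 1 3 0]
  linear_combination mo c (-17) 16 (-7) 1 (-6) * (3 * Y c - 3 * Y c ^ 2 - 24 * X c * Y c + 29 * X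
    c * Y c ^ 2 + 14 * X c ^ 2 + 50 * X c ^ 2 * Y c - 13 * X c ^ 2 * Y c ^ 2 - 51 * X c ^ 3 - 50 *
    X c ^ 3 * Y c - 9 * X c ^ 3 * Y c ^ 2 + 69 * X c ^ 4 + 26 * X c ^ 4 * Y c - 41 * X c ^ 5 - 5 *
    X c ^ 5 * Y c + 9 * X c ^ 6) * curve hc

theorem rank_class_e : -(mo c (-7) 3 (-5) (-1) (-3) * mo c 0 0 (-1) 0 1) * (3 - 6 * Y c + 7 * X c
    + 17 * X c * Y c - 23 * X c ^ 2 - 8 * X c ^ 2 * Y c + 13 * X c ^ 3) - (mo c (-8) 3 (-5) (-1)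
    (-2) * mo c (-1) 1 0 0 0) * (6 * Y c - 16 * X c * Y c + 14 * X c ^ 2 - 6 * X c ^ 2 * Y c - 9 *
    X c ^ 3) + (mo c (-7) 4 (-6) (-2) (-2) * mo c 0 (-1) 0 1 0) * (9 - 9 * Y c - 23 * X c + 16 * X
    c * Y c + 18 * X c ^ 2 - 11 * X c ^ 2 * Y c - 2 * X c ^ 3) + (mo c (-6) 3 (-6) (-2) (-2) * mo
    c 0 0 1 (-1) 0) * (12 - 12 * Y c - 16 * X c + 14 * X c * Y c + 13 * X c ^ 2 - 10 * X c ^ 3) +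
    mo c (-6) 3 (-5) (-3) (-2) * (13 - 13 * Y c - 10 * X c - 5 * X c * Y c + 15 * X c ^ 2 - 9 * X
    c ^ 3) - (mo c (-7) 3 (-6) 0 (-3) * mo c 1 0 0 0 (-1)) * (11 + 5 * Y c - 55 * X c + 5 * X c *
    Y c + 52 * X c ^ 2 - 5 * X c ^ 2 * Y c - 13 * X c ^ 3) + 11 * mo c (-6) 3 (-5) (-3) (-2) * (1
    - Y c - 5 * X c + 3 * X c * Y c + 2 * X c ^ 2 + X c ^ 3) = 0 := by
  rw [mo_mul_eq hc (-14) 13 (-7) 1 (-6) (-7) 3 (-5) (-1) (-3) 0 0 (-1) 0 1 0 1 1 1, mo_mul_eq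
    hc (-14) 13 (-7) 1 (-6) (-8) 3 (-5) (-1) (-2) (-1) 1 0 0 0 0 2 0 1, mo_mul_eq hc (-14) 13
    (-7) 1 (-6) (-7) 4 (-6) (-2) (-2) 0 (-1) 0 1 0 0 1 1 1, mo_mul_eq hc (-14) 13 (-7) 1 (-6)
    (-6) 3 (-6) (-2) (-2) 0 0 1 (-1) 0 0 2 2 0, mo_eq hc (-14) 13 (-7) 1 (-6) (-6) 3 (-5) (-3)
    (-2) 0 2 2 0, mo_mul_eq hc (-14) 13 (-7) 1 (-6) (-7) 3 (-6) 0 (-3) 1 0 0 0 (-1) 1 0 1 1]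
  linear_combination mo c (-14) 13 (-7) 1 (-6) * (-33 * Y c - 14 * X c + 117 * X c * Y c + 37 * X
    c ^ 2 - 113 * X c ^ 2 * Y c - 32 * X c ^ 3 + 34 * X c ^ 3 * Y c + 9 * X c ^ 4) * curve hc

theorem rank_class_f : -(mo c (-7) 3 (-5) (-2) (-2) * mo c 1 0 0 0 (-1)) * (3 - 3 * Y c + 7 * X c
    - 2 * X c * Y c - 27 * X c ^ 2 + 14 * X c ^ 3) - (mo c (-8) 3 (-5) (-1) (-2) * mo c 0 0 (-1) 0
    1) * (6 * Y c - 16 * X c * Y c + 14 * X c ^ 2 - 6 * X c ^ 2 * Y c - 9 * X c ^ 3) - (mo c (-7)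
    4 (-6) (-2) (-2) * mo c (-1) 1 0 0 0) * (9 - 9 * Y c - 23 * X c + 16 * X c * Y c + 18 * X c ^
    2 - 11 * X c ^ 2 * Y c - 2 * X c ^ 3) + (mo c (-6) 2 (-5) (-2) (-2) * mo c 0 (-1) 0 1 0) * (4
    - 4 * Y c + 13 * X c + X c * Y c - 14 * X c ^ 2 + 4 * X c ^ 3) + (mo c (-6) 3 (-6) (-1) (-3) *
    mo c 0 0 1 (-1) 0) * (11 - 15 * Y c + 7 * X c * Y c - 13 * X c ^ 2 + 4 * X c ^ 2 * Y c + 6 * X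
    c ^ 3) + mo c (-7) 3 (-6) 0 (-3) * (11 + 5 * Y c - 55 * X c + 5 * X c * Y c + 52 * X c ^ 2 - 5
    * X c ^ 2 * Y c - 13 * X c ^ 3) = 0 := by
  rw [mo_mul_eq hc (-12) 10 (-7) 0 (-4) (-7) 3 (-5) (-2) (-2) 1 0 0 0 (-1) 1 1 1 0, mo_mul_eq
    hc (-12) 10 (-7) 0 (-4) (-8) 3 (-5) (-1) (-2) 0 0 (-1) 0 1 0 1 0 1, mo_mul_eq hc (-12) 10
    (-7) 0 (-4) (-7) 4 (-6) (-2) (-2) (-1) 1 0 0 0 0 1 1 0, mo_mul_eq hc (-12) 10 (-7) 0 (-4)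
    (-6) 2 (-5) (-2) (-2) 0 (-1) 0 1 0 1 1 0 1, mo_mul_eq hc (-12) 10 (-7) 0 (-4) (-6) 3 (-6)
    (-1) (-3) 0 0 1 (-1) 0 1 1 1 0, mo_eq hc (-12) 10 (-7) 0 (-4) (-7) 3 (-6) 0 (-3) 1 0 0 1]
  linear_combination mo c (-12) 10 (-7) 0 (-4) * (15 - 60 * X c + 48 * X c ^ 2 - 4 * X c ^ 3 - 4 *
    X c ^ 4) * curve hc

theorem rank_class_g : mo c (-7) 3 (-5) (-2) (-2) * (3 - 3 * Y c + 7 * X c - 2 * X c * Y c - 27 *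
    X c ^ 2 + 14 * X c ^ 3) - (mo c (-7) 3 (-5) (-1) (-3) * mo c 1 0 0 0 (-1)) * (3 - 6 * Y c + 7
    * X c + 17 * X c * Y c - 23 * X c ^ 2 - 8 * X c ^ 2 * Y c + 13 * X c ^ 3) - (mo c (-7) 4 (-6)
    (-2) (-2) * mo c 0 0 (-1) 0 1) * (9 - 9 * Y c - 23 * X c + 16 * X c * Y c + 18 * X c ^ 2 - 11
    * X c ^ 2 * Y c - 2 * X c ^ 3) - (mo c (-6) 2 (-5) (-2) (-2) * mo c (-1) 1 0 0 0) * (4 - 4 * Y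
    c + 13 * X c + X c * Y c - 14 * X c ^ 2 + 4 * X c ^ 3) + (mo c (-6) 2 (-5) (-1) (-3) * mo c 0
    (-1) 0 1 0) * (10 - 21 * Y c - 6 * X c + 19 * X c * Y c - 2 * X c ^ 2 - X c ^ 3) + (mo c (-6)
    3 (-5) (-3) (-2) * mo c 0 0 1 (-1) 0) * (13 - 13 * Y c - 10 * X c - 5 * X c * Y c + 15 * X c ^
    2 - 9 * X c ^ 3) = 0 := by
  rw [mo_eq hc (-16) 15 (-7) 0 (-5) (-7) 3 (-5) (-2) (-2) 1 1 1 1, mo_mul_eq hc (-16) 15 (-7)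
    0 (-5) (-7) 3 (-5) (-1) (-3) 1 0 0 0 (-1) 2 0 1 1, mo_mul_eq hc (-16) 15 (-7) 0 (-5) (-7) 4
    (-6) (-2) (-2) 0 0 (-1) 0 1 0 0 2 1, mo_mul_eq hc (-16) 15 (-7) 0 (-5) (-6) 2 (-5) (-2) (-2)
    (-1) 1 0 0 0 1 1 1 1, mo_mul_eq hc (-16) 15 (-7) 0 (-5) (-6) 2 (-5) (-1) (-3) 0 (-1) 0 1 0 2
    0 0 2, mo_mul_eq hc (-16) 15 (-7) 0 (-5) (-6) 3 (-5) (-3) (-2) 0 0 1 (-1) 0 1 2 2 0]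
  linear_combination mo c (-16) 15 (-7) 0 (-5) * (9 * Y c - 9 * Y c ^ 2 + 10 * X c - 55 * X c * Y
    c + 16 * X c * Y c ^ 2 - 26 * X c ^ 2 + 57 * X c ^ 2 * Y c - 11 * X c ^ 2 * Y c ^ 2 + 20 * X c
    ^ 3 - 10 * X c ^ 3 * Y c - 3 * X c ^ 4 - 2 * X c ^ 4 * Y c - X c ^ 6) * curve hc

theorem rank_class_h : mo c (-7) 3 (-5) (-1) (-3) * (3 - 6 * Y c + 7 * X c + 17 * X c * Y c - 23 *
    X c ^ 2 - 8 * X c ^ 2 * Y c + 13 * X c ^ 3) - (mo c (-8) 3 (-5) (-1) (-2) * mo c 1 0 0 0 (-1))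
    * (6 * Y c - 16 * X c * Y c + 14 * X c ^ 2 - 6 * X c ^ 2 * Y c - 9 * X c ^ 3) - (mo c (-6) 2
    (-5) (-2) (-2) * mo c 0 0 (-1) 0 1) * (4 - 4 * Y c + 13 * X c + X c * Y c - 14 * X c ^ 2 + 4 *
    X c ^ 3) - (mo c (-6) 2 (-5) (-1) (-3) * mo c (-1) 1 0 0 0) * (10 - 21 * Y c - 6 * X c + 19 *
    X c * Y c - 2 * X c ^ 2 - X c ^ 3) + (mo c (-6) 0 (-4) (-2) (-1) * mo c 0 (-1) 0 1 0) * (11 *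
    Y c + 11 * X c ^ 2) + (mo c (-7) 3 (-6) 0 (-3) * mo c 0 0 1 (-1) 0) * (11 + 5 * Y c - 55 * X c
    + 5 * X c * Y c + 52 * X c ^ 2 - 5 * X c ^ 2 * Y c - 13 * X c ^ 3) - 11 * mo c (-7) 3 (-5)
    (-1) (-3) * (1 - Y c - 5 * X c + 3 * X c * Y c + 2 * X c ^ 2 + X c ^ 3) = 0 := by
  rw [mo_eq hc (-12) 8 (-6) 0 (-3) (-7) 3 (-5) (-1) (-3) 1 0 1 0, mo_mul_eq hc (-12) 8 (-6) 0
    (-3) (-8) 3 (-5) (-1) (-2) 1 0 0 0 (-1) 1 0 1 0, mo_mul_eq hc (-12) 8 (-6) 0 (-3) (-6) 2 (-5)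
    (-2) (-2) 0 0 (-1) 0 1 0 0 2 0, mo_mul_eq hc (-12) 8 (-6) 0 (-3) (-6) 2 (-5) (-1) (-3) (-1) 1
    0 0 0 1 0 1 0, mo_mul_eq hc (-12) 8 (-6) 0 (-3) (-6) 0 (-4) (-2) (-1) 0 (-1) 0 1 0 1 1 0 1,
    mo_mul_eq hc (-12) 8 (-6) 0 (-3) (-7) 3 (-6) 0 (-3) 0 0 1 (-1) 0 1 0 1 0]
  linear_combination mo c (-12) 8 (-6) 0 (-3) * (4 * Y c - X c * Y c + 11 * X c ^ 2 - 11 * X c ^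
    3) * curve hc

theorem rank_class_i : (mo c (-7) 3 (-5) (-2) (-2) * mo c 0 0 1 (-1) 0) * (3 - 3 * Y c + 7 * X c -
    2 * X c * Y c - 27 * X c ^ 2 + 14 * X c ^ 3) + mo c (-8) 3 (-5) (-1) (-2) * (6 * Y c - 16 * X
    c * Y c + 14 * X c ^ 2 - 6 * X c ^ 2 * Y c - 9 * X c ^ 3) - (mo c (-7) 4 (-6) (-2) (-2) * mo c
    1 0 0 0 (-1)) * (9 - 9 * Y c - 23 * X c + 16 * X c * Y c + 18 * X c ^ 2 - 11 * X c ^ 2 * Y c -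
    2 * X c ^ 3) - (mo c (-6) 2 (-5) (-1) (-3) * mo c 0 0 (-1) 0 1) * (10 - 21 * Y c - 6 * X c +
    19 * X c * Y c - 2 * X c ^ 2 - X c ^ 3) - (mo c (-6) 0 (-4) (-2) (-1) * mo c (-1) 1 0 0 0) *
    (11 * Y c + 11 * X c ^ 2) + (mo c (-6) 3 (-6) (-2) (-2) * mo c 0 (-1) 0 1 0) * (12 - 12 * Y c
    - 16 * X c + 14 * X c * Y c + 13 * X c ^ 2 - 10 * X c ^ 3) = 0 := by
  rw [mo_mul_eq hc (-12) 10 (-6) 0 (-5) (-7) 3 (-5) (-2) (-2) 0 0 1 (-1) 0 0 2 1 0, mo_eq hc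
    (-12) 10 (-6) 0 (-5) (-8) 3 (-5) (-1) (-2) 0 1 0 1, mo_mul_eq hc (-12) 10 (-6) 0 (-5) (-7) 4
    (-6) (-2) (-2) 1 0 0 0 (-1) 0 0 2 0, mo_mul_eq hc (-12) 10 (-6) 0 (-5) (-6) 2 (-5) (-1) (-3)
    0 0 (-1) 0 1 0 0 1 1, mo_mul_eq hc (-12) 10 (-6) 0 (-5) (-6) 0 (-4) (-2) (-1) (-1) 1 0 0 0 0
    2 0 1, mo_mul_eq hc (-12) 10 (-6) 0 (-5) (-6) 3 (-6) (-2) (-2) 0 (-1) 0 1 0 0 0 1 1]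
  linear_combination mo c (-12) 10 (-6) 0 (-5) * (3 * X c - 11 * X c * Y c - X c ^ 2 + 11 * X c ^
    2 * Y c - 2 * X c ^ 3) * curve hc

theorem rank_class_j : (mo c (-7) 3 (-5) (-1) (-3) * mo c 0 0 1 (-1) 0) * (3 - 6 * Y c + 7 * X c +
    17 * X c * Y c - 23 * X c ^ 2 - 8 * X c ^ 2 * Y c + 13 * X c ^ 3) + mo c (-7) 4 (-6) (-2) (-2)
    * (9 - 9 * Y c - 23 * X c + 16 * X c * Y c + 18 * X c ^ 2 - 11 * X c ^ 2 * Y c - 2 * X c ^ 3)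
    - (mo c (-6) 2 (-5) (-2) (-2) * mo c 1 0 0 0 (-1)) * (4 - 4 * Y c + 13 * X c + X c * Y c - 14
    * X c ^ 2 + 4 * X c ^ 3) - (mo c (-6) 0 (-4) (-2) (-1) * mo c 0 0 (-1) 0 1) * (11 * Y c + 11 *
    X c ^ 2) - (mo c (-6) 3 (-6) (-2) (-2) * mo c (-1) 1 0 0 0) * (12 - 12 * Y c - 16 * X c + 14 *
    X c * Y c + 13 * X c ^ 2 - 10 * X c ^ 3) + (mo c (-6) 3 (-6) (-1) (-3) * mo c 0 (-1) 0 1 0) *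
    (11 - 15 * Y c + 7 * X c * Y c - 13 * X c ^ 2 + 4 * X c ^ 2 * Y c + 6 * X c ^ 3) = 0 := by
  rw [mo_mul_eq hc (-11) 9 (-7) 0 (-4) (-7) 3 (-5) (-1) (-3) 0 0 1 (-1) 0 1 2 0 0, mo_eq hc
    (-11) 9 (-7) 0 (-4) (-7) 4 (-6) (-2) (-2) 0 1 1 0, mo_mul_eq hc (-11) 9 (-7) 0 (-4) (-6) 2
    (-5) (-2) (-2) 1 0 0 0 (-1) 1 1 1 0, mo_mul_eq hc (-11) 9 (-7) 0 (-4) (-6) 0 (-4) (-2) (-1) 0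
    0 (-1) 0 1 0 2 0 1, mo_mul_eq hc (-11) 9 (-7) 0 (-4) (-6) 3 (-6) (-2) (-2) (-1) 1 0 0 0 0 1 1
    0, mo_mul_eq hc (-11) 9 (-7) 0 (-4) (-6) 3 (-6) (-1) (-3) 0 (-1) 0 1 0 1 0 0 1]
  linear_combination mo c (-11) 9 (-7) 0 (-4) * (14 - 4 * X c - 14 * X c ^ 2 + 8 * X c ^ 3) *
    curve hc

theorem rank_class_k : (mo c (-8) 3 (-5) (-1) (-2) * mo c 0 0 1 (-1) 0) * (6 * Y c - 16 * X c * Y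
    c + 14 * X c ^ 2 - 6 * X c ^ 2 * Y c - 9 * X c ^ 3) + mo c (-6) 2 (-5) (-2) (-2) * (4 - 4 * Y
    c + 13 * X c + X c * Y c - 14 * X c ^ 2 + 4 * X c ^ 3) - (mo c (-6) 2 (-5) (-1) (-3) * mo c 1
    0 0 0 (-1)) * (10 - 21 * Y c - 6 * X c + 19 * X c * Y c - 2 * X c ^ 2 - X c ^ 3) - (mo c (-6)
    3 (-6) (-2) (-2) * mo c 0 0 (-1) 0 1) * (12 - 12 * Y c - 16 * X c + 14 * X c * Y c + 13 * X c
    ^ 2 - 10 * X c ^ 3) - (mo c (-6) 3 (-6) (-1) (-3) * mo c (-1) 1 0 0 0) * (11 - 15 * Y c + 7 *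
    X c * Y c - 13 * X c ^ 2 + 4 * X c ^ 2 * Y c + 6 * X c ^ 3) + (mo c (-6) 3 (-5) (-3) (-2) * mo
    c 0 (-1) 0 1 0) * (13 - 13 * Y c - 10 * X c - 5 * X c * Y c + 15 * X c ^ 2 - 9 * X c ^ 3) = 0
    := by
  rw [mo_mul_eq hc (-12) 9 (-7) 0 (-3) (-8) 3 (-5) (-1) (-2) 0 0 1 (-1) 0 1 2 0 0, mo_eq hc
    (-12) 9 (-7) 0 (-3) (-6) 2 (-5) (-2) (-2) 1 1 1 0, mo_mul_eq hc (-12) 9 (-7) 0 (-3) (-6) 2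
    (-5) (-1) (-3) 1 0 0 0 (-1) 2 0 1 0, mo_mul_eq hc (-12) 9 (-7) 0 (-3) (-6) 3 (-6) (-2) (-2) 0
    0 (-1) 0 1 0 0 2 0, mo_mul_eq hc (-12) 9 (-7) 0 (-3) (-6) 3 (-6) (-1) (-3) (-1) 1 0 0 0 1 0 1
    0, mo_mul_eq hc (-12) 9 (-7) 0 (-3) (-6) 3 (-5) (-3) (-2) 0 (-1) 0 1 0 1 1 1 0]
  linear_combination mo c (-12) 9 (-7) 0 (-3) * (12 * Y c - 14 * X c * Y c + 14 * X c ^ 2 - 9 * X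
    c ^ 3) * curve hc

theorem rank_theta_terms : h ^ 3 * (T (2 * c) * T (4 * c) / (T c * T (3 * c) * T (-c))
        + T (3 * c) * T (6 * c) / (T c * T (4 * c) * T (-(2 * c)))
        + T (4 * c) * T (8 * c) / (T c * T (5 * c) * T (-(3 * c)))
        + T (5 * c) * T (10 * c) / (T c * T (6 * c) * T (-(4 * c)))) =
    h ^ 3 * (mo c (-2) 1 (-1) 1 0 - mo c (-1) (-1) 1 (-1) 1 + mo c (-1) 0 0 1 (-1) - mo c 0 0 0
      (-1) 0) := by
  have n1 := T_ne_zero hc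
  have n2 := T_ne_zero (a := 2 * c) (by omega)
  have n3 := T_ne_zero (a := 3 * c) (by omega)
  have n4 := T_ne_zero (a := 4 * c) (by omega)
  have n5 := T_ne_zero (a := 5 * c) (by omega)
  rw [T_congr (a := 6 * c) (b := -(5 * c)) (by omega),
    T_congr (a := 8 * c) (b := -(3 * c)) (by omega), T_congr (a := 10 * c) (b := -c) (by omega)]
  simp only [T_neg, mo]
  field_simp
  ring

theorem mo_shift (h12 : h ^ 12 * fcub c = mo c 6 (-3) 5 2 2) (e₁ e₂ e₃ e₄ e₅ : ℤ) :
    mo c e₁ e₂ e₃ e₄ e₅ =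
      h ^ 12 * (mo c (e₁ - 6) (e₂ + 3) (e₃ - 5) (e₄ - 2) (e₅ - 2) * fcub c) := by
  have := mo_mul hc (e₁ - 6) (e₂ + 3) (e₃ - 5) (e₄ - 2) (e₅ - 2) 6 (-3) 5 2 2
  rw [← h12, show e₁ - 6 + 6 = e₁ by ring, show e₂ + 3 + -3 = e₂ by ring,
    show e₃ - 5 + 5 = e₃ by ring, show e₄ - 2 + 2 = e₄ by ring,
    show e₅ - 2 + 2 = e₅ by ring] at this
  linear_combination -this

theorem frank_eq (h12 : h ^ 12 * fcub c = mo c 6 (-3) 5 2 2) : frank c * h * tq c =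
    h ^ 3 * (T (2 * c) * T (4 * c) / (T c * T (3 * c) * T (-c))
        + T (3 * c) * T (6 * c) / (T c * T (4 * c) * T (-(2 * c)))
        + T (4 * c) * T (8 * c) / (T c * T (5 * c) * T (-(3 * c)))
        + T (5 * c) * T (10 * c) / (T c * T (6 * c) * T (-(4 * c))))
      - (rho c + rho (2 * c)) := by
  rw [rank_theta_terms hc, tq_mo hc, frank]
  have s0 := mo_shift hc h12 (-2) 1 (-1) 1 0
  have s1 := mo_shift hc h12 (-1) (-1) 1 (-1) 1
  have s2 := mo_shift hc h12 (-1) 0 0 1 (-1)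
  have s3 := mo_shift hc h12 0 0 0 (-1) 0
  have s4 := mo_shift hc h12 (-6) 5 (-3) 2 1
  have r1 := rho_formula_one hc
  have r2 := rho_formula_two hc
  norm_num at s0 s1 s2 s3 s4
  rw [s4] at r1 r2
  rw [s0, s1, s2, s3]
  simp only [fcub] at r1 r2 ⊢
  push_cast at r1 r2 ⊢
  linear_combination h ^ 15 / 11 * (rank_class_a hc + rank_class_b hc + rank_class_c hc +
    rank_class_d hc + rank_class_e hc + rank_class_f hc + rank_class_g hc + rank_class_h hc +
    rank_class_i hc + rank_class_j hc + rank_class_k hc) + (r1 + r2) / 11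

end

/-- The crank analogue of `frank`. -/
noncomputable def fcrank (c : ℤ) : K := h ^ 2 / 11 *
    (mo c (-1) 0 0 0 0 + mo c 0 (-1) (-1) 0 1 + 2 * mo c (-1) 0 1 (-1) 0 + 3 * mo c (-1) 1 (-1) 0
      0 + 5 * mo c 0 (-1) 0 0 0 - 4 * mo c 0 (-1) 0 1 (-1) + 4 * mo c 0 0 (-1) 0 0 + 6 * mo c 1 0
      0 (-1) (-1) - 3 * mo c 0 0 0 (-1) 0 - 2 * mo c 0 0 0 0 (-1))

section
variable {c : ℤ} (hc : ¬ 11 ∣ c)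
include hc

theorem crank_class_a : mo c (-1) 0 0 0 0 - (mo c 0 (-1) (-1) 0 1 * mo c 1 0 0 0 (-1)) - 3 * (mo c
    (-1) 1 (-1) 0 0 * mo c 0 0 (-1) 0 1) - 5 * (mo c 0 (-1) 0 0 0 * mo c (-1) 1 0 0 0) - 4 * (mo c
    0 (-1) 0 1 (-1) * mo c 0 (-1) 0 1 0) - 3 * (mo c 0 0 0 (-1) 0 * mo c 0 0 1 (-1) 0) + 11 * mo c
    (-1) 0 0 0 0 = 0 := by
  rw [mo_eq hc (-10) 12 (-2) 2 (-3) (-1) 0 0 0 0 1 1 1 1, mo_mul_eq hc (-10) 12 (-2) 2 (-3) 0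
    (-1) (-1) 0 1 1 0 0 0 (-1) 1 0 2 1, mo_mul_eq hc (-10) 12 (-2) 2 (-3) (-1) 1 (-1) 0 0 0 0
    (-1) 0 1 0 0 2 1, mo_mul_eq hc (-10) 12 (-2) 2 (-3) 0 (-1) 0 0 0 (-1) 1 0 0 0 1 1 1 1,
    mo_mul_eq hc (-10) 12 (-2) 2 (-3) 0 (-1) 0 1 (-1) 0 (-1) 0 1 0 2 0 0 2, mo_mul_eq hc (-10)
    12 (-2) 2 (-3) 0 0 0 (-1) 0 0 0 1 (-1) 0 1 2 2 0]
  linear_combination mo c (-10) 12 (-2) 2 (-3) * (3 * Y c - 4 * X c + X c * Y c + 8 * X c ^ 2 - 4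
    * X c ^ 3) * curve hc

theorem crank_class_b : mo c 0 (-1) (-1) 0 1 - 2 * (mo c (-1) 0 1 (-1) 0 * mo c 1 0 0 0 (-1)) - 5
    * (mo c 0 (-1) 0 0 0 * mo c 0 0 (-1) 0 1) + 4 * (mo c 0 (-1) 0 1 (-1) * mo c (-1) 1 0 0 0) - 2
    * (mo c 0 0 0 0 (-1) * mo c 0 0 1 (-1) 0) = 0 := by
  rw [mo_eq hc (-6) 7 (-1) 1 (-2) 0 (-1) (-1) 0 1 0 0 1 1, mo_mul_eq hc (-6) 7 (-1) 1 (-2)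
    (-1) 0 1 (-1) 0 1 0 0 0 (-1) 1 1 1 0, mo_mul_eq hc (-6) 7 (-1) 1 (-2) 0 (-1) 0 0 0 0 0 (-1) 0
    1 0 0 1 1, mo_mul_eq hc (-6) 7 (-1) 1 (-2) 0 (-1) 0 1 (-1) (-1) 1 0 0 0 1 0 0 1, mo_mul_eq
    hc (-6) 7 (-1) 1 (-2) 0 0 0 0 (-1) 0 0 1 (-1) 0 1 1 1 0]
  linear_combination mo c (-6) 7 (-1) 1 (-2) * (4) * curve hc

theorem crank_class_c : (mo c (-1) 0 0 0 0 * mo c 0 0 1 (-1) 0) + 2 * mo c (-1) 0 1 (-1) 0 - 3 *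
    (mo c (-1) 1 (-1) 0 0 * mo c 1 0 0 0 (-1)) + 4 * (mo c 0 (-1) 0 1 (-1) * mo c 0 0 (-1) 0 1) +
    4 * (mo c 0 0 (-1) 0 0 * mo c 0 (-1) 0 1 0) - 11 * mo c 0 (-1) (-1) 1 0 = 0 := by
  rw [mo_mul_eq hc (-3) 4 (-1) 1 (-2) (-1) 0 0 0 0 0 0 1 (-1) 0 0 2 0 0, mo_eq hc (-3) 4 (-1)
    1 (-2) (-1) 0 1 (-1) 0 0 2 0 0, mo_mul_eq hc (-3) 4 (-1) 1 (-2) (-1) 1 (-1) 0 0 1 0 0 0 (-1)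
    0 0 1 0, mo_mul_eq hc (-3) 4 (-1) 1 (-2) 0 (-1) 0 1 (-1) 0 0 (-1) 0 1 0 0 0 1, mo_mul_eq
    hc (-3) 4 (-1) 1 (-2) 0 0 (-1) 0 0 0 (-1) 0 1 0 0 0 0 1, mo_eq hc (-3) 4 (-1) 1 (-2) 0 (-1)
    (-1) 1 0 0 0 0 1]
  ring

theorem crank_class_d : (mo c 0 (-1) (-1) 0 1 * mo c 0 0 1 (-1) 0) + 3 * mo c (-1) 1 (-1) 0 0 - 5
    * (mo c 0 (-1) 0 0 0 * mo c 1 0 0 0 (-1)) - 4 * (mo c 0 0 (-1) 0 0 * mo c (-1) 1 0 0 0) + 6 *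
    (mo c 1 0 0 (-1) (-1) * mo c 0 (-1) 0 1 0) = 0 := by
  rw [mo_mul_eq hc (-1) 1 (-1) 0 0 0 (-1) (-1) 0 1 0 0 1 (-1) 0 0 1 0 0, mo_eq hc (-1) 1 (-1)
    0 0 (-1) 1 (-1) 0 0 0 0 0 0, mo_mul_eq hc (-1) 1 (-1) 0 0 0 (-1) 0 0 0 1 0 0 0 (-1) 1 0 0 0,
    mo_mul_eq hc (-1) 1 (-1) 0 0 0 0 (-1) 0 0 (-1) 1 0 0 0 0 0 0 0, mo_mul_eq hc (-1) 1 (-1) 0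
    0 1 0 0 (-1) (-1) 0 (-1) 0 1 0 1 0 0 0]
  ring

theorem crank_class_e : 2 * (mo c (-1) 0 1 (-1) 0 * mo c 0 0 1 (-1) 0) + 5 * mo c 0 (-1) 0 0 0 + 4
    * (mo c 0 (-1) 0 1 (-1) * mo c 1 0 0 0 (-1)) - 4 * (mo c 0 0 (-1) 0 0 * mo c 0 0 (-1) 0 1) - 6
    * (mo c 1 0 0 (-1) (-1) * mo c (-1) 1 0 0 0) - 3 * (mo c 0 0 0 (-1) 0 * mo c 0 (-1) 0 1 0) = 0
    := by
  rw [mo_mul_eq hc (-6) 8 (-2) 1 (-2) (-1) 0 1 (-1) 0 0 0 1 (-1) 0 1 3 0 0, mo_eq hc (-6) 8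
    (-2) 1 (-2) 0 (-1) 0 0 0 1 1 0 1, mo_mul_eq hc (-6) 8 (-2) 1 (-2) 0 (-1) 0 1 (-1) 1 0 0 0
    (-1) 2 0 0 1, mo_mul_eq hc (-6) 8 (-2) 1 (-2) 0 0 (-1) 0 0 0 0 (-1) 0 1 0 0 1 1, mo_mul_eq
    hc (-6) 8 (-2) 1 (-2) 1 0 0 (-1) (-1) (-1) 1 0 0 0 1 1 1 0, mo_mul_eq hc (-6) 8 (-2) 1 (-2) 0
    0 0 (-1) 0 0 (-1) 0 1 0 1 1 0 1]
  linear_combination mo c (-6) 8 (-2) 1 (-2) * (4) * curve hc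

theorem crank_class_f : 3 * (mo c (-1) 1 (-1) 0 0 * mo c 0 0 1 (-1) 0) - 4 * mo c 0 (-1) 0 1 (-1)
    - 6 * (mo c 1 0 0 (-1) (-1) * mo c 0 0 (-1) 0 1) + 3 * (mo c 0 0 0 (-1) 0 * mo c (-1) 1 0 0 0)
    - 2 * (mo c 0 0 0 0 (-1) * mo c 0 (-1) 0 1 0) = 0 := by
  rw [mo_mul_eq hc (-5) 6 (-1) 1 (-2) (-1) 1 (-1) 0 0 0 0 1 (-1) 0 0 1 1 0, mo_eq hc (-5) 6
    (-1) 1 (-2) 0 (-1) 0 1 (-1) 1 0 0 1, mo_mul_eq hc (-5) 6 (-1) 1 (-2) 1 0 0 (-1) (-1) 0 0 (-1)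
    0 1 0 0 2 0, mo_mul_eq hc (-5) 6 (-1) 1 (-2) 0 0 0 (-1) 0 (-1) 1 0 0 0 0 1 1 0, mo_mul_eq
    hc (-5) 6 (-1) 1 (-2) 0 0 0 0 (-1) 0 (-1) 0 1 0 1 0 0 1]
  linear_combination mo c (-5) 6 (-1) 1 (-2) * (-6) * curve hc

theorem crank_class_g : (mo c (-1) 0 0 0 0 * mo c 0 (-1) 0 1 0) + 5 * (mo c 0 (-1) 0 0 0 * mo c 0
    0 1 (-1) 0) - 4 * (mo c 0 0 (-1) 0 0 * mo c 1 0 0 0 (-1)) + 3 * (mo c 0 0 0 (-1) 0 * mo c 0 0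
    (-1) 0 1) + 2 * (mo c 0 0 0 0 (-1) * mo c (-1) 1 0 0 0) - mo c (-6) 5 (-3) 2 1 * (-3 * Y c + 3
    * X c - 2 * X c ^ 2 + 5 * X c ^ 2 * Y c + X c ^ 3) = 0 := by
  rw [mo_mul_eq hc (-9) 10 (-3) 2 (-1) (-1) 0 0 0 0 0 (-1) 0 1 0 2 1 0 1, mo_mul_eq hc (-9) 10
    (-3) 2 (-1) 0 (-1) 0 0 0 0 0 1 (-1) 0 2 2 1 0, mo_mul_eq hc (-9) 10 (-3) 2 (-1) 0 0 (-1) 0 0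
    1 0 0 0 (-1) 2 0 2 0, mo_mul_eq hc (-9) 10 (-3) 2 (-1) 0 0 0 (-1) 0 0 0 (-1) 0 1 1 1 2 0,
    mo_mul_eq hc (-9) 10 (-3) 2 (-1) 0 0 0 0 (-1) (-1) 1 0 0 0 2 1 1 0, mo_eq hc (-9) 10 (-3)
    2 (-1) (-6) 5 (-3) 2 1 0 0 0 1]
  linear_combination mo c (-9) 10 (-3) 2 (-1) * (-3 + 3 * X c - 2 * X c ^ 2) * curve hc

theorem crank_class_h : -(mo c (-1) 0 0 0 0 * mo c (-1) 1 0 0 0) + (mo c 0 (-1) (-1) 0 1 * mo c 0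
    (-1) 0 1 0) - 4 * (mo c 0 (-1) 0 1 (-1) * mo c 0 0 1 (-1) 0) + 4 * mo c 0 0 (-1) 0 0 - 6 * (mo
    c 1 0 0 (-1) (-1) * mo c 1 0 0 0 (-1)) + 2 * (mo c 0 0 0 0 (-1) * mo c 0 0 (-1) 0 1) + 11 * mo
    c 2 0 0 (-1) (-2) = 0 := by
  rw [mo_mul_eq hc (-6) 8 (-1) 1 (-3) (-1) 0 0 0 0 (-1) 1 0 0 0 0 1 0 1, mo_mul_eq hc (-6) 8
    (-1) 1 (-3) 0 (-1) (-1) 0 1 0 (-1) 0 1 0 0 0 0 2, mo_mul_eq hc (-6) 8 (-1) 1 (-3) 0 (-1) 0 1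
    (-1) 0 0 1 (-1) 0 1 1 0 1, mo_eq hc (-6) 8 (-1) 1 (-3) 0 0 (-1) 0 0 0 0 1 1, mo_mul_eq hc
    (-6) 8 (-1) 1 (-3) 1 0 0 (-1) (-1) 1 0 0 0 (-1) 1 0 2 0, mo_mul_eq hc (-6) 8 (-1) 1 (-3) 0 0
    0 0 (-1) 0 0 (-1) 0 1 0 0 1 1, mo_eq hc (-6) 8 (-1) 1 (-3) 2 0 0 (-1) (-2) 1 0 2 0]
  linear_combination mo c (-6) 8 (-1) 1 (-3) * (-5 + 5 * X c) * curve hc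

theorem crank_class_i : -(mo c (-1) 0 0 0 0 * mo c 0 0 (-1) 0 1) - (mo c 0 (-1) (-1) 0 1 * mo c
    (-1) 1 0 0 0) + 2 * (mo c (-1) 0 1 (-1) 0 * mo c 0 (-1) 0 1 0) + 6 * mo c 1 0 0 (-1) (-1) + 3
    * (mo c 0 0 0 (-1) 0 * mo c 1 0 0 0 (-1)) - 11 * mo c 1 0 0 (-1) (-1) = 0 := by
  rw [mo_mul_eq hc (-7) 8 (-1) 1 (-2) (-1) 0 0 0 0 0 0 (-1) 0 1 0 0 1 1, mo_mul_eq hc (-7) 8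
    (-1) 1 (-2) 0 (-1) (-1) 0 1 (-1) 1 0 0 0 0 0 1 1, mo_mul_eq hc (-7) 8 (-1) 1 (-2) (-1) 0 1
    (-1) 0 0 (-1) 0 1 0 1 1 0 1, mo_eq hc (-7) 8 (-1) 1 (-2) 1 0 0 (-1) (-1) 1 0 2 0,
    mo_mul_eq hc (-7) 8 (-1) 1 (-2) 0 0 0 (-1) 0 1 0 0 0 (-1) 1 0 2 0]
  linear_combination mo c (-7) 8 (-1) 1 (-2) * (2 - 2 * X c) * curve hc

theorem crank_class_j : -(mo c 0 (-1) (-1) 0 1 * mo c 0 0 (-1) 0 1) - 2 * (mo c (-1) 0 1 (-1) 0 *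
    mo c (-1) 1 0 0 0) + 3 * (mo c (-1) 1 (-1) 0 0 * mo c 0 (-1) 0 1 0) + 4 * (mo c 0 0 (-1) 0 0 *
    mo c 0 0 1 (-1) 0) - 3 * mo c 0 0 0 (-1) 0 + 2 * (mo c 0 0 0 0 (-1) * mo c 1 0 0 0 (-1)) = 0
    := by
  rw [mo_mul_eq hc (-6) 7 (-2) 1 (-1) 0 (-1) (-1) 0 1 0 0 (-1) 0 1 0 0 1 1, mo_mul_eq hc (-6)
    7 (-2) 1 (-1) (-1) 0 1 (-1) 0 (-1) 1 0 0 0 1 2 0 0, mo_mul_eq hc (-6) 7 (-2) 1 (-1) (-1) 1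
    (-1) 0 0 0 (-1) 0 1 0 1 0 0 1, mo_mul_eq hc (-6) 7 (-2) 1 (-1) 0 0 (-1) 0 0 0 0 1 (-1) 0 1 1
    1 0, mo_eq hc (-6) 7 (-2) 1 (-1) 0 0 0 (-1) 0 1 1 1 0, mo_mul_eq hc (-6) 7 (-2) 1 (-1) 0 0
    0 0 (-1) 1 0 0 0 (-1) 2 0 1 0]
  linear_combination mo c (-6) 7 (-2) 1 (-1) * (1) * curve hc

theorem crank_class_k : -(mo c (-1) 0 0 0 0 * mo c 1 0 0 0 (-1)) - 2 * (mo c (-1) 0 1 (-1) 0 * mo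
    c 0 0 (-1) 0 1) - 3 * (mo c (-1) 1 (-1) 0 0 * mo c (-1) 1 0 0 0) + 5 * (mo c 0 (-1) 0 0 0 * mo
    c 0 (-1) 0 1 0) + 6 * (mo c 1 0 0 (-1) (-1) * mo c 0 0 1 (-1) 0) - 2 * mo c 0 0 0 0 (-1) + 11
    * mo c 1 (-1) (-1) (-1) 1 = 0 := by
  rw [mo_mul_eq hc (-8) 10 (-1) 1 (-3) (-1) 0 0 0 0 1 0 0 0 (-1) 1 0 1 1, mo_mul_eq hc (-8) 10
    (-1) 1 (-3) (-1) 0 1 (-1) 0 0 0 (-1) 0 1 0 1 1 1, mo_mul_eq hc (-8) 10 (-1) 1 (-3) (-1) 1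
    (-1) 0 0 (-1) 1 0 0 0 0 0 1 1, mo_mul_eq hc (-8) 10 (-1) 1 (-3) 0 (-1) 0 0 0 0 (-1) 0 1 0 1 0
    0 2, mo_mul_eq hc (-8) 10 (-1) 1 (-3) 1 0 0 (-1) (-1) 0 0 1 (-1) 0 1 1 2 0, mo_eq hc (-8)
    10 (-1) 1 (-3) 0 0 0 0 (-1) 1 0 1 1, mo_eq hc (-8) 10 (-1) 1 (-3) 1 (-1) (-1) (-1) 1 0 0 2 1]
  linear_combination mo c (-8) 10 (-1) 1 (-3) * (5 - 11 * Y c - 10 * X c + 5 * X c ^ 2) * curve hc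

theorem crank_theta_terms : h ^ 3 * (1 / T c
        + T (4 * c) * T c / (T (2 * c) * T (3 * c) * T (-c))
        + T (6 * c) * T c / (T (3 * c) * T (4 * c) * T (-(2 * c)))
        + T (8 * c) * T c / (T (4 * c) * T (5 * c) * T (-(3 * c)))
        + T (10 * c) * T c / (T (5 * c) * T (6 * c) * T (-(4 * c)))) =
    h ^ 3 * (-mo c (-1) 0 0 0 0 + mo c 0 (-1) (-1) 1 0 - mo c 1 (-1) (-1) (-1) 1 + mo c 1 0 0 (-1)
      (-1) - mo c 2 0 0 (-1) (-2)) := by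
  have n1 := T_ne_zero hc
  have n2 := T_ne_zero (a := 2 * c) (by omega)
  have n3 := T_ne_zero (a := 3 * c) (by omega)
  have n4 := T_ne_zero (a := 4 * c) (by omega)
  have n5 := T_ne_zero (a := 5 * c) (by omega)
  rw [T_congr (a := 6 * c) (b := -(5 * c)) (by omega),
    T_congr (a := 8 * c) (b := -(3 * c)) (by omega), T_congr (a := 10 * c) (b := -c) (by omega)]
  simp only [T_neg, mo]
  field_simp
  ring

theorem fcrank_eq : fcrank c * h * tq c =
    h ^ 3 * (1 / T c
        + T (4 * c) * T c / (T (2 * c) * T (3 * c) * T (-c))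
        + T (6 * c) * T c / (T (3 * c) * T (4 * c) * T (-(2 * c)))
        + T (8 * c) * T c / (T (4 * c) * T (5 * c) * T (-(3 * c)))
        + T (10 * c) * T c / (T (5 * c) * T (6 * c) * T (-(4 * c))))
      + (rho c - rho (2 * c)) := by
  have r1 := rho_formula_one hc
  have r2 := rho_formula_two hc
  rw [crank_theta_terms hc, tq_mo hc, fcrank]
  linear_combination h ^ 3 / 11 * (crank_class_a hc + crank_class_b hc + crank_class_c hc +
    crank_class_d hc + crank_class_e hc + crank_class_f hc + crank_class_g hc + crank_class_h hc +
    crank_class_i hc + crank_class_j hc + crank_class_k hc) - (r1 - r2) / 11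

theorem mo_double (e₁ e₂ e₃ e₄ e₅ : ℤ) : mo (2 * c) e₁ e₂ e₃ e₄ e₅ =
    (-1) ^ (e₁ + e₃ + e₅) * mo c e₅ e₁ e₄ e₂ e₃ := by
  have n : (-1 : K) ≠ 0 := neg_ne_zero.2 one_ne_zero
  rw [mo, mo, T_congr (a := 3 * (2 * c)) (b := -(5 * c)) (by omega),
    T_congr (a := 4 * (2 * c)) (b := -(3 * c)) (by omega),
    T_congr (a := 5 * (2 * c)) (b := -c) (by omega), show 2 * (2 * c) = 4 * c by ring,
    T_neg, T_neg, T_neg, neg_eq_neg_one_mul (T (2 * c)), mul_zpow,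
    neg_eq_neg_one_mul (-T (5 * c)), neg_eq_neg_one_mul (-T c), mul_zpow, mul_zpow,
    zpow_add₀ n, zpow_add₀ n]
  ring

theorem X_double : X (2 * c) = mo c (-1) 2 0 (-2) 1 := by
  rw [X, mo_double hc]; norm_num

theorem Y_double : Y (2 * c) = mo c 1 3 (-1) (-3) 0 := by
  rw [Y, mo_double hc]; norm_num

theorem fcub_class_a : mo c 0 0 0 0 0 - 5 * mo c (-1) 2 0 (-2) 1 - mo c 1 3 (-1) (-3) 0 + 2 * mo c
    (-2) 4 0 (-4) 2 + 3 * mo c 0 5 (-1) (-5) 1 + mo c (-3) 6 0 (-6) 3 + mo c (-4) 9 (-3) (-5) 3 *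
    (1 - Y c - 5 * X c + 3 * X c * Y c + 2 * X c ^ 2 + X c ^ 3) = 0 := by
  rw [mo_eq hc (-17) 23 (-4) 0 (-2) 0 0 0 0 0 4 0 0 3, mo_eq hc (-17) 23 (-4) 0 (-2) (-1) 2 0
    (-2) 1 3 1 1 2, mo_eq hc (-17) 23 (-4) 0 (-2) 1 3 (-1) (-3) 0 3 0 3 1, mo_eq hc (-17) 23
    (-4) 0 (-2) (-2) 4 0 (-4) 2 2 2 2 1, mo_eq hc (-17) 23 (-4) 0 (-2) 0 5 (-1) (-5) 1 2 1 4 0,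
    mo_eq hc (-17) 23 (-4) 0 (-2) (-3) 6 0 (-6) 3 1 3 3 0, mo_eq hc (-17) 23 (-4) 0 (-2) (-4)
    9 (-3) (-5) 3 0 1 4 0]
  linear_combination mo c (-17) 23 (-4) 0 (-2) * (-Y c ^ 3 - 2 * X c * Y c ^ 2 + 4 * X c * Y c ^ 3
    - 4 * X c ^ 2 * Y c + 7 * X c ^ 2 * Y c ^ 2 - 3 * X c ^ 2 * Y c ^ 3 + X c ^ 3 + 10 * X c ^ 3 *
    Y c - 3 * X c ^ 3 * Y c ^ 2 - 4 * X c ^ 4 - 8 * X c ^ 4 * Y c - X c ^ 4 * Y c ^ 2 + 6 * X c ^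
    5 + 2 * X c ^ 5 * Y c - 4 * X c ^ 6 + X c ^ 7) * curve hc

theorem fcub_double : fcub (2 * c) = -(mo c (-4) 9 (-3) (-5) 3 * fcub c) := by
  have key := fcub_class_a hc
  have h0 : mo c 0 0 0 0 0 = 1 := by simp [mo]
  have hX2 := mo_mul hc (-1) (2) (0) (-2) (1) (-1) (2) (0) (-2) (1)
  have hXY := mo_mul hc (-1) (2) (0) (-2) (1) (1) (3) (-1) (-3) (0)
  have hX3 := mo_mul hc (-2) (4) (0) (-4) (2) (-1) (2) (0) (-2) (1)
  norm_num at hX2 hXY hX3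
  rw [h0, ← hX3, ← hX2, ← hXY] at key
  simp only [fcub, X_double hc, Y_double hc]
  push_cast
  linear_combination key

end

theorem mo_congr {a b : ℤ} (hab : 11 ∣ a - b) (e₁ e₂ e₃ e₄ e₅ : ℤ) :
    mo a e₁ e₂ e₃ e₄ e₅ = mo b e₁ e₂ e₃ e₄ e₅ := by
  rw [mo, T_congr hab, T_congr (a := 2 * a) (b := 2 * b) (by omega),
    T_congr (a := 3 * a) (b := 3 * b) (by omega), T_congr (a := 4 * a) (b := 4 * b) (by omega),
    T_congr (a := 5 * a) (b := 5 * b) (by omega), mo]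

theorem fcub_congr {a b : ℤ} (hab : 11 ∣ a - b) : fcub a = fcub b := by
  rw [fcub, X, Y, mo_congr hab, mo_congr hab, fcub, X, Y]

theorem h_pow_twelve {c : ℤ} (hc : ¬ 11 ∣ c) : h ^ 12 * fcub c = mo c 6 (-3) 5 2 2 := by
  have step {c : ℤ} (hc : ¬ 11 ∣ c) (ih : h ^ 12 * fcub c = mo c 6 (-3) 5 2 2) :
      h ^ 12 * fcub (2 * c) = mo (2 * c) 6 (-3) 5 2 2 := by
    have := mo_mul hc (-4) (9) (-3) (-5) (3) (6) (-3) (5) (2) (2)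
    norm_num at this
    rw [fcub_double hc, mo_double hc]
    norm_num
    rw [← this, ← ih]
    ring
  have h11 (k : ℕ) : ¬ (11 : ℤ) ∣ 2 ^ k := fun hd => by
    have hp : Prime (11 : ℤ) := Int.prime_iff_natAbs_prime.mpr (by norm_num)
    have := hp.dvd_of_dvd_pow hd
    omega
  have hpow (k : ℕ) : h ^ 12 * fcub (2 ^ k) = mo (2 ^ k) 6 (-3) 5 2 2 := by
    induction k with
    | zero => exact h_pow_twelve_one
    | succ k ih =>
      rw [show (2 : ℤ) ^ (k + 1) = 2 * 2 ^ k by ring]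
      exact step (h11 k) ih
  obtain ⟨k, hk⟩ : ∃ k : ℕ, (11 : ℤ) ∣ c - 2 ^ k := by
    have : c % 11 = 1 ∨ c % 11 = 2 ∨ c % 11 = 3 ∨ c % 11 = 4 ∨ c % 11 = 5 ∨ c % 11 = 6 ∨
      c % 11 = 7 ∨ c % 11 = 8 ∨ c % 11 = 9 ∨ c % 11 = 10 := by omega
    rcases this with e | e | e | e | e | e | e | e | e | e
    · exact ⟨0, by omega⟩
    · exact ⟨1, by omega⟩
    · exact ⟨8, by omega⟩
    · exact ⟨2, by omega⟩
    · exact ⟨4, by omega⟩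
    · exact ⟨9, by omega⟩
    · exact ⟨7, by omega⟩
    · exact ⟨3, by omega⟩
    · exact ⟨6, by omega⟩
    · exact ⟨5, by omega⟩
  rw [fcub_congr hk, mo_congr hk]
  exact hpow k

/-- All exponents of `f` lie in the class of `m` modulo `264`. -/
def Supp (m : ℤ) (f : K) : Prop := ∀ i, f.coeff i ≠ 0 → (264 : ℤ) ∣ i - m

theorem Supp.congr_class {m n : ℤ} {f : K} (hf : Supp m f) (h : (264 : ℤ) ∣ m - n) : Supp n f :=
  fun i hi => by have := hf i hi; omega

theorem supp_zero (m : ℤ) : Supp m 0 := fun i hi => absurd rfl hi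

theorem supp_u (n : ℤ) : Supp n (u n) := fun i hi => by
  rw [coeff_u] at hi
  have : i = n := by by_contra h; exact hi (if_neg h)
  omega

theorem Supp.add {m : ℤ} {f g : K} (hf : Supp m f) (hg : Supp m g) : Supp m (f + g) := fun i hi => by
  rw [HahnSeries.coeff_add] at hi
  by_cases h : f.coeff i = 0
  · exact hg i fun h' => hi (by rw [h, h', add_zero])
  · exact hf i h

theorem Supp.neg {m : ℤ} {f : K} (hf : Supp m f) : Supp m (-f) := fun i hi =>
  hf i fun h => hi (by rw [HahnSeries.coeff_neg, h, neg_zero])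

theorem Supp.sub {m : ℤ} {f g : K} (hf : Supp m f) (hg : Supp m g) : Supp m (f - g) := by
  rw [sub_eq_add_neg]; exact hf.add hg.neg

theorem Supp.sum {ι : Type*} {m : ℤ} {f : ι → K} {s : Finset ι} (h : ∀ i ∈ s, Supp m (f i)) :
    Supp m (∑ i ∈ s, f i) := by
  classical
  induction s using Finset.induction with
  | empty => exact supp_zero m
  | insert a s ha ih =>
    rw [sum_insert ha]
    exact (h a (mem_insert_self _ _)).add (ih fun i hi => h i (mem_insert_of_mem hi))

theorem Supp.mul {m n : ℤ} {f g : K} (hf : Supp m f) (hg : Supp n g) : Supp (m + n) (f * g) :=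
  fun i hi => by
    rw [HahnSeries.coeff_mul] at hi
    obtain ⟨p, hp, h⟩ := exists_ne_zero_of_sum_ne_zero hi
    rw [Finset.mem_antidiagonal] at hp
    have h1 := hf p.1 (left_ne_zero_of_mul h)
    have h2 := hg p.2 (right_ne_zero_of_mul h)
    have h3 := hp.2.2
    omega

theorem supp_one : Supp 0 1 := by simpa [u_zero] using supp_u 0

theorem supp_C (a : ℚ) : Supp 0 (HahnSeries.C a) := fun i hi => by
  rw [HahnSeries.C_apply] at hi
  have : i = 0 := by by_contra h; exact hi (HahnSeries.coeff_single_of_ne h)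
  omega

theorem Supp.pow {m : ℤ} {f : K} (hf : Supp m f) (n : ℕ) : Supp (m * n) (f ^ n) := by
  induction n with
  | zero => simpa using supp_one
  | succ n ih => rw [pow_succ]; push_cast; rw [mul_add, mul_one]; exact ih.mul hf

theorem Supp.mul_zero_class {m : ℤ} {f g : K} (hf : Supp m f) (hg : Supp 0 g) : Supp m (f * g) := by
  simpa using hf.mul hg

theorem Supp.tends {m : ℤ} {F : ℕ → K} {f : K} (hf : Tends F f) (h : ∀ n, Supp m (F n)) :
    Supp m f := fun i hi => by
  obtain ⟨N, hN⟩ := hf (i + 1)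
  have := hN N le_rfl i (by omega)
  rw [HahnSeries.coeff_sub, sub_eq_zero] at this
  exact h N i (this ▸ hi)

theorem Supp.isSum {ι : Type*} {m : ℤ} {F : ι → K} {f : K} (hf : IsSum F f)
    (h : ∀ n, Supp m (F n)) : Supp m f := fun i hi => by
  obtain ⟨S, hS⟩ := hf (i + 1)
  have := hS S subset_rfl i (by omega)
  rw [HahnSeries.coeff_sub, sub_eq_zero] at this
  exact Supp.sum (fun j _ => h j) i (this ▸ hi)

/-- The geometric series for the inverse of a series with leading term `1`. -/
theorem tends_geometric {f : K} (hf : IsOne f) : Tends (fun n => ∑ k ∈ range n, (1 - f) ^ k) f⁻¹ := by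
  have h1 : IsO 1 (1 - f) := by simpa using IsO.neg hf
  have hp : ∀ n : ℕ, IsO n ((1 - f) ^ n) := fun n => by
    induction n with
    | zero => simpa using isO_one
    | succ n ih => rw [pow_succ]; push_cast; exact ih.mul h1
  intro d
  refine ⟨d.toNat, fun n hn => ?_⟩
  have : ∑ k ∈ range n, (1 - f) ^ k - f⁻¹ = -((1 - f) ^ n * f⁻¹) := by
    have h2 := geom_sum_mul_neg (1 - f) n
    rw [sub_sub_cancel] at h2
    rw [eq_div_of_mul_eq hf.ne_zero h2]
    have := hf.ne_zero
    field_simp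
    ring
  rw [this]
  exact ((hp n).mul' hf.inv.isO (by omega)).neg

theorem Supp.inv_of_isOne {f : K} (h1 : IsOne f) (hf : Supp 0 f) : Supp 0 f⁻¹ :=
  Supp.tends (tends_geometric h1) fun n => Supp.sum fun k _ => by
    simpa using (supp_one.sub hf).pow k

theorem Supp.inv {m : ℤ} {f : K} (hf : Supp m f) : Supp (-m) f⁻¹ := by
  by_cases h0 : f = 0
  · rw [h0, inv_zero]; exact supp_zero _
  have ha : f.leadingCoeff ≠ 0 := HahnSeries.leadingCoeff_ne_zero.2 h0
  have hc : f.coeff f.order = f.leadingCoeff := (HahnSeries.leadingCoeff_eq).symm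
  have hm := hf f.order (hc ▸ ha)
  set g : K := HahnSeries.C f.leadingCoeff⁻¹ * (u (-f.order) * f) with hg
  have g1 : IsOne g := fun i hi => by
    rw [HahnSeries.coeff_sub, hg, HahnSeries.C_mul_eq_smul, HahnSeries.coeff_smul, coeff_u_mul,
      sub_neg_eq_add, HahnSeries.coeff_one]
    rcases eq_or_ne i 0 with rfl | h
    · simp [hc, ha]
    · rw [if_neg h, HahnSeries.coeff_eq_zero_of_lt_order (by omega)]; simp
  have gs : Supp 0 g := by
    refine ((supp_C _).mul ((supp_u (-f.order)).mul hf)).congr_class ?_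
    omega
  have hC : (HahnSeries.C f.leadingCoeff : K) * HahnSeries.C f.leadingCoeff⁻¹ = 1 := by
    rw [← map_mul, mul_inv_cancel₀ ha, map_one]
  have hu : u f.order * u (-f.order) = 1 := by rw [← u_add, add_neg_cancel, u_zero]
  have : f⁻¹ = HahnSeries.C f.leadingCoeff⁻¹ * u (-f.order) * g⁻¹ := by
    rw [eq_mul_inv_iff_mul_eq₀ g1.ne_zero, inv_mul_eq_iff_eq_mul₀ h0, hg]
    ring
  rw [this]
  exact (((supp_C _).mul (supp_u _)).mul (Supp.inv_of_isOne g1 gs)).congr_class (by omega)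

theorem Supp.div {m n : ℤ} {f g : K} (hf : Supp m f) (hg : Supp n g) : Supp (m - n) (f / g) := by
  rw [div_eq_mul_inv, sub_eq_add_neg]; exact hf.mul hg.inv

theorem Supp.zpow {m : ℤ} {f : K} (hf : Supp m f) (n : ℤ) : Supp (m * n) (f ^ n) := by
  obtain ⟨k, rfl | rfl⟩ := n.eq_nat_or_neg
  · rw [zpow_natCast]; exact hf.pow k
  · rw [zpow_neg, zpow_natCast, mul_neg]; exact (hf.pow k).inv

theorem supp_sg (n : ℤ) : Supp 0 (sg n) := by
  rw [sg]
  simpa using supp_one.neg.zpow n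

theorem supp_T (a : ℤ) : Supp (3 * (2 * a - 11) ^ 2) (T a) :=
  Supp.isSum (isSum_T a) fun n => by
    refine ((supp_sg _).mul (supp_u _)).congr_class ?_
    obtain ⟨k, hk⟩ := Int.even_mul_succ_self n
    refine ⟨n * (a + 5 * n - 6) + k, ?_⟩
    linear_combination 132 * hk

theorem supp_h : Supp 121 h :=
  Supp.isSum isSum_h fun j => by
    refine ((supp_sg _).mul (supp_u _)).congr_class ?_
    obtain ⟨k, hk⟩ := Int.even_mul_succ_self j
    refine ⟨16 * j ^ 2 - 6 * j + k, ?_⟩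
    linear_combination 132 * hk

theorem supp_Lam {n : ℤ} (hn : 1 ≤ n) {B : ℤ} (d : ℤ) (h : Even (n + B)) :
    Supp (12 * n * d ^ 2 + 12 * B * d) (Lam n (12 * B) d) :=
  Supp.isSum (isSum_Lam hn (12 * B) d) fun j => by
    rw [lt, y]
    refine (((supp_sg _).mul (supp_u _)).div (supp_one.sub
      ((supp_u _).congr_class (n := 0) (Dvd.intro (d + 11 * j) (by ring))))).congr_class ?_
    obtain ⟨l, hl⟩ := h
    obtain ⟨k, hk⟩ := Int.even_mul_pred_self j
    refine ⟨n * d * j + 5 * n * j ^ 2 + n * k + l * j, ?_⟩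
    linear_combination 132 * j * hl + 132 * n * hk

theorem supp_mo (c e₁ e₂ e₃ e₄ e₅ : ℤ) : Supp (3 * ((2 * c - 11) ^ 2 * e₁ + (4 * c - 11) ^ 2 * e₂
    + (6 * c - 11) ^ 2 * e₃ + (8 * c - 11) ^ 2 * e₄ + (10 * c - 11) ^ 2 * e₅))
    (mo c e₁ e₂ e₃ e₄ e₅) := by
  refine (((((((supp_T _).neg.zpow e₁).mul ((supp_T _).zpow e₂)).mul ((supp_T _).neg.zpow e₃)).mul
    ((supp_T _).zpow e₄)).mul ((supp_T _).neg.zpow e₅))).congr_class (Dvd.intro 0 ?_)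
  ring

theorem supp_X (c : ℤ) : Supp 0 (X c) :=
  (supp_mo _ _ _ _ _ _).congr_class (Dvd.intro (2 * c - c ^ 2) (by ring))

theorem supp_Y (c : ℤ) : Supp 0 (Y c) :=
  (supp_mo _ _ _ _ _ _).congr_class (Dvd.intro c (by ring))

/-- The eleven components of `frank`. -/
noncomputable def rankTerm (c : ℤ) : Fin 11 → K := ![
  mo c (-7) 3 (-5) (-2) (-2) * (3 - 3 * Y c + 7 * X c - 2 * X c * Y c - 27 * X c ^ 2 + 14 * X c ^
    3),
  mo c (-7) 3 (-5) (-1) (-3) * (3 - 6 * Y c + 7 * X c + 17 * X c * Y c - 23 * X c ^ 2 - 8 * X c ^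
    2 * Y c + 13 * X c ^ 3),
  mo c (-8) 3 (-5) (-1) (-2) * (6 * Y c - 16 * X c * Y c + 14 * X c ^ 2 - 6 * X c ^ 2 * Y c - 9 *
    X c ^ 3),
  mo c (-7) 4 (-6) (-2) (-2) * (9 - 9 * Y c - 23 * X c + 16 * X c * Y c + 18 * X c ^ 2 - 11 * X c
    ^ 2 * Y c - 2 * X c ^ 3),
  mo c (-6) 2 (-5) (-2) (-2) * (4 - 4 * Y c + 13 * X c + X c * Y c - 14 * X c ^ 2 + 4 * X c ^ 3),
  mo c (-6) 2 (-5) (-1) (-3) * (10 - 21 * Y c - 6 * X c + 19 * X c * Y c - 2 * X c ^ 2 - X c ^ 3),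
  mo c (-6) 0 (-4) (-2) (-1) * (11 * Y c + 11 * X c ^ 2),
  mo c (-6) 3 (-6) (-2) (-2) * (12 - 12 * Y c - 16 * X c + 14 * X c * Y c + 13 * X c ^ 2 - 10 * X
    c ^ 3),
  mo c (-6) 3 (-6) (-1) (-3) * (11 - 15 * Y c + 7 * X c * Y c - 13 * X c ^ 2 + 4 * X c ^ 2 * Y c +
    6 * X c ^ 3),
  mo c (-6) 3 (-5) (-3) (-2) * (13 - 13 * Y c - 10 * X c - 5 * X c * Y c + 15 * X c ^ 2 - 9 * X c
    ^ 3),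
  mo c (-7) 3 (-6) 0 (-3) * (11 + 5 * Y c - 55 * X c + 5 * X c * Y c + 52 * X c ^ 2 - 5 * X c ^ 2
    * Y c - 13 * X c ^ 3)]

/-- The ten components of `fcrank`. -/
noncomputable def crankTerm (c : ℤ) : Fin 10 → K := ![
  mo c (-1) 0 0 0 0,
  mo c 0 (-1) (-1) 0 1,
  2 * mo c (-1) 0 1 (-1) 0,
  3 * mo c (-1) 1 (-1) 0 0,
  5 * mo c 0 (-1) 0 0 0,
  -4 * mo c 0 (-1) 0 1 (-1),
  4 * mo c 0 0 (-1) 0 0,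
  6 * mo c 1 0 0 (-1) (-1),
  -3 * mo c 0 0 0 (-1) 0,
  -2 * mo c 0 0 0 0 (-1)]

theorem frank_eq_sum (c : ℤ) : frank c = h ^ 14 / 11 * ∑ i, rankTerm c i := by
  simp only [frank, rankTerm, Fin.sum_univ_succ, Matrix.cons_val_zero, Matrix.cons_val_succ,
    Fin.sum_univ_zero]
  ring

theorem fcrank_eq_sum (c : ℤ) : fcrank c = h ^ 2 / 11 * ∑ i, crankTerm c i := by
  simp only [fcrank, crankTerm, Fin.sum_univ_succ, Matrix.cons_val_zero, Matrix.cons_val_succ,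
    Fin.sum_univ_zero]
  ring

/-- The class modulo `264` of a theta monomial. -/
def moClass (c e₁ e₂ e₃ e₄ e₅ : ℤ) : ℤ := 3 * ((2 * c - 11) ^ 2 * e₁ + (4 * c - 11) ^ 2 * e₂
    + (6 * c - 11) ^ 2 * e₃ + (8 * c - 11) ^ 2 * e₄ + (10 * c - 11) ^ 2 * e₅)

/-- The classes modulo `264` of the components of `frank`. -/
def rankClass (c : ℤ) : Fin 11 → ℤ := ![
  moClass c (-7) 3 (-5) (-2) (-2),
  moClass c (-7) 3 (-5) (-1) (-3),
  moClass c (-8) 3 (-5) (-1) (-2),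
  moClass c (-7) 4 (-6) (-2) (-2),
  moClass c (-6) 2 (-5) (-2) (-2),
  moClass c (-6) 2 (-5) (-1) (-3),
  moClass c (-6) 0 (-4) (-2) (-1),
  moClass c (-6) 3 (-6) (-2) (-2),
  moClass c (-6) 3 (-6) (-1) (-3),
  moClass c (-6) 3 (-5) (-3) (-2),
  moClass c (-7) 3 (-6) 0 (-3)]

/-- The classes modulo `264` of the components of `fcrank`. -/
def crankClass (c : ℤ) : Fin 10 → ℤ := ![
  moClass c (-1) 0 0 0 0,
  moClass c 0 (-1) (-1) 0 1,
  moClass c (-1) 0 1 (-1) 0,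
  moClass c (-1) 1 (-1) 0 0,
  moClass c 0 (-1) 0 0 0,
  moClass c 0 (-1) 0 1 (-1),
  moClass c 0 0 (-1) 0 0,
  moClass c 1 0 0 (-1) (-1),
  moClass c 0 0 0 (-1) 0,
  moClass c 0 0 0 0 (-1)]

/-- The series supported on multiples of `264`. -/
noncomputable def suppSubring : Subring K where
  carrier := {f | Supp 0 f}
  mul_mem' hf hg := hf.mul hg
  one_mem' := supp_one
  add_mem' hf hg := hf.add hg
  zero_mem' := supp_zero 0
  neg_mem' hf := hf.neg

theorem supp_vecCons {n : ℕ} {m : ℤ} {f : K} {v : Fin n → K} {w : Fin n → ℤ} (hf : Supp m f)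
    (h : ∀ i, Supp (w i) (v i)) (i : Fin (n + 1)) :
    Supp (Matrix.vecCons m w i) (Matrix.vecCons f v i) := by
  refine Fin.cases ?_ (fun j => ?_) i
  · exact hf
  · exact h j

theorem supp_mo_mul {c e₁ e₂ e₃ e₄ e₅ : ℤ} {f : K} (hf : f ∈ suppSubring) :
    Supp (moClass c e₁ e₂ e₃ e₄ e₅) (mo c e₁ e₂ e₃ e₄ e₅ * f) :=
  (supp_mo c e₁ e₂ e₃ e₄ e₅).mul_zero_class hf

theorem supp_mul_mo {c e₁ e₂ e₃ e₄ e₅ : ℤ} {f : K} (hf : f ∈ suppSubring) :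
    Supp (moClass c e₁ e₂ e₃ e₄ e₅) (f * mo c e₁ e₂ e₃ e₄ e₅) := by
  rw [mul_comm]; exact supp_mo_mul hf


theorem supp_rankTerm (c : ℤ) : ∀ i, Supp (rankClass c i) (rankTerm c i) := by
  have hX : X c ∈ suppSubring := supp_X c
  have hY : Y c ∈ suppSubring := supp_Y c
  have nil (i : Fin 0) : Supp ((![] : Fin 0 → ℤ) i) ((![] : Fin 0 → K) i) := i.elim0
  unfold rankClass rankTerm
  refine supp_vecCons (supp_mo_mul ?_) <| supp_vecCons (supp_mo_mul ?_) <| supp_vecCons (supp_mo_mul ?_) <|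
    supp_vecCons (supp_mo_mul ?_) <| supp_vecCons (supp_mo_mul ?_) <| supp_vecCons (supp_mo_mul
    ?_) <| supp_vecCons (supp_mo_mul ?_) <| supp_vecCons (supp_mo_mul ?_) <| supp_vecCons
    (supp_mo_mul ?_) <| supp_vecCons (supp_mo_mul ?_) <| supp_vecCons (supp_mo_mul ?_) <| nil
  all_goals
    repeat' first
      | with_reducible exact hX
      | with_reducible exact hY
      | with_reducible exact ofNat_mem _ _
      | with_reducible apply add_mem
      | with_reducible apply sub_mem
      | with_reducible apply mul_mem
      | with_reducible apply pow_mem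

theorem supp_crankTerm (c : ℤ) : ∀ i, Supp (crankClass c i) (crankTerm c i) := by
  have nil (i : Fin 0) : Supp ((![] : Fin 0 → ℤ) i) ((![] : Fin 0 → K) i) := i.elim0
  unfold crankClass crankTerm
  refine supp_vecCons (supp_mo _ _ _ _ _ _) <| supp_vecCons (supp_mo _ _ _ _ _ _) <| supp_vecCons
    (supp_mul_mo ?_) <| supp_vecCons (supp_mul_mo ?_) <| supp_vecCons (supp_mul_mo ?_) <|
    supp_vecCons (supp_mul_mo ?_) <| supp_vecCons (supp_mul_mo ?_) <| supp_vecCons (supp_mul_mo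
    ?_) <| supp_vecCons (supp_mul_mo ?_) <| supp_vecCons (supp_mul_mo ?_) <| nil
  all_goals
    first
      | with_reducible exact ofNat_mem _ _
      | exact neg_mem (ofNat_mem _ _)

theorem mo_two_mul {a b : ℤ} (hb : ¬ 11 ∣ b) (hab : 11 ∣ a - 2 * b) (e₁ e₂ e₃ e₄ e₅ : ℤ) :
    mo a e₁ e₂ e₃ e₄ e₅ = (-1) ^ (e₁ + e₃ + e₅) * mo b e₅ e₁ e₄ e₂ e₃ := by
  rw [mo_congr hab, mo_double hb]

theorem mo_neg (c e₁ e₂ e₃ e₄ e₅ : ℤ) : mo (-c) e₁ e₂ e₃ e₄ e₅ =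
    (-1) ^ (e₁ + e₂ + e₃ + e₄ + e₅) * mo c e₁ e₂ e₃ e₄ e₅ := by
  have n : (-1 : K) ≠ 0 := neg_ne_zero.2 one_ne_zero
  have t (x : K) (e : ℤ) : (-x) ^ e = (-1) ^ e * x ^ e := by rw [← mul_zpow, neg_one_mul]
  simp only [mo, mul_neg, T_neg]
  rw [t (-T c), t (T (2 * c)), t (-T (3 * c)), t (T (4 * c)), t (-T (5 * c)), zpow_add₀ n,
    zpow_add₀ n, zpow_add₀ n, zpow_add₀ n]
  ring

theorem mo_neg_two (e₁ e₂ e₃ e₄ e₅ : ℤ) : mo (-2) e₁ e₂ e₃ e₄ e₅ =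
    (-1) ^ (e₁ + e₃ + e₅) * ((-1) ^ (e₅ + e₁ + e₄ + e₂ + e₃) * mo 1 e₅ e₁ e₄ e₂ e₃) := by
  rw [mo_two_mul (b := -1) (by norm_num) (by norm_num), mo_neg]

theorem mo_two (e₁ e₂ e₃ e₄ e₅ : ℤ) : mo 2 e₁ e₂ e₃ e₄ e₅ =
    (-1) ^ (e₁ + e₃ + e₅) * mo 1 e₅ e₁ e₄ e₂ e₃ :=
  mo_two_mul (by norm_num) (by norm_num) ..

theorem mo_four (e₁ e₂ e₃ e₄ e₅ : ℤ) : mo 4 e₁ e₂ e₃ e₄ e₅ =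
    (-1) ^ (e₁ + e₃ + e₅) * ((-1) ^ (e₅ + e₄ + e₃) * mo 1 e₃ e₅ e₂ e₁ e₄) := by
  rw [mo_two_mul (b := 2) (by norm_num) (by norm_num), mo_two]

theorem mo_neg_three (e₁ e₂ e₃ e₄ e₅ : ℤ) : mo (-3) e₁ e₂ e₃ e₄ e₅ = (-1) ^ (e₁ + e₃ + e₅) *
    ((-1) ^ (e₅ + e₄ + e₃) * ((-1) ^ (e₃ + e₂ + e₄) * mo 1 e₄ e₃ e₁ e₅ e₂)) := by
  rw [mo_two_mul (b := 4) (by norm_num) (by norm_num), mo_four]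

theorem mo_five (e₁ e₂ e₃ e₄ e₅ : ℤ) : mo 5 e₁ e₂ e₃ e₄ e₅ = (-1) ^ (e₁ + e₃ + e₅) *
    ((-1) ^ (e₅ + e₄ + e₃) * ((-1) ^ (e₃ + e₂ + e₄) * ((-1) ^ (e₄ + e₁ + e₂) *
      mo 1 e₂ e₄ e₅ e₃ e₁))) := by
  rw [mo_two_mul (b := -3) (by norm_num) (by norm_num), mo_neg_three]

theorem mo_three (e₁ e₂ e₃ e₄ e₅ : ℤ) : mo 3 e₁ e₂ e₃ e₄ e₅ =
    (-1) ^ (e₁ + e₂ + e₃ + e₄ + e₅) * mo (-3) e₁ e₂ e₃ e₄ e₅ :=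
  (mo_congr (b := - -3) (by norm_num) ..).trans (mo_neg (-3) ..)

theorem X_neg_two : X (-2) = mo 1 (-1) 2 0 (-2) 1 := by
  rw [X, mo_neg_two]; norm_num

theorem Y_neg_two : Y (-2) = mo 1 1 3 (-1) (-3) 0 := by
  rw [Y, mo_neg_two]; norm_num

theorem X_five : X 5 = -mo 1 (-2) 0 (-1) 1 2 := by
  rw [X, mo_five]; norm_num

theorem Y_five : Y 5 = -mo 1 (-3) (-1) 1 0 3 := by
  rw [Y, mo_five]; norm_num

theorem X_neg_three : X (-3) = -mo 1 0 1 2 (-1) (-2) := by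
  rw [X, mo_neg_three]; norm_num

theorem Y_neg_three : Y (-3) = mo 1 (-1) 0 3 1 (-3) := by
  rw [Y, mo_neg_three]; norm_num

theorem X_four : X 4 = mo 1 1 (-1) (-2) 2 0 := by
  rw [X, mo_four]; norm_num

theorem Y_four : Y 4 = mo 1 0 1 (-3) 3 (-1) := by
  rw [Y, mo_four]; norm_num

theorem mo_one_mono (a₁ a₂ a₃ a₄ a₅ x₁ x₂ x₃ x₄ x₅ y₁ y₂ y₃ y₄ y₅ b₁ b₂ b₃ b₄ b₅ : ℤ)
    (m n i j k l : ℕ)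
    (hyp : a₁ + x₁ * m + y₁ * n = b₁ + 2 * i + j + 3 * k + 3 * l ∧
      a₂ + x₂ * m + y₂ * n = b₂ - 2 * i - 2 * j - 3 * k - 5 * l ∧
      a₃ + x₃ * m + y₃ * n = b₃ + i + j ∧ a₄ + x₄ * m + y₄ * n = b₄ - j - k ∧
      a₅ + x₅ * m + y₅ * n = b₅ - i + j + k + 2 * l) :
    mo 1 a₁ a₂ a₃ a₄ a₅ * mo 1 x₁ x₂ x₃ x₄ x₅ ^ m * mo 1 y₁ y₂ y₃ y₄ y₅ ^ n =
      mo 1 b₁ b₂ b₃ b₄ b₅ * (X 1 ^ i * (1 - X 1) ^ j * Y 1 ^ k * ((1 - X 1) ^ 2 - Y 1) ^ l) := by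
  have hc : ¬ (11 : ℤ) ∣ 1 := by norm_num
  rw [mo_pow, mo_pow, mo_mul hc, mo_mul hc]
  exact mo_eq hc _ _ _ _ _ _ _ _ _ _ i j k l hyp

theorem mono_one (a₁ a₂ a₃ a₄ a₅ b₁ b₂ b₃ b₄ b₅ : ℤ) (i j k l : ℕ)
    (hyp : a₁ = b₁ + 2 * i + j + 3 * k + 3 * l ∧ a₂ = b₂ - 2 * i - 2 * j - 3 * k - 5 * l ∧
      a₃ = b₃ + i + j ∧ a₄ = b₄ - j - k ∧ a₅ = b₅ - i + j + k + 2 * l := by norm_num) :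
    mo 1 a₁ a₂ a₃ a₄ a₅ = mo 1 b₁ b₂ b₃ b₄ b₅ *
      (X 1 ^ i * (1 - X 1) ^ j * Y 1 ^ k * ((1 - X 1) ^ 2 - Y 1) ^ l) :=
  mo_eq (by norm_num) _ _ _ _ _ _ _ _ _ _ i j k l hyp

theorem curve_one : Y 1 ^ 2 - Y 1 + X 1 * (1 - X 1) ^ 2 = 0 := curve (by norm_num)

theorem rankTerm_zero_seven : rankTerm (-2) 9 =
    mo 1 (-6) 3 (-6) (-2) (-2) * (9 - 9 * Y 1 - 34 * X 1 + 16 * X 1 * Y 1 + 29 * X 1 ^ 2 - 13 * X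
      1 ^ 3) := by
  have e := mo_neg_two (-6) 3 (-5) (-3) (-2)
  norm_num at e
  change mo (-2) (-6) 3 (-5) (-3) (-2) * (13 - 13 * Y (-2) - 10 * X (-2) - 5 * X (-2) * Y (-2) +
    15 * X (-2) ^ 2 - 9 * X (-2) ^ 3) = _
  rw [e, X_neg_two, Y_neg_two]
  have M := mo_one_mono (-2) (-6) (-3) 3 (-5) (-1) 2 0 (-2) 1 1 3 (-1) (-3) 0 (-19) 17 (-7) 3 (-7)
  linear_combination 13 * M 0 0 4 0 0 3 (by norm_num) - 10 * M 1 0 3 1 1 2 (by norm_num) - 13 * M 0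
    1 3 0 3 1 (by norm_num) + 15 * M 2 0 2 2 2 1 (by norm_num) - 5 * M 1 1 2 1 4 0 (by norm_num) - 9
    * M 3 0 1 3 3 0 (by norm_num) - (9 - 9 * Y 1 - 34 * X 1 + 16 * X 1 * Y 1 + 29 * X 1 ^ 2 - 13 * X
    1 ^ 3) * mono_one (-6) 3 (-6) (-2) (-2) (-19) 17 (-7) 3 (-7) 0 1 4 0 + mo 1 (-19) 17 (-7) 3 (-7)
    * (9 * Y 1 ^ 3 + 18 * X 1 * Y 1 ^ 2 - 25 * X 1 * Y 1 ^ 3 + 3 * X 1 ^ 2 * Y 1 - 52 * X 1 ^ 2 * Y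
    1 ^ 2 + 16 * X 1 ^ 2 * Y 1 ^ 3 + 13 * X 1 ^ 3 - 35 * X 1 ^ 3 * Y 1 + 60 * X 1 ^ 3 * Y 1 ^ 2 - 52
    * X 1 ^ 4 + 61 * X 1 ^ 4 * Y 1 - 13 * X 1 ^ 4 * Y 1 ^ 2 + 78 * X 1 ^ 5 - 29 * X 1 ^ 5 * Y 1 - 52
    * X 1 ^ 6 + 13 * X 1 ^ 7) * curve_one

theorem rankTerm_two_seven : rankTerm 1 7 =
    mo 1 (-6) 3 (-6) (-2) (-2) * (12 - 12 * Y 1 - 16 * X 1 + 14 * X 1 * Y 1 + 13 * X 1 ^ 2 - 10 *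
      X 1 ^ 3) := by
  rfl

theorem rankTerm_three_seven : rankTerm (-3) 0 =
    mo 1 (-6) 3 (-6) (-2) (-2) * (8 - 8 * Y 1 + 4 * X 1 - 9 * X 1 * Y 1 - 6 * X 1 ^ 2 + 8 * X 1 ^
      3) := by
  have e := mo_neg_three (-7) 3 (-5) (-2) (-2)
  norm_num at e
  change mo (-3) (-7) 3 (-5) (-2) (-2) * (3 - 3 * Y (-3) + 7 * X (-3) - 2 * X (-3) * Y (-3) - 27 *
    X (-3) ^ 2 + 14 * X (-3) ^ 3) = _
  rw [e, X_neg_three, Y_neg_three]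
  have M := mo_one_mono (-2) (-5) (-7) (-2) 3 0 1 2 (-1) (-2) (-1) 0 3 1 (-3) (-17) 16 (-7) 0 (-5)
  linear_combination -3 * M 0 0 0 0 2 3 (by norm_num) + 7 * M 1 0 1 1 2 2 (by norm_num) + 3 * M 0 1
    2 1 0 3 (by norm_num) + 27 * M 2 0 2 2 2 1 (by norm_num) - 2 * M 1 1 3 2 0 2 (by norm_num) + 14
    * M 3 0 3 3 2 0 (by norm_num) - (8 - 8 * Y 1 + 4 * X 1 - 9 * X 1 * Y 1 - 6 * X 1 ^ 2 + 8 * X 1 ^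
    3) * mono_one (-6) 3 (-6) (-2) (-2) (-17) 16 (-7) 0 (-5) 1 0 2 1 + mo 1 (-17) 16 (-7) 0 (-5) *
    (3 * Y 1 - 6 * Y 1 ^ 2 + 3 * Y 1 ^ 3 + 3 * X 1 - 20 * X 1 * Y 1 + 17 * X 1 * Y 1 ^ 2 - 17 * X 1
    ^ 2 + 44 * X 1 ^ 2 * Y 1 - 25 * X 1 ^ 2 * Y 1 ^ 2 + 38 * X 1 ^ 3 - 40 * X 1 ^ 3 * Y 1 - 42 * X 1
    ^ 4 + 13 * X 1 ^ 4 * Y 1 + 23 * X 1 ^ 5 - 5 * X 1 ^ 6) * curve_one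

theorem rankTerm_four_seven : rankTerm 4 4 =
    mo 1 (-6) 3 (-6) (-2) (-2) * (4 - 4 * Y 1 + 2 * X 1 - 10 * X 1 * Y 1 + 19 * X 1 ^ 2 - 7 * X 1
      ^ 3) := by
  have e := mo_four (-6) 2 (-5) (-2) (-2)
  norm_num at e
  change mo 4 (-6) 2 (-5) (-2) (-2) * (4 - 4 * Y 4 + 13 * X 4 + X 4 * Y 4 - 14 * X 4 ^ 2 + 4 * X 4
    ^ 3) = _
  rw [e, X_four, Y_four]
  have M := mo_one_mono (-5) (-2) 2 (-6) (-2) 1 (-1) (-2) 2 0 0 1 (-3) 3 (-1) (-15) 14 (-6) 0 (-6)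
  linear_combination 4 * M 0 0 2 6 0 0 (by norm_num) + 13 * M 1 0 2 4 0 1 (by norm_num) - 4 * M 0 1
    2 3 0 1 (by norm_num) - 14 * M 2 0 2 2 0 2 (by norm_num) + 1 * M 1 1 2 1 0 2 (by norm_num) + 4 *
    M 3 0 2 0 0 3 (by norm_num) - (4 - 4 * Y 1 + 2 * X 1 - 10 * X 1 * Y 1 + 19 * X 1 ^ 2 - 7 * X 1 ^
    3) * mono_one (-6) 3 (-6) (-2) (-2) (-15) 14 (-6) 0 (-6) 0 0 2 1 + mo 1 (-15) 14 (-6) 0 (-6) *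
    (4 * Y 1 - 4 * Y 1 ^ 2 + 4 * X 1 - 6 * X 1 * Y 1 - 10 * X 1 * Y 1 ^ 2 - 19 * X 1 ^ 2 - X 1 ^ 2 *
    Y 1 + 33 * X 1 ^ 3 + 3 * X 1 ^ 3 * Y 1 - 25 * X 1 ^ 4 + 7 * X 1 ^ 5) * curve_one

theorem crank_base_seven : h ^ 2 * mo 1 0 0 (-1) 0 0 =
    h ^ 14 * (mo 1 (-6) 3 (-6) (-2) (-2) * (1 - Y 1 - 5 * X 1 + 3 * X 1 * Y 1 + 2 * X 1 ^ 2 + X 1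
      ^ 3)) := by
  have hc : ¬ (11 : ℤ) ∣ 1 := by norm_num
  have e : mo 1 0 0 (-1) 0 0 = h ^ 12 * (mo 1 (-6) 3 (-6) (-2) (-2) * fcub 1) := by
    rw [mul_left_comm, h_pow_twelve hc, mo_mul hc]; norm_num
  rw [e, fcub]
  push_cast
  linear_combination h ^ 14 * (1 - 5 * X 1 - Y 1 + 2 * X 1 ^ 2 + 3 * X 1 * Y 1 + X 1 ^ 3) * mono_one
    (-6) 3 (-6) (-2) (-2) (-6) 3 (-6) (-2) (-2) 0 0 0 0 - h ^ 14 * (1 - Y 1 - 5 * X 1 + 3 * X 1 * Y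
    1 + 2 * X 1 ^ 2 + X 1 ^ 3) * mono_one (-6) 3 (-6) (-2) (-2) (-6) 3 (-6) (-2) (-2) 0 0 0 0

theorem crankTerm_zero_seven : crankTerm 5 9 = -2 * mo 1 0 0 (-1) 0 0 := by
  have e := mo_five 0 0 0 0 (-1)
  norm_num at e
  change -2 * mo 5 0 0 0 0 (-1) = _
  linear_combination (-2 : K) * e

theorem crankTerm_one_seven : crankTerm 4 4 = 5 * mo 1 0 0 (-1) 0 0 := by
  have e := mo_four 0 (-1) 0 0 0
  norm_num at e
  change 5 * mo 4 0 (-1) 0 0 0 = _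
  linear_combination (5 : K) * e

theorem rankTerm_zero_eight : rankTerm (-2) 1 =
    mo 1 (-6) 3 (-6) (-1) (-3) * (8 * Y 1 + 11 * X 1 - 14 * X 1 * Y 1 - 18 * X 1 ^ 2 + 3 * X 1 ^ 2
      * Y 1 + 10 * X 1 ^ 3) := by
  have e := mo_neg_two (-7) 3 (-5) (-1) (-3)
  norm_num at e
  change mo (-2) (-7) 3 (-5) (-1) (-3) * (3 - 6 * Y (-2) + 7 * X (-2) + 17 * X (-2) * Y (-2) - 23
    * X (-2) ^ 2 - 8 * X (-2) ^ 2 * Y (-2) + 13 * X (-2) ^ 3) = _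
  rw [e, X_neg_two, Y_neg_two]
  have M := mo_one_mono (-3) (-7) (-1) 3 (-5) (-1) 2 0 (-2) 1 1 3 (-1) (-3) 0 (-24) 23 (-6) 4
    (-10)
  linear_combination 3 * M 0 0 4 1 0 4 (by norm_num) + 7 * M 1 0 3 2 1 3 (by norm_num) - 6 * M 0 1 3
    1 3 2 (by norm_num) - 23 * M 2 0 2 3 2 2 (by norm_num) + 17 * M 1 1 2 2 4 1 (by norm_num) + 13 *
    M 3 0 1 4 3 1 (by norm_num) - 8 * M 2 1 1 3 5 0 (by norm_num) - (8 * Y 1 + 11 * X 1 - 14 * X 1 *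
    Y 1 - 18 * X 1 ^ 2 + 3 * X 1 ^ 2 * Y 1 + 10 * X 1 ^ 3) * mono_one (-6) 3 (-6) (-1) (-3) (-24) 23
    (-6) 4 (-10) 0 0 5 1 + mo 1 (-24) 23 (-6) 4 (-10) * (8 * Y 1 ^ 5 - 13 * X 1 * Y 1 ^ 2 + 27 * X 1
    * Y 1 ^ 4 - 14 * X 1 * Y 1 ^ 5 + 10 * X 1 ^ 2 * Y 1 + 42 * X 1 ^ 2 * Y 1 ^ 2 + 23 * X 1 ^ 2 * Y
    1 ^ 3 - 54 * X 1 ^ 2 * Y 1 ^ 4 + 3 * X 1 ^ 2 * Y 1 ^ 5 + 3 * X 1 ^ 3 - 69 * X 1 ^ 3 * Y 1 - 26 *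
    X 1 ^ 3 * Y 1 ^ 2 - 62 * X 1 ^ 3 * Y 1 ^ 3 + 30 * X 1 ^ 3 * Y 1 ^ 4 - 21 * X 1 ^ 4 + 195 * X 1 ^
    4 * Y 1 - 47 * X 1 ^ 4 * Y 1 ^ 2 + 52 * X 1 ^ 4 * Y 1 ^ 3 - 3 * X 1 ^ 4 * Y 1 ^ 4 + 63 * X 1 ^ 5
    - 290 * X 1 ^ 5 * Y 1 + 72 * X 1 ^ 5 * Y 1 ^ 2 - 13 * X 1 ^ 5 * Y 1 ^ 3 - 105 * X 1 ^ 6 + 240 *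
    X 1 ^ 6 * Y 1 - 31 * X 1 ^ 6 * Y 1 ^ 2 + 105 * X 1 ^ 7 - 105 * X 1 ^ 7 * Y 1 + 3 * X 1 ^ 7 * Y 1
    ^ 2 - 63 * X 1 ^ 8 + 19 * X 1 ^ 8 * Y 1 + 21 * X 1 ^ 9 - 3 * X 1 ^ 10) * curve_one

theorem rankTerm_one_eight : rankTerm 5 3 =
    mo 1 (-6) 3 (-6) (-1) (-3) * (11 - 9 * Y 1 - 22 * X 1 + 2 * X 1 * Y 1 + 34 * X 1 ^ 2 - 2 * X 1
      ^ 2 * Y 1 - 14 * X 1 ^ 3) := by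
  have e := mo_five (-7) 4 (-6) (-2) (-2)
  norm_num at e
  change mo 5 (-7) 4 (-6) (-2) (-2) * (9 - 9 * Y 5 - 23 * X 5 + 16 * X 5 * Y 5 + 18 * X 5 ^ 2 - 11
    * X 5 ^ 2 * Y 5 - 2 * X 5 ^ 3) = _
  rw [e, X_five, Y_five]
  have M := mo_one_mono 4 (-2) (-2) (-6) (-7) (-2) 0 (-1) 1 2 (-3) (-1) 1 0 3 (-15) 18 (-6) (-1)
    (-9)
  linear_combination 9 * M 0 0 3 1 4 0 (by norm_num) + 23 * M 1 0 2 1 3 1 (by norm_num) + 9 * M 0 1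
    2 3 2 1 (by norm_num) + 18 * M 2 0 1 1 2 2 (by norm_num) + 16 * M 1 1 1 3 1 2 (by norm_num) + 2
    * M 3 0 0 1 1 3 (by norm_num) + 11 * M 2 1 0 3 0 3 (by norm_num) - (11 - 9 * Y 1 - 22 * X 1 + 2
    * X 1 * Y 1 + 34 * X 1 ^ 2 - 2 * X 1 ^ 2 * Y 1 - 14 * X 1 ^ 3) * mono_one (-6) 3 (-6) (-1) (-3)
    (-15) 18 (-6) (-1) (-9) 0 0 0 3 + mo 1 (-15) 18 (-6) (-1) (-9) * (-11 + 22 * Y 1 - 11 * Y 1 ^ 2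
    + 43 * X 1 - 65 * X 1 * Y 1 + 22 * X 1 * Y 1 ^ 2 - 59 * X 1 ^ 2 + 95 * X 1 ^ 2 * Y 1 - 43 * X 1
    ^ 2 * Y 1 ^ 2 + 26 * X 1 ^ 3 - 97 * X 1 ^ 3 * Y 1 + 32 * X 1 ^ 3 * Y 1 ^ 2 + 11 * X 1 ^ 4 + 59 *
    X 1 ^ 4 * Y 1 - 9 * X 1 ^ 4 * Y 1 ^ 2 - 13 * X 1 ^ 5 - 14 * X 1 ^ 5 * Y 1 + 3 * X 1 ^ 6) *
    curve_one

theorem rankTerm_two_eight : rankTerm 1 8 =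
    mo 1 (-6) 3 (-6) (-1) (-3) * (11 - 15 * Y 1 + 7 * X 1 * Y 1 - 13 * X 1 ^ 2 + 4 * X 1 ^ 2 * Y 1
      + 6 * X 1 ^ 3) := by
  rfl

theorem rankTerm_three_eight : rankTerm (-3) 5 =
    mo 1 (-6) 3 (-6) (-1) (-3) * (11 - 10 * Y 1 - 11 * X 1 + 12 * X 1 * Y 1 + 6 * X 1 ^ 2 - X 1 ^
      2 * Y 1 - 7 * X 1 ^ 3) := by
  have e := mo_neg_three (-6) 2 (-5) (-1) (-3)
  norm_num at e
  change mo (-3) (-6) 2 (-5) (-1) (-3) * (10 - 21 * Y (-3) - 6 * X (-3) + 19 * X (-3) * Y (-3) - 2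
    * X (-3) ^ 2 - X (-3) ^ 3) = _
  rw [e, X_neg_three, Y_neg_three]
  have M := mo_one_mono (-1) (-5) (-6) (-3) 2 0 1 2 (-1) (-2) (-1) 0 3 1 (-3) (-17) 18 (-7) 0 (-7)
  linear_combination -10 * M 0 0 0 1 2 3 (by norm_num) - 6 * M 1 0 1 2 2 2 (by norm_num) + 21 * M 0
    1 2 2 0 3 (by norm_num) + 2 * M 2 0 2 3 2 1 (by norm_num) + 19 * M 1 1 3 3 0 2 (by norm_num) - 1
    * M 3 0 3 4 2 0 (by norm_num) - (11 - 10 * Y 1 - 11 * X 1 + 12 * X 1 * Y 1 + 6 * X 1 ^ 2 - X 1 ^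
    2 * Y 1 - 7 * X 1 ^ 3) * mono_one (-6) 3 (-6) (-1) (-3) (-17) 18 (-7) 0 (-7) 1 0 1 2 + mo 1
    (-17) 18 (-7) 0 (-7) * (10 * Y 1 - 20 * Y 1 ^ 2 + 10 * Y 1 ^ 3 + 21 * X 1 - 95 * X 1 * Y 1 + 84
    * X 1 * Y 1 ^ 2 - 10 * X 1 * Y 1 ^ 3 - 107 * X 1 ^ 2 + 244 * X 1 ^ 2 * Y 1 - 90 * X 1 ^ 2 * Y 1
    ^ 2 + 220 * X 1 ^ 3 - 261 * X 1 ^ 3 * Y 1 + 25 * X 1 ^ 3 * Y 1 ^ 2 - 230 * X 1 ^ 4 + 120 * X 1 ^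
    4 * Y 1 + 125 * X 1 ^ 5 - 18 * X 1 ^ 5 * Y 1 - 31 * X 1 ^ 6 + 2 * X 1 ^ 7) * curve_one

theorem rankTerm_four_eight : rankTerm 4 2 =
    mo 1 (-6) 3 (-6) (-1) (-3) * (11 - 5 * Y 1 - 33 * X 1 + 6 * X 1 * Y 1 + 25 * X 1 ^ 2 + 5 * X 1
      ^ 2 * Y 1 - 9 * X 1 ^ 3) := by
  have e := mo_four (-8) 3 (-5) (-1) (-2)
  norm_num at e
  change mo 4 (-8) 3 (-5) (-1) (-2) * (6 * Y 4 - 16 * X 4 * Y 4 + 14 * X 4 ^ 2 - 6 * X 4 ^ 2 * Y 4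
    - 9 * X 4 ^ 3) = _
  rw [e, X_four, Y_four]
  have M := mo_one_mono (-5) (-2) 3 (-8) (-1) 1 (-1) (-2) 2 0 0 1 (-3) 3 (-1) (-12) 11 (-6) 0 (-6)
  linear_combination -6 * M 0 1 1 5 0 0 (by norm_num) - 14 * M 2 0 1 4 0 1 (by norm_num) + 16 * M 1
    1 1 3 0 1 (by norm_num) + 9 * M 3 0 1 2 0 2 (by norm_num) + 6 * M 2 1 1 1 0 2 (by norm_num) -
    (11 - 5 * Y 1 - 33 * X 1 + 6 * X 1 * Y 1 + 25 * X 1 ^ 2 + 5 * X 1 ^ 2 * Y 1 - 9 * X 1 ^ 3) *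
    mono_one (-6) 3 (-6) (-1) (-3) (-12) 11 (-6) 0 (-6) 0 0 1 1 + mo 1 (-12) 11 (-6) 0 (-6) * (11 -
    5 * Y 1 - 28 * X 1 + 6 * X 1 * Y 1 + 18 * X 1 ^ 2 + 5 * X 1 ^ 2 * Y 1 + 4 * X 1 ^ 3 - 5 * X 1 ^
    4) * curve_one

theorem crank_base_eight : h ^ 2 * mo 1 1 0 0 (-1) (-1) =
    h ^ 14 * (mo 1 (-6) 3 (-6) (-1) (-3) * (Y 1 + X 1 * Y 1 - 5 * X 1 ^ 2 - X 1 ^ 2 * Y 1 + 4 * X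
      1 ^ 3)) := by
  have hc : ¬ (11 : ℤ) ∣ 1 := by norm_num
  have e : mo 1 1 0 0 (-1) (-1) = h ^ 12 * (mo 1 (-5) 3 (-5) (-3) (-3) * fcub 1) := by
    rw [mul_left_comm, h_pow_twelve hc, mo_mul hc]; norm_num
  rw [e, fcub]
  push_cast
  linear_combination h ^ 14 * (1 - 5 * X 1 - Y 1 + 2 * X 1 ^ 2 + 3 * X 1 * Y 1 + X 1 ^ 3) * mono_one
    (-5) 3 (-5) (-3) (-3) (-9) 8 (-6) (-1) (-5) 0 1 1 0 - h ^ 14 * (Y 1 + X 1 * Y 1 - 5 * X 1 ^ 2 -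
    X 1 ^ 2 * Y 1 + 4 * X 1 ^ 3) * mono_one (-6) 3 (-6) (-1) (-3) (-9) 8 (-6) (-1) (-5) 0 0 0 1 + h
    ^ 14 * mo 1 (-9) 8 (-6) (-1) (-5) * (5 * X 1 - 4 * X 1 ^ 2) * curve_one

theorem crankTerm_zero_eight : crankTerm 5 3 = -3 * mo 1 1 0 0 (-1) (-1) := by
  have e := mo_five (-1) 1 (-1) 0 0
  norm_num at e
  change 3 * mo 5 (-1) 1 (-1) 0 0 = _
  linear_combination (3 : K) * e

theorem crankTerm_one_eight : crankTerm 4 2 = 2 * mo 1 1 0 0 (-1) (-1) := by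
  have e := mo_four (-1) 0 1 (-1) 0
  norm_num at e
  change 2 * mo 4 (-1) 0 1 (-1) 0 = _
  linear_combination (2 : K) * e

theorem rankTerm_zero_nine : rankTerm (-2) 4 =
    mo 1 (-6) 3 (-5) (-3) (-2) * (7 - 7 * Y 1 - 24 * X 1 + 21 * X 1 * Y 1 + 25 * X 1 ^ 2 - 4 * X 1
      ^ 3) := by
  have e := mo_neg_two (-6) 2 (-5) (-2) (-2)
  norm_num at e
  change mo (-2) (-6) 2 (-5) (-2) (-2) * (4 - 4 * Y (-2) + 13 * X (-2) + X (-2) * Y (-2) - 14 * X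
    (-2) ^ 2 + 4 * X (-2) ^ 3) = _
  rw [e, X_neg_two, Y_neg_two]
  have M := mo_one_mono (-2) (-6) (-2) 2 (-5) (-1) 2 0 (-2) 1 1 3 (-1) (-3) 0 (-19) 17 (-6) 2 (-7)
  linear_combination 4 * M 0 0 4 0 0 3 (by norm_num) + 13 * M 1 0 3 1 1 2 (by norm_num) - 4 * M 0 1
    3 0 3 1 (by norm_num) - 14 * M 2 0 2 2 2 1 (by norm_num) + 1 * M 1 1 2 1 4 0 (by norm_num) + 4 *
    M 3 0 1 3 3 0 (by norm_num) - (7 - 7 * Y 1 - 24 * X 1 + 21 * X 1 * Y 1 + 25 * X 1 ^ 2 - 4 * X 1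
    ^ 3) * mono_one (-6) 3 (-5) (-3) (-2) (-19) 17 (-6) 2 (-7) 0 1 4 0 + mo 1 (-19) 17 (-6) 2 (-7) *
    (7 * Y 1 ^ 3 + 3 * X 1 * Y 1 ^ 2 - 28 * X 1 * Y 1 ^ 3 + 17 * X 1 ^ 2 * Y 1 - 27 * X 1 ^ 2 * Y 1
    ^ 2 + 21 * X 1 ^ 2 * Y 1 ^ 3 + 4 * X 1 ^ 3 - 59 * X 1 ^ 3 * Y 1 + 32 * X 1 ^ 3 * Y 1 ^ 2 - 16 *
    X 1 ^ 4 + 67 * X 1 ^ 4 * Y 1 - 4 * X 1 ^ 4 * Y 1 ^ 2 + 24 * X 1 ^ 5 - 25 * X 1 ^ 5 * Y 1 - 16 *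
    X 1 ^ 6 + 4 * X 1 ^ 7) * curve_one

theorem rankTerm_one_nine : rankTerm 5 7 =
    mo 1 (-6) 3 (-5) (-3) (-2) * (10 - 10 * Y 1 - 6 * X 1 - 3 * X 1 * Y 1 - 2 * X 1 ^ 2 + 10 * X 1
      ^ 3) := by
  have e := mo_five (-6) 3 (-6) (-2) (-2)
  norm_num at e
  change mo 5 (-6) 3 (-6) (-2) (-2) * (12 - 12 * Y 5 - 16 * X 5 + 14 * X 5 * Y 5 + 13 * X 5 ^ 2 -
    10 * X 5 ^ 3) = _
  rw [e, X_five, Y_five]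
  have M := mo_one_mono 3 (-2) (-2) (-6) (-6) (-2) 0 (-1) 1 2 (-3) (-1) 1 0 3 (-12) 13 (-5) (-3)
    (-6)
  linear_combination 12 * M 0 0 3 0 3 0 (by norm_num) + 16 * M 1 0 2 0 2 1 (by norm_num) + 12 * M 0
    1 2 2 1 1 (by norm_num) + 13 * M 2 0 1 0 1 2 (by norm_num) + 14 * M 1 1 1 2 0 2 (by norm_num) +
    10 * M 3 0 0 0 0 3 (by norm_num) - (10 - 10 * Y 1 - 6 * X 1 - 3 * X 1 * Y 1 - 2 * X 1 ^ 2 + 10 *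
    X 1 ^ 3) * mono_one (-6) 3 (-5) (-3) (-2) (-12) 13 (-5) (-3) (-6) 0 0 0 2 + mo 1 (-12) 13 (-5)
    (-3) (-6) * (-16 * X 1 + 16 * X 1 * Y 1 + 36 * X 1 ^ 2 - 16 * X 1 ^ 2 * Y 1 - 24 * X 1 ^ 3 + 12
    * X 1 ^ 3 * Y 1 + 4 * X 1 ^ 4) * curve_one

theorem rankTerm_two_nine : rankTerm 1 9 =
    mo 1 (-6) 3 (-5) (-3) (-2) * (13 - 13 * Y 1 - 10 * X 1 - 5 * X 1 * Y 1 + 15 * X 1 ^ 2 - 9 * X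
      1 ^ 3) := by
  rfl

theorem rankTerm_four_nine : rankTerm 4 0 =
    mo 1 (-6) 3 (-5) (-3) (-2) * (8 - 8 * Y 1 - 7 * X 1 + 2 * X 1 * Y 1 - 6 * X 1 ^ 2 - 3 * X 1 ^
      3) := by
  have e := mo_four (-7) 3 (-5) (-2) (-2)
  norm_num at e
  change mo 4 (-7) 3 (-5) (-2) (-2) * (3 - 3 * Y 4 + 7 * X 4 - 2 * X 4 * Y 4 - 27 * X 4 ^ 2 + 14 *
    X 4 ^ 3) = _
  rw [e, X_four, Y_four]
  have M := mo_one_mono (-5) (-2) 3 (-7) (-2) 1 (-1) (-2) 2 0 0 1 (-3) 3 (-1) (-15) 14 (-5) (-1)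
    (-6)
  linear_combination -3 * M 0 0 2 6 0 0 (by norm_num) - 7 * M 1 0 2 4 0 1 (by norm_num) + 3 * M 0 1
    2 3 0 1 (by norm_num) + 27 * M 2 0 2 2 0 2 (by norm_num) + 2 * M 1 1 2 1 0 2 (by norm_num) - 14
    * M 3 0 2 0 0 3 (by norm_num) - (8 - 8 * Y 1 - 7 * X 1 + 2 * X 1 * Y 1 - 6 * X 1 ^ 2 - 3 * X 1 ^
    3) * mono_one (-6) 3 (-5) (-3) (-2) (-15) 14 (-5) (-1) (-6) 0 0 2 1 + mo 1 (-15) 14 (-5) (-1)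
    (-6) * (8 * Y 1 - 8 * Y 1 ^ 2 + 8 * X 1 - 23 * X 1 * Y 1 + 2 * X 1 * Y 1 ^ 2 - 27 * X 1 ^ 2 + 20
    * X 1 ^ 2 * Y 1 + 33 * X 1 ^ 3 - 5 * X 1 ^ 3 * Y 1 - 17 * X 1 ^ 4 + 3 * X 1 ^ 5) * curve_one

theorem crank_base_nine : h ^ 2 * mo 1 0 0 0 (-1) 0 =
    h ^ 14 * (mo 1 (-6) 3 (-5) (-3) (-2) * (1 - Y 1 - 5 * X 1 + 3 * X 1 * Y 1 + 2 * X 1 ^ 2 + X 1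
      ^ 3)) := by
  have hc : ¬ (11 : ℤ) ∣ 1 := by norm_num
  have e : mo 1 0 0 0 (-1) 0 = h ^ 12 * (mo 1 (-6) 3 (-5) (-3) (-2) * fcub 1) := by
    rw [mul_left_comm, h_pow_twelve hc, mo_mul hc]; norm_num
  rw [e, fcub]
  push_cast
  linear_combination h ^ 14 * (1 - 5 * X 1 - Y 1 + 2 * X 1 ^ 2 + 3 * X 1 * Y 1 + X 1 ^ 3) * mono_one
    (-6) 3 (-5) (-3) (-2) (-6) 3 (-5) (-3) (-2) 0 0 0 0 - h ^ 14 * (1 - Y 1 - 5 * X 1 + 3 * X 1 * Y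
    1 + 2 * X 1 ^ 2 + X 1 ^ 3) * mono_one (-6) 3 (-5) (-3) (-2) (-6) 3 (-5) (-3) (-2) 0 0 0 0

theorem crankTerm_zero_nine : crankTerm 5 6 = -4 * mo 1 0 0 0 (-1) 0 := by
  have e := mo_five 0 0 (-1) 0 0
  norm_num at e
  change 4 * mo 5 0 0 (-1) 0 0 = _
  linear_combination (4 : K) * e

theorem crankTerm_one_nine : crankTerm 4 0 = -1 * mo 1 0 0 0 (-1) 0 := by
  have e := mo_four (-1) 0 0 0 0
  norm_num at e
  change mo 4 (-1) 0 0 0 0 = _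
  linear_combination (1 : K) * e

theorem rankTerm_zero_ten : rankTerm (-2) 7 =
    mo 1 (-7) 3 (-6) 0 (-3) * (-10 * Y 1 + 11 * X 1 + 23 * X 1 * Y 1 - 16 * X 1 ^ 2 - 12 * X 1 ^ 2
      * Y 1 + 4 * X 1 ^ 3) := by
  have e := mo_neg_two (-6) 3 (-6) (-2) (-2)
  norm_num at e
  change mo (-2) (-6) 3 (-6) (-2) (-2) * (12 - 12 * Y (-2) - 16 * X (-2) + 14 * X (-2) * Y (-2) +
    13 * X (-2) ^ 2 - 10 * X (-2) ^ 3) = _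
  rw [e, X_neg_two, Y_neg_two]
  have M := mo_one_mono (-2) (-6) (-2) 3 (-6) (-1) 2 0 (-2) 1 1 3 (-1) (-3) 0 (-19) 17 (-6) 3 (-8)
  linear_combination -12 * M 0 0 4 0 0 3 (by norm_num) + 16 * M 1 0 3 1 1 2 (by norm_num) + 12 * M 0
    1 3 0 3 1 (by norm_num) - 13 * M 2 0 2 2 2 1 (by norm_num) - 14 * M 1 1 2 1 4 0 (by norm_num) +
    10 * M 3 0 1 3 3 0 (by norm_num) - (-10 * Y 1 + 11 * X 1 + 23 * X 1 * Y 1 - 16 * X 1 ^ 2 - 12 *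
    X 1 ^ 2 * Y 1 + 4 * X 1 ^ 3) * mono_one (-7) 3 (-6) 0 (-3) (-19) 17 (-6) 3 (-8) 0 0 3 1 + mo 1
    (-19) 17 (-6) 3 (-8) * (-10 * Y 1 ^ 3 - 9 * X 1 * Y 1 ^ 2 + 23 * X 1 * Y 1 ^ 3 + 4 * X 1 ^ 2 * Y
    1 + 26 * X 1 ^ 2 * Y 1 ^ 2 - 12 * X 1 ^ 2 * Y 1 ^ 3 - 12 * X 1 ^ 3 + 12 * X 1 ^ 3 * Y 1 - 41 * X
    1 ^ 3 * Y 1 ^ 2 + 48 * X 1 ^ 4 - 36 * X 1 ^ 4 * Y 1 + 12 * X 1 ^ 4 * Y 1 ^ 2 - 72 * X 1 ^ 5 + 20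
    * X 1 ^ 5 * Y 1 + 48 * X 1 ^ 6 - 12 * X 1 ^ 7) * curve_one

theorem rankTerm_one_ten : rankTerm 5 0 =
    mo 1 (-7) 3 (-6) 0 (-3) * (-8 * Y 1 + 22 * X 1 + 3 * X 1 * Y 1 - 37 * X 1 ^ 2 + 8 * X 1 ^ 2 *
      Y 1 + 12 * X 1 ^ 3) := by
  have e := mo_five (-7) 3 (-5) (-2) (-2)
  norm_num at e
  change mo 5 (-7) 3 (-5) (-2) (-2) * (3 - 3 * Y 5 + 7 * X 5 - 2 * X 5 * Y 5 - 27 * X 5 ^ 2 + 14 *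
    X 5 ^ 3) = _
  rw [e, X_five, Y_five]
  have M := mo_one_mono 3 (-2) (-2) (-5) (-7) (-2) 0 (-1) 1 2 (-3) (-1) 1 0 3 (-16) 18 (-6) 0 (-9)
  linear_combination -3 * M 0 0 3 1 4 0 (by norm_num) + 7 * M 1 0 2 1 3 1 (by norm_num) - 3 * M 0 1
    2 3 2 1 (by norm_num) + 27 * M 2 0 1 1 2 2 (by norm_num) + 2 * M 1 1 1 3 1 2 (by norm_num) + 14
    * M 3 0 0 1 1 3 (by norm_num) - (-8 * Y 1 + 22 * X 1 + 3 * X 1 * Y 1 - 37 * X 1 ^ 2 + 8 * X 1 ^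
    2 * Y 1 + 12 * X 1 ^ 3) * mono_one (-7) 3 (-6) 0 (-3) (-16) 18 (-6) 0 (-9) 0 0 0 3 + mo 1 (-16)
    18 (-6) 0 (-9) * (-22 + 44 * Y 1 - 22 * Y 1 ^ 2 + 125 * X 1 - 169 * X 1 * Y 1 + 44 * X 1 * Y 1 ^
    2 - 292 * X 1 ^ 2 + 247 * X 1 ^ 2 * Y 1 - 26 * X 1 ^ 2 * Y 1 ^ 2 + 358 * X 1 ^ 3 - 173 * X 1 ^ 3
    * Y 1 + 4 * X 1 ^ 3 * Y 1 ^ 2 - 242 * X 1 ^ 4 + 61 * X 1 ^ 4 * Y 1 + 3 * X 1 ^ 4 * Y 1 ^ 2 + 85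
    * X 1 ^ 5 - 10 * X 1 ^ 5 * Y 1 - 12 * X 1 ^ 6) * curve_one

theorem rankTerm_three_ten : rankTerm (-3) 4 =
    mo 1 (-7) 3 (-6) 0 (-3) * (7 * Y 1 + 11 * X 1 - 15 * X 1 * Y 1 - 13 * X 1 ^ 2 + 4 * X 1 ^ 2 *
      Y 1 + 6 * X 1 ^ 3) := by
  have e := mo_neg_three (-6) 2 (-5) (-2) (-2)
  norm_num at e
  change mo (-3) (-6) 2 (-5) (-2) (-2) * (4 - 4 * Y (-3) + 13 * X (-3) + X (-3) * Y (-3) - 14 * X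
    (-3) ^ 2 + 4 * X (-3) ^ 3) = _
  rw [e, X_neg_three, Y_neg_three]
  have M := mo_one_mono (-2) (-5) (-6) (-2) 2 0 1 2 (-1) (-2) (-1) 0 3 1 (-3) (-18) 18 (-7) 1 (-7)
  linear_combination -4 * M 0 0 0 1 2 3 (by norm_num) + 13 * M 1 0 1 2 2 2 (by norm_num) + 4 * M 0 1
    2 2 0 3 (by norm_num) + 14 * M 2 0 2 3 2 1 (by norm_num) + 1 * M 1 1 3 3 0 2 (by norm_num) + 4 *
    M 3 0 3 4 2 0 (by norm_num) - (7 * Y 1 + 11 * X 1 - 15 * X 1 * Y 1 - 13 * X 1 ^ 2 + 4 * X 1 ^ 2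
    * Y 1 + 6 * X 1 ^ 3) * mono_one (-7) 3 (-6) 0 (-3) (-18) 18 (-7) 1 (-7) 1 0 1 2 + mo 1 (-18) 18
    (-7) 1 (-7) * (4 * Y 1 - 8 * Y 1 ^ 2 + 4 * Y 1 ^ 3 + 4 * X 1 - 38 * X 1 * Y 1 + 38 * X 1 * Y 1 ^
    2 - 4 * X 1 * Y 1 ^ 3 - 23 * X 1 ^ 2 + 102 * X 1 ^ 2 * Y 1 - 47 * X 1 ^ 2 * Y 1 ^ 2 + 55 * X 1 ^
    3 - 122 * X 1 ^ 3 * Y 1 + 21 * X 1 ^ 3 * Y 1 ^ 2 - 70 * X 1 ^ 4 + 70 * X 1 ^ 4 * Y 1 + 50 * X 1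
    ^ 5 - 16 * X 1 ^ 5 * Y 1 - 19 * X 1 ^ 6 + 3 * X 1 ^ 7) * curve_one

theorem rankTerm_four_ten : rankTerm 4 9 =
    mo 1 (-7) 3 (-6) 0 (-3) * (-13 * Y 1 + 22 * X 1 + 20 * X 1 * Y 1 - 45 * X 1 ^ 2 - 9 * X 1 ^ 2
      * Y 1 + 25 * X 1 ^ 3) := by
  have e := mo_four (-6) 3 (-5) (-3) (-2)
  norm_num at e
  change mo 4 (-6) 3 (-5) (-3) (-2) * (13 - 13 * Y 4 - 10 * X 4 - 5 * X 4 * Y 4 + 15 * X 4 ^ 2 - 9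
    * X 4 ^ 3) = _
  rw [e, X_four, Y_four]
  have M := mo_one_mono (-5) (-2) 3 (-6) (-3) 1 (-1) (-2) 2 0 0 1 (-3) 3 (-1) (-16) 16 (-6) 1 (-8)
  linear_combination -13 * M 0 0 2 7 0 0 (by norm_num) + 10 * M 1 0 2 5 0 1 (by norm_num) + 13 * M 0
    1 2 4 0 1 (by norm_num) - 15 * M 2 0 2 3 0 2 (by norm_num) + 5 * M 1 1 2 2 0 2 (by norm_num) + 9
    * M 3 0 2 1 0 3 (by norm_num) - (-13 * Y 1 + 22 * X 1 + 20 * X 1 * Y 1 - 45 * X 1 ^ 2 - 9 * X 1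
    ^ 2 * Y 1 + 25 * X 1 ^ 3) * mono_one (-7) 3 (-6) 0 (-3) (-16) 16 (-6) 1 (-8) 0 0 1 2 + mo 1
    (-16) 16 (-6) 1 (-8) * (-13 * Y 1 + 13 * Y 1 ^ 2 + 9 * X 1 + 50 * X 1 * Y 1 - 20 * X 1 * Y 1 ^ 2
    - 27 * X 1 ^ 2 - 79 * X 1 ^ 2 * Y 1 + 9 * X 1 ^ 2 * Y 1 ^ 2 + 18 * X 1 ^ 3 + 60 * X 1 ^ 3 * Y 1
    + 18 * X 1 ^ 4 - 18 * X 1 ^ 4 * Y 1 - 27 * X 1 ^ 5 + 9 * X 1 ^ 6) * curve_one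

theorem crank_base_ten : h ^ 2 * mo 1 0 0 0 0 (-1) =
    h ^ 14 * (mo 1 (-7) 3 (-6) 0 (-3) * (Y 1 + X 1 * Y 1 - 5 * X 1 ^ 2 - X 1 ^ 2 * Y 1 + 4 * X 1 ^
      3)) := by
  have hc : ¬ (11 : ℤ) ∣ 1 := by norm_num
  have e : mo 1 0 0 0 0 (-1) = h ^ 12 * (mo 1 (-6) 3 (-5) (-2) (-3) * fcub 1) := by
    rw [mul_left_comm, h_pow_twelve hc, mo_mul hc]; norm_num
  rw [e, fcub]
  push_cast
  linear_combination h ^ 14 * (1 - 5 * X 1 - Y 1 + 2 * X 1 ^ 2 + 3 * X 1 * Y 1 + X 1 ^ 3) * mono_one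
    (-6) 3 (-5) (-2) (-3) (-10) 8 (-6) 0 (-5) 0 1 1 0 - h ^ 14 * (Y 1 + X 1 * Y 1 - 5 * X 1 ^ 2 - X
    1 ^ 2 * Y 1 + 4 * X 1 ^ 3) * mono_one (-7) 3 (-6) 0 (-3) (-10) 8 (-6) 0 (-5) 0 0 0 1 + h ^ 14 *
    mo 1 (-10) 8 (-6) 0 (-5) * (5 * X 1 - 4 * X 1 ^ 2) * curve_one

theorem crankTerm_zero_ten : crankTerm 5 0 = 1 * mo 1 0 0 0 0 (-1) := by
  have e := mo_five (-1) 0 0 0 0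
  norm_num at e
  change mo 5 (-1) 0 0 0 0 = _
  linear_combination (1 : K) * e

theorem crankTerm_two_ten : crankTerm 3 4 = 5 * mo 1 0 0 0 0 (-1) := by
  have e := mo_three 0 (-1) 0 0 0
  norm_num [mo_neg_three] at e
  change 5 * mo 3 0 (-1) 0 0 0 = _
  linear_combination (5 : K) * e

theorem crankTerm_three_ten : crankTerm 2 6 = -4 * mo 1 0 0 0 0 (-1) := by
  have e := mo_two 0 0 (-1) 0 0
  norm_num at e
  change 4 * mo 2 0 0 (-1) 0 0 = _
  linear_combination (4 : K) * e

theorem seven_a :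
    2 * (h ^ 14 * rankTerm (-2) 9) + h ^ 2 * crankTerm 5 9 - h ^ 2 * crankTerm 4 4 = 11 * (h ^ 14
      * (3 * mo 1 (-1) (-3) (-3) (-3) (-3) + mo 1 (-3) (-2) (-6) (-2) 0 - mo 1 (-3) (-2) (-2) (-3)
      (-3))) := by
  rw [rankTerm_zero_seven, crankTerm_zero_seven, crankTerm_one_seven]
  linear_combination -7 * crank_base_seven + h ^ 14 * (11 - 11 * Y 1 - 33 * X 1 + 11 * X 1 * Y 1 +
    44 * X 1 ^ 2 - 33 * X 1 ^ 3) * mono_one (-6) 3 (-6) (-2) (-2) (-9) 6 (-6) (-1) (-3) 0 0 1 0 - 33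
    * h ^ 14 * mono_one (-1) (-3) (-3) (-3) (-3) (-9) 6 (-6) (-1) (-3) 2 1 1 0 - 11 * h ^ 14 *
    mono_one (-3) (-2) (-6) (-2) 0 (-9) 6 (-6) (-1) (-3) 0 0 1 1 + 11 * h ^ 14 * mono_one (-3) (-2)
    (-2) (-3) (-3) (-9) 6 (-6) (-1) (-3) 2 2 0 0 - h ^ 14 * mo 1 (-9) 6 (-6) (-1) (-3) * (-11 * X 1)
    * curve_one

theorem seven_b :
    h ^ 14 * rankTerm (-3) 0 - h ^ 14 * rankTerm 4 4 + 2 * (h ^ 2 * crankTerm 5 9) = 11 * (h ^ 14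
      * (mo 1 (-2) (-3) (-3) (-4) (-1) + mo 1 (-2) (-3) (-4) (-1) (-3))) := by
  rw [crankTerm_zero_seven, rankTerm_three_seven, rankTerm_four_seven]
  linear_combination -4 * crank_base_seven + h ^ 14 * (22 * X 1 - 11 * X 1 * Y 1 - 33 * X 1 ^ 2 + 11
    * X 1 ^ 3) * mono_one (-6) 3 (-6) (-2) (-2) (-9) 6 (-6) (-1) (-3) 0 0 1 0 - 11 * h ^ 14 *
    mono_one (-2) (-3) (-3) (-4) (-1) (-9) 6 (-6) (-1) (-3) 1 2 1 0 - 11 * h ^ 14 * mono_one (-2)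
    (-3) (-4) (-1) (-3) (-9) 6 (-6) (-1) (-3) 2 0 0 1 - h ^ 14 * mo 1 (-9) 6 (-6) (-1) (-3) * (11 *
    X 1) * curve_one

theorem seven_c :
    -(h ^ 14 * rankTerm 1 7) + 2 * (h ^ 14 * rankTerm 4 4) - 2 * (h ^ 2 * crankTerm 5 9) = 11 * (h
      ^ 14 * (2 * mo 1 (-1) (-1) (-3) (-4) (-4) + mo 1 (-2) (-1) (-4) (-2) (-4))) := by
  rw [crankTerm_zero_seven, rankTerm_two_seven, rankTerm_four_seven]
  linear_combination 4 * crank_base_seven + h ^ 14 * (-22 * X 1 * Y 1 + 33 * X 1 ^ 2) * mono_one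
    (-6) 3 (-6) (-2) (-2) (-9) 8 (-6) (-2) (-4) 0 0 0 1 - 22 * h ^ 14 * mono_one (-1) (-1) (-3) (-4)
    (-4) (-9) 8 (-6) (-2) (-4) 2 1 1 0 - 11 * h ^ 14 * mono_one (-2) (-1) (-4) (-2) (-4) (-9) 8 (-6)
    (-2) (-4) 2 0 0 1 - h ^ 14 * mo 1 (-9) 8 (-6) (-2) (-4) * (-22 * X 1) * curve_one

theorem eight_a :
    -(h ^ 14 * rankTerm 5 3) + h ^ 14 * rankTerm 1 8 + h ^ 2 * crankTerm 5 3 - h ^ 2 * crankTerm 4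
      2 = 11 * (h ^ 14 * (mo 1 (-2) (-1) (-3) (-4) (-3) + mo 1 (-2) (-4) (-1) (-3) (-3))) := by
  rw [crankTerm_zero_eight, rankTerm_one_eight, crankTerm_one_eight, rankTerm_two_eight]
  linear_combination -5 * crank_base_eight + h ^ 14 * (-11 * Y 1 + 22 * X 1 - 22 * X 1 ^ 2 + 11 * X
    1 ^ 2 * Y 1) * mono_one (-6) 3 (-6) (-1) (-3) (-12) 11 (-6) 0 (-6) 0 0 1 1 - 11 * h ^ 14 *
    mono_one (-2) (-1) (-3) (-4) (-3) (-12) 11 (-6) 0 (-6) 1 2 2 0 - 11 * h ^ 14 * mono_one (-2)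
    (-4) (-1) (-3) (-3) (-12) 11 (-6) 0 (-6) 2 3 0 1 - h ^ 14 * mo 1 (-12) 11 (-6) 0 (-6) * (-11 * Y
    1 + 11 * X 1 - 33 * X 1 ^ 2 + 11 * X 1 ^ 2 * Y 1 + 33 * X 1 ^ 3 - 11 * X 1 ^ 4) * curve_one

theorem eight_b :
    h ^ 14 * rankTerm 1 8 - h ^ 14 * rankTerm (-3) 5 + 2 * (h ^ 2 * crankTerm 5 3) = 11 * (h ^ 14
      * (mo 1 0 (-3) (-2) (-4) (-4) + mo 1 (-1) (-1) (-3) (-3) (-5) + mo 1 (-2) (-1) (-3) (-4)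
      (-3))) := by
  rw [crankTerm_zero_eight, rankTerm_two_eight, rankTerm_three_eight]
  linear_combination -6 * crank_base_eight + h ^ 14 * (-11 * Y 1 + 11 * X 1 - 11 * X 1 * Y 1 + 11 *
    X 1 ^ 2 + 11 * X 1 ^ 2 * Y 1 - 11 * X 1 ^ 3) * mono_one (-6) 3 (-6) (-1) (-3) (-9) 8 (-6) (-1)
    (-5) 0 0 0 1 - 11 * h ^ 14 * mono_one 0 (-3) (-2) (-4) (-4) (-9) 8 (-6) (-1) (-5) 2 2 1 0 - 11 *
    h ^ 14 * mono_one (-1) (-1) (-3) (-3) (-5) (-9) 8 (-6) (-1) (-5) 2 1 1 0 - 11 * h ^ 14 *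
    mono_one (-2) (-1) (-3) (-4) (-3) (-9) 8 (-6) (-1) (-5) 1 2 1 0 - h ^ 14 * mo 1 (-9) 8 (-6) (-1)
    (-5) * (-11 - 11 * X 1 + 11 * X 1 ^ 2) * curve_one

theorem eight_c :
    h ^ 14 * rankTerm 5 3 - h ^ 14 * rankTerm 1 8 + h ^ 14 * rankTerm (-3) 5 - h ^ 14 * rankTerm 4
      2 + h ^ 2 * crankTerm 5 3 + h ^ 2 * crankTerm 4 2 = 11 * (h ^ 14 * (2 * mo 1 (-1) (-3) (-3)
      (-2) (-4) + mo 1 (-1) (-4) (-1) (-2) (-5))) := by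
  rw [crankTerm_zero_eight, rankTerm_one_eight, crankTerm_one_eight, rankTerm_two_eight,
    rankTerm_three_eight, rankTerm_four_eight]
  linear_combination -crank_base_eight + h ^ 14 * (33 * X 1 ^ 2 - 11 * X 1 ^ 2 * Y 1 - 22 * X 1 ^ 3)
    * mono_one (-6) 3 (-6) (-1) (-3) (-9) 6 (-6) 0 (-4) 0 0 1 0 - 22 * h ^ 14 * mono_one (-1) (-3)
    (-3) (-2) (-4) (-9) 6 (-6) 0 (-4) 2 1 1 0 - 11 * h ^ 14 * mono_one (-1) (-4) (-1) (-2) (-5) (-9)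
    6 (-6) 0 (-4) 3 2 0 0 - h ^ 14 * mo 1 (-9) 6 (-6) 0 (-4) * (11 * X 1 ^ 2) * curve_one

theorem eight_d :
    -(h ^ 14 * rankTerm (-2) 1) + h ^ 14 * rankTerm 5 3 + 2 * (h ^ 14 * rankTerm 1 8) - 2 * (h ^
      14 * rankTerm (-3) 5) - h ^ 14 * rankTerm 4 2 = 11 * (h ^ 14 * (mo 1 0 (-2) (-4) (-4) (-3) +
      2 * mo 1 (-1) (-1) (-3) (-3) (-5) + mo 1 (-2) (-1) (-3) (-4) (-3))) := by
  rw [rankTerm_zero_eight, rankTerm_one_eight, rankTerm_two_eight, rankTerm_three_eight,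
    rankTerm_four_eight]
  linear_combination h ^ 14 * (-22 * Y 1 + 22 * X 1 - 11 * X 1 ^ 2 + 11 * X 1 ^ 3) * mono_one (-6) 3
    (-6) (-1) (-3) (-9) 8 (-6) (-1) (-5) 0 0 0 1 - 11 * h ^ 14 * mono_one 0 (-2) (-4) (-4) (-3) (-9)
    8 (-6) (-1) (-5) 1 1 2 0 - 22 * h ^ 14 * mono_one (-1) (-1) (-3) (-3) (-5) (-9) 8 (-6) (-1) (-5)
    2 1 1 0 - 11 * h ^ 14 * mono_one (-2) (-1) (-3) (-4) (-3) (-9) 8 (-6) (-1) (-5) 1 2 1 0 - h ^ 14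
    * mo 1 (-9) 8 (-6) (-1) (-5) * (-22 + 11 * X 1 - 11 * X 1 ^ 2) * curve_one

theorem eight_e :
    2 * (h ^ 14 * rankTerm (-2) 1) + 2 * (h ^ 14 * rankTerm 5 3) - 2 * (h ^ 14 * rankTerm 1 8) + 2
      * (h ^ 2 * crankTerm 5 3) = 11 * (h ^ 14 * (2 * mo 1 0 (-4) (-4) (-3) (-2) + 2 * mo 1 (-1)
      (-2) 0 (-6) (-4))) := by
  rw [rankTerm_zero_eight, crankTerm_zero_eight, rankTerm_one_eight, rankTerm_two_eight]
  linear_combination -6 * crank_base_eight + h ^ 14 * (22 * Y 1 - 22 * X 1 - 44 * X 1 * Y 1 + 88 * X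
    1 ^ 2 - 44 * X 1 ^ 3) * mono_one (-6) 3 (-6) (-1) (-3) (-12) 13 (-6) (-1) (-7) 0 0 0 2 - 22 * h
    ^ 14 * mono_one 0 (-4) (-4) (-3) (-2) (-12) 13 (-6) (-1) (-7) 1 1 1 2 - 22 * h ^ 14 * mono_one
    (-1) (-2) 0 (-6) (-4) (-12) 13 (-6) (-1) (-7) 2 4 1 0 - h ^ 14 * mo 1 (-12) 13 (-6) (-1) (-7) *
    (22 - 22 * Y 1 - 132 * X 1 + 66 * X 1 * Y 1 + 242 * X 1 ^ 2 - 22 * X 1 ^ 2 * Y 1 - 176 * X 1 ^ 3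
    + 44 * X 1 ^ 4) * curve_one

theorem eight_f :
    -(h ^ 14 * rankTerm 1 8) + 2 * (h ^ 14 * rankTerm (-3) 5) - h ^ 14 * rankTerm 4 2 + 3 * (h ^ 2
      * crankTerm 5 3) - h ^ 2 * crankTerm 4 2 = 11 * (h ^ 14 * (4 * mo 1 (-1) (-3) (-3) (-2) (-4)
      + mo 1 (-2) (-1) (-3) (-4) (-3) + mo 1 (-2) (-2) (-1) (-4) (-4))) := by
  rw [crankTerm_zero_eight, crankTerm_one_eight, rankTerm_two_eight, rankTerm_three_eight,
    rankTerm_four_eight]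
  linear_combination -11 * crank_base_eight + h ^ 14 * (-11 * Y 1 + 11 * X 1 + 55 * X 1 ^ 2 - 55 * X
    1 ^ 3) * mono_one (-6) 3 (-6) (-1) (-3) (-9) 8 (-6) (-1) (-5) 0 0 0 1 - 44 * h ^ 14 * mono_one
    (-1) (-3) (-3) (-2) (-4) (-9) 8 (-6) (-1) (-5) 2 1 0 1 - 11 * h ^ 14 * mono_one (-2) (-1) (-3)
    (-4) (-3) (-9) 8 (-6) (-1) (-5) 1 2 1 0 - 11 * h ^ 14 * mono_one (-2) (-2) (-1) (-4) (-4) (-9) 8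
    (-6) (-1) (-5) 2 3 0 0 - h ^ 14 * mo 1 (-9) 8 (-6) (-1) (-5) * (-11) * curve_one

theorem eight_g :
    -(h ^ 14 * rankTerm 5 3) + h ^ 14 * rankTerm (-3) 5 + 2 * (h ^ 2 * crankTerm 5 3) - 2 * (h ^ 2
      * crankTerm 4 2) = 11 * (h ^ 14 * (mo 1 0 (-3) (-2) (-4) (-4) + 2 * mo 1 (-1) (-3) (-3) (-2)
      (-4) + mo 1 (-2) (-1) (-3) (-4) (-3))) := by
  rw [crankTerm_zero_eight, rankTerm_one_eight, crankTerm_one_eight, rankTerm_three_eight]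
  linear_combination -10 * crank_base_eight + h ^ 14 * (-11 * Y 1 + 11 * X 1 + 22 * X 1 ^ 2 + 11 * X
    1 ^ 2 * Y 1 - 33 * X 1 ^ 3) * mono_one (-6) 3 (-6) (-1) (-3) (-9) 8 (-6) (-1) (-5) 0 0 0 1 - 11
    * h ^ 14 * mono_one 0 (-3) (-2) (-4) (-4) (-9) 8 (-6) (-1) (-5) 2 2 1 0 - 22 * h ^ 14 * mono_one
    (-1) (-3) (-3) (-2) (-4) (-9) 8 (-6) (-1) (-5) 2 1 0 1 - 11 * h ^ 14 * mono_one (-2) (-1) (-3)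
    (-4) (-3) (-9) 8 (-6) (-1) (-5) 1 2 1 0 - h ^ 14 * mo 1 (-9) 8 (-6) (-1) (-5) * (-11 + 11 * X 1
    ^ 2) * curve_one

theorem eight_h :
    h ^ 14 * rankTerm (-2) 1 - h ^ 14 * rankTerm 5 3 + h ^ 14 * rankTerm 4 2 + 4 * (h ^ 2 *
      crankTerm 5 3) = 11 * (h ^ 14 * (2 * mo 1 0 (-3) (-2) (-4) (-4) + mo 1 (-1) (-3) (-3) (-2)
      (-4))) := by
  rw [rankTerm_zero_eight, crankTerm_zero_eight, rankTerm_one_eight, rankTerm_four_eight]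
  linear_combination -12 * crank_base_eight + h ^ 14 * (-22 * X 1 * Y 1 + 33 * X 1 ^ 2 + 22 * X 1 ^
    2 * Y 1 - 33 * X 1 ^ 3) * mono_one (-6) 3 (-6) (-1) (-3) (-9) 8 (-6) (-1) (-5) 0 0 0 1 - 22 * h
    ^ 14 * mono_one 0 (-3) (-2) (-4) (-4) (-9) 8 (-6) (-1) (-5) 2 2 1 0 - 11 * h ^ 14 * mono_one
    (-1) (-3) (-3) (-2) (-4) (-9) 8 (-6) (-1) (-5) 2 1 0 1 - h ^ 14 * mo 1 (-9) 8 (-6) (-1) (-5) *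
    (-22 * X 1 + 22 * X 1 ^ 2) * curve_one

theorem nine_a :
    -(h ^ 14 * rankTerm 5 7) + h ^ 14 * rankTerm 1 9 + h ^ 2 * crankTerm 5 6 - h ^ 2 * crankTerm 4
      0 = 11 * (h ^ 14 * (2 * mo 1 (-1) (-3) (-2) (-4) (-3) + mo 1 (-2) (-3) (-3) (-2) (-3))) :=
      by
  rw [crankTerm_zero_nine, rankTerm_one_nine, crankTerm_one_nine, rankTerm_two_nine]
  linear_combination -3 * crank_base_nine + h ^ 14 * (11 * X 1 - 11 * X 1 * Y 1 + 11 * X 1 ^ 2 - 22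
    * X 1 ^ 3) * mono_one (-6) 3 (-5) (-3) (-2) (-9) 6 (-5) (-2) (-3) 0 0 1 0 - 22 * h ^ 14 *
    mono_one (-1) (-3) (-2) (-4) (-3) (-9) 6 (-5) (-2) (-3) 2 1 1 0 - 11 * h ^ 14 * mono_one (-2)
    (-3) (-3) (-2) (-3) (-9) 6 (-5) (-2) (-3) 2 0 0 1 - h ^ 14 * mo 1 (-9) 6 (-5) (-2) (-3) * (11 *
    X 1) * curve_one

theorem nine_b :
    h ^ 14 * rankTerm 4 0 + 2 * (h ^ 2 * crankTerm 5 6) = 11 * (h ^ 14 * (mo 1 (-1) (-3) (-2) (-4)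
      (-3) + 2 * mo 1 (-2) (-3) (-3) (-2) (-3) + mo 1 (-3) (-1) (-3) (-4) (-2))) := by
  rw [crankTerm_zero_nine, rankTerm_four_nine]
  linear_combination -8 * crank_base_nine + h ^ 14 * (33 * X 1 - 22 * X 1 * Y 1 - 22 * X 1 ^ 2 - 11
    * X 1 ^ 3) * mono_one (-6) 3 (-5) (-3) (-2) (-9) 6 (-5) (-2) (-3) 0 0 1 0 - 11 * h ^ 14 *
    mono_one (-1) (-3) (-2) (-4) (-3) (-9) 6 (-5) (-2) (-3) 2 1 1 0 - 22 * h ^ 14 * mono_one (-2)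
    (-3) (-3) (-2) (-3) (-9) 6 (-5) (-2) (-3) 2 0 0 1 - 11 * h ^ 14 * mono_one (-3) (-1) (-3) (-4)
    (-2) (-9) 6 (-5) (-2) (-3) 1 1 1 0 - h ^ 14 * mo 1 (-9) 6 (-5) (-2) (-3) * (22 * X 1) *
    curve_one

theorem nine_c :
    h ^ 14 * rankTerm 5 7 - h ^ 14 * rankTerm 1 9 + h ^ 14 * rankTerm 4 0 + h ^ 2 * crankTerm 5 6
      + h ^ 2 * crankTerm 4 0 = 11 * (h ^ 14 * (mo 1 (-2) (-3) (-2) (-5) (-1) + mo 1 (-2) (-3)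
      (-3) (-2) (-3))) := by
  rw [crankTerm_zero_nine, rankTerm_one_nine, crankTerm_one_nine, rankTerm_two_nine,
    rankTerm_four_nine]
  linear_combination -5 * crank_base_nine + h ^ 14 * (22 * X 1 - 11 * X 1 * Y 1 - 33 * X 1 ^ 2 + 11
    * X 1 ^ 3) * mono_one (-6) 3 (-5) (-3) (-2) (-9) 6 (-5) (-2) (-3) 0 0 1 0 - 11 * h ^ 14 *
    mono_one (-2) (-3) (-2) (-5) (-1) (-9) 6 (-5) (-2) (-3) 1 2 1 0 - 11 * h ^ 14 * mono_one (-2)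
    (-3) (-3) (-2) (-3) (-9) 6 (-5) (-2) (-3) 2 0 0 1 - h ^ 14 * mo 1 (-9) 6 (-5) (-2) (-3) * (11 *
    X 1) * curve_one

theorem nine_d :
    2 * (h ^ 14 * rankTerm (-2) 4) + h ^ 14 * rankTerm 5 7 - h ^ 14 * rankTerm 1 9 + 3 * (h ^ 2 *
      crankTerm 5 6) - h ^ 2 * crankTerm 4 0 = 11 * (h ^ 14 * (mo 1 (-1) (-2) (-4) (-4) (-2) + 2 *
      mo 1 (-2) (-1) (-3) (-3) (-4) + mo 1 (-3) (-1) (-3) (-4) (-2))) := by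
  rw [rankTerm_zero_nine, crankTerm_zero_nine, rankTerm_one_nine, crankTerm_one_nine,
    rankTerm_two_nine]
  linear_combination -11 * crank_base_nine - 11 * h ^ 14 * mono_one (-1) (-2) (-4) (-4) (-2) (-6) 3
    (-5) (-3) (-2) 1 0 1 0 - 22 * h ^ 14 * mono_one (-2) (-1) (-3) (-3) (-4) (-6) 3 (-5) (-3) (-2) 2
    0 0 0 - 11 * h ^ 14 * mono_one (-3) (-1) (-3) (-4) (-2) (-6) 3 (-5) (-3) (-2) 1 1 0 0

theorem nine_e :
    -(h ^ 14 * rankTerm 5 7) + 2 * (h ^ 14 * rankTerm 1 9) - 2 * (h ^ 14 * rankTerm 4 0) = 11 * (h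
      ^ 14 * (mo 1 (-1) (-3) (-2) (-4) (-3) + mo 1 (-2) (-1) (-3) (-3) (-4) + mo 1 (-2) (-2) 0
      (-6) (-3))) := by
  rw [rankTerm_one_nine, rankTerm_two_nine, rankTerm_four_nine]
  linear_combination h ^ 14 * (-11 * X 1 * Y 1 + 44 * X 1 ^ 2 - 22 * X 1 ^ 3) * mono_one (-6) 3 (-5)
    (-3) (-2) (-9) 8 (-5) (-3) (-4) 0 0 0 1 - 11 * h ^ 14 * mono_one (-1) (-3) (-2) (-4) (-3) (-9) 8
    (-5) (-3) (-4) 2 1 0 1 - 11 * h ^ 14 * mono_one (-2) (-1) (-3) (-3) (-4) (-9) 8 (-5) (-3) (-4) 2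
    0 0 1 - 11 * h ^ 14 * mono_one (-2) (-2) 0 (-6) (-3) (-9) 8 (-5) (-3) (-4) 2 3 0 0 - h ^ 14 * mo
    1 (-9) 8 (-5) (-3) (-4) * (-11 * X 1) * curve_one

theorem ten_a :
    -(h ^ 14 * rankTerm (-2) 7) + h ^ 14 * rankTerm 5 0 - 2 * (h ^ 2 * crankTerm 5 0) = 11 * (h ^
      14 * (mo 1 (-1) (-3) (-2) (-3) (-4) + mo 1 (-2) (-5) (-3) 0 (-3))) := by
  rw [rankTerm_zero_ten, crankTerm_zero_ten, rankTerm_one_ten]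
  linear_combination -2 * crank_base_ten + h ^ 14 * (11 * X 1 - 22 * X 1 * Y 1 - 11 * X 1 ^ 2 + 22 *
    X 1 ^ 2 * Y 1) * mono_one (-7) 3 (-6) 0 (-3) (-13) 11 (-6) 1 (-6) 0 0 1 1 - 11 * h ^ 14 *
    mono_one (-1) (-3) (-2) (-3) (-4) (-13) 11 (-6) 1 (-6) 2 2 2 0 - 11 * h ^ 14 * mono_one (-2)
    (-5) (-3) 0 (-3) (-13) 11 (-6) 1 (-6) 2 1 0 2 - h ^ 14 * mo 1 (-13) 11 (-6) 1 (-6) * (11 * X 1 -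
    22 * X 1 * Y 1 - 33 * X 1 ^ 2 + 22 * X 1 ^ 2 * Y 1 + 33 * X 1 ^ 3 - 11 * X 1 ^ 4) * curve_one

theorem ten_b :
    h ^ 14 * rankTerm (-3) 4 - h ^ 14 * rankTerm 4 9 - h ^ 2 * crankTerm 3 4 + h ^ 2 * crankTerm 2
      6 = 11 * (h ^ 14 * (mo 1 (-1) (-3) (-2) (-3) (-4) + mo 1 (-2) (-2) 0 (-5) (-4) + 2 * mo 1
      (-2) (-3) (-3) (-1) (-4))) := by
  rw [crankTerm_two_ten, rankTerm_three_ten, crankTerm_three_ten, rankTerm_four_ten]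
  linear_combination -9 * crank_base_ten + h ^ 14 * (11 * Y 1 - 11 * X 1 - 44 * X 1 * Y 1 + 77 * X 1
    ^ 2 + 22 * X 1 ^ 2 * Y 1 - 55 * X 1 ^ 3) * mono_one (-7) 3 (-6) 0 (-3) (-13) 13 (-6) 0 (-7) 0 0
    0 2 - 11 * h ^ 14 * mono_one (-1) (-3) (-2) (-3) (-4) (-13) 13 (-6) 0 (-7) 2 2 1 1 - 11 * h ^ 14
    * mono_one (-2) (-2) 0 (-5) (-4) (-13) 13 (-6) 0 (-7) 2 4 1 0 - 22 * h ^ 14 * mono_one (-2) (-3)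
    (-3) (-1) (-4) (-13) 13 (-6) 0 (-7) 2 1 0 2 - h ^ 14 * mo 1 (-13) 13 (-6) 0 (-7) * (11 - 11 * Y
    1 - 77 * X 1 + 44 * X 1 * Y 1 + 154 * X 1 ^ 2 - 22 * X 1 ^ 2 * Y 1 - 121 * X 1 ^ 3 + 33 * X 1 ^
    4) * curve_one

theorem ten_c :
    3 * (h ^ 14 * rankTerm (-2) 7) - h ^ 14 * rankTerm 5 0 + h ^ 14 * rankTerm (-3) 4 - h ^ 14 *
      rankTerm 4 9 + 2 * (h ^ 2 * crankTerm 5 0) = 11 * (h ^ 14 * (3 * mo 1 (-1) (-4) (-4) (-2)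
      (-2) + mo 1 (-2) (-3) (-3) (-1) (-4))) := by
  rw [rankTerm_zero_ten, crankTerm_zero_ten, rankTerm_one_ten, rankTerm_three_ten,
    rankTerm_four_ten]
  linear_combination 2 * crank_base_ten - 33 * h ^ 14 * mono_one (-1) (-4) (-4) (-2) (-2) (-7) 3
    (-6) 0 (-3) 1 1 1 0 - 11 * h ^ 14 * mono_one (-2) (-3) (-3) (-1) (-4) (-7) 3 (-6) 0 (-3) 2 1 0 0

theorem ten_d :
    -(h ^ 14 * rankTerm 5 0) + h ^ 14 * rankTerm (-3) 4 - 4 * (h ^ 2 * crankTerm 5 0) = 11 * (h ^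
      14 * (mo 1 (-1) (-4) (-4) (-2) (-2) + mo 1 (-2) (-2) 0 (-5) (-4))) := by
  rw [crankTerm_zero_ten, rankTerm_one_ten, rankTerm_three_ten]
  linear_combination -4 * crank_base_ten + h ^ 14 * (11 * Y 1 - 11 * X 1 - 22 * X 1 * Y 1 + 44 * X 1
    ^ 2 - 22 * X 1 ^ 3) * mono_one (-7) 3 (-6) 0 (-3) (-13) 13 (-6) 0 (-7) 0 0 0 2 - 11 * h ^ 14 *
    mono_one (-1) (-4) (-4) (-2) (-2) (-13) 13 (-6) 0 (-7) 1 1 1 2 - 11 * h ^ 14 * mono_one (-2)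
    (-2) 0 (-5) (-4) (-13) 13 (-6) 0 (-7) 2 4 1 0 - h ^ 14 * mo 1 (-13) 13 (-6) 0 (-7) * (11 - 11 *
    Y 1 - 66 * X 1 + 33 * X 1 * Y 1 + 121 * X 1 ^ 2 - 11 * X 1 ^ 2 * Y 1 - 88 * X 1 ^ 3 + 22 * X 1 ^
    4) * curve_one

theorem ten_e :
    -(h ^ 14 * rankTerm (-2) 7) + h ^ 14 * rankTerm 5 0 - h ^ 14 * rankTerm (-3) 4 + h ^ 14 *
      rankTerm 4 9 - 4 * (h ^ 2 * crankTerm 5 0) = 11 * (h ^ 14 * (2 * mo 1 (-1) (-2) (-4) (-3)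
      (-3) + mo 1 (-1) (-3) (-2) (-3) (-4))) := by
  rw [rankTerm_zero_ten, crankTerm_zero_ten, rankTerm_one_ten, rankTerm_three_ten,
    rankTerm_four_ten]
  linear_combination -4 * crank_base_ten + h ^ 14 * (-22 * Y 1 + 22 * X 1 + 11 * X 1 * Y 1 - 33 * X
    1 ^ 2 + 11 * X 1 ^ 2 * Y 1 + 11 * X 1 ^ 3) * mono_one (-7) 3 (-6) 0 (-3) (-10) 8 (-6) 0 (-5) 0 0
    0 1 - 22 * h ^ 14 * mono_one (-1) (-2) (-4) (-3) (-3) (-10) 8 (-6) 0 (-5) 1 1 2 0 - 11 * h ^ 14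
    * mono_one (-1) (-3) (-2) (-3) (-4) (-10) 8 (-6) 0 (-5) 2 2 1 0 - h ^ 14 * mo 1 (-10) 8 (-6) 0
    (-5) * (-22 + 33 * X 1 - 11 * X 1 ^ 2) * curve_one

theorem ten_f :
    -(h ^ 14 * rankTerm (-2) 7) + 2 * (h ^ 14 * rankTerm 5 0) - h ^ 14 * rankTerm (-3) 4 - h ^ 2 *
      crankTerm 3 4 + h ^ 2 * crankTerm 2 6 = 11 * (h ^ 14 * (mo 1 (-1) (-2) (-4) (-3) (-3) + 3 *
      mo 1 (-1) (-3) (-2) (-3) (-4) + mo 1 (-3) (-1) (-3) (-3) (-3))) := by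
  rw [rankTerm_zero_ten, rankTerm_one_ten, crankTerm_two_ten, rankTerm_three_ten,
    crankTerm_three_ten]
  linear_combination -9 * crank_base_ten + h ^ 14 * (-22 * Y 1 + 22 * X 1 - 11 * X 1 * Y 1 + 33 * X
    1 ^ 2 * Y 1 - 22 * X 1 ^ 3) * mono_one (-7) 3 (-6) 0 (-3) (-10) 8 (-6) 0 (-5) 0 0 0 1 - 11 * h ^
    14 * mono_one (-1) (-2) (-4) (-3) (-3) (-10) 8 (-6) 0 (-5) 1 1 2 0 - 33 * h ^ 14 * mono_one (-1)
    (-3) (-2) (-3) (-4) (-10) 8 (-6) 0 (-5) 2 2 1 0 - 11 * h ^ 14 * mono_one (-3) (-1) (-3) (-3)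
    (-3) (-10) 8 (-6) 0 (-5) 1 2 1 0 - h ^ 14 * mo 1 (-10) 8 (-6) 0 (-5) * (-22 + 22 * X 1 ^ 2) *
    curve_one

theorem coeff_natCast_mul (k : ℕ) (f : K) (i : ℤ) : ((k : K) * f).coeff i = k * f.coeff i := by
  rw [← nsmul_eq_mul, HahnSeries.coeff_nsmul, Pi.smul_apply, nsmul_eq_mul]

theorem coeff_ofNat_mul (k : ℕ) [k.AtLeastTwo] (f : K) (i : ℤ) :
    ((ofNat(k) : K) * f).coeff i = ofNat(k) * f.coeff i :=
  coeff_natCast_mul k f i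

theorem coeff_sum {ι : Type*} (s : Finset ι) (f : ι → K) (i : ℤ) :
    (∑ j ∈ s, f j).coeff i = ∑ j ∈ s, (f j).coeff i :=
  map_sum (HahnSeries.coeff.addMonoidHom i) f s

theorem Supp.coeff_eq_zero {m i : ℤ} {f : K} (hf : Supp m f) (h : ¬ (264 : ℤ) ∣ i - m) :
    f.coeff i = 0 :=
  by_contra fun hn => h (hf i hn)

theorem eta_ne_zero : eta ≠ 0 := by
  refine mul_ne_zero (u_ne_zero 1) (IsOne.ne_zero ?_)
  exact (tends_emb_pentagonal 24).isOne ⟨0, fun N _ => IsOne.prod fun i _ =>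
    isOne_one_sub_u (by push_cast; positivity)⟩

/-- The rank dissection series. -/
noncomputable def rankF (b : ℤ) : K :=
  (lamSum 3 (12 * (2 * b + 1)) + (1 / 2 - ((2 * b + 1 : ℤ) : K) / 22)) / eta

/-- The crank dissection series. -/
noncomputable def crankF (b : ℤ) : K :=
  (lamSum 1 (12 * (2 * b + 1)) + (1 / 2 - ((2 * b + 1 : ℤ) : K) / 22)) / eta

theorem rankF_eq {b c : ℤ} (hc : ¬ 11 ∣ c) (h11 : 11 ∣ 2 * b + 1 + 6 * c) :
    rankF b = Lam 3 (12 * (2 * b + 1)) c / h + frank c := by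
  have e := frank_eq hc (h_pow_twelve hc)
  have e2 := eta_eq
  rw [← tq_eq hc] at e2
  have h0 := eta_ne_zero
  rw [rankF, lamSum_three hc (odd_two_mul_add_one b) h11, div_eq_iff h0, add_sub_assoc, ← e, e2,
    add_mul]
  field_simp [h_ne_zero]

theorem crankF_eq {b c : ℤ} (hc : ¬ 11 ∣ c) (h11 : 11 ∣ 2 * b + 1 + 2 * c) :
    crankF b = fcrank c := by
  have e := fcrank_eq hc
  have e2 := eta_eq
  rw [← tq_eq hc] at e2
  rw [crankF, lamSum_one hc (odd_two_mul_add_one b) h11, div_eq_iff eta_ne_zero, ← e, e2, mul_assoc]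

theorem coeff_rankF {b c : ℤ} (i m : ℤ) (r : Fin 11) (hi : 264 ∣ i - m) (hc : ¬ 11 ∣ c)
    (h11 : 11 ∣ 2 * b + 1 + 6 * c) (hL : ¬ 264 ∣ m - (36 * c ^ 2 + 12 * (2 * b + 1) * c - 121))
    (hr : ∀ j ≠ r, ¬ 264 ∣ m - (1694 + rankClass c j)) :
    11 * (rankF b).coeff i = (h ^ 14 * rankTerm c r).coeff i := by
  have hS := (supp_Lam (n := 3) (by norm_num) (B := 2 * b + 1) c ⟨b + 2, by ring⟩).div supp_h
  have e : frank c * 11 = ∑ j, h ^ 14 * rankTerm c j := by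
    rw [frank_eq_sum, ← mul_sum]
    ring
  rw [rankF_eq hc h11, HahnSeries.coeff_add, hS.coeff_eq_zero (by omega), zero_add,
    ← coeff_ofNat_mul, mul_comm 11, e, coeff_sum]
  refine sum_eq_single r (fun j _ hj => ?_) (fun hj => absurd (mem_univ r) hj)
  have := hr j hj
  exact ((supp_h.pow 14).mul (supp_rankTerm c j)).coeff_eq_zero (by push_cast; omega)

theorem coeff_crankF {b c : ℤ} (i m : ℤ) (r : Fin 10) (hi : 264 ∣ i - m) (hc : ¬ 11 ∣ c)
    (h11 : 11 ∣ 2 * b + 1 + 2 * c) (hr : ∀ j ≠ r, ¬ 264 ∣ m - (242 + crankClass c j)) :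
    11 * (crankF b).coeff i = (h ^ 2 * crankTerm c r).coeff i := by
  have e : fcrank c * 11 = ∑ j, h ^ 2 * crankTerm c j := by
    rw [fcrank_eq_sum, ← mul_sum]
    ring
  rw [crankF_eq hc h11, ← coeff_ofNat_mul, mul_comm 11, e, coeff_sum]
  refine sum_eq_single r (fun j _ hj => ?_) (fun hj => absurd (mem_univ r) hj)
  have := hr j hj
  exact ((supp_h.pow 2).mul (supp_crankTerm c j)).coeff_eq_zero (by push_cast; omega)

/-- Series with nonnegative coefficients. -/
def Nonneg (f : K) : Prop := ∀ i, 0 ≤ f.coeff i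

theorem nonneg_zero : Nonneg 0 := fun _ => le_rfl

theorem nonneg_u (n : ℤ) : Nonneg (u n) := fun i => by
  rw [coeff_u]
  split_ifs <;> norm_num

theorem nonneg_one : Nonneg 1 := nonneg_u 0

theorem Nonneg.add {f g : K} (hf : Nonneg f) (hg : Nonneg g) : Nonneg (f + g) := fun i =>
  add_nonneg (hf i) (hg i)

theorem Nonneg.mul {f g : K} (hf : Nonneg f) (hg : Nonneg g) : Nonneg (f * g) := fun i => by
  rw [HahnSeries.coeff_mul]
  exact sum_nonneg fun p _ => mul_nonneg (hf _) (hg _)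

theorem Nonneg.pow {f : K} (hf : Nonneg f) (n : ℕ) : Nonneg (f ^ n) := by
  induction n with
  | zero => simpa using nonneg_one
  | succ n ih => rw [pow_succ]; exact ih.mul hf

theorem Nonneg.sum {ι : Type*} {s : Finset ι} {f : ι → K} (h : ∀ i ∈ s, Nonneg (f i)) :
    Nonneg (∑ i ∈ s, f i) := fun i => by
  rw [coeff_sum]
  exact sum_nonneg fun j hj => h j hj i

theorem Nonneg.tends {F : ℕ → K} {f : K} (hf : Tends F f) (h : ∀ n, Nonneg (F n)) : Nonneg f :=
  fun i => by
    obtain ⟨N, hN⟩ := hf (i + 1)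
    have h1 := hN N le_rfl i (by omega)
    rw [HahnSeries.coeff_sub, sub_eq_zero] at h1
    exact h1 ▸ h N i

theorem nonneg_ofNat (n : ℕ) [n.AtLeastTwo] : Nonneg (OfNat.ofNat n) := fun i => by
  rw [← mul_one (OfNat.ofNat n), coeff_ofNat_mul]
  exact mul_nonneg (Nat.ofNat_nonneg n) (nonneg_one i)

theorem nonneg_inv_one_sub_y {a : ℤ} (ha : 0 < a) : Nonneg (1 - y a)⁻¹ :=
  Nonneg.tends (tends_geometric (isOne_one_sub_y ha)) fun n => Nonneg.sum fun k _ => by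
    rw [sub_sub_cancel]
    exact (nonneg_u _).pow k

theorem poch_succ_inv (a : ℤ) (N : ℕ) :
    (poch a (N + 1))⁻¹ = (poch a N)⁻¹ * (1 - y (a + 11 * N))⁻¹ := by rw [poch_succ, mul_inv]

theorem nonneg_inv_poch {a : ℤ} (ha : 0 < a) (N : ℕ) : Nonneg (poch a N)⁻¹ := by
  induction N with
  | zero => simpa [poch_zero] using nonneg_one
  | succ N ih => rw [poch_succ_inv]; exact ih.mul (nonneg_inv_one_sub_y (by omega))

theorem tends_inv_poch {a : ℤ} (ha : 0 < a) : Tends (fun N => (poch a N)⁻¹) (pochInf a)⁻¹ :=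
  (tends_poch ha).inv ⟨0, fun N _ => isOne_poch ha N⟩

theorem nonneg_inv_pochInf {a : ℤ} (ha : 0 < a) : Nonneg (pochInf a)⁻¹ :=
  Nonneg.tends (tends_inv_poch ha) (nonneg_inv_poch ha)

theorem poch_add (a : ℤ) (m n : ℕ) : poch a (m + n) = poch a m * poch (a + 11 * m) n := by
  rw [poch, prod_range_add, poch, poch]
  congr 1
  exact prod_congr rfl fun i _ => by congr 2; push_cast; ring

theorem pochInf_shift {a : ℤ} (ha : 0 < a) (m : ℕ) :
    pochInf a = poch a m * pochInf (a + 11 * m) := by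
  refine Tends.unique ((tends_poch ha).comp (φ := fun N => m + N) fun n => ⟨n, fun N hN => by omega⟩)
    (((tends_poch (a := a + 11 * m) (by omega)).const_mul (poch a m)).congr ⟨0, fun N _ => ?_⟩)
  exact (poch_add a m N).symm

/-- The terms of the `q`-binomial series. -/
noncomputable def qbinTerm (a b : ℤ) (n : ℕ) : K := poch a n / poch 11 n * y (b * n)

theorem isO_qbinTerm {a b : ℤ} (ha : 0 < a) (n : ℕ) : IsO (264 * (b * n)) (qbinTerm a b n) := by
  have h1 := (isOne_poch ha n).isO.mul (isOne_poch (a := 11) (by norm_num) n).inv.isO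
  exact (h1.mul (isO_u (264 * (b * n)))).mono (by omega)

theorem qbinTerm_sum (a b : ℤ) (N : ℕ) :
    (1 - y b) * ∑ n ∈ range N, qbinTerm a b n + (1 - y (11 * N)) * qbinTerm a b N =
      (1 - y (a + b)) * ∑ n ∈ range N, qbinTerm a (b + 11) n := by
  induction N with
  | zero => simp [y_zero]
  | succ N ih =>
    have h1 : (1 - y (11 * (N + 1 : ℕ))) * qbinTerm a b (N + 1) =
        (1 - y (a + 11 * N)) * (y b * qbinTerm a b N) := by
      have := poch11_ne_zero N
      have h2 : 1 - y (11 + 11 * N) ≠ 0 := one_sub_y_ne_zero (by omega)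
      rw [qbinTerm, qbinTerm, poch_succ, poch_succ, Nat.cast_succ, mul_add_one, mul_add_one, y_add (b * N),
        add_comm (11 * (N : ℤ))]
      field_simp
    have h3 : qbinTerm a (b + 11) N = y (11 * N) * qbinTerm a b N := by
      rw [qbinTerm, qbinTerm, add_mul, y_add]
      ring
    rw [sum_range_succ, sum_range_succ, h1, h3, mul_add, mul_add, ← ih, y_add, y_add]
    ring

theorem exists_tends_qbin {a b : ℤ} (ha : 0 < a) (hb : 0 < b) :
    ∃ f, Tends (fun N => ∑ n ∈ range N, qbinTerm a b n) f :=
  exists_tends fun d => ⟨d.toNat, fun N hN => by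
    rw [sum_range_succ, add_sub_cancel_left]
    refine (isO_qbinTerm ha N).mono ?_
    have : (N : ℤ) ≤ b * N := le_mul_of_one_le_left (by omega) hb
    omega⟩

/-- The `q`-binomial theorem. -/
theorem tends_qbin {a b : ℤ} (ha : 0 < a) (hb : 0 < b) :
    Tends (fun N => ∑ n ∈ range N, qbinTerm a b n) (pochInf (a + b) / pochInf b) := by
  have hk (k : ℕ) : 0 < b + 11 * (k : ℤ) := by omega
  choose f hf using fun k : ℕ => exists_tends_qbin ha (hk k)
  have h0 (k : ℕ) (N : ℕ) (hN : 1 ≤ N) :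
      IsO (264 * (11 * k)) (∑ n ∈ range N, qbinTerm a (b + 11 * k) n - 1) := by
    obtain ⟨M, rfl⟩ := Nat.exists_eq_add_of_le' hN
    rw [sum_range_succ', show qbinTerm a (b + 11 * k) 0 = 1 by
      simp [qbinTerm, poch_zero, y_zero], add_sub_cancel_right]
    refine IsO.sum fun n _ => (isO_qbinTerm ha _).mono ?_
    push_cast
    nlinarith [mul_nonneg (hk k).le (Nat.cast_nonneg (α := ℤ) n)]
  have h1 : Tends f 1 := fun d => ⟨d.toNat, fun k hk => Tends.isO ((hf k).sub (tends_const 1))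
    ⟨1, fun N hN => (h0 k N hN).mono (by omega)⟩⟩
  have h2 (k : ℕ) : (1 - y (b + 11 * k)) * f k = (1 - y (a + b + 11 * k)) * f (k + 1) := by
    have t1 : Tends (fun N : ℕ => (1 - y (11 * N)) * qbinTerm a (b + 11 * k) N) 0 :=
      tends_zero_of_isO fun d => ⟨d.toNat + 1, fun N hN =>
        (isOne_one_sub_y (by omega)).isO.mul' (isO_qbinTerm ha N) (by
          have : (N : ℤ) ≤ (b + 11 * k) * N := le_mul_of_one_le_left (by omega) (hk k)
          omega)⟩
    have t2 := ((hf k).const_mul (1 - y (b + 11 * k))).add t1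
    rw [add_zero] at t2
    refine t2.unique (((hf (k + 1)).const_mul _).congr ⟨0, fun N _ => ?_⟩)
    rw [qbinTerm_sum, Nat.cast_succ, mul_add_one, ← add_assoc, ← add_assoc]
  have h3 (k : ℕ) : poch b k * f 0 = poch (a + b) k * f k := by
    induction k with
    | zero => simp [poch_zero]
    | succ k ih =>
      rw [poch_succ, poch_succ]
      linear_combination (1 - y (b + 11 * k)) * ih + poch (a + b) k * h2 k
  have h4 : pochInf b * f 0 = pochInf (a + b) * 1 := by
    refine Tends.unique ((tends_poch hb).mul (tends_const (f 0)))
      (((tends_poch (a := a + b) (by omega)).mul h1).congr ⟨0, fun N _ => (h3 N).symm⟩)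
  have h5 := hf 0
  rw [mul_one, mul_comm] at h4
  rw [← h4, mul_div_cancel_right₀ _ (isOne_pochInf hb).ne_zero]
  simpa using h5

/-- The reciprocal theta products. -/
noncomputable def thInv (a : ℤ) : K := (pochInf a)⁻¹ * (pochInf (11 - a))⁻¹

theorem nonneg_thInv {a : ℤ} (h0 : 0 < a) (h1 : a < 11) : Nonneg (thInv a) :=
  (nonneg_inv_pochInf h0).mul (nonneg_inv_pochInf (by omega))

theorem nonneg_E_mul_thInv {a : ℤ} (h0 : 0 < a) (h1 : a < 11) : Nonneg (E * thInv a) := by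
  have h := (tends_qbin h0 (b := 11 - a) (by omega)).const_mul (pochInf a)⁻¹
  rw [add_sub_cancel] at h
  have e : E * thInv a = (pochInf a)⁻¹ * (pochInf 11 / pochInf (11 - a)) := by
    rw [E, thInv, div_eq_mul_inv]
    ring
  rw [e]
  refine Nonneg.tends h fun N => ?_
  rw [mul_sum]
  refine Nonneg.sum fun n _ => ?_
  have e2 : (pochInf a)⁻¹ * qbinTerm a (11 - a) n =
      (pochInf (a + 11 * n))⁻¹ * (poch 11 n)⁻¹ * y ((11 - a) * n) := by
    have := (isOne_poch h0 n).ne_zero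
    rw [pochInf_shift h0 n, qbinTerm]
    field_simp
  rw [e2]
  exact ((nonneg_inv_pochInf (by omega)).mul (nonneg_inv_poch (by norm_num) n)).mul (nonneg_u _)

theorem nonneg_one_sub_y_mul_thInv {d : ℕ} : Nonneg ((1 - y d) * thInv 1) := by
  have e : (1 - y d) * thInv 1 =
      (∑ k ∈ range d, y 1 ^ k) * ((pochInf 12)⁻¹ * (pochInf 10)⁻¹) := by
    have h1 : 1 - y 1 ≠ 0 := one_sub_y_ne_zero (by norm_num)
    have h2 := pochInf_shift (a := 1) (by norm_num) 1
    have h3 : poch 1 1 = 1 - y 1 := by simp [poch]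
    have h4 := geom_sum_mul_neg (y 1) d
    have h5 : y (d : ℤ) = y 1 ^ d := by rw [y, y, ← u_natMul]; congr 1; ring
    rw [h5, ← h4, thInv, h2, h3]
    norm_num
    field_simp
  rw [e]
  exact (Nonneg.sum fun k _ => (nonneg_u _).pow k).mul
    ((nonneg_inv_pochInf (by norm_num)).mul (nonneg_inv_pochInf (by norm_num)))

theorem poch_pair_sub {a d e : ℕ} (ha : 0 < a) (h11 : 2 * a + d + e = 11) (N : ℕ) :
    ∃ R, Nonneg R ∧ (poch a N)⁻¹ * (poch (11 - a) N)⁻¹ -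
      (poch (a + d) N)⁻¹ * (poch (11 - (a + d)) N)⁻¹ = (1 - y d) * (1 - y e) * R := by
  induction N with
  | zero => exact ⟨0, nonneg_zero, by simp [poch_zero]⟩
  | succ N ih =>
    obtain ⟨R, hR, h⟩ := ih
    have p1 : (0 : ℤ) < a + 11 * N := by omega
    have p2 : (0 : ℤ) < 11 - a + 11 * N := by omega
    have p3 : (0 : ℤ) < a + d + 11 * N := by omega
    have p4 : (0 : ℤ) < 11 - (a + d) + 11 * N := by omega
    refine ⟨(1 - y (a + 11 * N))⁻¹ * (1 - y (11 - a + 11 * N))⁻¹ * R +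
      (poch (a + d) N)⁻¹ * (poch (11 - (a + d)) N)⁻¹ * ((1 - y (a + 11 * N))⁻¹ *
        (1 - y (11 - a + 11 * N))⁻¹ * ((1 - y (a + d + 11 * N))⁻¹ *
        (1 - y (11 - (a + d) + 11 * N))⁻¹) * y (a + 11 * N)), ?_, ?_⟩
    · have i1 := nonneg_inv_one_sub_y p1
      have i2 := nonneg_inv_one_sub_y p2
      have i3 := nonneg_inv_one_sub_y p3
      have i4 := nonneg_inv_one_sub_y p4
      exact ((i1.mul i2).mul hR).add (((nonneg_inv_poch (by omega) N).mul
        (nonneg_inv_poch (by omega) N)).mul (((i1.mul i2).mul (i3.mul i4)).mul (nonneg_u _)))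
    · have n1 := one_sub_y_ne_zero p1.ne'
      have n2 := one_sub_y_ne_zero p2.ne'
      have n3 := one_sub_y_ne_zero p3.ne'
      have n4 := one_sub_y_ne_zero p4.ne'
      have key : (1 - y (a + 11 * N))⁻¹ * (1 - y (11 - a + 11 * N))⁻¹ -
          (1 - y (a + d + 11 * N))⁻¹ * (1 - y (11 - (a + d) + 11 * N))⁻¹ = (1 - y d) * (1 - y e) *
          ((1 - y (a + 11 * N))⁻¹ * (1 - y (11 - a + 11 * N))⁻¹ * ((1 - y (a + d + 11 * N))⁻¹ *
          (1 - y (11 - (a + d) + 11 * N))⁻¹) * y (a + 11 * N)) := by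
        have e1 : y (a + d + 11 * N) = y (a + 11 * N) * y d := by rw [← y_add]; congr 1; ring
        have e2 : y (11 - (a + d) + 11 * N) = y (a + 11 * N) * y e := by
          rw [← y_add]; congr 1; omega
        have e3 : y (11 - a + 11 * N) = y (a + 11 * N) * y d * y e := by
          rw [← y_add, ← y_add]; congr 1; omega
        rw [e3] at n2
        rw [e1] at n3
        rw [e2] at n4
        rw [e1, e2, e3]
        field_simp
        ring
      simp only [poch_succ_inv]
      linear_combination (1 - y (a + 11 * N))⁻¹ * (1 - y (11 - a + 11 * N))⁻¹ * h +
        (poch (a + d) N)⁻¹ * (poch (11 - (a + d)) N)⁻¹ * key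

theorem nonneg_thInv_sub {a d e : ℕ} (ha : 0 < a) (h11 : 2 * a + d + e = 11) :
    Nonneg (thInv 1 ^ 2 * (thInv a - thInv (a + d))) := by
  have hT (b : ℤ) (h0 : 0 < b) (h1 : b < 11) :
      Tends (fun N => (poch b N)⁻¹ * (poch (11 - b) N)⁻¹) (thInv b) :=
    (tends_inv_poch h0).mul (tends_inv_poch (by omega))
  refine Nonneg.tends (((hT a (by omega) (by omega)).sub
    (hT (a + d) (by omega) (by omega))).const_mul (thInv 1 ^ 2)) fun N => ?_
  obtain ⟨R, hR, h⟩ := poch_pair_sub ha h11 N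
  rw [h, show thInv 1 ^ 2 * ((1 - y d) * (1 - y e) * R) =
    (1 - y d) * thInv 1 * ((1 - y e) * thInv 1) * R by ring]
  exact (nonneg_one_sub_y_mul_thInv.mul nonneg_one_sub_y_mul_thInv).mul hR

theorem sg_mul_T {a : ℤ} (h0 : 0 < a) (h1 : a < 11) :
    sg a * T a = u (3 * (2 * a - 11) ^ 2) * E * (thInv a)⁻¹ := by
  rw [T_eq h0 h1, thInv, ← mul_inv, inv_inv]
  linear_combination u (3 * (2 * a - 11) ^ 2) * E * pochInf a * pochInf (11 - a) * sg_sq a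

theorem h_pow_mul_mo (k₁ k₂ k₃ k₄ k₅ : ℤ) (hk : k₁ + k₂ + k₃ + k₄ + k₅ = 13) :
    h ^ 14 * mo 1 (-k₁) (-k₂) (-k₃) (-k₄) (-k₅) =
      u (1694 - 3 * (81 * k₁ + 49 * k₂ + 25 * k₃ + 9 * k₄ + k₅)) * (E * (thInv 1 ^ k₁ *
        thInv 2 ^ k₂ * thInv 3 ^ k₃ * thInv 4 ^ k₄ * thInv 5 ^ k₅)) := by
  have t1 := sg_mul_T (a := 1) (by norm_num) (by norm_num)
  have t2 := sg_mul_T (a := 2) (by norm_num) (by norm_num)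
  have t3 := sg_mul_T (a := 3) (by norm_num) (by norm_num)
  have t4 := sg_mul_T (a := 4) (by norm_num) (by norm_num)
  have t5 := sg_mul_T (a := 5) (by norm_num) (by norm_num)
  rw [sg_odd (by decide), neg_one_mul] at t1 t3 t5
  rw [sg_even (by decide), one_mul] at t2 t4
  have hE : E ^ (14 : ℕ) * (E ^ (-k₁) * E ^ (-k₂) * E ^ (-k₃) * E ^ (-k₄) * E ^ (-k₅)) = E := by
    simp only [← zpow_natCast E 14, ← zpow_add₀ E_ne_zero]
    rw [show ((14 : ℕ) : ℤ) + (-k₁ + -k₂ + -k₃ + -k₄ + -k₅) = 1 by push_cast; omega, zpow_one]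
  rw [mo, mul_one, mul_one, mul_one, mul_one, t1, t2, t3, t4, t5]
  simp only [mul_zpow, inv_zpow', neg_neg, u_zpow]
  rw [h, mul_pow, ← u_natMul]
  have hu : u (1694 - 3 * (81 * k₁ + 49 * k₂ + 25 * k₃ + 9 * k₄ + k₅)) = u ((14 : ℕ) * 121) *
      (u (-k₁ * (3 * (2 * 1 - 11) ^ 2)) * u (-k₂ * (3 * (2 * 2 - 11) ^ 2)) *
      u (-k₃ * (3 * (2 * 3 - 11) ^ 2)) * u (-k₄ * (3 * (2 * 4 - 11) ^ 2)) *
      u (-k₅ * (3 * (2 * 5 - 11) ^ 2))) := by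
    simp only [← u_add]
    congr 1
    push_cast
    ring
  rw [hu]
  nth_rewrite 7 [← hE]
  ring

theorem nonneg_E_mul_prod (k₁ k₂ k₃ k₄ k₅ : ℕ) (hk : k₁ + k₂ + k₃ + k₄ + k₅ = 13) :
    Nonneg (E * (thInv 1 ^ k₁ * thInv 2 ^ k₂ * thInv 3 ^ k₃ * thInv 4 ^ k₄ * thInv 5 ^ k₅)) := by
  have p1 := nonneg_thInv (a := 1) (by norm_num) (by norm_num)
  have p2 := nonneg_thInv (a := 2) (by norm_num) (by norm_num)
  have p3 := nonneg_thInv (a := 3) (by norm_num) (by norm_num)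
  have p4 := nonneg_thInv (a := 4) (by norm_num) (by norm_num)
  have p5 := nonneg_thInv (a := 5) (by norm_num) (by norm_num)
  have h (n₁ n₂ n₃ n₄ n₅ : ℕ) {f : K} (hf : Nonneg f) : Nonneg (f * (thInv 1 ^ n₁ * thInv 2 ^ n₂ *
      thInv 3 ^ n₃ * thInv 4 ^ n₄ * thInv 5 ^ n₅)) :=
    hf.mul (((((p1.pow n₁).mul (p2.pow n₂)).mul (p3.pow n₃)).mul (p4.pow n₄)).mul (p5.pow n₅))
  have q (a : ℤ) (h0 : 0 < a) (h1 : a < 11) := nonneg_E_mul_thInv h0 h1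
  rcases k₁ with _ | k₁
  · rcases k₂ with _ | k₂
    · rcases k₃ with _ | k₃
      · rcases k₄ with _ | k₄
        · rcases k₅ with _ | k₅
          · omega
          · convert h 0 0 0 0 k₅ (q 5 (by norm_num) (by norm_num)) using 1
            ring
        · convert h 0 0 0 k₄ k₅ (q 4 (by norm_num) (by norm_num)) using 1
          ring
      · convert h 0 0 k₃ k₄ k₅ (q 3 (by norm_num) (by norm_num)) using 1
        ring
    · convert h 0 k₂ k₃ k₄ k₅ (q 2 (by norm_num) (by norm_num)) using 1
      ring
  · convert h k₁ k₂ k₃ k₄ k₅ (q 1 (by norm_num) (by norm_num)) using 1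
    ring

theorem nonneg_mo {e₁ e₂ e₃ e₄ e₅ : ℤ} (he : e₁ ≤ 0 ∧ e₂ ≤ 0 ∧ e₃ ≤ 0 ∧ e₄ ≤ 0 ∧ e₅ ≤ 0 ∧
    e₁ + e₂ + e₃ + e₄ + e₅ = -13) : Nonneg (h ^ 14 * mo 1 e₁ e₂ e₃ e₄ e₅) := by
  obtain ⟨h1, h2, h3, h4, h5, hs⟩ := he
  obtain ⟨k₁, rfl⟩ := Int.exists_eq_neg_ofNat h1
  obtain ⟨k₂, rfl⟩ := Int.exists_eq_neg_ofNat h2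
  obtain ⟨k₃, rfl⟩ := Int.exists_eq_neg_ofNat h3
  obtain ⟨k₄, rfl⟩ := Int.exists_eq_neg_ofNat h4
  obtain ⟨k₅, rfl⟩ := Int.exists_eq_neg_ofNat h5
  rw [h_pow_mul_mo _ _ _ _ _ (by omega)]
  simp only [zpow_natCast]
  exact (nonneg_u _).mul (nonneg_E_mul_prod _ _ _ _ _ (by omega))

theorem nonneg_seven_a : Nonneg (h ^ 14 * (3 * mo 1 (-1) (-3) (-3) (-3) (-3) +
    mo 1 (-3) (-2) (-6) (-2) 0 - mo 1 (-3) (-2) (-2) (-3) (-3))) := by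
  have e1 := h_pow_mul_mo 3 2 6 2 0 (by norm_num)
  have e2 := h_pow_mul_mo 3 2 2 3 3 (by norm_num)
  norm_num [zpow_ofNat] at e1 e2
  have p2 := nonneg_thInv (a := 2) (by norm_num) (by norm_num)
  have p3 := nonneg_thInv (a := 3) (by norm_num) (by norm_num)
  have p4 := nonneg_thInv (a := 4) (by norm_num) (by norm_num)
  have p5 := nonneg_thInv (a := 5) (by norm_num) (by norm_num)
  have p1 := nonneg_thInv (a := 1) (by norm_num) (by norm_num)
  have d1 : Nonneg (thInv 1 ^ 2 * (thInv 3 - thInv 4)) := by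
    simpa using nonneg_thInv_sub (a := 3) (d := 1) (e := 4) (by norm_num) (by norm_num)
  have d2 : Nonneg (thInv 1 ^ 2 * (thInv 3 - thInv 5)) := by
    simpa using nonneg_thInv_sub (a := 3) (d := 2) (e := 3) (by norm_num) (by norm_num)
  have d3 : Nonneg ((1 - y 1) * thInv 1) := by simpa using nonneg_one_sub_y_mul_thInv (d := 1)
  have hE := nonneg_E_mul_thInv (a := 2) (by norm_num) (by norm_num)
  have hu : u 431 = u 167 * y 1 := by rw [y, ← u_add]; norm_num
  have e : h ^ 14 * (3 * mo 1 (-1) (-3) (-3) (-3) (-3) +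
    mo 1 (-3) (-2) (-6) (-2) 0 - mo 1 (-3) (-2) (-2) (-3) (-3)) =
      3 * (h ^ 14 * mo 1 (-1) (-3) (-3) (-3) (-3)) + u 167 * (E * thInv 2) * (thInv 2 *
        thInv 3 ^ 2 * thInv 4 ^ 2) * (thInv 1 * thInv 3 ^ 3 * (thInv 1 ^ 2 * (thInv 3 - thInv 4)) +
        thInv 1 * thInv 4 * (thInv 3 ^ 2 + thInv 3 * thInv 5 + thInv 5 ^ 2) *
          (thInv 1 ^ 2 * (thInv 3 - thInv 5)) +
        thInv 1 ^ 2 * thInv 4 * thInv 5 ^ 3 * ((1 - y 1) * thInv 1)) := by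
    rw [hu] at e2
    linear_combination e1 - e2
  rw [e]
  refine ((nonneg_ofNat 3).mul (nonneg_mo (by norm_num))).add ?_
  refine (((nonneg_u _).mul hE).mul ((p2.mul (p3.pow 2)).mul (p4.pow 2))).mul (Nonneg.add (.add ?_ ?_) ?_)
  · exact (p1.mul (p3.pow 3)).mul d1
  · exact ((p1.mul p4).mul (((p3.pow 2).add (p3.mul p5)).add (p5.pow 2))).mul d2
  · exact (((p1.pow 2).mul p4).mul (p5.pow 3)).mul d3

open Classical in
/-- The number of partitions of `n` whose multiset of parts satisfies `p`. -/
noncomputable def cnt (p : Multiset ℕ → Prop) (n : ℕ) : ℕ := #{π : n.Partition | p π.parts}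

/-- The generating function of `cnt p` in `q = u 24`. -/
noncomputable def gf (p : Multiset ℕ → Prop) : K := emb 24 (PowerSeries.mk fun n => (cnt p n : ℚ))

theorem coeff_gf (p : Multiset ℕ → Prop) (n : ℕ) : (gf p).coeff (24 * n) = cnt p n := by
  simpa [gf] using coeff_emb (m := 24) (PowerSeries.mk fun n => (cnt p n : ℚ)) n

theorem zero_notMem_parts {n : ℕ} (π : n.Partition) : 0 ∉ π.parts := fun h => (π.parts_pos h).ne rfl

theorem cnt_congr {p q : Multiset ℕ → Prop} {n : ℕ}
    (h : ∀ m : Multiset ℕ, 0 ∉ m → m.sum = n → (p m ↔ q m)) : cnt p n = cnt q n := by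
  classical
  exact congrArg card (filter_congr fun π _ => h _ (zero_notMem_parts π) π.parts_sum)

theorem gf_congr {p q : Multiset ℕ → Prop} (h : ∀ m : Multiset ℕ, 0 ∉ m → (p m ↔ q m)) :
    gf p = gf q := by
  rw [gf, gf, funext fun n => congrArg (Nat.cast (R := ℚ)) (cnt_congr fun m hm _ => h m hm)]

theorem cnt_eq_card (p : Multiset ℕ → Prop) (n : ℕ) :
    cnt p n = Nat.card {π : n.Partition // p π.parts} := by
  classical
  rw [Nat.card_eq_fintype_card, Fintype.card_subtype, cnt]

theorem cnt_eq_zero {p : Multiset ℕ → Prop} {n : ℕ} (h : ∀ m : Multiset ℕ, m.sum = n → ¬ p m) :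
    cnt p n = 0 := by
  classical
  rw [cnt, card_eq_zero, filter_eq_empty_iff]
  exact fun π _ => h _ π.parts_sum

theorem cnt_split (p r : Multiset ℕ → Prop) (n : ℕ) :
    cnt p n = cnt (fun m => p m ∧ r m) n + cnt (fun m => p m ∧ ¬ r m) n := by
  classical
  simp only [cnt, ← filter_filter]
  exact (card_filter_add_card_filter_not _).symm

theorem gf_split (p r : Multiset ℕ → Prop) :
    gf p = gf (fun m => p m ∧ r m) + gf (fun m => p m ∧ ¬ r m) := by
  rw [gf, gf, gf, ← map_add]
  congr 1
  ext n
  simp [cnt_split p r n]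

theorem isO_gf {p : Multiset ℕ → Prop} {d : ℕ} (h : ∀ m, p m → d ≤ m.sum) : IsO d (gf p) := by
  refine isO_emb (m := 24) _ d fun n hn => ?_
  rw [PowerSeries.coeff_mk, cnt_eq_zero fun m hm hp => absurd (h m hp) (by omega), Nat.cast_zero]

theorem isSum_gf (p : Multiset ℕ → Prop) {f : Multiset ℕ → ℕ} (hf : ∀ m, f m ≤ m.sum) :
    IsSum (fun k : ℕ => gf fun m => p m ∧ f m = k) (gf p) := by
  intro d
  refine ⟨range d.toNat, fun S hS => ?_⟩
  have e (S : Finset ℕ) : ∑ k ∈ S, gf (fun m => p m ∧ f m = k) = gf fun m => p m ∧ f m ∈ S := by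
    induction S using Finset.induction_on with
    | empty =>
      refine (eq_zero_of_isO fun d => IsO.mono (isO_gf (d := d.toNat) fun m hm => ?_) ?_).symm
      · exact absurd hm.2 (notMem_empty _)
      · omega
    | insert a S ha ih =>
      rw [sum_insert ha, ih, gf_split (fun m => p m ∧ f m ∈ insert a S) fun m => f m = a]
      refine congrArg₂ (· + ·) (gf_congr fun m _ => ?_) (gf_congr fun m _ => ?_) <;>
        simp only [mem_insert] <;> grind
  rw [e, gf_split p fun m => f m ∈ S, add_sub_cancel_left]
  refine (isO_gf (d := d.toNat) fun m hm => ?_).mono (by omega)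
  have h1 := hf m
  by_contra hlt
  exact hm.2 (hS (mem_range.mpr (by omega)))

theorem gf_insert {j : ℕ} (hj : 0 < j) (p : Multiset ℕ → Prop) :
    gf (fun m => j ∈ m ∧ p (m.erase j)) = u (24 * j) * gf p := by
  have e := emb_X_pow (m := 24) j
  push_cast at e
  rw [← e, gf, gf, ← map_mul]
  congr 1
  ext n
  rw [PowerSeries.coeff_X_pow_mul', PowerSeries.coeff_mk, PowerSeries.coeff_mk]
  split_ifs with hn
  · rw [cnt_eq_card, cnt_eq_card]
    refine congrArg Nat.cast (Nat.card_congr ((Equiv.subtypeSubtypeEquivSubtypeInter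
      (fun π : n.Partition => j ∈ π.parts) fun π => p (π.parts.erase j)).symm.trans
      ((Nat.Partition.partitionWithPartEquiv hj hn).subtypeEquiv fun π => ?_)))
    rw [Nat.Partition.partitionWithPartEquiv_apply_parts]
  · rw [cnt_eq_zero, Nat.cast_zero]
    exact fun m hm hp => hn (hm ▸ Multiset.le_sum_of_mem hp.1)

/-- The number of elements of `m` that exceed `a`. -/
def above (m : Multiset ℕ) (a : ℕ) : ℕ := (m.filter (a < ·)).card

theorem above_cons (x : ℕ) (m : Multiset ℕ) (a : ℕ) :
    above (x ::ₘ m) a = (if a < x then 1 else 0) + above m a := by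
  rw [above, Multiset.filter_cons, Multiset.card_add, above]
  split_ifs <;> rfl

theorem above_add_count (m : Multiset ℕ) (a : ℕ) :
    above m (a + 1) + m.count (a + 1) = above m a := by
  induction m using Multiset.induction_on with
  | empty => rfl
  | cons x m ih =>
    rw [above_cons, above_cons, Multiset.count_cons, ← ih]
    split_ifs <;> omega

theorem above_zero {m : Multiset ℕ} (hm : 0 ∉ m) : above m 0 = m.card := by
  rw [above, Multiset.filter_eq_self.mpr fun a ha => Nat.pos_of_ne_zero (ne_of_mem_of_not_mem ha hm)]

theorem above_eq_zero {m : Multiset ℕ} {a : ℕ} : above m a = 0 ↔ m.sup ≤ a := by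
  rw [above, Multiset.card_eq_zero, Multiset.filter_eq_nil, Multiset.sup_le]
  simp

theorem above_anti (m : Multiset ℕ) {a b : ℕ} (h : a ≤ b) : above m b ≤ above m a :=
  Multiset.card_le_card (Multiset.monotone_filter_right m fun _ hx => h.trans_lt hx)

theorem eq_of_above {m m' : Multiset ℕ} (hm : 0 ∉ m) (hm' : 0 ∉ m')
    (h : ∀ a, above m a = above m' a) : m = m' := by
  ext a
  rcases a with _ | a
  · rw [Multiset.count_eq_zero_of_notMem hm, Multiset.count_eq_zero_of_notMem hm']
  · have h1 := above_add_count m a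
    have h2 := above_add_count m' a
    rw [h, h] at h1
    omega

/-- The conjugate of a partition. -/
def conj (m : Multiset ℕ) : Multiset ℕ := (Multiset.range m.sup).map (above m)

theorem lt_above_conj (m : Multiset ℕ) (a b : ℕ) : a < above (conj m) b ↔ b < above m a := by
  have e : above (conj m) b = #{i ∈ range m.sup | b < above m i} := by
    rw [above, conj, Multiset.filter_map, Multiset.card_map]
    rfl
  rw [e]
  constructor <;> intro h
  · by_contra! hb
    refine h.not_ge ((card_le_card fun i hi => ?_).trans_eq (card_range a))
    rw [mem_filter] at hi
    by_contra ha
    have := above_anti m (not_lt.mp (mt mem_range.mpr ha))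
    omega
  · refine (Nat.lt_succ_self a).trans_le ((card_range _).symm.trans_le (card_le_card fun i hi => ?_))
    have := above_anti m (Nat.lt_succ_iff.mp (mem_range.mp hi))
    refine mem_filter.mpr ⟨mem_range.mpr ?_, by omega⟩
    by_contra! hs
    have := above_eq_zero.mpr hs
    omega

theorem zero_notMem_conj (m : Multiset ℕ) : 0 ∉ conj m := by
  intro h
  obtain ⟨i, hi, h0⟩ := Multiset.mem_map.mp h
  exact (Multiset.mem_range.mp hi).not_ge (above_eq_zero.mp h0)

theorem above_conj_conj (m : Multiset ℕ) (a : ℕ) : above (conj (conj m)) a = above m a :=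
  eq_of_forall_lt_iff fun b => by rw [lt_above_conj, lt_above_conj]

theorem conj_conj {m : Multiset ℕ} (hm : 0 ∉ m) : conj (conj m) = m :=
  eq_of_above (zero_notMem_conj _) hm (above_conj_conj m)

theorem card_conj (m : Multiset ℕ) : (conj m).card = m.sup := by simp [conj]

theorem sup_conj {m : Multiset ℕ} (hm : 0 ∉ m) : (conj m).sup = m.card := by
  rw [← card_conj, conj_conj hm]

theorem sum_conj (m : Multiset ℕ) : (conj m).sum = m.sum := by
  have h (s : ℕ) (hs : m.sup ≤ s) : ∑ i ∈ range s, above m i = m.sum := by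
    induction m using Multiset.induction_on with
    | empty => exact sum_const_zero
    | cons x m ih =>
      rw [Multiset.sup_cons, max_le_iff] at hs
      simp only [above_cons, sum_add_distrib, ih hs.2, Multiset.sum_cons]
      rw [← card_filter, show {i ∈ range s | i < x} = range x by grind, card_range]
  exact h _ le_rfl

theorem gf_conj (p : Multiset ℕ → Prop) : gf p = gf fun m => p (conj m) := by
  classical
  have e (n : ℕ) : cnt p n = cnt (fun m => p (conj m)) n := by
    let c (π : n.Partition) : n.Partition := ⟨conj π.parts, fun {i} hi =>
      Nat.pos_of_ne_zero (ne_of_mem_of_not_mem hi (zero_notMem_conj _)),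
      (sum_conj _).trans π.parts_sum⟩
    have hc (π : n.Partition) : c (c π) = π :=
      Nat.Partition.ext (conj_conj (zero_notMem_parts π))
    refine card_bijective c (Function.Involutive.bijective hc) fun π => ?_
    rw [mem_filter_univ, mem_filter_univ]
    exact iff_of_eq (congrArg p (conj_conj (zero_notMem_parts π)).symm)
  rw [gf, gf, funext fun n => congrArg (Nat.cast (R := ℚ)) (e n)]

theorem eq_zero_of_sup {m : Multiset ℕ} (hm : 0 ∉ m) (h : m.sup = 0) : m = 0 := by
  rw [← Multiset.card_eq_zero, ← above_zero hm, above_eq_zero, h]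

theorem mem_of_sup_eq {m : Multiset ℕ} {L : ℕ} (hL : 0 < L) (h : m.sup = L) : L ∈ m := by
  obtain ⟨i, rfl⟩ := Nat.exists_eq_succ_of_ne_zero hL.ne'
  by_contra hm
  have h1 := above_add_count m i
  rw [above_eq_zero.mpr h.le, Multiset.count_eq_zero.mpr hm, eq_comm, above_eq_zero] at h1
  omega

theorem sup_le_sum (m : Multiset ℕ) : m.sup ≤ m.sum :=
  Multiset.sup_le.mpr fun _ h => Multiset.le_sum_of_mem h

theorem gf_sup_eq (L c : ℕ) : gf (fun m => m.sup = L ∧ m.card ≤ c + 1) =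
    u (24 * L) * gf fun m => m.sup ≤ L ∧ m.card ≤ c := by
  rcases L.eq_zero_or_pos with rfl | hL
  · rw [Nat.cast_zero, mul_zero, u_zero, one_mul]
    refine gf_congr fun m hm => ⟨fun h => ?_, fun h => ⟨by omega, by omega⟩⟩
    simp [eq_zero_of_sup hm h.1]
  · rw [← gf_insert hL]
    refine gf_congr fun m _ => ⟨fun h => ?_, fun h => ?_⟩
    · have hm := mem_of_sup_eq hL h.1
      have e := Multiset.cons_erase hm
      refine ⟨hm, ?_, ?_⟩
      · have := h.1
        rw [← e, Multiset.sup_cons] at this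
        exact le_sup_right.trans this.le
      · rw [Multiset.card_erase_of_mem hm]
        exact Nat.pred_le_iff.mpr h.2
    · rw [← Multiset.cons_erase h.1, Multiset.sup_cons, Multiset.card_cons, sup_eq_left]
      exact ⟨h.2.1, by omega⟩

/-- The partition generating function. -/
noncomputable def gfAll : K := gf fun _ => True

theorem gf_not (p : Multiset ℕ → Prop) : gf (fun m => ¬ p m) = gfAll - gf p := by
  rw [eq_sub_iff_add_eq', gfAll, gf_split (fun _ => True) p]
  simp only [true_and]

theorem gf_rank (s : ℕ) : gf (fun m => m ≠ 0 ∧ m.card + s ≤ m.sup) =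
    u (24 * (s + 1)) * (gfAll - gf fun m => m.card + (s + 3) ≤ m.sup) := by
  rw [← gf_not, gf_conj fun m => ¬ m.card + (s + 3) ≤ m.sup]
  refine (isSum_gf _ (f := fun m => m.sup - (s + 1)) fun m => (Nat.sub_le _ _).trans
    (sup_le_sum m)).unique (((isSum_gf _ (f := fun m => m.sup) sup_le_sum).mul_left _).congr
    fun l => ?_)
  have e1 : gf (fun m => ¬ (conj m).card + (s + 3) ≤ (conj m).sup ∧ m.sup = l) =
      gf fun m => m.sup = l ∧ m.card ≤ l + s + 1 + 1 := gf_congr fun m hm => by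
    rw [card_conj, sup_conj hm]
    omega
  have e2 : gf (fun m => m.sup ≤ l ∧ m.card ≤ l + s + 1) =
      gf fun m => m.sup ≤ l + s + 1 ∧ m.card ≤ l := by
    rw [gf_conj]
    refine gf_congr fun m hm => ?_
    rw [card_conj, sup_conj hm, and_comm]
  have e3 : gf (fun m => (m ≠ 0 ∧ m.card + s ≤ m.sup) ∧ m.sup - (s + 1) = l) =
      gf fun m => m.sup = l + s + 1 ∧ m.card ≤ l + 1 := gf_congr fun m _ => by
    constructor
    · rintro ⟨⟨h0, h1⟩, h2⟩
      have := Multiset.card_pos.mpr h0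
      omega
    · rintro ⟨h1, h2⟩
      refine ⟨⟨?_, by omega⟩, by omega⟩
      rintro rfl
      simp at h1
  rw [e1, e3, gf_sup_eq, gf_sup_eq, e2, ← mul_assoc, ← u_add]
  congr 2
  push_cast
  ring

theorem gf_rank_pos {s : ℕ} (hs : 1 ≤ s) : gf (fun m => m.card + s ≤ m.sup) =
    u (24 * (s + 1)) * (gfAll - gf fun m => m.card + (s + 3) ≤ m.sup) := by
  rw [← gf_rank]
  refine gf_congr fun m _ => ⟨fun h => ⟨?_, h⟩, And.right⟩
  rintro rfl
  simp at h
  omega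

theorem gf_zero : gf (fun m => m = 0) = 1 := by
  have : (PowerSeries.mk fun n => (cnt (fun m => m = 0) n : ℚ)) = 1 := by
    ext n
    rw [PowerSeries.coeff_mk, PowerSeries.coeff_one]
    split_ifs with h
    · subst h
      rw [cnt_congr (q := fun _ => True) fun m hm h => iff_of_true ?_ trivial]
      · simp [cnt]
      · exact Multiset.eq_zero_of_forall_notMem fun x hx =>
          hm (by simpa [Multiset.sum_eq_zero_iff.mp h x hx] using hx)
    · rw [cnt_eq_zero, Nat.cast_zero]
      rintro m h1 rfl
      exact h h1.symm
  rw [gf, this, map_one]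

theorem gfAll_eq : gfAll = 1 + u 24 * (gfAll - gf fun m => m.card + 3 ≤ m.sup) +
    gf fun m => m.card + 1 ≤ m.sup := by
  have h := gf_rank 0
  rw [Nat.cast_zero, zero_add, mul_one] at h
  simp only [zero_add, add_zero] at h
  rw [← h, gfAll, gf_split _ fun m => m = 0, gf_split (fun m => True ∧ ¬ m = 0) fun m =>
    m.card ≤ m.sup, ← gf_zero, gf_conj fun m => m.card + 1 ≤ m.sup, ← add_assoc]
  refine congrArg₂ _ (congrArg₂ _ (gf_congr fun m _ => by simp) (gf_congr fun m _ => by simp))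
    (gf_congr fun m hm => ?_)
  rw [card_conj, sup_conj hm]
  constructor
  · rintro ⟨-, h⟩
    omega
  · intro h
    refine ⟨⟨trivial, ?_⟩, by omega⟩
    rintro rfl
    simp at h

theorem IsSum.telescope {F : ℕ → K} (hF : ∀ k : ℕ, IsO k (F k)) :
    IsSum (fun k => F k - F (k + 1)) (F 0) := by
  obtain ⟨s, hs⟩ := exists_isSum (f := fun k => F k - F (k + 1)) fun d =>
    (Set.finite_Iio d.toNat).subset fun k hk => Set.mem_Iio.mpr <| by
      by_contra! hd
      exact hk (((hF k).sub ((hF (k + 1)).mono (by push_cast; omega))).mono (by omega))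
  refine (sub_eq_zero.mp (eq_zero_of_isO (f := s - F 0) fun d => ?_)) ▸ hs
  obtain ⟨S, hS⟩ := hs d
  obtain ⟨N, hN⟩ := S.exists_nat_subset_range
  have h1 := hS (range (N + d.toNat)) (hN.trans (range_mono (by omega)))
  rw [sum_range_sub'] at h1
  have h2 := h1.sub ((hF (N + d.toNat)).mono (by push_cast; omega))
  rwa [show s - (F 0 - F (N + d.toNat)) - F (N + d.toNat) = s - F 0 by ring] at h2

/-- The generating function of partitions with at least `i` parts exceeding `j`. -/
noncomputable def gfAbove (i j : ℕ) : K := gf fun m => i ≤ above m j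

theorem gfAbove_zero (j : ℕ) : gfAbove 0 j = gfAll := gf_congr fun m _ => by simp

theorem gfAbove_symm (i j : ℕ) : gfAbove (i + 1) j = gfAbove (j + 1) i := by
  rw [gfAbove, gf_conj]
  exact gf_congr fun m _ => lt_above_conj m i j

theorem above_le_sum {m : Multiset ℕ} (hm : 0 ∉ m) (j : ℕ) : above m j ≤ m.sum := by
  refine (above_anti m (Nat.zero_le j)).trans ?_
  rw [above_zero hm, ← sup_conj hm, ← sum_conj]
  exact sup_le_sum _

theorem gf_mem_eq_zero {p : Multiset ℕ → Prop} : gf p = gf fun m => 0 ∉ m ∧ p m :=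
  gf_congr fun _ hm => by simp [hm]

theorem isO_gfAbove (i j : ℕ) : IsO i (gfAbove i j) := by
  rw [gfAbove, gf_mem_eq_zero]
  exact isO_gf fun m hm => hm.2.trans (above_le_sum hm.1 j)

theorem gf_sub {p r : Multiset ℕ → Prop} (h : ∀ m, r m → p m) :
    gf p - gf r = gf fun m => p m ∧ ¬ r m := by
  rw [sub_eq_iff_eq_add', gf_split p r]
  exact congrArg (· + _) (gf_congr fun m _ => and_iff_right_of_imp (h m))

theorem gfAbove_row (i t : ℕ) : gfAbove (i + 1) t - gfAbove (i + 1) (t + 1) =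
    u (24 * (t + 1)) * (gfAbove i t - gfAbove (i + 1) (t + 1)) := by
  have e := gf_insert (Nat.succ_pos t) fun m => i ≤ above m t ∧ ¬ i + 1 ≤ above m (t + 1)
  rw [gfAbove, gfAbove, gfAbove, gf_sub fun m h => h.trans (above_anti m (Nat.le_succ t)),
    gf_sub fun m h => (Nat.le_succ i).trans (h.trans (above_anti m (Nat.le_succ t))),
    ← Nat.cast_succ, ← e]
  refine gf_congr fun m _ => ?_
  by_cases hm : t + 1 ∈ m
  · obtain ⟨m, rfl⟩ := Multiset.exists_cons_of_mem hm
    simp only [above_cons, Multiset.erase_cons_head, Nat.succ_eq_add_one]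
    simp
    omega
  · have h1 := above_add_count m t
    rw [Multiset.count_eq_zero.mpr hm] at h1
    simp only [Nat.succ_eq_add_one, hm, false_and, iff_false]
    omega

theorem gfAbove_col (i t : ℕ) : gfAbove i (t + 1) - gfAbove (i + 1) (t + 1) =
    u (24 * i) * (gfAbove i t - gfAbove (i + 1) (t + 1)) := by
  rcases i with _ | i
  · rw [gfAbove_zero, gfAbove_zero, Nat.cast_zero, mul_zero, u_zero, one_mul]
  · rw [gfAbove_symm i, gfAbove_symm (i + 1), gfAbove_symm i t, Nat.cast_succ, gfAbove_row]

theorem gf_count {p : Multiset ℕ → Prop} (hp : ∀ m, p (1 ::ₘ m) ↔ p m) (ω : ℕ) :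
    gf (fun m => p m ∧ m.count 1 = ω) = u (24 * ω) * (1 - u 24) * gf p := by
  have e (ω : ℕ) : gf (fun m => p m ∧ ω ≤ m.count 1) = u (24 * ω) * gf p := by
    induction ω with
    | zero =>
      rw [Nat.cast_zero, mul_zero, u_zero, one_mul]
      exact gf_congr fun m _ => by simp
    | succ ω ih =>
      rw [Nat.cast_succ, mul_add, u_add, mul_comm (u _), mul_assoc, ← ih]
      refine Eq.trans ?_ (gf_insert one_pos fun m => p m ∧ ω ≤ m.count 1)
      refine gf_congr fun m _ => ?_
      by_cases hm : 1 ∈ m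
      · obtain ⟨m, rfl⟩ := Multiset.exists_cons_of_mem hm
        simp [hp]
      · simp [hm]
  rw [show u (24 * ω) * (1 - u 24) * gf p = u (24 * ω) * gf p - u (24 * (ω + 1 : ℕ)) * gf p by
    push_cast; rw [mul_add, u_add]; ring_nf, ← e, ← e, gf_sub fun m h => ⟨h.1, by omega⟩]
  refine gf_congr fun m _ => ?_
  simp only [not_and]
  grind

/-- The generating function of partitions with crank greater than `t`, up to a correction in
weight one. -/
noncomputable def gfCrank (t : ℕ) : K :=
  lsum fun k : ℕ => u (24 * k) * (1 - u 24) * gfAbove (k + 1) (k + t)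

theorem isSum_gfCrank (t : ℕ) :
    IsSum (fun k : ℕ => u (24 * k) * (1 - u 24) * gfAbove (k + 1) (k + t)) (gfCrank t) := by
  refine isSum_lsum (exists_isSum fun d => (Set.finite_Iio d.toNat).subset fun k hk =>
    Set.mem_Iio.mpr ?_)
  by_contra! hd
  refine hk (((isO_u _).mul (isOne_one_sub_u (by norm_num)).isO).mul' (isO_gfAbove _ _) ?_)
  push_cast
  omega

theorem gfCrank_rec (t : ℕ) : gfCrank t = u (24 * (t + 1)) * (gfAll - gfCrank (t + 1)) := by
  rw [mul_sub, eq_sub_iff_add_eq]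
  let F (k : ℕ) : K := (u (24 * k) - 1) * (gfAbove (k + 1) (k + t) +
    u (24 * (t + 1)) * gfAbove (k + 1) (k + t + 1)) + u (24 * (t + 1)) * gfAbove k (k + t + 1)
  have hF (k : ℕ) : IsO k (F k) := by
    have h0 : IsO 0 (u (24 * (t + 1))) := (isO_u _).mono (by positivity)
    refine IsO.add (IsO.mul' (a := 0) (b := k) ?_ ?_ (by simp)) (h0.mul' (isO_gfAbove _ _) (by simp))
    · exact ((isO_u _).mono (by positivity)).sub isO_one
    · exact ((isO_gfAbove _ _).mono (by push_cast; omega)).add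
        (h0.mul' (isO_gfAbove _ _) (by push_cast; omega))
  have e0 : F 0 = u (24 * (t + 1)) * gfAll := by
    simp only [F, Nat.cast_zero, mul_zero, u_zero, gfAbove_zero]
    ring
  refine ((isSum_gfCrank t).add ((isSum_gfCrank (t + 1)).mul_left _)).unique
    (e0 ▸ (IsSum.telescope hF).congr fun k => ?_)
  have c1 := gfAbove_col (k + 1) (k + t)
  have c2 := gfAbove_col (k + 1) (k + t + 1)
  have c3 := gfAbove_row k (k + t)
  have c4 := gfAbove_col k (k + t)
  have ea : u (24 * ((k + 1 : ℕ) : ℤ)) = u (24 * k) * u 24 := by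
    rw [← u_add]; push_cast; ring_nf
  have eb : u (24 * ((k + t : ℕ) + 1)) = u (24 * k) * u (24 * (t + 1)) := by
    rw [← u_add]; push_cast; ring_nf
  rw [ea] at c1 c2
  rw [eb] at c3
  simp only [F]
  rw [ea]
  simp only [show k + 1 + t = k + t + 1 by omega, show k + (t + 1) = k + t + 1 by omega]
  linear_combination -c1 - u (24 * (t + 1)) * c2 - c3 + u (24 * (t + 1)) * c4

section
variable {n : ℤ}

theorem isSum_ite_eq {ι : Type*} [DecidableEq ι] (i : ι) (a : K) :
    IsSum (fun k => if k = i then a else 0) a := fun d => ⟨{i}, fun S hS => by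
  rw [sum_ite_eq', if_pos (singleton_subset_iff.mp hS), sub_self]
  exact isO_zero d⟩

/-- The half Lambert series. -/
noncomputable def half (n s : ℤ) : K := lsum fun k : ℤ => if 0 < k then -lt n (12 * (2 * s - 1)) k else 0

/-- The partial theta series. -/
noncomputable def ptheta (n s : ℤ) : K :=
  lsum fun k : ℤ => if 0 < k then -(sg k * u (12 * n * k ^ 2 + 12 * (2 * s - 1) * k)) else 0

theorem half_exponent (hn : 1 ≤ n) {s k : ℤ} (hs : 0 ≤ s) (hk : 0 < k) :
    k - 1 + 24 * s ≤ 12 * n * k ^ 2 + 12 * (2 * s - 1) * k := by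
  nlinarith [mul_nonneg (sub_nonneg.mpr hn) (sq_nonneg k), mul_nonneg hs (sub_nonneg.mpr hk),
    sq_nonneg (k - 1)]

theorem isSum_ptheta (hn : 1 ≤ n) {s : ℤ} (hs : 0 ≤ s) : IsSum (fun k : ℤ => if 0 < k then
    -(sg k * u (12 * n * k ^ 2 + 12 * (2 * s - 1) * k)) else 0) (ptheta n s) := by
  refine isSum_of_isO 1 fun k => ?_
  split_ifs with hk
  · have := half_exponent hn hs hk
    exact ((isO_sg k).mul' (isO_u _) (by rw [abs_of_pos hk]; omega)).neg
  · exact isO_zero _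

theorem isO_half_term (hn : 1 ≤ n) {s : ℤ} (hs : 0 ≤ s) (k : ℤ) :
    IsO (|k| - 1 + 24 * s) (if 0 < k then -lt n (12 * (2 * s - 1)) k else 0) := by
  split_ifs with hk
  · have := half_exponent hn hs hk
    rw [lt, div_eq_mul_inv]
    exact (((isO_sg k).mul (isO_u _)).mul' (isO_inv_one_sub_y k)
      (by rw [abs_of_pos hk]; omega)).neg
  · exact isO_zero _

theorem isSum_half (hn : 1 ≤ n) {s : ℤ} (hs : 0 ≤ s) :
    IsSum (fun k : ℤ => if 0 < k then -lt n (12 * (2 * s - 1)) k else 0) (half n s) :=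
  isSum_of_isO 1 fun k => (isO_half_term hn hs k).mono (by omega)

theorem isO_half (hn : 1 ≤ n) {s : ℤ} (hs : 0 ≤ s) : IsO (24 * s - 1) (half n s) :=
  (isSum_half hn hs).isO fun k => (isO_half_term hn hs k).mono (by have := abs_nonneg k; omega)

theorem ptheta_eq_half (hn : 1 ≤ n) {s : ℤ} (hs : 0 ≤ s) :
    ptheta n s = half n s - half n (s + 11) := by
  refine (isSum_ptheta hn hs).unique (((isSum_half hn hs).sub
    (isSum_half hn (s := s + 11) (by omega))).congr fun k => ?_)
  split_ifs with hk
  · have h1 := one_sub_y_ne_zero hk.ne'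
    rw [lt, lt, show 12 * n * k ^ 2 + 12 * (2 * (s + 11) - 1) * k =
      12 * n * k ^ 2 + 12 * (2 * s - 1) * k + 264 * k by ring, u_add _ (264 * k), ← y]
    field_simp
    ring
  · exact sub_self 0

theorem ptheta_rec (hn : 1 ≤ n) {s : ℤ} (hs : 0 ≤ s) :
    ptheta n s = u (24 * s + 12 * (n - 1)) * (1 - ptheta n (s + n)) := by
  refine ((isSum_ptheta hn hs).comp_equiv (Equiv.addRight 1)).unique
    ((((isSum_ite_eq 0 1).sub (isSum_ptheta hn (s := s + n) (by omega))).mul_left _).congr fun k => ?_)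
  rw [Equiv.coe_addRight]
  rcases lt_trichotomy k 0 with hk | rfl | hk
  · simp [hk.ne, hk.not_gt, show ¬ 0 < k + 1 by omega]
  · simp [sg_one]
    ring_nf
  · rw [if_neg hk.ne', if_pos hk, if_pos (hk.trans (lt_add_one k)), sg_add, sg_one, zero_sub, neg_neg,
      mul_left_comm, ← u_add]
    ring_nf

theorem lamSum_eq_half (hn : 1 ≤ n) {b : ℤ} (hb : -1 ≤ b ∧ b ≤ 11) :
    lamSum n (12 * (2 * b + 1)) = half n (11 - b) - half n (b + 1) := by
  refine (isSum_lamSum hn _).unique ((((isSum_half hn (s := 11 - b) (by omega)).comp_equiv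
    (Equiv.neg ℤ)).sub (isSum_half hn (s := b + 1) (by omega))).congr fun k => ?_)
  rw [Equiv.neg_apply]
  rcases lt_trichotomy k 0 with hk | rfl | hk
  · rw [if_pos (by omega), if_neg (by omega), sub_zero, lt, lt, sg_neg, y_neg,
      show 12 * n * (-k) ^ 2 + 12 * (2 * (11 - b) - 1) * -k =
        12 * n * k ^ 2 + 12 * (2 * b + 1) * k - 264 * k by ring, u_sub _ (264 * k), ← y]
    have h1 := one_sub_y_ne_zero hk.ne
    have h2 := y_ne_zero k
    have h3 : y k - 1 ≠ 0 := by rwa [← neg_ne_zero, neg_sub]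
    rw [← one_div, one_sub_div h2]
    field_simp
    ring
  · simp [lt_zero]
  · rw [if_neg (by omega), if_pos hk, zero_sub, neg_neg]
    ring_nf

theorem isO_gfAll : IsO 0 gfAll := isO_gf (d := 0) fun _ _ => Nat.zero_le _

theorem eq_ptheta {n : ℕ} (hn : 1 ≤ n) {R : ℕ → K} (hO : ∀ s, IsO 0 (R s))
    (h : ∀ s, 1 ≤ s → R s = u (24 * s + 12 * (n - 1)) * (gfAll - R (s + n))) {s : ℕ} (hs : 1 ≤ s) :
    R s = gfAll * ptheta n s := by
  have hn' : (1 : ℤ) ≤ n := by exact_mod_cast hn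
  refine sub_eq_zero.mp (eq_zero_of_isO fun d => ?_)
  suffices H : ∀ d : ℕ, ∀ s : ℕ, 1 ≤ s → IsO d (R s - gfAll * ptheta n s) from
    (H d.toNat s hs).mono (Int.self_le_toNat d)
  intro d
  induction d with
  | zero =>
    intro s hs
    have h1 := isO_half hn' (s := s) (by positivity)
    have h2 := isO_half hn' (s := s + 11) (by positivity)
    rw [ptheta_eq_half hn' (by positivity)]
    exact (hO s).sub (isO_gfAll.mul' (a := 0) (b := 0) ((h1.mono (by omega)).sub
      (h2.mono (by omega))) (by simp))
  | succ d ih =>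
    intro s hs
    have e : R s - gfAll * ptheta n s = -(u (24 * s + 12 * (n - 1)) *
        (R (s + n) - gfAll * ptheta n ↑(s + n))) := by
      rw [h s hs, ptheta_rec hn' (s := s) (by positivity), Nat.cast_add]
      ring
    rw [e]
    exact ((isO_u _).mul' (ih (s + n) (by omega)) (by push_cast; omega)).neg

theorem gf_rank_eq {s : ℕ} (hs : 1 ≤ s) :
    gf (fun m => m.card + s ≤ m.sup) = gfAll * ptheta 3 s :=
  eq_ptheta (n := 3) (R := fun s => gf fun m => m.card + s ≤ m.sup) (by norm_num)
    (fun _ => isO_gf (d := 0) fun _ _ => Nat.zero_le _)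
    (fun s hs => (gf_rank_pos hs).trans (by congr 2)) hs

theorem gfCrank_eq (t : ℕ) : gfCrank t = gfAll * ptheta 1 (t + 1) := by
  have := eq_ptheta (n := 1) (R := fun s => gfCrank (s - 1)) le_rfl (fun s => ?_)
    (fun s hs => ?_) (s := t + 1) (by omega)
  · exact_mod_cast this
  · exact (isSum_gfCrank (s - 1)).isO fun k => ((isO_u _).mul (isOne_one_sub_u
      (by norm_num)).isO).mul' (isO_gfAbove _ _) (by positivity)
  · obtain ⟨t, rfl⟩ := Nat.exists_eq_add_of_le' hs
    rw [gfCrank_rec]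
    simp

theorem gfAll_mul_eta : gfAll * eta = u 1 := by
  have h0 := ptheta_rec (n := 3) (by norm_num) (s := 0) le_rfl
  have e : eta = u 1 * (1 - ptheta 3 0 - ptheta 3 1) := by
    refine isSum_eta.unique (((((isSum_ite_eq 0 1).sub ((isSum_ptheta (n := 3) (by norm_num)
      le_rfl).comp_equiv (Equiv.neg ℤ))).sub (isSum_ptheta (n := 3) (by norm_num)
      zero_le_one)).mul_left _).congr fun k => ?_)
    rw [Equiv.neg_apply, sg_neg, u_add _ 1]
    rcases lt_trichotomy k 0 with hk | rfl | hk
    · rw [if_neg hk.ne, if_pos (by omega), if_neg (by omega)]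
      ring_nf
    · simp [sg_zero, u_zero]
    · rw [if_neg hk.ne', if_neg (by omega), if_pos (by omega)]
      ring_nf
  have h := gfAll_eq
  rw [gf_rank_eq le_rfl, gf_rank_eq (by norm_num)] at h
  norm_num at h0 h
  rw [e, h0]
  linear_combination u 1 * h
end

theorem count_one_le_sum (m : Multiset ℕ) : m.count 1 ≤ m.sum := by
  induction m using Multiset.induction_on with
  | empty => exact le_rfl
  | cons x m ih =>
    rw [Multiset.count_cons, Multiset.sum_cons]
    split_ifs <;> omega

/-- The crank of a multiset of parts. -/
def crankOf (m : Multiset ℕ) : ℤ :=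
  if m.count 1 = 0 then m.sup else above m (m.count 1) - m.count 1

theorem above_cons_one {j : ℕ} (hj : 1 ≤ j) (m : Multiset ℕ) : above (1 ::ₘ m) j = above m j := by
  rw [above_cons, if_neg (by omega), zero_add]

theorem gf_crank_pos (t : ℕ) :
    gfCrank t = gf (fun m => t + 1 ≤ crankOf m) + if t = 0 then u 24 else 0 := by
  refine (isSum_gfCrank t).unique (((isSum_gf _ count_one_le_sum).add
    (isSum_ite_eq 0 _)).congr fun k => ?_)
  rcases k.eq_zero_or_pos with rfl | hk
  · rw [if_pos rfl, zero_add, zero_add]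
    have e0 (m : Multiset ℕ) : ((t + 1 ≤ crankOf m) ∧ m.count 1 = 0) ↔
        1 ≤ above m t ∧ m.count 1 = 0 := by
      refine and_congr_left fun h => ?_
      rw [crankOf, if_pos h, Nat.one_le_iff_ne_zero, Ne, above_eq_zero]
      omega
    simp only [e0]
    rcases t.eq_zero_or_pos with rfl | ht
    · have h1 := gf_count (p := fun _ => True) (fun _ => Iff.rfl) 0
      have h2 : gfAbove 1 0 = gfAll - 1 := by
        rw [← gf_zero, ← gf_not]
        refine gf_congr fun m hm => ?_
        rw [above_zero hm, Nat.one_le_iff_ne_zero, Ne, Multiset.card_eq_zero]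
      have h3 : gf (fun m => (True ∧ m.count 1 = 0) ∧ m = 0) = 1 := by
        rw [← gf_zero]
        refine gf_congr fun m _ => ⟨And.right, ?_⟩
        rintro rfl
        simp
      have h4 : gf (fun m => (True ∧ m.count 1 = 0) ∧ ¬ m = 0) =
          gf fun m => 1 ≤ above m 0 ∧ m.count 1 = 0 := gf_congr fun m hm => by
        rw [above_zero hm, Nat.one_le_iff_ne_zero, Ne, Multiset.card_eq_zero]
        tauto
      rw [gf_split _ fun m => m = 0, h3, h4] at h1
      rw [if_pos rfl, h2]
      simp only [Nat.cast_zero, mul_zero, u_zero] at h1 ⊢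
      rw [gfAll]
      linear_combination h1
    · rw [if_neg ht.ne', add_zero, gf_count fun m => by rw [above_cons_one ht]]
      rfl
  · rw [if_neg hk.ne', add_zero, gfAbove_symm, gfAbove, ← gf_count fun m => by
      rw [above_cons_one hk]]
    refine gf_congr fun m _ => and_congr_left fun h => ?_
    rw [crankOf, if_neg (by omega), h]
    omega

theorem gf_crank_neg (t : ℕ) : gf (fun m => t + 1 ≤ -crankOf m) = gfCrank t := by
  have hs := (isSum_gf (fun _ => True) count_one_le_sum).congr fun k => gf_count (fun _ => Iff.rfl) k
  rw [gfCrank_rec]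
  refine (isSum_gf _ (f := fun m => m.count 1 - (t + 1)) fun m => (Nat.sub_le _ _).trans
    (count_one_le_sum m)).unique (((hs.sub (isSum_gfCrank (t + 1))).mul_left _).congr fun k => ?_)
  have e : gf (fun m => t + 1 ≤ -crankOf m ∧ m.count 1 - (t + 1) = k) =
      gf fun m => ¬ k + 1 ≤ above m (k + (t + 1)) ∧ m.count 1 = k + (t + 1) := by
    refine gf_congr fun m _ => ?_
    rw [crankOf]
    split_ifs with h0
    · omega
    · constructor
      · rintro ⟨h1, h2⟩
        have h3 : m.count 1 = k + (t + 1) := by omega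
        rw [h3] at h1
        omega
      · rintro ⟨h1, h2⟩
        rw [h2]
        omega
  rw [e, gf_count fun m => by rw [above_cons_one (by omega)], gf_not, ← gfAbove, ← gfAll,
    show (24 : ℤ) * ((k + (t + 1) : ℕ) : ℤ) = 24 * k + 24 * (t + 1) by push_cast; ring, u_add]
  ring

theorem card_eq_coeff {N : ℕ} {r : N.Partition → Prop} [DecidablePred r] {p : Multiset ℕ → Prop}
    (h : ∀ π, r π ↔ p π.parts) : (#{π | r π} : ℚ) = (gf p).coeff (24 * N) := by
  rw [coeff_gf, cnt]
  congr 2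
  ext π
  simp only [mem_filter_univ, h]

section residues

variable {ι : Type*} [Fintype ι] {st : ι → ℤ} {X : ℕ → ℚ} (hX : ∃ B, ∀ s ≥ B, X s = 0)
  (h : ∀ s : ℕ, 1 ≤ s → (#{π | s ≤ st π} : ℚ) = X s - X (s + 11))
  (h' : ∀ s : ℕ, 1 ≤ s → (#{π | s ≤ -st π} : ℚ) = X s - X (s + 11))
include hX h

theorem card_progression {s : ℕ} (hs : 1 ≤ s) :
    (#{π | s ≤ st π ∧ 11 ∣ st π - s} : ℚ) = X s - X (s + 1) := by
  obtain ⟨B, hB⟩ := hX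
  suffices H : ∀ d s, 1 ≤ s → B ≤ s + d → (#{π | s ≤ st π ∧ 11 ∣ st π - s} : ℚ) = X s - X (s + 1)
    from H B s hs (by omega)
  intro d
  induction d with
  | zero =>
    intro s hs hd
    have h0 := h s hs
    rw [hB s hd, hB _ (by omega), sub_zero, Nat.cast_eq_zero, card_eq_zero,
      filter_eq_empty_iff] at h0
    rw [hB s hd, hB _ (by omega), sub_zero, Nat.cast_eq_zero, card_eq_zero, filter_eq_empty_iff]
    exact fun π hπ hc => h0 hπ hc.1
  | succ d ih =>
    intro s hs hd
    have h1 := ih (s + 11) (by omega) (by omega)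
    have e : #{π | s ≤ st π ∧ 11 ∣ st π - s} + #{π | ((s + 1 : ℕ) : ℤ) ≤ st π} =
        #{π | s ≤ st π} + #{π | ((s + 11 : ℕ) : ℤ) ≤ st π ∧ 11 ∣ st π - (s + 11 : ℕ)} := by
      simp only [card_filter, ← sum_add_distrib]
      refine sum_congr rfl fun π _ => ?_
      split_ifs <;> omega
    have e' := congrArg (Nat.cast (R := ℚ)) e
    rw [Nat.cast_add (R := ℚ), Nat.cast_add (R := ℚ), h s hs, h (s + 1) (by omega), h1,
      add_right_comm s 1 11] at e'
    linear_combination e'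

include h'

theorem card_residue {a : ℕ} (ha : 1 ≤ a) (ha' : a ≤ 10) :
    (#{π | st π % 11 = a} : ℚ) = X a - X (a + 1) + (X (11 - a) - X (12 - a)) := by
  have h1 := card_progression hX h' (s := 11 - a) (by omega)
  have e : #{π | st π % 11 = a} = #{π | a ≤ st π ∧ 11 ∣ st π - a} +
      #{π | ((11 - a : ℕ) : ℤ) ≤ -st π ∧ 11 ∣ -st π - (11 - a : ℕ)} := by
    simp only [card_filter, ← sum_add_distrib]
    refine sum_congr rfl fun π _ => ?_
    split_ifs <;> omega
  rw [e, Nat.cast_add (R := ℚ), card_progression hX h ha, h1, show 12 - a = 11 - a + 1 by omega]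

theorem card_residue_zero :
    (#{π | st π % 11 = 0} : ℚ) = Fintype.card ι + 2 * (X 11 - X 1) := by
  have h1 := card_progression hX h (s := 11) (by norm_num)
  have h2 := card_progression hX h' (s := 11) (by norm_num)
  have h3 := h 1 le_rfl
  have h4 := h' 1 le_rfl
  have e : #{π | st π % 11 = 0} + #{π | ((1 : ℕ) : ℤ) ≤ st π} + #{π | ((1 : ℕ) : ℤ) ≤ -st π} =
      Fintype.card ι + #{π | ((11 : ℕ) : ℤ) ≤ st π ∧ 11 ∣ st π - (11 : ℕ)} +
      #{π | ((11 : ℕ) : ℤ) ≤ -st π ∧ 11 ∣ -st π - (11 : ℕ)} := by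
    rw [Fintype.card_eq_sum_ones]
    simp only [card_filter, ← sum_add_distrib]
    refine sum_congr rfl fun π _ => ?_
    split_ifs <;> omega
  have e' := congrArg (Nat.cast (R := ℚ)) e
  simp only [Nat.cast_add (R := ℚ), h1, h2, h3, h4] at e'
  linear_combination e'

end residues

theorem count_eq {N : ℕ} {st : N.Partition → ℤ} {n : ℤ} {F : ℤ → K} (hn : 1 ≤ n)
    (hF : ∀ b, F b = (lamSum n (12 * (2 * b + 1)) + (1 / 2 - ((2 * b + 1 : ℤ) : K) / 22)) / eta)
    (h : ∀ s : ℕ, 1 ≤ s → (#{π | s ≤ st π} : ℚ) = (gfAll * ptheta n s).coeff (24 * N))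
    (h' : ∀ s : ℕ, 1 ≤ s → (#{π | s ≤ -st π} : ℚ) = (gfAll * ptheta n s).coeff (24 * N)) :
    (#{π | st π % 11 = 0} : ℚ) =
      Fintype.card N.Partition / 11 + 2 * (F 0).coeff (24 * N - 1) ∧
    (∀ a : ℕ, 1 ≤ a → a ≤ 5 → (#{π | st π % 11 = a} : ℚ) = Fintype.card N.Partition / 11 +
      (F a).coeff (24 * N - 1) - (F (a - 1 : ℕ)).coeff (24 * N - 1)) ∧
    (F 5).coeff (24 * N - 1) = 0 := by
  let X (s : ℕ) : ℚ := (gfAll * half n s).coeff (24 * N)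
  have hX : ∃ B, ∀ s ≥ B, X s = 0 := ⟨N + 1, fun s hs =>
    isO_gfAll.mul (isO_half hn (s := s) (by positivity)) _ (by omega)⟩
  have e (s : ℕ) : (gfAll * ptheta n s).coeff (24 * N) = X s - X (s + 11) := by
    rw [ptheta_eq_half hn (by positivity), mul_sub, HahnSeries.coeff_sub]
    rfl
  simp only [e] at h h'
  have hp : (gfAll.coeff (24 * N)) = Fintype.card N.Partition := by
    rw [gfAll, ← card_eq_coeff (r := fun _ => True) fun _ => Iff.rfl, filter_true, card_univ]
  have hb (b : ℕ) (hb : b ≤ 5) : (F b).coeff (24 * N - 1) =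
      X (11 - b) - X (b + 1) + (5 - b : ℕ) / 11 * Fintype.card N.Partition := by
    have h1 : ((11 : ℕ) : K) * F b = u (-1) * (((11 : ℕ) : K) * (gfAll * half n (11 - b : ℕ) -
        gfAll * half n (b + 1 : ℕ)) + ((5 - b : ℕ) : K) * gfAll) := by
      have h2 := gfAll_mul_eta
      rw [hF, lamSum_eq_half hn (by omega), u_neg, ← h2]
      have h3 : gfAll ≠ 0 := fun h0 => u_ne_zero 1 (by rw [← h2, h0, zero_mul])
      have h4 := eta_ne_zero
      push_cast [Nat.cast_sub hb, Nat.cast_sub (show b ≤ 11 by omega)]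
      field_simp
      ring
    have h2 := congrArg (fun f : K => f.coeff (24 * N - 1)) h1
    simp only [coeff_natCast_mul, coeff_u_mul, HahnSeries.coeff_add, HahnSeries.coeff_sub, sub_neg_eq_add,
      sub_add_cancel, hp] at h2
    simp only [X]
    push_cast at h2 ⊢
    linear_combination h2 / 11
  refine ⟨?_, fun a ha ha' => ?_, ?_⟩
  · rw [card_residue_zero hX h h', ← Nat.cast_zero, hb 0 (by norm_num)]
    norm_num
    ring
  · rw [card_residue hX h h' ha (by omega), hb a ha', hb (a - 1) (by omega),
      show 11 - (a - 1) = 12 - a by omega, Nat.sub_add_cancel ha,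
      show 5 - (a - 1) = 5 - a + 1 by omega, Nat.cast_succ]
    ring
  · have := hb 5 le_rfl
    norm_num at this
    exact this

theorem rankCount_eq (N : ℕ) :
    (rankCount 0 11 N : ℚ) =
      Fintype.card N.Partition / 11 + 2 * (rankF 0).coeff (24 * N - 1) ∧
    (∀ a : ℕ, 1 ≤ a → a ≤ 5 → (rankCount a 11 N : ℚ) = Fintype.card N.Partition / 11 +
      (rankF a).coeff (24 * N - 1) - (rankF (a - 1 : ℕ)).coeff (24 * N - 1)) ∧
    (rankF 5).coeff (24 * N - 1) = 0 := by
  have H := count_eq (N := N) (st := partitionRank) (n := 3) (by norm_num) (F := rankF)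
    (fun _ => rfl) (fun s hs => ?_) (fun s hs => ?_)
  · refine ⟨H.1, fun a h1 h2 => ?_, H.2.2⟩
    rw [← H.2.1 a h1 h2, rankCount, Int.emod_eq_of_lt (by omega : (0 : ℤ) ≤ a) (by omega)]
  · rw [← gf_rank_eq hs]
    refine card_eq_coeff fun π => ?_
    rw [partitionRank]
    omega
  · rw [← gf_rank_eq hs, gf_conj]
    refine card_eq_coeff fun π => ?_
    rw [card_conj, sup_conj (zero_notMem_parts π), partitionRank]
    omega

theorem crankCount_eq {N : ℕ} (hN : 2 ≤ N) :
    (crankCount 0 N : ℚ) =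
      Fintype.card N.Partition / 11 + 2 * (crankF 0).coeff (24 * N - 1) ∧
    (∀ a : ℕ, 1 ≤ a → a ≤ 5 → (crankCount a N : ℚ) = Fintype.card N.Partition / 11 +
      (crankF a).coeff (24 * N - 1) - (crankF (a - 1 : ℕ)).coeff (24 * N - 1)) := by
  have H := count_eq (N := N) (st := partitionCrank) (n := 1) le_rfl (F := crankF)
    (fun _ => rfl) (fun s hs => ?_) (fun s hs => ?_)
  · refine ⟨?_, fun a h1 h2 => ?_⟩
    · rw [← H.1, crankCount, if_neg (by omega), Int.cast_natCast]
      rfl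
    · rw [← H.2.1 a h1 h2, crankCount, if_neg (by omega), Int.cast_natCast,
        Int.emod_eq_of_lt (by omega : (0 : ℤ) ≤ a) (by omega)]
  · obtain ⟨t, rfl⟩ := Nat.exists_eq_add_of_le' hs
    have e : (if t = 0 then u 24 else 0).coeff (24 * N) = 0 := by
      split_ifs
      · rw [coeff_u, if_neg (by omega)]
      · rfl
    rw [Nat.cast_succ, ← gfCrank_eq, gf_crank_pos, HahnSeries.coeff_add, e, add_zero]
    exact card_eq_coeff fun π => Iff.rfl
  · obtain ⟨t, rfl⟩ := Nat.exists_eq_add_of_le' hs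
    rw [Nat.cast_succ, ← gfCrank_eq, ← gf_crank_neg]
    exact card_eq_coeff fun π => Iff.rfl

theorem rankCount_coeff (N : ℕ) {i : ℤ} (hi : i = 24 * N - 1) : ∃ p : ℚ,
    (p = Fintype.card N.Partition / 11) ∧
    rankCount 0 11 N = p + 2 * (rankF 0).coeff i ∧
    rankCount 1 11 N = p + (rankF 1).coeff i - (rankF 0).coeff i ∧
    rankCount 2 11 N = p + (rankF 2).coeff i - (rankF 1).coeff i ∧
    rankCount 3 11 N = p + (rankF 3).coeff i - (rankF 2).coeff i ∧
    rankCount 4 11 N = p + (rankF 4).coeff i - (rankF 3).coeff i ∧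
    rankCount 5 11 N = p - (rankF 4).coeff i := by
  have h0 := rankCount_eq N
  rw [← hi] at h0
  obtain ⟨h0, h1, h5⟩ := h0
  have e := h1 5 (by norm_num) le_rfl
  norm_num [h5] at e
  refine ⟨_, rfl, h0, ?_, ?_, ?_, ?_, e⟩
  · simpa using h1 1
  · simpa using h1 2
  · simpa using h1 3
  · simpa using h1 4

theorem crankCount_coeff {N : ℕ} (hN : 2 ≤ N) {i : ℤ} (hi : i = 24 * N - 1) {p : ℚ}
    (hp : p = Fintype.card N.Partition / 11) :
    crankCount 0 N = p + 2 * (crankF 0).coeff i ∧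
    crankCount 1 N = p + (crankF 1).coeff i - (crankF 0).coeff i ∧
    crankCount 3 N = p + (crankF 3).coeff i - (crankF 2).coeff i := by
  have h0 := crankCount_eq hN
  rw [← hi, ← hp] at h0
  refine ⟨h0.1, ?_, ?_⟩
  · simpa using h0.2 1
  · simpa using h0.2 3

theorem nonneg_mul_add {A B C : K} (h1 : Nonneg (A * B)) (h2 : Nonneg (A * C)) :
    Nonneg (A * (B + C)) := by
  rw [mul_add]
  exact h1.add h2

theorem nonneg_mul_ofNat {A B : K} (k : ℕ) [k.AtLeastTwo] (h1 : Nonneg (A * B)) :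
    Nonneg (A * (OfNat.ofNat k * B)) := by
  rw [mul_left_comm]
  exact (nonneg_ofNat k).mul h1

theorem coeff_nonneg {L R : K} (e : L = 11 * R) (i : ℤ) (hR : Nonneg R := by
    with_reducible (repeat' first | apply nonneg_mul_add | apply nonneg_mul_ofNat | apply nonneg_mo)
    all_goals norm_num) : 0 ≤ L.coeff i := by
  rw [e]
  exact (nonneg_ofNat 11).mul hR i

theorem rank_crank_seven {n N : ℕ} (hN : N = 11 * n + 7) :
    (rankCount 0 11 N : ℤ) ≥ crankCount 1 N ∧
    crankCount 0 N ≥ (rankCount 4 11 N : ℤ) ∧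
    (rankCount 3 11 N : ℤ) + (rankCount 4 11 N : ℤ) ≥ (rankCount 5 11 N : ℤ) + crankCount 0 N := by
  obtain ⟨i, e⟩ : ∃ i : ℤ, i = 24 * N - 1 := ⟨_, rfl⟩
  have hi : 264 ∣ i - (24 * 7 - 1) := by omega
  obtain ⟨p, hp, R0, R1, R2, R3, R4, R5⟩ := rankCount_coeff N e
  obtain ⟨C0, C1, C3⟩ := crankCount_coeff (by omega) e hp
  have r0 := coeff_rankF (b := 0) (c := -2) i _ 9 hi (by decide) (by decide) (by decide) (by decide)
  have r2 := coeff_rankF (b := 2) (c := 1) i _ 7 hi (by decide) (by decide) (by decide) (by decide)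
  have r3 := coeff_rankF (b := 3) (c := -3) i _ 0 hi (by decide) (by decide) (by decide) (by decide)
  have r4 := coeff_rankF (b := 4) (c := 4) i _ 4 hi (by decide) (by decide) (by decide) (by decide)
  have c0 := coeff_crankF (b := 0) (c := 5) i _ 9 hi (by decide) (by decide) (by decide)
  have c1 := coeff_crankF (b := 1) (c := 4) i _ 4 hi (by decide) (by decide) (by decide)
  have seven_a := coeff_nonneg seven_a i nonneg_seven_a
  have seven_b := coeff_nonneg seven_b i
  have seven_c := coeff_nonneg seven_c i
  simp only [HahnSeries.coeff_add, HahnSeries.coeff_sub, HahnSeries.coeff_neg, coeff_ofNat_mul,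
    ← r0, ← r2, ← r3, ← r4, ← c0, ← c1] at seven_a seven_b seven_c
  simp only [ge_iff_le, ← Int.cast_le (R := ℚ)]
  push_cast
  simp only [R0, R1, R2, R3, R4, R5, C0, C1, C3]
  clear R0 R1 R2 R3 R4 R5 C0 C1 C3 r0 r2 r3 r4 c0 c1 hp
  refine ⟨?_, ?_, ?_⟩ <;> linarith

theorem rank_crank_eight {n N : ℕ} (hN : N = 11 * n + 8) :
    (rankCount 2 11 N : ℤ) ≥ crankCount 1 N ∧
    crankCount 0 N ≥ (rankCount 3 11 N : ℤ) ∧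
    crankCount 0 N + crankCount 1 N ≥ (rankCount 2 11 N : ℤ) + (rankCount 4 11 N : ℤ) ∧
    (rankCount 1 11 N : ℤ) + (rankCount 5 11 N : ℤ) ≥ 2 * (rankCount 3 11 N : ℤ) ∧
    (rankCount 0 11 N : ℤ) + crankCount 0 N ≥ 2 * (rankCount 2 11 N : ℤ) ∧
    (rankCount 3 11 N : ℤ) + crankCount 0 N ≥ (rankCount 4 11 N : ℤ) + crankCount 1 N ∧
    (rankCount 2 11 N : ℤ) + (rankCount 3 11 N : ℤ) ≥ 2 * crankCount 1 N ∧
    2 * crankCount 0 N ≥ (rankCount 1 11 N : ℤ) + (rankCount 5 11 N : ℤ) := by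
  obtain ⟨i, e⟩ : ∃ i : ℤ, i = 24 * N - 1 := ⟨_, rfl⟩
  have hi : 264 ∣ i - (24 * 8 - 1) := by omega
  obtain ⟨p, hp, R0, R1, R2, R3, R4, R5⟩ := rankCount_coeff N e
  obtain ⟨C0, C1, C3⟩ := crankCount_coeff (by omega) e hp
  have r0 := coeff_rankF (b := 0) (c := -2) i _ 1 hi (by decide) (by decide) (by decide) (by decide)
  have r1 := coeff_rankF (b := 1) (c := 5) i _ 3 hi (by decide) (by decide) (by decide) (by decide)
  have r2 := coeff_rankF (b := 2) (c := 1) i _ 8 hi (by decide) (by decide) (by decide) (by decide)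
  have r3 := coeff_rankF (b := 3) (c := -3) i _ 5 hi (by decide) (by decide) (by decide) (by decide)
  have r4 := coeff_rankF (b := 4) (c := 4) i _ 2 hi (by decide) (by decide) (by decide) (by decide)
  have c0 := coeff_crankF (b := 0) (c := 5) i _ 3 hi (by decide) (by decide) (by decide)
  have c1 := coeff_crankF (b := 1) (c := 4) i _ 2 hi (by decide) (by decide) (by decide)
  have eight_a := coeff_nonneg eight_a i
  have eight_b := coeff_nonneg eight_b i
  have eight_c := coeff_nonneg eight_c i
  have eight_d := coeff_nonneg eight_d i
  have eight_e := coeff_nonneg eight_e i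
  have eight_f := coeff_nonneg eight_f i
  have eight_g := coeff_nonneg eight_g i
  have eight_h := coeff_nonneg eight_h i
  simp only [HahnSeries.coeff_add, HahnSeries.coeff_sub, HahnSeries.coeff_neg, coeff_ofNat_mul,
    ← r0, ← r1, ← r2, ← r3, ← r4, ← c0, ← c1]
    at eight_a eight_b eight_c eight_d eight_e eight_f eight_g eight_h
  simp only [ge_iff_le, ← Int.cast_le (R := ℚ)]
  push_cast
  simp only [R0, R1, R2, R3, R4, R5, C0, C1, C3]
  clear R0 R1 R2 R3 R4 R5 C0 C1 C3 r0 r1 r2 r3 r4 c0 c1 hp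
  refine ⟨?_, ?_, ?_, ?_, ?_, ?_, ?_, ?_⟩ <;> linarith

theorem rank_crank_nine {n N : ℕ} (hN : N = 11 * n + 9) :
    (rankCount 2 11 N : ℤ) ≥ crankCount 1 N ∧
    crankCount 0 N ≥ (rankCount 5 11 N : ℤ) ∧
    crankCount 1 N + crankCount 0 N ≥ (rankCount 2 11 N : ℤ) + (rankCount 5 11 N : ℤ) ∧
    (rankCount 0 11 N : ℤ) + crankCount 0 N ≥ (rankCount 2 11 N : ℤ) + crankCount 1 N ∧
    (rankCount 2 11 N : ℤ) + (rankCount 5 11 N : ℤ) ≥ (rankCount 3 11 N : ℤ) + (rankCount 4 11 N :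
      ℤ) := by
  obtain ⟨i, e⟩ : ∃ i : ℤ, i = 24 * N - 1 := ⟨_, rfl⟩
  have hi : 264 ∣ i - (24 * 9 - 1) := by omega
  obtain ⟨p, hp, R0, R1, R2, R3, R4, R5⟩ := rankCount_coeff N e
  obtain ⟨C0, C1, C3⟩ := crankCount_coeff (by omega) e hp
  have r0 := coeff_rankF (b := 0) (c := -2) i _ 4 hi (by decide) (by decide) (by decide) (by decide)
  have r1 := coeff_rankF (b := 1) (c := 5) i _ 7 hi (by decide) (by decide) (by decide) (by decide)
  have r2 := coeff_rankF (b := 2) (c := 1) i _ 9 hi (by decide) (by decide) (by decide) (by decide)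
  have r4 := coeff_rankF (b := 4) (c := 4) i _ 0 hi (by decide) (by decide) (by decide) (by decide)
  have c0 := coeff_crankF (b := 0) (c := 5) i _ 6 hi (by decide) (by decide) (by decide)
  have c1 := coeff_crankF (b := 1) (c := 4) i _ 0 hi (by decide) (by decide) (by decide)
  have nine_a := coeff_nonneg nine_a i
  have nine_b := coeff_nonneg nine_b i
  have nine_c := coeff_nonneg nine_c i
  have nine_d := coeff_nonneg nine_d i
  have nine_e := coeff_nonneg nine_e i
  simp only [HahnSeries.coeff_add, HahnSeries.coeff_sub, HahnSeries.coeff_neg, coeff_ofNat_mul,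
    ← r0, ← r1, ← r2, ← r4, ← c0, ← c1] at nine_a nine_b nine_c nine_d nine_e
  simp only [ge_iff_le, ← Int.cast_le (R := ℚ)]
  push_cast
  simp only [R0, R1, R2, R3, R4, R5, C0, C1, C3]
  clear R0 R1 R2 R3 R4 R5 C0 C1 C3 r0 r1 r2 r4 c0 c1 hp
  refine ⟨?_, ?_, ?_, ?_, ?_⟩ <;> linarith

theorem rank_crank_ten {n N : ℕ} (hN : N = 11 * n + 10) :
    (rankCount 1 11 N : ℤ) ≥ crankCount 0 N ∧
    crankCount 3 N ≥ (rankCount 4 11 N : ℤ) ∧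
    (rankCount 0 11 N : ℤ) + crankCount 0 N ≥ (rankCount 1 11 N : ℤ) + (rankCount 4 11 N : ℤ) ∧
    (rankCount 2 11 N : ℤ) + (rankCount 3 11 N : ℤ) ≥ 2 * crankCount 0 N ∧
    (rankCount 1 11 N : ℤ) + (rankCount 4 11 N : ℤ) ≥ 2 * crankCount 0 N ∧
    (rankCount 1 11 N : ℤ) + crankCount 3 N ≥ (rankCount 2 11 N : ℤ) + (rankCount 3 11 N : ℤ) := by
  obtain ⟨i, e⟩ : ∃ i : ℤ, i = 24 * N - 1 := ⟨_, rfl⟩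
  have hi : 264 ∣ i - (24 * 10 - 1) := by omega
  obtain ⟨p, hp, R0, R1, R2, R3, R4, R5⟩ := rankCount_coeff N e
  obtain ⟨C0, C1, C3⟩ := crankCount_coeff (by omega) e hp
  have r0 := coeff_rankF (b := 0) (c := -2) i _ 7 hi (by decide) (by decide) (by decide) (by decide)
  have r1 := coeff_rankF (b := 1) (c := 5) i _ 0 hi (by decide) (by decide) (by decide) (by decide)
  have r3 := coeff_rankF (b := 3) (c := -3) i _ 4 hi (by decide) (by decide) (by decide) (by decide)
  have r4 := coeff_rankF (b := 4) (c := 4) i _ 9 hi (by decide) (by decide) (by decide) (by decide)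
  have c0 := coeff_crankF (b := 0) (c := 5) i _ 0 hi (by decide) (by decide) (by decide)
  have c2 := coeff_crankF (b := 2) (c := 3) i _ 4 hi (by decide) (by decide) (by decide)
  have c3 := coeff_crankF (b := 3) (c := 2) i _ 6 hi (by decide) (by decide) (by decide)
  have ten_a := coeff_nonneg ten_a i
  have ten_b := coeff_nonneg ten_b i
  have ten_c := coeff_nonneg ten_c i
  have ten_d := coeff_nonneg ten_d i
  have ten_e := coeff_nonneg ten_e i
  have ten_f := coeff_nonneg ten_f i
  simp only [HahnSeries.coeff_add, HahnSeries.coeff_sub, HahnSeries.coeff_neg, coeff_ofNat_mul,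
    ← r0, ← r1, ← r3, ← r4, ← c0, ← c2, ← c3] at ten_a ten_b ten_c ten_d ten_e ten_f
  simp only [ge_iff_le, ← Int.cast_le (R := ℚ)]
  push_cast
  simp only [R0, R1, R2, R3, R4, R5, C0, C1, C3]
  clear R0 R1 R2 R3 R4 R5 C0 C1 C3 r0 r1 r3 r4 c0 c2 c3 hp
  refine ⟨?_, ?_, ?_, ?_, ?_, ?_⟩ <;> linarith

end RankCrank

/-- Two-term and four-term rank-crank inequalities, residues seven to ten. -/
theorem rank_crank_two_and_four_term_residues_seven_to_ten (n : ℕ) :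
    ((rankCount 0 11 (11  *  n  +  7) : ℤ) ≥ crankCount 1 (11  *  n  +  7))
    ∧ (crankCount 0 (11  *  n  +  7) ≥ (rankCount 4 11 (11  *  n  +  7) : ℤ))
    ∧ ((rankCount 3 11 (11  *  n  +  7) : ℤ)  +  (rankCount 4 11 (11  *  n  +  7) : ℤ) ≥ (rankCount 5 11 (11  *  n  +  7) : ℤ)  +  crankCount 0 (11  *  n  +  7))
    ∧ ((rankCount 2 11 (11  *  n  +  8) : ℤ) ≥ crankCount 1 (11  *  n  +  8))
    ∧ (crankCount 0 (11  *  n  +  8) ≥ (rankCount 3 11 (11  *  n  +  8) : ℤ))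
    ∧ (crankCount 0 (11  *  n  +  8)  +  crankCount 1 (11  *  n  +  8) ≥ (rankCount 2 11 (11  *  n  +  8) : ℤ)  +  (rankCount 4 11 (11  *  n  +  8) : ℤ))
    ∧ ((rankCount 1 11 (11  *  n  +  8) : ℤ)  +  (rankCount 5 11 (11  *  n  +  8) : ℤ) ≥ 2 * (rankCount 3 11 (11  *  n  +  8) : ℤ))
    ∧ ((rankCount 0 11 (11  *  n  +  8) : ℤ)  +  crankCount 0 (11  *  n  +  8) ≥ 2 * (rankCount 2 11 (11  *  n  +  8) : ℤ))
    ∧ ((rankCount 3 11 (11  *  n  +  8) : ℤ)  +  crankCount 0 (11  *  n  +  8) ≥ (rankCount 4 11 (11  *  n  +  8) : ℤ)  +  crankCount 1 (11  *  n  +  8))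
    ∧ ((rankCount 2 11 (11  *  n  +  8) : ℤ)  +  (rankCount 3 11 (11  *  n  +  8) : ℤ) ≥ 2 * crankCount 1 (11  *  n  +  8))
    ∧ (2 * crankCount 0 (11  *  n  +  8) ≥ (rankCount 1 11 (11  *  n  +  8) : ℤ)  +  (rankCount 5 11 (11  *  n  +  8) : ℤ))
    ∧ ((rankCount 2 11 (11  *  n  +  9) : ℤ) ≥ crankCount 1 (11  *  n  +  9))
    ∧ (crankCount 0 (11  *  n  +  9) ≥ (rankCount 5 11 (11  *  n  +  9) : ℤ))
    ∧ (crankCount 1 (11  *  n  +  9)  +  crankCount 0 (11  *  n  +  9) ≥ (rankCount 2 11 (11  *  n  +  9) : ℤ)  +  (rankCount 5 11 (11  *  n  +  9) : ℤ))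
    ∧ ((rankCount 0 11 (11  *  n  +  9) : ℤ)  +  crankCount 0 (11  *  n  +  9) ≥ (rankCount 2 11 (11  *  n  +  9) : ℤ)  +  crankCount 1 (11  *  n  +  9))
    ∧ ((rankCount 2 11 (11  *  n  +  9) : ℤ)  +  (rankCount 5 11 (11  *  n  +  9) : ℤ) ≥ (rankCount 3 11 (11  *  n  +  9) : ℤ)  +  (rankCount 4 11 (11  *  n  +  9) : ℤ))
    ∧ ((rankCount 1 11 (11  *  n  +  10) : ℤ) ≥ crankCount 0 (11  *  n  +  10))
    ∧ (crankCount 3 (11  *  n  +  10) ≥ (rankCount 4 11 (11  *  n  +  10) : ℤ))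
    ∧ ((rankCount 0 11 (11  *  n  +  10) : ℤ)  +  crankCount 0 (11  *  n  +  10) ≥ (rankCount 1 11 (11  *  n  +  10) : ℤ)  +  (rankCount 4 11 (11  *  n  +  10) : ℤ))
    ∧ ((rankCount 2 11 (11  *  n  +  10) : ℤ)  +  (rankCount 3 11 (11  *  n  +  10) : ℤ) ≥ 2 * crankCount 0 (11  *  n  +  10))
    ∧ ((rankCount 1 11 (11  *  n  +  10) : ℤ)  +  (rankCount 4 11 (11  *  n  +  10) : ℤ) ≥ 2 * crankCount 0 (11  *  n  +  10))
    ∧ ((rankCount 1 11 (11  *  n  +  10) : ℤ)  +  crankCount 3 (11  *  n  +  10) ≥ (rankCount 2 11 (11  *  n  +  10) : ℤ)  +  (rankCount 3 11 (11  *  n  +  10) : ℤ)) := by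
  obtain ⟨s1, s2, s3⟩ := RankCrank.rank_crank_seven (n := n) rfl
  obtain ⟨e1, e2, e3, e4, e5, e6, e7, e8⟩ := RankCrank.rank_crank_eight (n := n) rfl
  obtain ⟨i1, i2, i3, i4, i5⟩ := RankCrank.rank_crank_nine (n := n) rfl
  obtain ⟨t1, t2, t3, t4, t5, t6⟩ := RankCrank.rank_crank_ten (n := n) rfl
  exact ⟨s1, s2, s3, e1, e2, e3, e4, e5, e6, e7, e8, i1, i2, i3, i4, i5, t1, t2, t3, t4, t5, t6⟩
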